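/- Let n ≥ 2, 1 ≤ q ≤ n−1, s, k positive integers, 0 < λ < λ' < 1, n/2 < δ < n with δ ≠ n−1, μ > 0, T > 0, and let w ∈ F^{k,s(s,λ,λ',δ)}_{T,Λ^q,D_{d⊕d*}}. Then the operator I + Φ_q d_q Ψ_{μ,q} W_q, acting on the space F^{k,s(s,λ,λ',δ)}_{T,Λ^q,D_{d⊕d*}} ∩ S_{d*} (co-closed q-forms with the graph norm), is continuously invertible. -/

import Mathlib

open scoped BigOperators ENNReal Classical
open Filter MeasureTheory

noncomputable section

namespace NSdeRham

/-- Euclidean space `ℝⁿ`. -/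
abbrev Spc (n : ℕ) := EuclideanSpace ℝ (Fin n)

variable {n : ℕ}

/-- The weight `w(x) = √(1+|x|²)`. -/
def wt (x : Spc n) : ℝ := Real.sqrt (1 + ‖x‖ ^ 2)

/-- `w(x,y) = max (w x) (w y)`. -/
def wt2 (x y : Spc n) : ℝ := max (wt x) (wt y)

/-- Partial derivative in the `i`-th coordinate direction. -/
def pd (i : Fin n) (f : Spc n → ℝ) (x : Spc n) : ℝ :=
  fderiv ℝ f x (EuclideanSpace.single i 1)

/-- The Laplace operator `Δ = ∑ ∂²/∂xᵢ²`. -/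
def lap (f : Spc n → ℝ) (x : Spc n) : ℝ := ∑ i : Fin n, pd i (pd i f) x

section enorms

variable {F : Type*} [NormedAddCommGroup F]

/-- Weighted sup-"norm" `sup_x w(x)^δ ‖g x‖` (with values in `ℝ≥0∞`). -/
def eWSup (δ : ℝ) (g : Spc n → F) : ℝ≥0∞ :=
  ⨆ x : Spc n, ENNReal.ofReal (wt x ^ δ * ‖g x‖)

/-- Weighted Hölder seminorm `⟨g⟩_{λ,δ}`. -/
def eWHold (lam δ : ℝ) (g : Spc n → F) : ℝ≥0∞ :=
  ⨆ (x : Spc n) (y : Spc n) (_ : x ≠ y ∧ ‖x - y‖ ≤ ‖x‖ / 2),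
    ENNReal.ofReal (wt2 x y ^ (δ + lam) * ‖g x - g y‖ / ‖x - y‖ ^ lam)

/-- The ordinary Hölder norm on the (closed) unit ball around the origin. -/
def eOHold (lam : ℝ) (g : Spc n → F) : ℝ≥0∞ :=
  (⨆ (x : Spc n) (_ : ‖x‖ ≤ 1), ENNReal.ofReal ‖g x‖) +
    ⨆ (x : Spc n) (y : Spc n) (_ : ‖x‖ ≤ 1 ∧ ‖y‖ ≤ 1 ∧ x ≠ y),
      ENNReal.ofReal (‖g x - g y‖ / ‖x - y‖ ^ lam)

/-- The norm of `C^{0,λ,δ}`; for `λ = 0` this is just the weighted sup-norm. -/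
def eHol0 (lam δ : ℝ) (g : Spc n → F) : ℝ≥0∞ :=
  if lam = 0 then eWSup δ g else eOHold lam g + eWSup δ g + eWHold lam δ g

/-- The norm of the base anisotropic space `C^{𝐬(0,λ,δ)}_T`. -/
def eAniso0 (T lam δ : ℝ) (v : ℝ → Spc n → F) : ℝ≥0∞ :=
  (⨆ t : Set.Icc (0 : ℝ) T, eHol0 lam δ (v t)) +
    if lam = 0 then 0 else
      ⨆ (t₁ : Set.Icc (0 : ℝ) T) (t₂ : Set.Icc (0 : ℝ) T) (_ : (t₁ : ℝ) ≠ (t₂ : ℝ))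
        (x : Spc n),
        ENNReal.ofReal (wt x ^ δ * ‖v t₁ x - v t₂ x‖ / |(t₁ : ℝ) - (t₂ : ℝ)| ^ (lam / 2))

end enorms

/-- The norm of the static weighted Hölder space `C^{s,λ,δ}`. -/
def eHolS (s : ℕ) (lam δ : ℝ) (g : Spc n → ℝ) : ℝ≥0∞ :=
  ∑ m ∈ Finset.range (s + 1), eHol0 lam (δ + m) (iteratedFDeriv ℝ m g)

/-- Membership in the static weighted Hölder space `C^{s,λ,δ}`. -/
def HolSMem (s : ℕ) (lam δ : ℝ) (g : Spc n → ℝ) : Prop :=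
  ContDiff ℝ s g ∧ eHolS s lam δ g ≠ ⊤

/-- Time derivative of order `j` (within `[0,T]`). -/
def tDeriv (T : ℝ) (j : ℕ) (u : ℝ → Spc n → ℝ) (t : ℝ) (x : Spc n) : ℝ :=
  iteratedDerivWithin j (fun τ => u τ x) (Set.Icc 0 T) t

/-- Mixed derivative `∂_x^m ∂_t^j`. -/
def mixDeriv (T : ℝ) (m j : ℕ) (u : ℝ → Spc n → ℝ) (t : ℝ) :
    Spc n → ContinuousMultilinearMap ℝ (fun _ : Fin m => Spc n) ℝ :=
  iteratedFDeriv ℝ m (fun x => tDeriv T j u t x)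

/-- The norm of the anisotropic weighted parabolic Hölder space `C^{k,𝐬(s,λ,δ)}_T`. -/
def eAnisoKS (T : ℝ) (k s : ℕ) (lam δ : ℝ) (u : ℝ → Spc n → ℝ) : ℝ≥0∞ :=
  ∑ b ∈ Finset.range (k + 1), ∑ m ∈ Finset.range (2 * s + 1), ∑ j ∈ Finset.range (s + 1),
    if m + 2 * j ≤ 2 * s then eAniso0 T lam (δ + b + m) (mixDeriv T (b + m) j u) else 0

/-- Regularity required of members of `C^{k,𝐬(s,λ,δ)}_T`. -/
def AnisoReg (T : ℝ) (k s : ℕ) (u : ℝ → Spc n → ℝ) : Prop :=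
  (∀ x : Spc n, ContDiffOn ℝ s (fun t => u t x) (Set.Icc 0 T)) ∧
  (∀ j : ℕ, j ≤ s → ∀ t ∈ Set.Icc (0 : ℝ) T,
    ContDiff ℝ (2 * (s - j) + k) (fun x => tDeriv T j u t x)) ∧
  (∀ j m : ℕ, j ≤ s → m + 2 * j ≤ 2 * s + k →
    Continuous fun p : Set.Icc (0 : ℝ) T × Spc n => mixDeriv T m j u p.1 p.2)

/-- Membership in `C^{k,𝐬(s,λ,δ)}_T`. -/
def AnisoMem (T : ℝ) (k s : ℕ) (lam δ : ℝ) (u : ℝ → Spc n → ℝ) : Prop :=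
  AnisoReg T k s u ∧ eAnisoKS T k s lam δ u ≠ ⊤

/-- The norm of `𝓕^{k,𝐬(s,λ,λ',δ)}_T = C^{k+1,𝐬(s,λ,δ)}_T ∩ C^{k,𝐬(s,λ',δ)}_T`. -/
def eFn (T : ℝ) (k s : ℕ) (lam lam' δ : ℝ) (u : ℝ → Spc n → ℝ) : ℝ≥0∞ :=
  eAnisoKS T (k + 1) s lam δ u + eAnisoKS T k s lam' δ u

/-- Membership in `𝓕^{k,𝐬(s,λ,λ',δ)}_T`. -/
def FMem (T : ℝ) (k s : ℕ) (lam lam' δ : ℝ) (u : ℝ → Spc n → ℝ) : Prop :=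
  AnisoReg T (k + 1) s u ∧ eFn T k s lam lam' δ u ≠ ⊤

/-- Index set of a basis of `Λ^q`. -/
abbrev Idx (n q : ℕ) := {I : Finset (Fin n) // I.card = q}

/-- Static differential `q`-forms: coefficient functions. -/
abbrev FormS (n q : ℕ) := Idx n q → Spc n → ℝ

/-- Time-dependent differential `q`-forms. -/
abbrev FormT (n q : ℕ) := Idx n q → ℝ → Spc n → ℝ

/-- Fibre of the bundle `Λ^q`. -/
abbrev Fib (n q : ℕ) := Idx n q → ℝ

/-- The exterior derivative `d_q` on static `q`-forms. -/
def dS {q : ℕ} (u : FormS n q) : FormS n (q + 1) := fun J x =>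
  ∑ i : Fin n,
    if h : i ∈ J.1 then
      (-1 : ℝ) ^ (J.1.filter fun j => j < i).card *
        pd i (u ⟨J.1.erase i, by simp [Finset.card_erase_of_mem h, J.2]⟩) x
    else 0

/-- The exterior derivative `d_{q-1}` mapping `(q-1)`-forms to `q`-forms. -/
def dLowS {q : ℕ} (p : FormS n (q - 1)) : FormS n q := fun J x =>
  ∑ i : Fin n,
    if h : i ∈ J.1 ∧ (J.1.erase i).card = q - 1 then
      (-1 : ℝ) ^ (J.1.filter fun j => j < i).card * pd i (p ⟨J.1.erase i, h.2⟩) x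
    else 0

/-- The formal adjoint `d_{q-1}^*` mapping `q`-forms to `(q-1)`-forms. -/
def coDS {q : ℕ} (u : FormS n q) : FormS n (q - 1) := fun K x =>
  -∑ i : Fin n,
    if h : i ∉ K.1 ∧ (insert i K.1).card = q then
      (-1 : ℝ) ^ (K.1.filter fun j => j < i).card * pd i (u ⟨insert i K.1, h.2⟩) x
    else 0

/-- `d_q` on time-dependent forms. -/
def dT {q : ℕ} (u : FormT n q) : FormT n (q + 1) := fun J t => dS (fun I => u I t) J

/-- `d_{q-1}` on time-dependent forms. -/
def dLowT {q : ℕ} (p : FormT n (q - 1)) : FormT n q := fun J t => dLowS (fun I => p I t) J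

/-- `d_{q-1}^*` on time-dependent forms. -/
def coDT {q : ℕ} (u : FormT n q) : FormT n (q - 1) := fun K t => coDS (fun I => u I t) K

/-- Norm of `C^{k,𝐬(s,λ,δ)}_{T,Λ^q}`. -/
def eAnisoKSF {q : ℕ} (T : ℝ) (k s : ℕ) (lam δ : ℝ) (u : FormT n q) : ℝ≥0∞ :=
  ∑ I : Idx n q, eAnisoKS T k s lam δ (u I)

/-- Membership in `C^{k,𝐬(s,λ,δ)}_{T,Λ^q}`. -/
def CMemF {q : ℕ} (T : ℝ) (k s : ℕ) (lam δ : ℝ) (u : FormT n q) : Prop :=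
  (∀ I, AnisoReg T k s (u I)) ∧ eAnisoKSF T k s lam δ u ≠ ⊤

/-- Graph norm of `C^{k,𝐬(s,λ,δ)}_{T,Λ^q,𝒟_{d⊕d*}}`. -/
def eCD {q : ℕ} (T : ℝ) (k s : ℕ) (lam δ : ℝ) (u : FormT n q) : ℝ≥0∞ :=
  eAnisoKSF T k s lam δ u + eAnisoKSF T k s lam (δ + 1) (dT u) +
    eAnisoKSF T k s lam (δ + 1) (coDT u)

/-- Membership in `C^{k,𝐬(s,λ,δ)}_{T,Λ^q,𝒟_{d⊕d*}}`. -/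
def CMemD {q : ℕ} (T : ℝ) (k s : ℕ) (lam δ : ℝ) (u : FormT n q) : Prop :=
  CMemF T k s lam δ u ∧ CMemF T k s lam (δ + 1) (dT u) ∧ CMemF T k s lam (δ + 1) (coDT u)

/-- Norm of `𝓕^{k,𝐬(s,λ,λ',δ)}_{T,Λ^q}`. -/
def eFF {q : ℕ} (T : ℝ) (k s : ℕ) (lam lam' δ : ℝ) (u : FormT n q) : ℝ≥0∞ :=
  ∑ I : Idx n q, eFn T k s lam lam' δ (u I)

/-- Membership in `𝓕^{k,𝐬(s,λ,λ',δ)}_{T,Λ^q}`. -/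
def FMemF {q : ℕ} (T : ℝ) (k s : ℕ) (lam lam' δ : ℝ) (u : FormT n q) : Prop :=
  (∀ I, AnisoReg T (k + 1) s (u I)) ∧ eFF T k s lam lam' δ u ≠ ⊤

/-- Graph norm of `𝓕^{k,𝐬(s,λ,λ',δ)}_{T,Λ^q,𝒟_{d⊕d*}}`. -/
def eFD {q : ℕ} (T : ℝ) (k s : ℕ) (lam lam' δ : ℝ) (u : FormT n q) : ℝ≥0∞ :=
  eFF T k s lam lam' δ u + eFF T k s lam lam' (δ + 1) (dT u) +
    eFF T k s lam lam' (δ + 1) (coDT u)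

/-- Membership in `𝓕^{k,𝐬(s,λ,λ',δ)}_{T,Λ^q,𝒟_{d⊕d*}}`. -/
def FMemD {q : ℕ} (T : ℝ) (k s : ℕ) (lam lam' δ : ℝ) (u : FormT n q) : Prop :=
  FMemF T k s lam lam' δ u ∧ FMemF T k s lam lam' (δ + 1) (dT u) ∧
    FMemF T k s lam lam' (δ + 1) (coDT u)

/-- Norm of the static space `C^{s,λ,δ}_{Λ^q}`. -/
def eHolSF {q : ℕ} (s : ℕ) (lam δ : ℝ) (g : FormS n q) : ℝ≥0∞ :=
  ∑ I : Idx n q, eHolS s lam δ (g I)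

/-- Membership in the static space `C^{s,λ,δ}_{Λ^q}`. -/
def HolMemF {q : ℕ} (s : ℕ) (lam δ : ℝ) (g : FormS n q) : Prop :=
  (∀ I, ContDiff ℝ s (g I)) ∧ eHolSF s lam δ g ≠ ⊤

/-- Equality of time-dependent forms on `ℝⁿ × [0,T]`. -/
def EqOnT {q : ℕ} (T : ℝ) (u v : FormT n q) : Prop :=
  ∀ I, ∀ t ∈ Set.Icc (0 : ℝ) T, ∀ x, u I t x = v I t x

/-- The form `u` is co-closed (`d^* u = 0`) on `ℝⁿ × [0,T]`. -/
def CoClosed {q : ℕ} (T : ℝ) (u : FormT n q) : Prop :=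
  ∀ K, ∀ t ∈ Set.Icc (0 : ℝ) T, ∀ x, coDT u K t x = 0

/-- Type of the bilinear zero order operator `M₁^{(q)}`. -/
abbrev M1Type (n q : ℕ) := (Fib n (q + 1) × Fib n (q - 1)) →ₗ[ℝ] Fib n q →ₗ[ℝ] Fib n q

/-- Type of the bilinear zero order operator `M₂^{(q)}`. -/
abbrev M2Type (n q : ℕ) := Fib n q →ₗ[ℝ] Fib n q →ₗ[ℝ] Fib n (q - 1)

/-- Value of a time-dependent form at a point, as an element of the fibre. -/
def fib {q : ℕ} (u : FormT n q) (t : ℝ) (x : Spc n) : Fib n q := fun I => u I t x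

/-- Value of `(d_q ⊕ d_{q-1}^*) u` at a point. -/
def ddFib {q : ℕ} (u : FormT n q) (t : ℝ) (x : Spc n) : Fib n (q + 1) × Fib n (q - 1) :=
  (fun J => dT u J t x, fun K => coDT u K t x)

/-- The operator `W_q u = M₁((d⊕d^*)u, w) + M₁((d⊕d^*)w, u)`. -/
def Wop {q : ℕ} (M₁ : M1Type n q) (w u : FormT n q) : FormT n q := fun I t x =>
  M₁ (ddFib u t x) (fib w t x) I + M₁ (ddFib w t x) (fib u t x) I

/-- The symmetric bilinearization `B_q(w,u)` of the nonlinearity. -/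
def Bop {q : ℕ} (M₁ : M1Type n q) (M₂ : M2Type n q) (w u : FormT n q) : FormT n q :=
  fun I t x =>
    Wop M₁ w u I t x +
      dLowT (fun K t' x' =>
        M₂ (fib u t' x') (fib w t' x') K + M₂ (fib w t' x') (fib u t' x') K) I t x

/-- The nonlinearity `𝒩_q u = M₁((d⊕d^*)u, u) + d_{q-1} M₂(u,u)`. -/
def Nop {q : ℕ} (M₁ : M1Type n q) (M₂ : M2Type n q) (u : FormT n q) : FormT n q :=
  fun I t x =>
    M₁ (ddFib u t x) (fib u t x) I +
      dLowT (fun K t' x' => M₂ (fib u t' x') (fib u t' x') K) I t x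

/-- Fundamental solution of the heat operator `∂_t - μΔ`. -/
def heatKer (μ : ℝ) (x : Spc n) (t : ℝ) : ℝ :=
  if 0 < t then (4 * Real.pi * μ * t) ^ (-(n : ℝ) / 2) * Real.exp (-‖x‖ ^ 2 / (4 * μ * t))
  else 0

/-- Volume heat potential `Ψ_μ`. -/
def volPot (μ : ℝ) (f : ℝ → Spc n → ℝ) (t : ℝ) (x : Spc n) : ℝ :=
  ∫ τ in Set.Ioc (0 : ℝ) t, ∫ y : Spc n, heatKer μ (x - y) (t - τ) * f τ y

/-- Poisson heat potential `Ψ_{μ,0}`. -/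
def poisPot (μ : ℝ) (g : Spc n → ℝ) (t : ℝ) (x : Spc n) : ℝ :=
  ∫ y : Spc n, heatKer μ (x - y) t * g y

/-- Volume heat potential acting coefficient-wise on forms. -/
def volPotF {q : ℕ} (μ : ℝ) (f : FormT n q) : FormT n q := fun I => volPot μ (f I)

/-- Poisson heat potential acting coefficient-wise on forms. -/
def poisPotF {q : ℕ} (μ : ℝ) (g : FormS n q) : FormT n q := fun I => poisPot μ (g I)

/-- Area of the unit sphere in `ℝⁿ`. -/
def sphArea (n : ℕ) : ℝ := 2 * Real.pi ^ ((n : ℝ) / 2) / Real.Gamma ((n : ℝ) / 2)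

/-- Standard fundamental solution of the Laplace operator in `ℝⁿ`. -/
def lapKer (n : ℕ) (x : Spc n) : ℝ :=
  if n = 2 then (1 / Real.pi) * Real.log ‖x‖
  else ‖x‖ ^ (2 - (n : ℝ)) / (sphArea n * (2 - (n : ℝ)))

/-- Newtonian potential. -/
def newtPot (f : Spc n → ℝ) (x : Spc n) : ℝ := ∫ y : Spc n, lapKer n (x - y) * f y

/-- The integral operator `Φ_q` mapping `(q+1)`-forms to `q`-forms;
concretely `Φ_q f = -d^* (e * f)`. -/
def PhiOp {q : ℕ} (f : FormT n (q + 1)) : FormT n q := fun K t x =>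
  -coDS (n := n) (q := q + 1) (fun J y => newtPot (fun z => f J t z) y) K x

/-- Squared `L²` norm of a form at time `t`. -/
def l2Sq {q : ℕ} (u : FormT n q) (t : ℝ) : ℝ :=
  ∑ I : Idx n q, ∫ x : Spc n, (u I t x) ^ 2

/-- Squared `L²` norm of the spatial gradient of a form at time `t`. -/
def gradSq {q : ℕ} (u : FormT n q) (t : ℝ) : ℝ :=
  ∑ I : Idx n q, ∑ i : Fin n, ∫ x : Spc n, (pd i (fun y => u I t y) x) ^ 2

/-- The norm of `C^{0,𝐬(0,0,δ)}_{T,Λ^q}` (weighted sup-norm). -/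
def eSupT {q : ℕ} (T δ : ℝ) (u : FormT n q) : ℝ≥0∞ :=
  ∑ I : Idx n q,
    ⨆ (t : Set.Icc (0 : ℝ) T) (x : Spc n), ENNReal.ofReal (wt x ^ δ * |u I t x|)

/-- The norm `‖∇u‖_{C^{0,𝐬(0,0,δ)}_{T}}` of the spatial gradient. -/
def eSupGradT {q : ℕ} (T δ : ℝ) (u : FormT n q) : ℝ≥0∞ :=
  ∑ I : Idx n q, ∑ i : Fin n,
    ⨆ (t : Set.Icc (0 : ℝ) T) (x : Spc n),
      ENNReal.ofReal (wt x ^ δ * |pd i (fun y => u I t y) x|)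

/-- `q`-form with coefficients harmonic polynomials of degree at most `m`. -/
def HarmPolyForm {q : ℕ} (m : ℕ) (h : FormS n q) : Prop :=
  ∀ I, (∃ P : MvPolynomial (Fin n) ℝ, P.totalDegree ≤ m ∧
      ∀ x : Spc n, h I x = MvPolynomial.eval (fun i => x i) P) ∧
    ∀ x : Spc n, lap (h I) x = 0

/-- Classical solution of the Cauchy problem
`∂_t u - μ Δ u + extra = f` on `ℝⁿ × (0,T)`, `u(·,0) = u₀`. -/
def CauchySol {q : ℕ} (T μ : ℝ) (u extra f : FormT n q) (u₀ : FormS n q) : Prop :=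
  (∀ I, ∀ t ∈ Set.Ioo (0 : ℝ) T, ∀ x,
    deriv (fun τ => u I τ x) t - μ * lap (fun y => u I t y) x + extra I t x = f I t x) ∧
  ∀ I x, u I 0 x = u₀ I x

/-- `Ψ_{μ,q} 𝒩_q u`. -/
def NopPot {q : ℕ} (μ : ℝ) (M₁ : M1Type n q) (M₂ : M2Type n q) (u : FormT n q) : FormT n q :=
  volPotF μ (Nop M₁ M₂ u)

/-- `u + Ψ_{μ,q} 𝒩_q u`. -/
def TmapN {q : ℕ} (μ : ℝ) (M₁ : M1Type n q) (M₂ : M2Type n q) (u : FormT n q) : FormT n q :=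
  u + NopPot μ M₁ M₂ u

/-- The linearization `u + Ψ_{μ,q} B_q(v,u)`. -/
def LmapB {q : ℕ} (μ : ℝ) (M₁ : M1Type n q) (M₂ : M2Type n q) (v u : FormT n q) :
    FormT n q :=
  u + volPotF μ (Bop M₁ M₂ v u)

/-- `Φ_q d_q Ψ_{μ,q} 𝒩_q u`. -/
def PhiNpot {q : ℕ} (μ : ℝ) (M₁ : M1Type n q) (M₂ : M2Type n q) (u : FormT n q) :
    FormT n q :=
  PhiOp (dT (volPotF μ (Nop M₁ M₂ u)))

/-- `u + Φ_q d_q Ψ_{μ,q} 𝒩_q u`. -/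
def PhiNmap {q : ℕ} (μ : ℝ) (M₁ : M1Type n q) (M₂ : M2Type n q) (u : FormT n q) :
    FormT n q :=
  u + PhiNpot μ M₁ M₂ u

/-- The linearization `u + Φ_q d_q Ψ_{μ,q} B_q(v,u)`. -/
def PhiLmap {q : ℕ} (μ : ℝ) (M₁ : M1Type n q) (M₂ : M2Type n q) (v u : FormT n q) :
    FormT n q :=
  u + PhiOp (dT (volPotF μ (Bop M₁ M₂ v u)))

theorem wt_sq (x : Spc n) : wt x ^ 2 = 1 + ‖x‖ ^ 2 := by
  unfold wt; exact Real.sq_sqrt (by positivity)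

theorem one_le_wt (x : Spc n) : 1 ≤ wt x := by
  unfold wt; rw [Real.one_le_sqrt]; nlinarith [sq_nonneg ‖x‖]

theorem wt_pos (x : Spc n) : 0 < wt x := lt_of_lt_of_le one_pos (one_le_wt x)

theorem norm_le_wt (x : Spc n) : ‖x‖ ≤ wt x := by
  unfold wt; exact Real.le_sqrt_of_sq_le (by linarith)

theorem wt_le_one_add (x : Spc n) : wt x ≤ 1 + ‖x‖ := by
  unfold wt; rw [Real.sqrt_le_left (by positivity)]; nlinarith [norm_nonneg x]

theorem continuous_wt : Continuous (wt : Spc n → ℝ) := by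
  unfold wt; fun_prop

theorem wt_le_add (x y : Spc n) : wt x ≤ wt y + ‖x - y‖ := by
  have h1 : ‖x‖ ≤ ‖y‖ + ‖x - y‖ := by
    have := norm_add_le y (x - y); simpa using this
  have h2 := wt_sq y
  have h3 := norm_le_wt y
  have h4 := wt_pos y
  have h5 := norm_nonneg (x - y)
  unfold wt at *
  rw [Real.sqrt_le_left (by positivity)]
  nlinarith [norm_nonneg x, norm_nonneg y]

theorem wt_le_mul (x y : Spc n) : wt x ≤ wt y * (1 + ‖x - y‖) := by
  have := wt_le_add x y
  nlinarith [one_le_wt y, norm_nonneg (x - y)]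

theorem wt_rpow_le (p : ℝ) (x y : Spc n) {r : ℝ} (h : ‖x - y‖ ≤ r) :
    wt y ^ p ≤ (1 + r) ^ |p| * wt x ^ p := by
  have h0 : 0 ≤ r := (norm_nonneg _).trans h
  have hx := wt_pos x
  have hy := wt_pos y
  have h1 : wt x ≤ (1 + r) * wt y := by
    have := wt_le_mul x y
    nlinarith
  have h2 : wt y ≤ (1 + r) * wt x := by
    have := wt_le_mul y x
    rw [norm_sub_rev] at this
    nlinarith
  rcases le_total 0 p with hp | hp
  · rw [abs_of_nonneg hp, ← Real.mul_rpow (by positivity) hx.le]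
    exact Real.rpow_le_rpow hy.le h2 hp
  · rw [abs_of_nonpos hp]
    have h3 : wt x ^ (-p) ≤ (1 + r) ^ (-p) * wt y ^ (-p) := by
      rw [← Real.mul_rpow (by positivity) hy.le]
      exact Real.rpow_le_rpow hx.le h1 (by linarith)
    have e1 : wt x ^ (-p) * wt x ^ p = 1 := by rw [← Real.rpow_add hx]; simp
    have e2 : wt y ^ (-p) * wt y ^ p = 1 := by rw [← Real.rpow_add hy]; simp
    have p1 : 0 < wt x ^ p := by positivity
    have p2 : 0 < wt y ^ p := by positivity
    have := mul_le_mul_of_nonneg_right h3 (mul_pos p1 p2).le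
    calc wt y ^ p = (wt x ^ (-p) * wt x ^ p) * wt y ^ p := by rw [e1, one_mul]
      _ = wt x ^ (-p) * (wt x ^ p * wt y ^ p) := by ring
      _ ≤ (1 + r) ^ (-p) * wt y ^ (-p) * (wt x ^ p * wt y ^ p) := this
      _ = (1 + r) ^ (-p) * wt x ^ p * (wt y ^ (-p) * wt y ^ p) := by ring
      _ = _ := by rw [e2, mul_one]

theorem wt_rpow_near (p : ℝ) (x y : Spc n) (h : ‖x - y‖ ≤ wt x / 4) :
    wt y ^ p ≤ 2 ^ |p| * wt x ^ p := by
  have hx := wt_pos x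
  have hy := wt_pos y
  have h1 : wt x ≤ 2 * wt y := by
    have := wt_le_add x y
    linarith
  have h2 : wt y ≤ 2 * wt x := by
    have := wt_le_add y x
    rw [norm_sub_rev] at this
    linarith
  rcases le_total 0 p with hp | hp
  · rw [abs_of_nonneg hp, ← Real.mul_rpow (by positivity) hx.le]
    exact Real.rpow_le_rpow hy.le h2 hp
  · rw [abs_of_nonpos hp]
    have h4 := Real.rpow_le_rpow_of_nonpos (by positivity) (by linarith : wt x / 2 ≤ wt y) hp
    rw [Real.div_rpow hx.le (by norm_num)] at h4
    rw [Real.rpow_neg (by norm_num), mul_comm, ← div_eq_mul_inv]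
    exact h4

/-- Data of a base space: time horizon, Hölder exponent, exponential time weight and a switch
for the Hölder seminorms. -/
structure Cfg where
  /-- time horizon -/
  T : ℝ
  /-- Hölder exponent -/
  lam : ℝ
  /-- exponential weight in time -/
  β : ℝ
  /-- whether Hölder seminorms are included -/
  h : Prop
  hT : 0 < T
  hl0 : 0 < lam
  hl1 : lam < 1
  hβ : 0 ≤ β

/-- Joint continuity on `[0,T] × ℝⁿ`. -/
def JC (T : ℝ) (v : ℝ → Spc n → ℝ) : Prop :=
  ContinuousOn (fun p : ℝ × Spc n => v p.1 p.2) (Set.Icc 0 T ×ˢ Set.univ)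

/-- The base class: functions of weighted norm at most `K`. -/
def Bas (c : Cfg) (σ K : ℝ) (v : ℝ → Spc n → ℝ) : Prop :=
  JC c.T v ∧
  (∀ t ∈ Set.Icc 0 c.T, ∀ x, |v t x| ≤ K * Real.exp (c.β * t) * wt x ^ (-σ)) ∧
  (c.h →
    (∀ t ∈ Set.Icc 0 c.T, ∀ x y, ‖x - y‖ ≤ wt x / 4 →
      |v t x - v t y| ≤ K * Real.exp (c.β * c.T) * ‖x - y‖ ^ c.lam * wt x ^ (-(σ + c.lam))) ∧
    ∀ t ∈ Set.Icc 0 c.T, ∀ t' ∈ Set.Icc 0 c.T, ∀ x,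
      |v t x - v t' x| ≤ K * Real.exp (c.β * c.T) * |t - t'| ^ (c.lam / 2) * wt x ^ (-σ))

/-- Functions whose space derivatives up to order `N` lie in the base class, each derivative
improving the weight by one. -/
def Cl (c : Cfg) : ℕ → ℝ → ℝ → (ℝ → Spc n → ℝ) → Prop
  | 0, σ, K, v => Bas c σ K v
  | N + 1, σ, K, v => Bas c σ K v ∧ (∀ t ∈ Set.Icc 0 c.T, Differentiable ℝ (v t)) ∧
      ∀ i, Cl c N (σ + 1) K (fun t => pd i (v t))

/-- The configuration with trivial exponential weight. -/
def Cfg.flat (c : Cfg) : Cfg := { c with β := 0, hβ := le_rfl }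

theorem Cl.bas {c : Cfg} {N : ℕ} {σ K : ℝ} {v : ℝ → Spc n → ℝ} (h : Cl c N σ K v) :
    Bas c σ K v := by
  cases N with
  | zero => exact h
  | succ N => exact h.1

theorem Cfg.zero_mem (c : Cfg) : (0 : ℝ) ∈ Set.Icc 0 c.T := ⟨le_rfl, c.hT.le⟩

theorem Bas.nonneg {c : Cfg} {σ K : ℝ} {v : ℝ → Spc n → ℝ} (h : Bas c σ K v) : 0 ≤ K := by
  have := h.2.1 0 c.zero_mem 0
  have h2 : 0 ≤ K * Real.exp (c.β * 0) * wt (0 : Spc n) ^ (-σ) := (abs_nonneg _).trans this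
  have p := wt_pos (0 : Spc n)
  have : 0 < Real.exp (c.β * 0) * wt (0 : Spc n) ^ (-σ) := by positivity
  by_contra hK
  push Not at hK
  nlinarith

theorem Cl.nonneg {c : Cfg} {N : ℕ} {σ K : ℝ} {v : ℝ → Spc n → ℝ} (h : Cl c N σ K v) : 0 ≤ K :=
  h.bas.nonneg

theorem Bas.mono {c : Cfg} {σ σ' K K' : ℝ} {v : ℝ → Spc n → ℝ} (h : Bas c σ K v)
    (hσ : σ' ≤ σ) (hK : K ≤ K') : Bas c σ' K' v := by
  have h0 := h.nonneg
  have hw : ∀ (x : Spc n) (a : ℝ), wt x ^ (-(σ + a)) ≤ wt x ^ (-(σ' + a)) := fun x a =>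
    Real.rpow_le_rpow_of_exponent_le (one_le_wt x) (by linarith)
  have hw0 : ∀ (x : Spc n), wt x ^ (-σ) ≤ wt x ^ (-σ') := fun x =>
    Real.rpow_le_rpow_of_exponent_le (one_le_wt x) (by linarith)
  have hp : ∀ (x : Spc n) (a : ℝ), 0 ≤ wt x ^ a := fun x a => Real.rpow_nonneg (wt_pos x).le a
  have hK' : 0 ≤ K' := h0.trans hK
  refine ⟨h.1, fun t ht x => (h.2.1 t ht x).trans ?_, fun hh => ⟨fun t ht x y hxy =>
    ((h.2.2 hh).1 t ht x y hxy).trans ?_, fun t ht t' ht' x =>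
    ((h.2.2 hh).2 t ht t' ht' x).trans ?_⟩⟩
  · exact mul_le_mul (mul_le_mul_of_nonneg_right hK (Real.exp_pos _).le) (hw0 x) (hp _ _)
      (by positivity)
  · exact mul_le_mul (mul_le_mul_of_nonneg_right
      (mul_le_mul_of_nonneg_right hK (Real.exp_pos _).le) (by positivity)) (hw x _) (hp _ _)
      (by positivity)
  · exact mul_le_mul (mul_le_mul_of_nonneg_right
      (mul_le_mul_of_nonneg_right hK (Real.exp_pos _).le) (by positivity)) (hw0 x) (hp _ _)
      (by positivity)

theorem Cl.mono {c : Cfg} {N : ℕ} {σ σ' K K' : ℝ} {v : ℝ → Spc n → ℝ} (h : Cl c N σ K v)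
    (hσ : σ' ≤ σ) (hK : K ≤ K') : Cl c N σ' K' v := by
  induction N generalizing σ σ' v with
  | zero => exact Bas.mono h hσ hK
  | succ N ih => exact ⟨h.1.mono hσ hK, h.2.1, fun i => ih (h.2.2 i) (by linarith)⟩

theorem Cl.drop {c : Cfg} {N : ℕ} {σ K : ℝ} {v : ℝ → Spc n → ℝ} (h : Cl c (N + 1) σ K v) :
    Cl c N σ K v := by
  induction N generalizing σ v with
  | zero => exact h.1
  | succ N ih => exact ⟨h.1, h.2.1, fun i => ih (h.2.2 i)⟩

theorem Cl.le {c : Cfg} {N M : ℕ} {σ K : ℝ} {v : ℝ → Spc n → ℝ} (h : Cl c N σ K v)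
    (hM : M ≤ N) : Cl c M σ K v := by
  induction hM with
  | refl => exact h
  | step _ ih => exact ih h.drop

theorem JC.congr {T : ℝ} {v v' : ℝ → Spc n → ℝ} (h : JC T v)
    (he : ∀ t ∈ Set.Icc 0 T, v' t = v t) : JC T v' := by
  refine ContinuousOn.congr h ?_
  rintro ⟨t, x⟩ ⟨ht, -⟩
  simp only [he t ht]

theorem Bas.congr {c : Cfg} {σ K : ℝ} {v v' : ℝ → Spc n → ℝ} (h : Bas c σ K v)
    (he : ∀ t ∈ Set.Icc 0 c.T, v' t = v t) : Bas c σ K v' := by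
  refine ⟨h.1.congr he, fun t ht x => ?_, fun hh => ⟨fun t ht x y hxy => ?_,
    fun t ht t' ht' x => ?_⟩⟩
  · rw [he t ht]; exact h.2.1 t ht x
  · rw [he t ht]; exact (h.2.2 hh).1 t ht x y hxy
  · rw [he t ht, he t' ht']; exact (h.2.2 hh).2 t ht t' ht' x

theorem Cl.congr {c : Cfg} {N : ℕ} {σ K : ℝ} {v v' : ℝ → Spc n → ℝ} (h : Cl c N σ K v)
    (he : ∀ t ∈ Set.Icc 0 c.T, v' t = v t) : Cl c N σ K v' := by
  induction N generalizing σ v v' with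
  | zero => exact Bas.congr h he
  | succ N ih =>
    refine ⟨h.1.congr he, fun t ht => ?_, fun i => ih (h.2.2 i) fun t ht => ?_⟩
    · rw [he t ht]; exact h.2.1 t ht
    · rw [he t ht]

theorem Bas.add {c : Cfg} {σ K K' : ℝ} {v v' : ℝ → Spc n → ℝ} (h : Bas c σ K v)
    (h' : Bas c σ K' v') : Bas c σ (K + K') (fun t x => v t x + v' t x) := by
  refine ⟨ContinuousOn.add h.1 h'.1, fun t ht x => ?_, fun hh => ⟨fun t ht x y hxy => ?_,
    fun t ht t' ht' x => ?_⟩⟩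
  · calc _ ≤ |v t x| + |v' t x| := abs_add_le _ _
      _ ≤ _ := add_le_add (h.2.1 t ht x) (h'.2.1 t ht x)
      _ = _ := by ring
  · calc _ = |(v t x - v t y) + (v' t x - v' t y)| := by congr 1; ring
      _ ≤ |v t x - v t y| + |v' t x - v' t y| := abs_add_le _ _
      _ ≤ _ := add_le_add ((h.2.2 hh).1 t ht x y hxy) ((h'.2.2 hh).1 t ht x y hxy)
      _ = _ := by ring
  · calc _ = |(v t x - v t' x) + (v' t x - v' t' x)| := by congr 1; ring
      _ ≤ |v t x - v t' x| + |v' t x - v' t' x| := abs_add_le _ _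
      _ ≤ _ := add_le_add ((h.2.2 hh).2 t ht t' ht' x) ((h'.2.2 hh).2 t ht t' ht' x)
      _ = _ := by ring

theorem pd_add (i : Fin n) {f g : Spc n → ℝ} (hf : Differentiable ℝ f) (hg : Differentiable ℝ g) :
    pd i (fun x => f x + g x) = fun x => pd i f x + pd i g x := by
  funext x
  simp only [pd]
  rw [fderiv_fun_add (hf x) (hg x)]; rfl

theorem pd_const_mul (i : Fin n) {f : Spc n → ℝ} (a : ℝ) (hf : Differentiable ℝ f) :
    pd i (fun x => a * f x) = fun x => a * pd i f x := by
  funext x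
  simp only [pd]
  rw [fderiv_const_mul (hf x)]; rfl

theorem pd_mul (i : Fin n) {f g : Spc n → ℝ} (hf : Differentiable ℝ f) (hg : Differentiable ℝ g) :
    pd i (fun x => f x * g x) = fun x => pd i f x * g x + f x * pd i g x := by
  funext x
  simp only [pd]
  rw [fderiv_fun_mul (hf x) (hg x)]
  simp only [add_apply, smul_apply, smul_eq_mul]
  ring

theorem Cl.add {c : Cfg} {N : ℕ} {σ K K' : ℝ} {v v' : ℝ → Spc n → ℝ} (h : Cl c N σ K v)
    (h' : Cl c N σ K' v') : Cl c N σ (K + K') (fun t x => v t x + v' t x) := by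
  induction N generalizing σ v v' with
  | zero => exact Bas.add h h'
  | succ N ih =>
    refine ⟨h.1.add h'.1, fun t ht => (h.2.1 t ht).add (h'.2.1 t ht), fun i => ?_⟩
    refine (ih (h.2.2 i) (h'.2.2 i)).congr fun t ht => ?_
    exact pd_add i (h.2.1 t ht) (h'.2.1 t ht)

theorem Bas.smul {c : Cfg} {σ K : ℝ} {v : ℝ → Spc n → ℝ} (h : Bas c σ K v) (a : ℝ) :
    Bas c σ (|a| * K) (fun t x => a * v t x) := by
  refine ⟨ContinuousOn.mul continuousOn_const h.1, fun t ht x => ?_,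
    fun hh => ⟨fun t ht x y hxy => ?_, fun t ht t' ht' x => ?_⟩⟩
  · rw [abs_mul]
    have := mul_le_mul_of_nonneg_left (h.2.1 t ht x) (abs_nonneg a)
    linarith
  · rw [← mul_sub, abs_mul]
    have := mul_le_mul_of_nonneg_left ((h.2.2 hh).1 t ht x y hxy) (abs_nonneg a)
    linarith
  · rw [← mul_sub, abs_mul]
    have := mul_le_mul_of_nonneg_left ((h.2.2 hh).2 t ht t' ht' x) (abs_nonneg a)
    linarith

theorem Cl.smul {c : Cfg} {N : ℕ} {σ K : ℝ} {v : ℝ → Spc n → ℝ} (h : Cl c N σ K v) (a : ℝ) :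
    Cl c N σ (|a| * K) (fun t x => a * v t x) := by
  induction N generalizing σ v with
  | zero => exact Bas.smul h a
  | succ N ih =>
    refine ⟨h.1.smul a, fun t ht => (h.2.1 t ht).const_mul a, fun i => ?_⟩
    exact (ih (h.2.2 i)).congr fun t ht => pd_const_mul i a (h.2.1 t ht)

theorem Bas.zero (c : Cfg) (σ : ℝ) {K : ℝ} (hK : 0 ≤ K) :
    Bas c σ K (fun _ (_ : Spc n) => 0) := by
  have hp : ∀ (x : Spc n) (a : ℝ), 0 ≤ wt x ^ a := fun x a => Real.rpow_nonneg (wt_pos x).le a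
  refine ⟨continuousOn_const, fun t _ x => ?_, fun _ => ⟨fun t _ x y _ => ?_,
    fun t _ t' _ x => ?_⟩⟩
  · simp only [abs_zero]; have := hp x (-σ); positivity
  · simp only [sub_self, abs_zero]; have := hp x (-(σ + c.lam)); positivity
  · simp only [sub_self, abs_zero]; have := hp x (-σ); positivity

theorem pd_const (i : Fin n) (a : ℝ) : pd i (fun _ : Spc n => a) = fun _ => 0 := by
  funext x; simp [pd]

theorem Cl.zero (c : Cfg) (N : ℕ) (σ : ℝ) {K : ℝ} (hK : 0 ≤ K) :
    Cl c N σ K (fun _ (_ : Spc n) => 0) := by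
  induction N generalizing σ with
  | zero => exact Bas.zero c σ hK
  | succ N ih =>
    refine ⟨Bas.zero c σ hK, fun t _ => differentiable_const _, fun i => ?_⟩
    exact (ih (σ + 1)).congr fun t _ => pd_const i 0

theorem Cl.sum {c : Cfg} {N : ℕ} {σ : ℝ} {ι : Type*} (s : Finset ι) {K : ι → ℝ}
    {v : ι → ℝ → Spc n → ℝ} (h : ∀ i ∈ s, Cl c N σ (K i) (v i)) :
    Cl c N σ (∑ i ∈ s, K i) (fun t x => ∑ i ∈ s, v i t x) := by
  induction s using Finset.induction_on with
  | empty => simpa using Cl.zero c N σ le_rfl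
  | insert a s ha ih =>
    simp only [Finset.sum_insert ha]
    exact (h a (by simp)).add (ih fun i hi => h i (by simp [hi]))

theorem Bas.mul {c : Cfg} {σ₁ σ₂ K₁ K₂ : ℝ} {a b : ℝ → Spc n → ℝ} (ha : Bas c.flat σ₁ K₁ a)
    (hb : Bas c σ₂ K₂ b) :
    Bas c (σ₁ + σ₂) ((1 + 2 ^ |σ₂|) * K₁ * K₂) (fun t x => a t x * b t x) := by
  have h1 := ha.nonneg
  have h2 := hb.nonneg
  have hp : ∀ (x : Spc n) (a : ℝ), 0 ≤ wt x ^ a := fun x a => Real.rpow_nonneg (wt_pos x).le a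
  have hC : (0 : ℝ) ≤ 2 ^ |σ₂| := by positivity
  have hT := c.hT
  have hβ := c.hβ
  have hexp : ∀ t ∈ Set.Icc 0 c.T, Real.exp (c.β * t) ≤ Real.exp (c.β * c.T) := fun t ht =>
    Real.exp_le_exp.2 (mul_le_mul_of_nonneg_left ht.2 hβ)
  have sa : ∀ t ∈ Set.Icc 0 c.T, ∀ x, |a t x| ≤ K₁ * wt x ^ (-σ₁) := fun t ht x => by
    have := ha.2.1 t ht x
    simpa [Cfg.flat] using this
  have sb := hb.2.1
  refine ⟨ContinuousOn.mul ha.1 hb.1, fun t ht x => ?_, fun hh => ⟨fun t ht x y hxy => ?_,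
    fun t ht t' ht' x => ?_⟩⟩
  · rw [abs_mul]
    calc |a t x| * |b t x| ≤ (K₁ * wt x ^ (-σ₁)) * (K₂ * Real.exp (c.β * t) * wt x ^ (-σ₂)) :=
          mul_le_mul (sa t ht x) (sb t ht x) (abs_nonneg _) (by have := hp x (-σ₁); positivity)
      _ = 1 * (K₁ * K₂ * Real.exp (c.β * t) * wt x ^ (-(σ₁ + σ₂))) := by
          rw [neg_add, Real.rpow_add (wt_pos x)]; ring
      _ ≤ (1 + 2 ^ |σ₂|) * (K₁ * K₂ * Real.exp (c.β * t) * wt x ^ (-(σ₁ + σ₂))) := by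
          apply mul_le_mul_of_nonneg_right (by linarith)
          have := hp x (-(σ₁ + σ₂)); positivity
      _ = _ := by ring
  · have ha1 : |a t x - a t y| ≤ K₁ * ‖x - y‖ ^ c.lam * wt x ^ (-(σ₁ + c.lam)) := by
      have := (ha.2.2 hh).1 t ht x y hxy
      simpa [Cfg.flat] using this
    have hb1 := (hb.2.2 hh).1 t ht x y hxy
    have hby : |b t y| ≤ K₂ * Real.exp (c.β * c.T) * (2 ^ |σ₂| * wt x ^ (-σ₂)) := by
      refine (sb t ht y).trans ?_
      have := wt_rpow_near (-σ₂) x y hxy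
      rw [abs_neg] at this
      have h3 := hexp t ht
      gcongr
      exact hp _ _
    have hn : 0 ≤ ‖x - y‖ ^ c.lam := by positivity
    calc |a t x * b t x - a t y * b t y|
        = |a t x * (b t x - b t y) + (a t x - a t y) * b t y| := by congr 1; ring
      _ ≤ |a t x| * |b t x - b t y| + |a t x - a t y| * |b t y| := by
          rw [← abs_mul, ← abs_mul]; exact abs_add_le _ _
      _ ≤ (K₁ * wt x ^ (-σ₁)) * (K₂ * Real.exp (c.β * c.T) * ‖x - y‖ ^ c.lam *
            wt x ^ (-(σ₂ + c.lam))) + (K₁ * ‖x - y‖ ^ c.lam * wt x ^ (-(σ₁ + c.lam))) *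
            (K₂ * Real.exp (c.β * c.T) * (2 ^ |σ₂| * wt x ^ (-σ₂))) := by
          have := hp x (-σ₁)
          have := hp x (-(σ₁ + c.lam))
          exact add_le_add (mul_le_mul (sa t ht x) hb1 (abs_nonneg _) (by positivity))
            (mul_le_mul ha1 hby (abs_nonneg _) (by positivity))
      _ = _ := by
          have e : wt x ^ (-(σ₁ + σ₂ + c.lam)) = wt x ^ (-σ₁) * wt x ^ (-σ₂) * wt x ^ (-c.lam) := by
            rw [← Real.rpow_add (wt_pos x), ← Real.rpow_add (wt_pos x)]; congr 1; ring
          rw [e, neg_add, neg_add, Real.rpow_add (wt_pos x), Real.rpow_add (wt_pos x)]; ring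
  · have ha1 : |a t x - a t' x| ≤ K₁ * |t - t'| ^ (c.lam / 2) * wt x ^ (-σ₁) := by
      have := (ha.2.2 hh).2 t ht t' ht' x
      simpa [Cfg.flat] using this
    have hb1 := (hb.2.2 hh).2 t ht t' ht' x
    have hby : |b t' x| ≤ K₂ * Real.exp (c.β * c.T) * wt x ^ (-σ₂) := by
      refine (sb t' ht' x).trans ?_
      have h3 := hexp t' ht'
      gcongr
      exact hp _ _
    have hn : 0 ≤ |t - t'| ^ (c.lam / 2) := by positivity
    have q1 := hp x (-σ₁)
    have q2 := hp x (-σ₂)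
    calc |a t x * b t x - a t' x * b t' x|
        = |a t x * (b t x - b t' x) + (a t x - a t' x) * b t' x| := by congr 1; ring
      _ ≤ |a t x| * |b t x - b t' x| + |a t x - a t' x| * |b t' x| := by
          rw [← abs_mul, ← abs_mul]; exact abs_add_le _ _
      _ ≤ (K₁ * wt x ^ (-σ₁)) * (K₂ * Real.exp (c.β * c.T) * |t - t'| ^ (c.lam / 2) *
            wt x ^ (-σ₂)) + (K₁ * |t - t'| ^ (c.lam / 2) * wt x ^ (-σ₁)) *
            (K₂ * Real.exp (c.β * c.T) * wt x ^ (-σ₂)) := by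
          exact add_le_add (mul_le_mul (sa t ht x) hb1 (abs_nonneg _) (by positivity))
            (mul_le_mul ha1 hby (abs_nonneg _) (by positivity))
      _ = 2 * (K₁ * K₂ * Real.exp (c.β * c.T) * |t - t'| ^ (c.lam / 2) *
            wt x ^ (-(σ₁ + σ₂))) := by
          rw [neg_add, Real.rpow_add (wt_pos x)]; ring
      _ ≤ (1 + 2 ^ |σ₂|) * (K₁ * K₂ * Real.exp (c.β * c.T) * |t - t'| ^ (c.lam / 2) *
            wt x ^ (-(σ₁ + σ₂))) := by
          apply mul_le_mul_of_nonneg_right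
          · have : (1 : ℝ) ≤ 2 ^ |σ₂| := Real.one_le_rpow (by norm_num) (abs_nonneg _)
            linarith
          · have := hp x (-(σ₁ + σ₂)); positivity
      _ = _ := by ring

theorem Cl.mul (N : ℕ) (σ₁ σ₂ : ℝ) : ∃ C : ℝ, 0 ≤ C ∧ ∀ (c : Cfg) (K₁ K₂ : ℝ)
    (a b : ℝ → Spc n → ℝ), Cl c.flat N σ₁ K₁ a → Cl c N σ₂ K₂ b →
      Cl c N (σ₁ + σ₂) (C * K₁ * K₂) (fun t x => a t x * b t x) := by
  induction N generalizing σ₁ σ₂ with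
  | zero => exact ⟨1 + 2 ^ |σ₂|, by positivity, fun c K₁ K₂ a b ha hb => Bas.mul ha hb⟩
  | succ N ih =>
    obtain ⟨C₁, hC₁, h₁⟩ := ih (σ₁ + 1) σ₂
    obtain ⟨C₂, hC₂, h₂⟩ := ih σ₁ (σ₂ + 1)
    refine ⟨(1 + 2 ^ |σ₂|) + C₁ + C₂, by positivity, fun c K₁ K₂ a b ha hb => ?_⟩
    have k1 := ha.nonneg
    have k2 := hb.nonneg
    have hC : (0 : ℝ) ≤ 1 + 2 ^ |σ₂| := by positivity
    have hk : 0 ≤ K₁ * K₂ := by positivity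
    refine ⟨(Bas.mul ha.1 hb.1).mono le_rfl ?_, fun t ht => (ha.2.1 t ht).mul (hb.2.1 t ht),
      fun i => ?_⟩
    · simp only [mul_assoc]
      exact mul_le_mul_of_nonneg_right (by linarith) hk
    · have e1 := h₁ c K₁ K₂ _ _ (ha.2.2 i) hb.drop
      have e2 := h₂ c K₁ K₂ _ _ ha.drop (hb.2.2 i)
      have e1' := e1.mono (by linarith : σ₁ + σ₂ + 1 ≤ σ₁ + 1 + σ₂) le_rfl
      have e2' := e2.mono (by linarith : σ₁ + σ₂ + 1 ≤ σ₁ + (σ₂ + 1)) le_rfl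
      refine ((e1'.add e2').mono le_rfl ?_).congr fun t ht => ?_
      · have : C₁ * K₁ * K₂ + C₂ * K₁ * K₂ = (C₁ + C₂) * (K₁ * K₂) := by ring
        rw [this, mul_assoc]
        exact mul_le_mul_of_nonneg_right (by linarith) hk
      · exact pd_mul i (ha.2.1 t ht) (hb.2.1 t ht)

theorem Bas.const (c : Cfg) (a : ℝ) : Bas c.flat 0 |a| (fun _ (_ : Spc n) => a) := by
  refine ⟨continuousOn_const, fun t _ x => by simp [Cfg.flat], fun _ => ⟨fun t _ x y _ => ?_,
    fun t _ t' _ x => ?_⟩⟩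
  · have := Real.rpow_nonneg (wt_pos x).le (-(0 + c.flat.lam))
    simp only [sub_self, abs_zero]; positivity
  · have := Real.rpow_nonneg (wt_pos x).le (-0)
    simp only [sub_self, abs_zero]; positivity

theorem Cl.const (c : Cfg) (N : ℕ) (a : ℝ) : Cl c.flat N 0 |a| (fun _ (_ : Spc n) => a) := by
  cases N with
  | zero => exact Bas.const c a
  | succ N =>
    exact ⟨Bas.const c a, fun t _ => differentiable_const _, fun i =>
      (Cl.zero c.flat N (0 + 1) (abs_nonneg a)).congr fun t _ => pd_const i a⟩

theorem abs_coord_le (a : Fin n) (x : Spc n) : |x a| ≤ ‖x‖ := by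
  simpa using EuclideanSpace.norm_eq x ▸ (by
    rw [← Real.sqrt_sq_eq_abs]
    refine Real.sqrt_le_sqrt ?_
    have := Finset.single_le_sum (f := fun i => ‖x i‖ ^ 2) (fun i _ => by positivity)
      (Finset.mem_univ a)
    simpa using this : |x a| ≤ Real.sqrt (∑ i, ‖x i‖ ^ 2))

theorem norm_le_sum_abs (x : Spc n) : ‖x‖ ≤ ∑ a, |x a| := by
  rw [EuclideanSpace.norm_eq, Real.sqrt_le_left (Finset.sum_nonneg fun _ _ => abs_nonneg _)]
  simpa using Finset.sum_sq_le_sq_sum_of_nonneg (s := Finset.univ) (f := fun a => |x a|)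
    (fun _ _ => abs_nonneg _)

theorem pd_coord (a b : Fin n) : pd b (fun x : Spc n => x a) = fun _ => if a = b then 1 else 0 := by
  funext x
  have : (fun x : Spc n => x a) = (EuclideanSpace.proj a : Spc n →L[ℝ] ℝ) := by
    funext x; simp
  rw [pd, this, ContinuousLinearMap.fderiv]
  simp

theorem differentiable_coord (a : Fin n) : Differentiable ℝ (fun x : Spc n => x a) := by
  fun_prop

theorem norm_le_rpow_mul {x : Spc n} {z lam : ℝ} (hz : 0 ≤ z) (h : z ≤ wt x) (h0 : 0 < lam)
    (h1 : lam < 1) : z ≤ z ^ lam * wt x ^ (1 - lam) := by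
  rcases hz.eq_or_lt with rfl | hz'
  · rw [Real.zero_rpow h0.ne']; simp
  · calc z = z ^ lam * z ^ (1 - lam) := by rw [← Real.rpow_add hz']; simp
      _ ≤ _ := by
        have := Real.rpow_le_rpow hz h (by linarith : 0 ≤ 1 - lam)
        gcongr

theorem Bas.coord (c : Cfg) (a : Fin n) : Bas c.flat (-1) 1 (fun _ (x : Spc n) => x a) := by
  refine ⟨Continuous.continuousOn (by fun_prop), fun t _ x => ?_, fun _ => ⟨fun t _ x y hxy => ?_,
    fun t _ t' _ x => ?_⟩⟩
  · simpa [Cfg.flat] using (abs_coord_le a x).trans (norm_le_wt x)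
  · have h1 : |x a - y a| ≤ ‖x - y‖ := by simpa using abs_coord_le a (x - y)
    have h2 := norm_le_rpow_mul (norm_nonneg (x - y))
      (hxy.trans (by have := wt_pos x; linarith : wt x / 4 ≤ wt x)) c.hl0 c.hl1
    have e : wt x ^ (-(-1 + c.lam)) = wt x ^ (1 - c.lam) := by congr 1; ring
    simpa only [Cfg.flat, e, zero_mul, Real.exp_zero, one_mul, mul_one] using h1.trans h2
  · have := Real.rpow_nonneg (wt_pos x).le (- -1)
    simp only [sub_self, abs_zero]; positivity

theorem Cl.coord (c : Cfg) (N : ℕ) (a : Fin n) :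
    Cl c.flat N (-1) 1 (fun _ (x : Spc n) => x a) := by
  cases N with
  | zero => exact Bas.coord c a
  | succ N =>
    refine ⟨Bas.coord c a, fun t _ => differentiable_coord a, fun i => ?_⟩
    refine Cl.congr (v := fun _ _ => if a = i then 1 else 0) ?_ fun t _ => pd_coord a i
    refine (Cl.const c N _).mono (by norm_num) ?_
    split_ifs <;> simp

theorem Cl.coord_mul (N : ℕ) (σ : ℝ) : ∃ C : ℝ, 0 ≤ C ∧ ∀ (c : Cfg) (K : ℝ) (a : Fin n)
    (v : ℝ → Spc n → ℝ), Cl c N σ K v → Cl c N (σ - 1) (C * K) (fun t x => x a * v t x) := by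
  obtain ⟨C, hC, h⟩ := Cl.mul (n := n) N (-1) σ
  refine ⟨C, hC, fun c K a v hv => ?_⟩
  have := h c 1 K _ _ (Cl.coord c N a) hv
  rw [mul_one] at this
  exact this.mono (by linarith) le_rfl

theorem Bas.of_coord (σ : ℝ) : ∃ C : ℝ, 0 ≤ C ∧ ∀ (c : Cfg) (K : ℝ) (v : ℝ → Spc n → ℝ),
    Bas c σ K v → (∀ a, Bas c σ K (fun t x => x a * v t x)) → Bas c (σ + 1) (C * K) v := by
  refine ⟨(1 + n) + n * ((1 + n) * 2 ^ |σ + 1|), by positivity, fun c K v h ha => ?_⟩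
  have hK := h.nonneg
  have hp : ∀ (x : Spc n) (a : ℝ), 0 ≤ wt x ^ a := fun x a => Real.rpow_nonneg (wt_pos x).le a
  have hw : ∀ (x : Spc n), wt x ≤ 1 + ∑ a, |x a| := fun x =>
    (wt_le_one_add x).trans (by linarith [norm_le_sum_abs x])
  have key : ∀ (x : Spc n) (A z : ℝ), |z| ≤ A → (∀ a, |x a| * |z| ≤ A) →
      wt x * |z| ≤ (1 + n) * A := by
    intro x A z hz hza
    calc wt x * |z| ≤ (1 + ∑ a, |x a|) * |z| := by gcongr; exact hw x
      _ = |z| + ∑ a, |x a| * |z| := by rw [add_mul, one_mul, Finset.sum_mul]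
      _ ≤ A + ∑ _a : Fin n, A := add_le_add hz (Finset.sum_le_sum fun a _ => hza a)
      _ = _ := by simp; ring
  have fin : ∀ (x : Spc n) (z A p : ℝ), wt x * |z| ≤ A * wt x ^ p → |z| ≤ A * wt x ^ (p - 1) := by
    intro x z A p hz
    rw [Real.rpow_sub (wt_pos x), Real.rpow_one, ← mul_div_assoc, le_div_iff₀ (wt_pos x)]
    linarith
  have hsup : ∀ t ∈ Set.Icc 0 c.T, ∀ x, |v t x| ≤ (1 + n) * K * Real.exp (c.β * t) *
      wt x ^ (-(σ + 1)) := by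
    intro t ht x
    have := key x _ (v t x) (h.2.1 t ht x) fun a => by
      have := (ha a).2.1 t ht x
      rwa [abs_mul] at this
    have e : -(σ + 1) = -σ - 1 := by ring
    rw [e]
    refine fin x _ _ _ (this.trans (le_of_eq ?_))
    ring
  have hexp : ∀ t ∈ Set.Icc 0 c.T, Real.exp (c.β * t) ≤ Real.exp (c.β * c.T) := fun t ht =>
    Real.exp_le_exp.2 (mul_le_mul_of_nonneg_left ht.2 c.hβ)
  refine ⟨h.1, fun t ht x => (hsup t ht x).trans ?_, fun hh => ⟨fun t ht x y hxy => ?_,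
    fun t ht t' ht' x => ?_⟩⟩
  · have : (1 + n) * K ≤ ((1 + n) + n * ((1 + n) * 2 ^ |σ + 1|)) * K := by
      exact mul_le_mul_of_nonneg_right (le_add_of_nonneg_right (by positivity)) hK
    exact mul_le_mul_of_nonneg_right (mul_le_mul_of_nonneg_right this (Real.exp_pos _).le) (hp _ _)
  · have hb := (h.2.2 hh).1 t ht x y hxy
    set E := Real.exp (c.β * c.T) with hE
    set A := K * E * ‖x - y‖ ^ c.lam * wt x ^ (-(σ + c.lam)) with hA
    have hE0 : 0 < E := Real.exp_pos _
    have hA0 : 0 ≤ A := (abs_nonneg _).trans hb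
    have hy : ‖x - y‖ * |v t y| ≤ (1 + n) * 2 ^ |σ + 1| * A := by
      have h1 : |v t y| ≤ (1 + n) * K * E * (2 ^ |σ + 1| * wt x ^ (-(σ + 1))) := by
        refine (hsup t ht y).trans ?_
        have h2 := wt_rpow_near (-(σ + 1)) x y hxy
        rw [abs_neg] at h2
        have h3 := hexp t ht
        gcongr
        exact hp _ _
      have h2 := norm_le_rpow_mul (norm_nonneg (x - y))
        (hxy.trans (by have := wt_pos x; linarith : wt x / 4 ≤ wt x)) c.hl0 c.hl1
      have h5 := hp x (1 - c.lam)
      calc _ ≤ (‖x - y‖ ^ c.lam * wt x ^ (1 - c.lam)) *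
            ((1 + n) * K * E * (2 ^ |σ + 1| * wt x ^ (-(σ + 1)))) :=
            mul_le_mul h2 h1 (abs_nonneg _) (by positivity)
        _ = (1 + n) * 2 ^ |σ + 1| * (K * E * ‖x - y‖ ^ c.lam *
            (wt x ^ (1 - c.lam) * wt x ^ (-(σ + 1)))) := by ring
        _ = _ := by
            rw [hA, ← Real.rpow_add (wt_pos x)]; congr 3
            ring
    have h6 : ∀ a, |x a| * |v t x - v t y| ≤ A + (1 + n) * 2 ^ |σ + 1| * A := by
      intro a
      have h7 := ((ha a).2.2 hh).1 t ht x y hxy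
      have h8 : |x a - y a| ≤ ‖x - y‖ := by simpa using abs_coord_le a (x - y)
      calc |x a| * |v t x - v t y| = |(x a * v t x - y a * v t y) - (x a - y a) * v t y| := by
            rw [← abs_mul]; congr 1; ring
        _ ≤ |x a * v t x - y a * v t y| + |x a - y a| * |v t y| := by
            rw [← abs_mul]; exact abs_sub _ _
        _ ≤ A + ‖x - y‖ * |v t y| := by gcongr
        _ ≤ _ := by linarith
    have h9 : wt x * |v t x - v t y| ≤ A + n * (A + (1 + n) * 2 ^ |σ + 1| * A) := by
      calc wt x * |v t x - v t y| ≤ (1 + ∑ a, |x a|) * |v t x - v t y| := by gcongr; exact hw x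
        _ = |v t x - v t y| + ∑ a, |x a| * |v t x - v t y| := by
            rw [add_mul, one_mul, Finset.sum_mul]
        _ ≤ A + ∑ _a : Fin n, (A + (1 + n) * 2 ^ |σ + 1| * A) :=
            add_le_add hb (Finset.sum_le_sum fun a _ => h6 a)
        _ = _ := by simp; ring
    have e : -(σ + 1 + c.lam) = -(σ + c.lam) - 1 := by ring
    rw [e]
    refine fin x _ _ _ (h9.trans (le_of_eq ?_))
    rw [hA]; ring
  · set E := Real.exp (c.β * c.T) with hE
    have hE0 : 0 < E := Real.exp_pos _
    have := key x _ (v t x - v t' x) ((h.2.2 hh).2 t ht t' ht' x) fun a => by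
      have := ((ha a).2.2 hh).2 t ht t' ht' x
      rwa [← mul_sub, abs_mul] at this
    have e : -(σ + 1) = -σ - 1 := by ring
    have h2 : |v t x - v t' x| ≤ (1 + n) * K * E * |t - t'| ^ (c.lam / 2) * wt x ^ (-(σ + 1)) := by
      rw [e]
      refine fin x _ _ _ (this.trans (le_of_eq ?_))
      ring
    refine h2.trans ?_
    have : (1 + n) * K ≤ ((1 + n) + n * ((1 + n) * 2 ^ |σ + 1|)) * K := by
      exact mul_le_mul_of_nonneg_right (le_add_of_nonneg_right (by positivity)) hK
    exact mul_le_mul_of_nonneg_right (mul_le_mul_of_nonneg_right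
      (mul_le_mul_of_nonneg_right this hE0.le) (by positivity)) (hp _ _)

/-- If `f` and all `x_a f` lie in a class, then `f` decays by one order better. -/
theorem Cl.of_coord (N : ℕ) (σ : ℝ) : ∃ C : ℝ, 0 ≤ C ∧ ∀ (c : Cfg) (K : ℝ)
    (v : ℝ → Spc n → ℝ), Cl c N σ K v → (∀ a, Cl c N σ K (fun t x => x a * v t x)) →
      Cl c N (σ + 1) (C * K) v := by
  induction N generalizing σ with
  | zero => exact Bas.of_coord σ
  | succ N ih =>
    obtain ⟨C₀, hC₀, h₀⟩ := Bas.of_coord (n := n) σ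
    obtain ⟨C₁, hC₁, h₁⟩ := ih σ
    obtain ⟨C₂, hC₂, h₂⟩ := ih (σ + 1)
    refine ⟨C₀ + C₂ * (1 + C₁), by positivity, fun c K v h ha => ?_⟩
    have hK := h.nonneg
    have hv := h₁ c K v h.drop fun a => (ha a).drop
    refine ⟨(h₀ c K v h.1 fun a => (ha a).1).mono le_rfl ?_, h.2.1, fun i => ?_⟩
    · gcongr; linarith [mul_nonneg hC₂ (by linarith : 0 ≤ 1 + C₁)]
    · refine (h₂ c ((1 + C₁) * K) _ ((h.2.2 i).mono le_rfl ?_) fun a => ?_).mono le_rfl ?_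
      · nlinarith [mul_nonneg hC₁ hK]
      · have e := (((ha a).2.2 i).add (hv.smul (if a = i then -1 else 0))).mono
          (K' := (1 + C₁) * K) le_rfl (by split_ifs <;> simp <;> nlinarith [mul_nonneg hC₁ hK])
        refine e.congr fun t ht => ?_
        rw [pd_mul i (differentiable_coord a) (h.2.1 t ht)]
        funext x
        rw [pd_coord]
        split_ifs <;> simp
      · nlinarith [mul_nonneg hC₀ hK]

theorem Cl.map {c c' : Cfg} {A : ℝ} (hT : c'.T = c.T)
    (hB : ∀ (σ K : ℝ) (v : ℝ → Spc n → ℝ), Bas c σ K v → Bas c' σ (A * K) v) {N : ℕ} {σ K : ℝ}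
    {v : ℝ → Spc n → ℝ} (h : Cl c N σ K v) : Cl c' N σ (A * K) v := by
  induction N generalizing σ v with
  | zero => exact hB _ _ _ h
  | succ N ih => exact ⟨hB _ _ _ h.1, hT ▸ h.2.1, fun i => ih (h.2.2 i)⟩

/-- Drop the Hölder seminorms. -/
def Cfg.sup (c : Cfg) : Cfg := { c with h := False }

theorem Cl.flat_of_sup {c : Cfg} (hh : ¬ c.h) {N : ℕ} {σ K : ℝ} {v : ℝ → Spc n → ℝ}
    (h : Cl c N σ K v) : Cl c.flat N σ (Real.exp (c.β * c.T) * K) v := by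
  refine Cl.map (c := c) (c' := c.flat) rfl (fun σ K v hv => ⟨hv.1, fun t ht x => ?_,
    fun h => (hh h).elim⟩) h
  have h1 := hv.2.1 t ht x
  have hK := hv.nonneg
  simp only [Cfg.flat, zero_mul, Real.exp_zero, mul_one]
  refine h1.trans ?_
  have h2 := Real.rpow_nonneg (wt_pos x).le (-σ)
  have h3 : Real.exp (c.β * t) ≤ Real.exp (c.β * c.T) :=
    Real.exp_le_exp.2 (mul_le_mul_of_nonneg_left ht.2 c.hβ)
  have := mul_le_mul_of_nonneg_left h3 hK
  exact mul_le_mul_of_nonneg_right (by linarith) h2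

/-- Lower the Hölder exponent. -/
theorem Cl.lower {c : Cfg} {l : ℝ} (hl0 : 0 < l) (hl : l ≤ c.lam) (hl1 : l < 1) {N : ℕ}
    {σ K : ℝ} {v : ℝ → Spc n → ℝ} (h : Cl c N σ K v) :
    Cl { c with lam := l, hl0 := hl0, hl1 := hl1 } N σ
      ((1 + c.T ^ ((c.lam - l) / 2)) * K) v := by
  have hT := c.hT
  refine Cl.map (c := c) (c' := { c with lam := l, hl0 := hl0, hl1 := hl1 })
    (A := 1 + c.T ^ ((c.lam - l) / 2)) rfl (fun σ K v hv =>
    ⟨hv.1, fun t ht x => (hv.2.1 t ht x).trans ?_, fun hh => ⟨fun t ht x y hxy =>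
    ((hv.2.2 hh).1 t ht x y hxy).trans ?_, fun t ht t' ht' x =>
    ((hv.2.2 hh).2 t ht t' ht' x).trans ?_⟩⟩) h
  all_goals
    have hK := hv.nonneg
    have hA : 0 ≤ c.T ^ ((c.lam - l) / 2) := by positivity
    have hp := fun p => Real.rpow_nonneg (wt_pos x).le p
  · have h1 := hp (-σ)
    have : K ≤ (1 + c.T ^ ((c.lam - l) / 2)) * K := by nlinarith [mul_nonneg hA hK]
    gcongr
  · have h1 := hp (-(σ + l))
    have e : ‖x - y‖ ^ c.lam * wt x ^ (-(σ + c.lam)) ≤ ‖x - y‖ ^ l * wt x ^ (-(σ + l)) := by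
      rcases (norm_nonneg (x - y)).eq_or_lt with h0 | h0
      · rw [← h0, Real.zero_rpow hl0.ne', Real.zero_rpow c.hl0.ne']; simp
      · have : ‖x - y‖ ≤ wt x := hxy.trans (by have := wt_pos x; linarith)
        have h3 := Real.rpow_le_rpow h0.le this (by linarith : 0 ≤ c.lam - l)
        have h4 := hp (-(σ + c.lam))
        calc _ = ‖x - y‖ ^ l * (‖x - y‖ ^ (c.lam - l) * wt x ^ (-(σ + c.lam))) := by
              rw [← mul_assoc, ← Real.rpow_add h0]; congr 2; ring
          _ ≤ ‖x - y‖ ^ l * (wt x ^ (c.lam - l) * wt x ^ (-(σ + c.lam))) := by gcongr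
          _ = _ := by rw [← Real.rpow_add (wt_pos x)]; congr 2; ring
    have hE := Real.exp_pos (c.β * c.T)
    calc _ = K * Real.exp (c.β * c.T) * (‖x - y‖ ^ c.lam * wt x ^ (-(σ + c.lam))) := by ring
      _ ≤ K * Real.exp (c.β * c.T) * (‖x - y‖ ^ l * wt x ^ (-(σ + l))) := by gcongr
      _ ≤ (1 + c.T ^ ((c.lam - l) / 2)) * (K * Real.exp (c.β * c.T) *
          (‖x - y‖ ^ l * wt x ^ (-(σ + l)))) :=
          le_mul_of_one_le_left (by positivity) (by linarith)
      _ = _ := by ring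
  · have h1 := hp (-σ)
    have e : |t - t'| ^ (c.lam / 2) ≤ (1 + c.T ^ ((c.lam - l) / 2)) * |t - t'| ^ (l / 2) := by
      have h2 : |t - t'| ≤ c.T := by rw [abs_le]; constructor <;> linarith [ht.1, ht.2, ht'.1, ht'.2]
      calc |t - t'| ^ (c.lam / 2) = |t - t'| ^ ((c.lam - l) / 2 + l / 2) := by congr 1; ring
        _ = |t - t'| ^ ((c.lam - l) / 2) * |t - t'| ^ (l / 2) :=
            Real.rpow_add_of_nonneg (abs_nonneg _) (by linarith) (by linarith)
        _ ≤ c.T ^ ((c.lam - l) / 2) * |t - t'| ^ (l / 2) := by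
            gcongr
        _ ≤ _ := by gcongr; linarith
    have hE := Real.exp_pos (c.β * c.T)
    calc _ ≤ K * Real.exp (c.β * c.T) * ((1 + c.T ^ ((c.lam - l) / 2)) * |t - t'| ^ (l / 2)) *
          wt x ^ (-σ) := by gcongr
      _ = _ := by ring

/-- `v'` is the time derivative of `v` on `[0,T]`. -/
def TD (T : ℝ) (v v' : ℝ → Spc n → ℝ) : Prop :=
  ∀ x, ∀ t ∈ Set.Icc 0 T, HasDerivWithinAt (fun τ => v τ x) (v' t x) (Set.Icc 0 T) t

theorem hasDerivAt_line {f : Spc n → ℝ} (hf : Differentiable ℝ f) (x : Spc n) (i : Fin n)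
    (η : ℝ) : HasDerivAt (fun h : ℝ => f (x + h • EuclideanSpace.single i 1))
      (pd i f (x + η • EuclideanSpace.single i 1)) η := by
  have h1 : HasDerivAt (fun h : ℝ => x + h • (EuclideanSpace.single i 1 : Spc n))
      (EuclideanSpace.single i 1) η := by
    simpa using ((hasDerivAt_id η).smul_const (EuclideanSpace.single i 1 : Spc n)).const_add x
  exact (hf _).hasFDerivAt.comp_hasDerivAt η h1

theorem norm_single_one (i : Fin n) : ‖(EuclideanSpace.single i 1 : Spc n)‖ = 1 := by simp

/-- Time derivatives commute with space derivatives. -/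
theorem TD.pd {T : ℝ} {v v' : ℝ → Spc n → ℝ} (h : TD T v v') (i : Fin n)
    (hv : ∀ t ∈ Set.Icc 0 T, Differentiable ℝ (v t))
    (hv' : ∀ t ∈ Set.Icc 0 T, Differentiable ℝ (v' t))
    (hc : JC T (fun t => NSdeRham.pd i (v' t))) :
    TD T (fun t => NSdeRham.pd i (v t)) (fun t => NSdeRham.pd i (v' t)) := by
  intro x t₀ ht₀
  rw [hasDerivWithinAt_iff_isLittleO, Asymptotics.isLittleO_iff]
  intro ε hε
  have hc0 := hc (t₀, x) ⟨ht₀, Set.mem_univ _⟩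
  rw [Metric.continuousWithinAt_iff] at hc0
  obtain ⟨r, hr, hc1⟩ := hc0 ε hε
  set e : Spc n := EuclideanSpace.single i 1 with he
  have hen : ‖e‖ = 1 := norm_single_one i
  set p₀ := NSdeRham.pd i (v' t₀) x with hp₀
  have hb : ∀ τ ∈ Set.Icc 0 T ∩ Metric.ball t₀ r, ∀ η ∈ Metric.ball (0 : ℝ) r,
      ‖NSdeRham.pd i (v' τ) (x + η • e) - p₀‖ ≤ ε := by
    intro τ hτ η hη
    have := hc1 (x := (τ, x + η • e)) ⟨hτ.1, Set.mem_univ _⟩ (by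
      rw [Prod.dist_eq, max_lt_iff]
      refine ⟨hτ.2, ?_⟩
      simpa [dist_eq_norm, norm_smul, hen] using hη)
    rw [dist_eq_norm] at this
    exact this.le
  have h1 : ∀ τ ∈ Set.Icc 0 T ∩ Metric.ball t₀ r, ∀ η ∈ Metric.ball (0 : ℝ) r,
      ‖v' τ (x + η • e) - v' τ x - η * p₀‖ ≤ ε * |η| := by
    intro τ hτ η hη
    have := (convex_ball (0 : ℝ) r).norm_image_sub_le_of_norm_hasDerivWithin_le
      (f := fun η : ℝ => v' τ (x + η • e) - η * p₀)
      (fun η' _ => (((hasDerivAt_line (hv' τ hτ.1) x i η').sub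
        ((hasDerivAt_id η').mul_const p₀)).hasDerivWithinAt))
      (fun η' hη' => by simpa using hb τ hτ η' hη') (Metric.mem_ball_self hr) hη
    simp only [zero_smul, add_zero, zero_mul, sub_zero] at this
    rw [show v' τ (x + η • e) - v' τ x - η * p₀ = v' τ (x + η • e) - η * p₀ - v' τ x by ring]
    simpa using this
  have h2 : ∀ t ∈ Set.Icc 0 T ∩ Metric.ball t₀ r, ∀ η ∈ Metric.ball (0 : ℝ) r,
      ‖(v t (x + η • e) - v t x - t * (η * p₀)) -
        (v t₀ (x + η • e) - v t₀ x - t₀ * (η * p₀))‖ ≤ ε * |η| * ‖t - t₀‖ := by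
    intro t ht η hη
    refine ((convex_Icc 0 T).inter (convex_ball t₀ r)).norm_image_sub_le_of_norm_hasDerivWithin_le
      (f := fun τ => v τ (x + η • e) - v τ x - τ * (η * p₀))
      (f' := fun τ => v' τ (x + η • e) - v' τ x - η * p₀)
      (fun τ hτ => ?_) (fun τ hτ => h1 τ hτ η hη) ⟨ht₀, Metric.mem_ball_self hr⟩ ht
    have := (((h (x + η • e) τ hτ.1).fun_sub (h x τ hτ.1)).fun_sub
      ((hasDerivWithinAt_id τ (Set.Icc 0 T)).mul_const (η * p₀)))
    simpa using this.mono Set.inter_subset_left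
  have hmem : Set.Icc 0 T ∩ Metric.ball t₀ r ∈ nhdsWithin t₀ (Set.Icc 0 T) :=
    Filter.inter_mem self_mem_nhdsWithin (mem_nhdsWithin_of_mem_nhds (Metric.ball_mem_nhds _ hr))
  filter_upwards [hmem] with t ht
  have hd : HasDerivAt (fun η : ℝ => v t (x + η • e) - v t₀ (x + η • e) - (t - t₀) * (η * p₀))
      (NSdeRham.pd i (v t) x - NSdeRham.pd i (v t₀) x - (t - t₀) * p₀) 0 := by
    have a1 := hasDerivAt_line (hv t ht.1) x i 0
    have a2 := hasDerivAt_line (hv t₀ ht₀) x i 0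
    simp only [zero_smul, add_zero] at a1 a2
    simpa using (a1.fun_sub a2).fun_sub (((hasDerivAt_id (0 : ℝ)).mul_const p₀).const_mul (t - t₀))
  have := hd.le_of_lip' (C := ε * ‖t - t₀‖) (by positivity) (by
    filter_upwards [Metric.ball_mem_nhds (0 : ℝ) hr] with η hη
    have := h2 t ht η hη
    simp only [zero_smul, add_zero, zero_mul, mul_zero, sub_zero]
    calc _ = ‖(v t (x + η • e) - v t x - t * (η * p₀)) -
        (v t₀ (x + η • e) - v t₀ x - t₀ * (η * p₀))‖ := by congr 1; ring
      _ ≤ _ := this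
      _ = _ := by rw [Real.norm_eq_abs η]; ring)
  simpa [smul_eq_mul] using this

theorem TD.add {T : ℝ} {v v' w w' : ℝ → Spc n → ℝ} (h : TD T v v') (h' : TD T w w') :
    TD T (fun t x => v t x + w t x) (fun t x => v' t x + w' t x) :=
  fun x t ht => (h x t ht).add (h' x t ht)

theorem TD.smul {T : ℝ} {v v' : ℝ → Spc n → ℝ} (h : TD T v v') (a : ℝ) :
    TD T (fun t x => a * v t x) (fun t x => a * v' t x) :=
  fun x t ht => (h x t ht).const_mul a

theorem TD.mul {T : ℝ} {v v' w w' : ℝ → Spc n → ℝ} (h : TD T v v') (h' : TD T w w') :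
    TD T (fun t x => v t x * w t x) (fun t x => v' t x * w t x + v t x * w' t x) :=
  fun x t ht => (h x t ht).mul (h' x t ht)

theorem TD.congr {T : ℝ} {v v' w : ℝ → Spc n → ℝ} (h : TD T v v')
    (he : ∀ t ∈ Set.Icc 0 T, w t = v t) : TD T w v' :=
  fun x t ht => (h x t ht).congr (fun τ hτ => by rw [he τ hτ]) (by rw [he t ht])

/-- Parabolic class: `r` time derivatives, each costing two space derivatives, and `m`
additional space derivatives. -/
def Pr (c : Cfg) : ℕ → ℕ → ℝ → ℝ → (ℝ → Spc n → ℝ) → Prop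
  | 0, m, σ, K, v => Cl c m σ K v
  | r + 1, m, σ, K, v => Cl c (2 * (r + 1) + m) σ K v ∧ ∃ v', TD c.T v v' ∧ Pr c r m σ K v'

theorem Pr.cl {c : Cfg} {r m : ℕ} {σ K : ℝ} {v : ℝ → Spc n → ℝ} (h : Pr c r m σ K v) :
    Cl c (2 * r + m) σ K v := by
  cases r with
  | zero => exact (show 2 * 0 + m = m by omega).symm ▸ h
  | succ r => exact h.1

theorem Pr.nonneg {c : Cfg} {r m : ℕ} {σ K : ℝ} {v : ℝ → Spc n → ℝ} (h : Pr c r m σ K v) :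
    0 ≤ K := h.cl.nonneg

theorem Pr.mono {c : Cfg} {r m m' : ℕ} {σ σ' K K' : ℝ} {v : ℝ → Spc n → ℝ}
    (h : Pr c r m σ K v) (hm : m' ≤ m) (hσ : σ' ≤ σ) (hK : K ≤ K') : Pr c r m' σ' K' v := by
  induction r generalizing v with
  | zero => exact (Cl.le h hm).mono hσ hK
  | succ r ih =>
    obtain ⟨h1, v', h2, h3⟩ := h
    exact ⟨(h1.le (by omega)).mono hσ hK, v', h2, ih h3⟩

theorem Pr.shift {c : Cfg} {r m : ℕ} {σ K : ℝ} {v : ℝ → Spc n → ℝ} (h : Pr c (r + 1) m σ K v) :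
    Pr c r (m + 2) σ K v := by
  induction r generalizing v with
  | zero =>
    have := h.1
    exact Cl.le this (by omega)
  | succ r ih =>
    obtain ⟨h1, v', h2, h3⟩ := h
    exact ⟨h1.le (by omega), v', h2, ih h3⟩

theorem Pr.congr {c : Cfg} {r m : ℕ} {σ K : ℝ} {v w : ℝ → Spc n → ℝ} (h : Pr c r m σ K v)
    (he : ∀ t ∈ Set.Icc 0 c.T, w t = v t) : Pr c r m σ K w := by
  cases r with
  | zero => exact Cl.congr h he
  | succ r =>
    obtain ⟨h1, v', h2, h3⟩ := h
    exact ⟨h1.congr he, v', h2.congr he, h3⟩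

theorem Pr.add {c : Cfg} {r m : ℕ} {σ K K' : ℝ} {v w : ℝ → Spc n → ℝ} (h : Pr c r m σ K v)
    (h' : Pr c r m σ K' w) : Pr c r m σ (K + K') (fun t x => v t x + w t x) := by
  induction r generalizing v w with
  | zero => exact Cl.add h h'
  | succ r ih =>
    obtain ⟨h1, v', h2, h3⟩ := h
    obtain ⟨h1', w', h2', h3'⟩ := h'
    exact ⟨h1.add h1', _, h2.add h2', ih h3 h3'⟩

theorem Pr.smul {c : Cfg} {r m : ℕ} {σ K : ℝ} {v : ℝ → Spc n → ℝ} (h : Pr c r m σ K v) (a : ℝ) :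
    Pr c r m σ (|a| * K) (fun t x => a * v t x) := by
  induction r generalizing v with
  | zero => exact Cl.smul h a
  | succ r ih =>
    obtain ⟨h1, v', h2, h3⟩ := h
    exact ⟨h1.smul a, _, h2.smul a, ih h3⟩

theorem Pr.zero (c : Cfg) (r m : ℕ) (σ : ℝ) {K : ℝ} (hK : 0 ≤ K) :
    Pr c r m σ K (fun _ (_ : Spc n) => 0) := by
  induction r with
  | zero => exact Cl.zero c m σ hK
  | succ r ih =>
    exact ⟨Cl.zero c _ σ hK, _, fun x t _ => hasDerivWithinAt_const _ _ _, ih⟩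

theorem Pr.sum {c : Cfg} {r m : ℕ} {σ : ℝ} {ι : Type*} (s : Finset ι) {K : ι → ℝ}
    {v : ι → ℝ → Spc n → ℝ} (h : ∀ i ∈ s, Pr c r m σ (K i) (v i)) :
    Pr c r m σ (∑ i ∈ s, K i) (fun t x => ∑ i ∈ s, v i t x) := by
  induction s using Finset.induction_on with
  | empty => simpa using Pr.zero c r m σ le_rfl
  | insert a s ha ih =>
    simp only [Finset.sum_insert ha]
    exact (h a (by simp)).add (ih fun i hi => h i (by simp [hi]))

theorem Pr.mul (r m : ℕ) (σ₁ σ₂ : ℝ) : ∃ C : ℝ, 0 ≤ C ∧ ∀ (c : Cfg) (K₁ K₂ : ℝ)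
    (a b : ℝ → Spc n → ℝ), Pr c.flat r m σ₁ K₁ a → Pr c.flat r m σ₂ K₂ b →
      Pr c.flat r m (σ₁ + σ₂) (C * K₁ * K₂) (fun t x => a t x * b t x) := by
  induction r with
  | zero =>
    obtain ⟨C, hC, h⟩ := Cl.mul (n := n) m σ₁ σ₂
    exact ⟨C, hC, fun c K₁ K₂ a b ha hb => h c.flat K₁ K₂ a b ha hb⟩
  | succ r ih =>
    obtain ⟨C₁, hC₁, h₁⟩ := Cl.mul (n := n) (2 * (r + 1) + m) σ₁ σ₂
    obtain ⟨C₂, hC₂, h₂⟩ := ih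
    refine ⟨C₁ + 2 * C₂, by positivity, fun c K₁ K₂ a b ha hb => ?_⟩
    have hk : 0 ≤ K₁ * K₂ := mul_nonneg ha.nonneg hb.nonneg
    have ha' := ha.shift.mono (m' := m) (by omega) le_rfl le_rfl
    have hb' := hb.shift.mono (m' := m) (by omega) le_rfl le_rfl
    obtain ⟨a1, a', a2, a3⟩ := ha
    obtain ⟨b1, b', b2, b3⟩ := hb
    refine ⟨(h₁ c.flat _ _ _ _ a1 b1).mono le_rfl ?_, _, a2.mul b2,
      ((h₂ c _ _ _ _ a3 hb').add (h₂ c _ _ _ _ ha' b3)).mono le_rfl le_rfl ?_⟩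
    · simp only [mul_assoc]; gcongr; linarith
    · nlinarith

theorem Pr.map {c c' : Cfg} {A : ℝ} (hT : c'.T = c.T)
    (hB : ∀ (N : ℕ) (σ K : ℝ) (v : ℝ → Spc n → ℝ), Cl c N σ K v → Cl c' N σ (A * K) v) {r m : ℕ}
    {σ K : ℝ} {v : ℝ → Spc n → ℝ} (h : Pr c r m σ K v) : Pr c' r m σ (A * K) v := by
  induction r generalizing v with
  | zero => exact hB _ _ _ _ h
  | succ r ih =>
    obtain ⟨h1, v', h2, h3⟩ := h
    exact ⟨hB _ _ _ _ h1, v', hT ▸ h2, ih h3⟩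

theorem Pr.pd {c : Cfg} {r m : ℕ} {σ K : ℝ} {v : ℝ → Spc n → ℝ} (h : Pr c r (m + 1) σ K v)
    (i : Fin n) : Pr c r m (σ + 1) K (fun t => NSdeRham.pd i (v t)) := by
  induction r generalizing v with
  | zero => exact h.2.2 i
  | succ r ih =>
    obtain ⟨h1, v', h2, h3⟩ := h
    have h1' : Cl c (2 * (r + 1) + m + 1) σ K v := h1
    have h4 : Cl c (2 * r + m + 1) σ K v' := h3.cl
    exact ⟨h1'.2.2 i, _, h2.pd i h1'.2.1 h4.2.1 (h4.2.2 i).bas.1, ih h3⟩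

theorem Pr.lap {c : Cfg} {r m : ℕ} {σ K : ℝ} {v : ℝ → Spc n → ℝ} (h : Pr c r (m + 2) σ K v) :
    Pr c r m σ (n * K) (fun t => NSdeRham.lap (v t)) := by
  have := Pr.sum (c := c) (r := r) (m := m) (σ := σ + 1 + 1) Finset.univ (K := fun _ : Fin n => K)
    (v := fun i t => NSdeRham.pd i (NSdeRham.pd i (v t))) fun i _ => (h.pd i).pd i
  simp only [Finset.sum_const, Finset.card_univ, Fintype.card_fin, nsmul_eq_mul] at this
  exact this.mono le_rfl (by linarith) le_rfl

theorem Cl.lap {c : Cfg} {N : ℕ} {σ K : ℝ} {v : ℝ → Spc n → ℝ} (h : Cl c (N + 2) σ K v) :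
    Cl c N (σ + 2) (n * K) (fun t => NSdeRham.lap (v t)) := by
  have := Cl.sum (c := c) (N := N) (σ := σ + 1 + 1) Finset.univ (K := fun _ : Fin n => K)
    (v := fun i t => NSdeRham.pd i (NSdeRham.pd i (v t))) fun i _ => (h.2.2 i).2.2 i
  simp only [Finset.sum_const, Finset.card_univ, Fintype.card_fin, nsmul_eq_mul] at this
  exact this.mono (by linarith) le_rfl

section vec

variable {F G : Type*} [NormedAddCommGroup F] [NormedAddCommGroup G]

/-- The base class for functions with values in a normed space. -/
def BasF (c : Cfg) (σ K : ℝ) (v : ℝ → Spc n → F) : Prop :=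
  ContinuousOn (fun p : ℝ × Spc n => v p.1 p.2) (Set.Icc 0 c.T ×ˢ Set.univ) ∧
  (∀ t ∈ Set.Icc 0 c.T, ∀ x, ‖v t x‖ ≤ K * Real.exp (c.β * t) * wt x ^ (-σ)) ∧
  (c.h →
    (∀ t ∈ Set.Icc 0 c.T, ∀ x y, ‖x - y‖ ≤ wt x / 4 →
      ‖v t x - v t y‖ ≤ K * Real.exp (c.β * c.T) * ‖x - y‖ ^ c.lam * wt x ^ (-(σ + c.lam))) ∧
    ∀ t ∈ Set.Icc 0 c.T, ∀ t' ∈ Set.Icc 0 c.T, ∀ x,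
      ‖v t x - v t' x‖ ≤ K * Real.exp (c.β * c.T) * |t - t'| ^ (c.lam / 2) * wt x ^ (-σ))

theorem bas_iff_basF {c : Cfg} {σ K : ℝ} {v : ℝ → Spc n → ℝ} : Bas c σ K v ↔ BasF c σ K v :=
  Iff.rfl

theorem BasF.comp [NormedSpace ℝ F] [NormedSpace ℝ G] {c : Cfg} {σ K : ℝ} {v : ℝ → Spc n → F}
    (h : BasF c σ K v) (L : F →L[ℝ] G) (hL : ∀ a, ‖L a‖ ≤ ‖a‖) :
    BasF c σ K (fun t x => L (v t x)) := by
  refine ⟨L.continuous.comp_continuousOn h.1, fun t ht x => (hL _).trans (h.2.1 t ht x),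
    fun hh => ⟨fun t ht x y hxy => ?_, fun t ht t' ht' x => ?_⟩⟩
  · rw [← map_sub]; exact (hL _).trans ((h.2.2 hh).1 t ht x y hxy)
  · rw [← map_sub]; exact (hL _).trans ((h.2.2 hh).2 t ht t' ht' x)

theorem BasF.sum {c : Cfg} {σ K : ℝ} {ι : Type*} (s : Finset ι) {v : ι → ℝ → Spc n → F}
    (h : ∀ i ∈ s, BasF c σ K (v i)) : BasF c σ (s.card * K) (fun t x => ∑ i ∈ s, v i t x) := by
  refine ⟨continuousOn_finsetSum s fun i hi => (h i hi).1, fun t ht x => ?_,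
    fun hh => ⟨fun t ht x y hxy => ?_, fun t ht t' ht' x => ?_⟩⟩
  · refine (norm_sum_le_of_le s fun i hi => (h i hi).2.1 t ht x).trans (le_of_eq ?_)
    simp; ring
  · rw [← Finset.sum_sub_distrib]
    refine (norm_sum_le_of_le s fun i hi => ((h i hi).2.2 hh).1 t ht x y hxy).trans (le_of_eq ?_)
    simp; ring
  · rw [← Finset.sum_sub_distrib]
    refine (norm_sum_le_of_le s fun i hi => ((h i hi).2.2 hh).2 t ht t' ht' x).trans (le_of_eq ?_)
    simp; ring

theorem BasF.congr {c : Cfg} {σ K : ℝ} {v v' : ℝ → Spc n → F} (h : BasF c σ K v)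
    (he : ∀ t ∈ Set.Icc 0 c.T, v' t = v t) : BasF c σ K v' := by
  refine ⟨h.1.congr ?_, fun t ht x => ?_, fun hh => ⟨fun t ht x y hxy => ?_,
    fun t ht t' ht' x => ?_⟩⟩
  · rintro ⟨t, x⟩ ⟨ht, -⟩
    simp only [he t ht]
  · rw [he t ht]; exact h.2.1 t ht x
  · rw [he t ht]; exact (h.2.2 hh).1 t ht x y hxy
  · rw [he t ht, he t' ht']; exact (h.2.2 hh).2 t ht t' ht' x

end vec

/-- Coefficient extraction `∂^{M+1} v ↦ ∂^M (∂_i v)`. -/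
def outMap (M : ℕ) (i : Fin n) :
    ContinuousMultilinearMap ℝ (fun _ : Fin (M + 1) => Spc n) ℝ →L[ℝ]
      ContinuousMultilinearMap ℝ (fun _ : Fin M => Spc n) ℝ :=
  (ContinuousLinearMap.compContinuousMultilinearMapL ℝ (fun _ : Fin M => Spc n) _ _
    (ContinuousLinearMap.apply ℝ ℝ (EuclideanSpace.single i 1 : Spc n))).comp
  (continuousMultilinearCurryRightEquiv' ℝ M (Spc n) ℝ).toContinuousLinearEquiv.toContinuousLinearMap

theorem norm_outMap (M : ℕ) (i : Fin n) (a) : ‖outMap M i a‖ ≤ ‖a‖ := by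
  simp only [outMap, ContinuousLinearMap.comp_apply]
  refine (ContinuousLinearMap.norm_compContinuousMultilinearMap_le _ _).trans ?_
  have h1 : ‖ContinuousLinearMap.apply ℝ ℝ (EuclideanSpace.single i 1 : Spc n)‖ ≤ 1 := by
    refine ContinuousLinearMap.opNorm_le_bound _ zero_le_one fun f => ?_
    simpa using f.le_opNorm (EuclideanSpace.single i 1 : Spc n)
  refine (mul_le_of_le_one_left (norm_nonneg _) h1).trans (le_of_eq ?_)
  exact (continuousMultilinearCurryRightEquiv' ℝ M (Spc n) ℝ).norm_map a

theorem outMap_iteratedFDeriv {f : Spc n → ℝ} {M : ℕ} (hf : ContDiff ℝ (M + 1) f) (i : Fin n)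
    (x : Spc n) : outMap M i (iteratedFDeriv ℝ (M + 1) f x) = iteratedFDeriv ℝ M (pd i f) x := by
  have h1 : ContDiff ℝ M (fderiv ℝ f) := (contDiff_succ_iff_fderiv.1 hf).2.2
  have h2 := ContinuousLinearMap.iteratedFDeriv_comp_left (x := x)
    (ContinuousLinearMap.apply ℝ ℝ (EuclideanSpace.single i 1 : Spc n)) h1.contDiffAt
    (i := M) le_rfl
  rw [show pd i f = ⇑(ContinuousLinearMap.apply ℝ ℝ (EuclideanSpace.single i 1 : Spc n)) ∘
    fderiv ℝ f from rfl, h2, iteratedFDeriv_succ_eq_comp_right]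
  simp only [outMap, Function.comp_apply, ContinuousLinearMap.comp_apply]
  exact congrArg (ContinuousLinearMap.compContinuousMultilinearMap
    (ContinuousLinearMap.apply ℝ ℝ (EuclideanSpace.single i 1 : Spc n)))
    ((continuousMultilinearCurryRightEquiv' ℝ M (Spc n) ℝ).apply_symm_apply _)

/-- Assembly of `∂^{M+1} v` from the `∂^M (∂_i v)`. -/
def inMap (M : ℕ) (i : Fin n) :
    ContinuousMultilinearMap ℝ (fun _ : Fin M => Spc n) ℝ →L[ℝ]
      ContinuousMultilinearMap ℝ (fun _ : Fin (M + 1) => Spc n) ℝ :=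
  (continuousMultilinearCurryRightEquiv' ℝ M (Spc n)
    ℝ).symm.toContinuousLinearEquiv.toContinuousLinearMap.comp
  (ContinuousLinearMap.compContinuousMultilinearMapL ℝ (fun _ : Fin M => Spc n) _ _
    ((ContinuousLinearMap.id ℝ ℝ).smulRight (EuclideanSpace.proj i : Spc n →L[ℝ] ℝ)))

theorem norm_proj_le (i : Fin n) : ‖(EuclideanSpace.proj i : Spc n →L[ℝ] ℝ)‖ ≤ 1 :=
  ContinuousLinearMap.opNorm_le_bound _ zero_le_one fun x => by
    simpa using abs_coord_le i x

theorem norm_inMap (M : ℕ) (i : Fin n) (a) : ‖inMap M i a‖ ≤ ‖a‖ := by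
  simp only [inMap, ContinuousLinearMap.comp_apply]
  refine (le_of_eq ((continuousMultilinearCurryRightEquiv' ℝ M (Spc n) ℝ).symm.norm_map _)).trans ?_
  refine (ContinuousLinearMap.norm_compContinuousMultilinearMap_le _ _).trans ?_
  refine mul_le_of_le_one_left (norm_nonneg _) ?_
  refine (ContinuousLinearMap.norm_smulRight_apply _ _).le.trans ?_
  exact mul_le_one₀ ContinuousLinearMap.norm_id_le (norm_nonneg _) (norm_proj_le i)

theorem fderiv_eq_sum (f : Spc n → ℝ) :
    fderiv ℝ f = fun x => ∑ i, (((ContinuousLinearMap.id ℝ ℝ).smulRight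
      (EuclideanSpace.proj i : Spc n →L[ℝ] ℝ)) ∘ pd i f) x := by
  funext x
  ext z
  have hz : z = ∑ i, z i • (EuclideanSpace.single i 1 : Spc n) := by
    ext j
    simp [Finset.sum_apply, Pi.single_apply]
  conv_lhs => rw [hz]
  simp [pd, mul_comm]

theorem iteratedFDeriv_eq_sum_inMap {f : Spc n → ℝ} {M : ℕ} (hf : ∀ i, ContDiff ℝ M (pd i f))
    (x : Spc n) :
    iteratedFDeriv ℝ (M + 1) f x = ∑ i, inMap M i (iteratedFDeriv ℝ M (pd i f) x) := by
  rw [iteratedFDeriv_succ_eq_comp_right, Function.comp_apply,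
    show (fun y => fderiv ℝ f y) = fderiv ℝ f from rfl, fderiv_eq_sum, iteratedFDeriv_sum
      fun i _ => (ContinuousLinearMap.contDiff _).comp (hf i)]
  simp only [Finset.sum_apply]
  refine (map_sum (continuousMultilinearCurryRightEquiv' ℝ M (Spc n)
    ℝ).symm.toLinearEquiv.toLinearMap _ _).trans ?_
  refine Finset.sum_congr rfl fun i _ => ?_
  rw [ContinuousLinearMap.iteratedFDeriv_comp_left _ (hf i).contDiffAt le_rfl]
  rfl

theorem contDiff_succ_of_pd {f : Spc n → ℝ} {N : ℕ} (h : Differentiable ℝ f)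
    (hf : ∀ i, ContDiff ℝ N (pd i f)) : ContDiff ℝ (N + 1) f := by
  refine contDiff_succ_iff_fderiv.2 ⟨h, fun h => by simp at h, ?_⟩
  rw [fderiv_eq_sum]
  exact ContDiff.sum fun i _ => (ContinuousLinearMap.contDiff _).comp (hf i)

theorem contDiff_pd {f : Spc n → ℝ} {N : ℕ} (h : ContDiff ℝ (N + 1) f) (i : Fin n) :
    ContDiff ℝ N (pd i f) :=
  (contDiff_succ_iff_fderiv.1 h).2.2.clm_apply contDiff_const

theorem Cl.contDiff {c : Cfg} {N : ℕ} {σ K : ℝ} {v : ℝ → Spc n → ℝ} (h : Cl c N σ K v) {t : ℝ}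
    (ht : t ∈ Set.Icc 0 c.T) : ContDiff ℝ N (v t) := by
  induction N generalizing σ v with
  | zero =>
    refine contDiff_zero.2 ?_
    have h1 : ContinuousOn (fun p : ℝ × Spc n => v p.1 p.2) (Set.Icc 0 c.T ×ˢ Set.univ) := h.1
    exact h1.comp_continuous (f := fun x => (t, x)) (by fun_prop) fun x => ⟨ht, Set.mem_univ _⟩
  | succ N ih => exact_mod_cast contDiff_succ_of_pd (h.2.1 t ht) fun i => ih (h.2.2 i)

theorem Cl.basF {c : Cfg} {N : ℕ} {σ K : ℝ} {v : ℝ → Spc n → ℝ} (h : Cl c N σ K v) {M : ℕ}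
    (hM : M ≤ N) : BasF c (σ + M) (n ^ M * K) (fun t => iteratedFDeriv ℝ M (v t)) := by
  induction N generalizing σ v M with
  | zero =>
    obtain rfl : M = 0 := by omega
    have := BasF.comp (bas_iff_basF.1 h) ((continuousMultilinearCurryFin0 ℝ (Spc n)
      ℝ).symm.toContinuousLinearEquiv.toContinuousLinearMap) fun a =>
        (LinearIsometryEquiv.norm_map _ a).le
    simpa [iteratedFDeriv_zero_eq_comp, Function.comp_def] using this
  | succ N ih =>
    rcases M with _ | M
    · have := BasF.comp (bas_iff_basF.1 h.1) ((continuousMultilinearCurryFin0 ℝ (Spc n)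
        ℝ).symm.toContinuousLinearEquiv.toContinuousLinearMap) fun a =>
          (LinearIsometryEquiv.norm_map _ a).le
      simpa [iteratedFDeriv_zero_eq_comp, Function.comp_def] using this
    · have := BasF.sum Finset.univ fun i _ =>
        (ih (h.2.2 i) (by omega : M ≤ N)).comp (inMap M i) (norm_inMap M i)
      have e : σ + 1 + M = σ + (M + 1 : ℕ) := by push_cast; ring
      have e' : ((Finset.univ : Finset (Fin n)).card : ℝ) * (n ^ M * K) = n ^ (M + 1) * K := by
        simp; ring
      rw [e, e'] at this
      refine this.congr fun t ht => funext fun x => ?_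
      exact iteratedFDeriv_eq_sum_inMap (fun i => ((h.2.2 i).contDiff ht).of_le
        (by exact_mod_cast (by omega : M ≤ N))) x

theorem Cl.of_basF {c : Cfg} {N : ℕ} {σ K : ℝ} {v : ℝ → Spc n → ℝ}
    (hc : ∀ t ∈ Set.Icc 0 c.T, ContDiff ℝ N (v t))
    (h : ∀ M ≤ N, BasF c (σ + M) K (fun t => iteratedFDeriv ℝ M (v t))) : Cl c N σ K v := by
  have h0 : ∀ {σ} {v : ℝ → Spc n → ℝ}, BasF c (σ + (0 : ℕ)) K (fun t => iteratedFDeriv ℝ 0 (v t)) →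
      Bas c σ K v := by
    intro σ v h
    have := BasF.comp h ((continuousMultilinearCurryFin0 ℝ (Spc n)
      ℝ).toContinuousLinearEquiv.toContinuousLinearMap) fun a =>
        (LinearIsometryEquiv.norm_map _ a).le
    simpa [iteratedFDeriv_zero_eq_comp, Function.comp_def, bas_iff_basF] using this
  induction N generalizing σ v with
  | zero => exact h0 (h 0 le_rfl)
  | succ N ih =>
    refine ⟨h0 (h 0 (by omega)), fun t ht => (hc t ht).differentiable (by simp), fun i => ih
      (fun t ht => contDiff_pd (hc t ht) i) fun M hM => ?_⟩
    have := (h (M + 1) (by omega)).comp (outMap M i) (norm_outMap M i)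
    have e : σ + (M + 1 : ℕ) = σ + 1 + M := by push_cast; ring
    rw [e] at this
    refine this.congr fun t ht => funext fun x => ?_
    exact (outMap_iteratedFDeriv ((hc t ht).of_le
      (by exact_mod_cast (by omega : M + 1 ≤ N + 1))) i x).symm

theorem eAniso0_imp {F : Type*} [NormedAddCommGroup F] {c : Cfg} (hβ : c.β = 0) {σ K : ℝ}
    (hσ : 0 ≤ σ) (hK : 0 ≤ K) {v : ℝ → Spc n → F}
    (hc : ContinuousOn (fun p : ℝ × Spc n => v p.1 p.2) (Set.Icc 0 c.T ×ˢ Set.univ))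
    (h : eAniso0 c.T c.lam σ v ≤ ENNReal.ofReal K) : BasF c σ (2 ^ (σ + 1) * K) v := by
  have hl := c.hl0
  have hC : (1 : ℝ) ≤ 2 ^ (σ + 1) := Real.one_le_rpow (by norm_num) (by linarith)
  have hKC : K ≤ 2 ^ (σ + 1) * K := le_mul_of_one_le_left hK hC
  rw [eAniso0, if_neg hl.ne'] at h
  have hsp : ∀ t ∈ Set.Icc (0 : ℝ) c.T, eHol0 c.lam σ (v t) ≤ ENNReal.ofReal K := fun t ht =>
    (le_iSup (fun t : Set.Icc (0 : ℝ) c.T => eHol0 c.lam σ (v t)) ⟨t, ht⟩).trans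
      (le_self_add.trans h)
  have htm := le_add_self.trans h
  simp only [iSup_le_iff] at htm
  simp only [eHol0, if_neg hl.ne'] at hsp
  have key : ∀ {a : ℝ}, ENNReal.ofReal a ≤ ENNReal.ofReal K → a ≤ K := fun h =>
    (ENNReal.ofReal_le_ofReal_iff hK).1 h
  have hsup : ∀ t ∈ Set.Icc (0 : ℝ) c.T, ∀ x, wt x ^ σ * ‖v t x‖ ≤ K := fun t ht x => by
    have := (le_add_self.trans le_self_add).trans (hsp t ht)
    rw [eWSup, iSup_le_iff] at this
    exact key (this x)
  have hwh : ∀ t ∈ Set.Icc (0 : ℝ) c.T, ∀ x y, x ≠ y ∧ ‖x - y‖ ≤ ‖x‖ / 2 →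
      wt2 x y ^ (σ + c.lam) * ‖v t x - v t y‖ / ‖x - y‖ ^ c.lam ≤ K := fun t ht x y hxy => by
    have := le_add_self.trans (hsp t ht)
    simp only [eWHold, iSup_le_iff] at this
    exact key (this x y hxy)
  have hoh : ∀ t ∈ Set.Icc (0 : ℝ) c.T, ∀ x y : Spc n, ‖x‖ ≤ 1 ∧ ‖y‖ ≤ 1 ∧ x ≠ y →
      ‖v t x - v t y‖ / ‖x - y‖ ^ c.lam ≤ K := fun t ht x y hxy => by
    have := (le_add_self.trans (le_self_add.trans le_self_add)).trans (hsp t ht)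
    simp only [iSup_le_iff] at this
    exact key (this x y hxy)
  refine ⟨hc, fun t ht x => ?_, fun _ => ⟨fun t ht x y hxy => ?_, fun t ht t' ht' x => ?_⟩⟩
  · rw [hβ, zero_mul, Real.exp_zero, mul_one, Real.rpow_neg (wt_pos x).le, ← div_eq_mul_inv,
      le_div_iff₀ (Real.rpow_pos_of_pos (wt_pos x) _), mul_comm]
    exact (hsup t ht x).trans hKC
  · rw [hβ, zero_mul, Real.exp_zero, mul_one]
    rcases eq_or_ne x y with rfl | hne
    · simp only [sub_self, norm_zero]
      have := Real.rpow_nonneg (wt_pos x).le (-(σ + c.lam))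
      positivity
    have hpos : 0 < ‖x - y‖ ^ c.lam := Real.rpow_pos_of_pos (norm_pos_iff.2 (sub_ne_zero.2 hne)) _
    rw [Real.rpow_neg (wt_pos x).le, ← div_eq_mul_inv,
      le_div_iff₀ (Real.rpow_pos_of_pos (wt_pos x) _)]
    by_cases hh : ‖x - y‖ ≤ ‖x‖ / 2
    · have h1 := hwh t ht x y ⟨hne, hh⟩
      rw [div_le_iff₀ hpos] at h1
      have h2 : wt x ^ (σ + c.lam) ≤ wt2 x y ^ (σ + c.lam) :=
        Real.rpow_le_rpow (wt_pos x).le (le_max_left _ _) (by linarith)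
      calc _ ≤ wt2 x y ^ (σ + c.lam) * ‖v t x - v t y‖ := by
            rw [mul_comm]; exact mul_le_mul_of_nonneg_right h2 (norm_nonneg _)
        _ ≤ _ := h1.trans (mul_le_mul_of_nonneg_right hKC hpos.le)
    · push Not at hh
      have h1 := wt_sq x
      have h2 := one_le_wt x
      have h3 := norm_nonneg x
      have h4 : wt x < 4 / 3 := by nlinarith
      have h5 : ‖x‖ ≤ 1 := by nlinarith
      have h6 : ‖y‖ ≤ 1 := by
        have : ‖y‖ ≤ ‖x‖ + ‖x - y‖ := by
          rw [norm_sub_rev]; simpa using norm_add_le x (y - x)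
        nlinarith
      have h7 := hoh t ht x y ⟨h5, h6, hne⟩
      rw [div_le_iff₀ hpos] at h7
      have h8 : wt x ^ (σ + c.lam) ≤ 2 ^ (σ + 1) :=
        (Real.rpow_le_rpow (wt_pos x).le (by linarith : wt x ≤ 2) (by linarith)).trans
          (Real.rpow_le_rpow_of_exponent_le (by norm_num) (by linarith [c.hl1]))
      calc _ ≤ (K * ‖x - y‖ ^ c.lam) * 2 ^ (σ + 1) :=
            mul_le_mul h7 h8 (Real.rpow_nonneg (wt_pos x).le _) (by positivity)
        _ = _ := by ring
  · rw [hβ, zero_mul, Real.exp_zero, mul_one]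
    rcases eq_or_ne t t' with rfl | hne
    · simp only [sub_self, norm_zero]
      have := Real.rpow_nonneg (wt_pos x).le (-σ)
      positivity
    have hpos : 0 < |t - t'| ^ (c.lam / 2) :=
      Real.rpow_pos_of_pos (abs_pos.2 (sub_ne_zero.2 hne)) _
    have h1 := key (htm ⟨t, ht⟩ ⟨t', ht'⟩ hne x)
    rw [div_le_iff₀ hpos] at h1
    rw [Real.rpow_neg (wt_pos x).le, ← div_eq_mul_inv,
      le_div_iff₀ (Real.rpow_pos_of_pos (wt_pos x) _), mul_comm]
    exact h1.trans (mul_le_mul_of_nonneg_right hKC hpos.le)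

theorem eAniso0_le {F : Type*} [NormedAddCommGroup F] {c : Cfg} (hβ : c.β = 0) (hh : c.h)
    {σ K : ℝ} (hσ : 0 ≤ σ) (hK : 0 ≤ K) {v : ℝ → Spc n → F} (h : BasF c σ K v) :
    eAniso0 c.T c.lam σ v ≤ ENNReal.ofReal ((11 + 2 ^ (σ + 1) * 4 * (1 + 2 ^ σ)) * K) := by
  have hl := c.hl0
  have hl1 := c.hl1
  obtain ⟨-, hs, hHt⟩ := h
  obtain ⟨hH, ht⟩ := hHt hh
  simp only [hβ, zero_mul, Real.exp_zero, mul_one] at hs hH ht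
  have h2σ : (0 : ℝ) < 2 ^ σ := by positivity
  have hwK : ∀ x : Spc n, wt x ^ (-σ) ≤ 1 := fun x =>
    Real.rpow_le_one_of_one_le_of_nonpos (one_le_wt x) (by linarith)
  have hs1 : ∀ t ∈ Set.Icc (0 : ℝ) c.T, ∀ x, ‖v t x‖ ≤ K := fun t ht' x =>
    (hs t ht' x).trans (mul_le_of_le_one_right hK (hwK x))
  have hfar : ∀ x y : Spc n, wt x / 4 < ‖x - y‖ → wt x ^ c.lam ≤ 4 * ‖x - y‖ ^ c.lam := by
    intro x y hxy
    calc wt x ^ c.lam ≤ (4 * ‖x - y‖) ^ c.lam :=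
          Real.rpow_le_rpow (wt_pos x).le (by linarith) hl.le
      _ = 4 ^ c.lam * ‖x - y‖ ^ c.lam := Real.mul_rpow (by norm_num) (norm_nonneg _)
      _ ≤ 4 ^ (1 : ℝ) * ‖x - y‖ ^ c.lam := by
          gcongr
          norm_num
      _ = _ := by norm_num
  rw [eAniso0, if_neg hl.ne', show (11 + 2 ^ (σ + 1) * 4 * (1 + 2 ^ σ)) * K =
    (((K + 8 * K) + K) + (2 ^ (σ + 1) * 4 * (1 + 2 ^ σ)) * K) + K by ring]
  rw [ENNReal.ofReal_add (by positivity) hK]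
  refine add_le_add (iSup_le fun t => ?_) (iSup_le fun t => iSup_le fun t' => iSup_le fun hne =>
    iSup_le fun x => ENNReal.ofReal_le_ofReal ?_)
  · rw [eHol0, if_neg hl.ne', ENNReal.ofReal_add (by positivity) (by positivity),
      ENNReal.ofReal_add (by positivity) (by positivity),
      ENNReal.ofReal_add (by positivity) (by positivity)]
    refine add_le_add (add_le_add (add_le_add ?_ ?_) ?_) ?_
    · exact iSup_le fun x => iSup_le fun _ => ENNReal.ofReal_le_ofReal (hs1 t t.2 x)
    · refine iSup_le fun x => iSup_le fun y => iSup_le fun hxy => ENNReal.ofReal_le_ofReal ?_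
      have hpos : 0 < ‖x - y‖ ^ c.lam :=
        Real.rpow_pos_of_pos (norm_pos_iff.2 (sub_ne_zero.2 hxy.2.2)) _
      rw [div_le_iff₀ hpos]
      rcases le_or_gt ‖x - y‖ (wt x / 4) with hn | hf
      · have h1 := hH t t.2 x y hn
        have h2 : wt x ^ (-(σ + c.lam)) ≤ 1 :=
          Real.rpow_le_one_of_one_le_of_nonpos (one_le_wt x) (by linarith)
        have h3 : K * ‖x - y‖ ^ c.lam * wt x ^ (-(σ + c.lam)) ≤ K * ‖x - y‖ ^ c.lam :=
          mul_le_of_le_one_right (by positivity) h2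
        nlinarith [mul_nonneg hK hpos.le]
      · have h1 : ‖v t x - v t y‖ ≤ K + K :=
          (norm_sub_le _ _).trans (add_le_add (hs1 t t.2 x) (hs1 t t.2 y))
        have h2 := hfar x y hf
        have h3 : 1 ≤ wt x ^ c.lam := Real.one_le_rpow (one_le_wt x) hl.le
        nlinarith
    · refine iSup_le fun x => ENNReal.ofReal_le_ofReal ?_
      have h1 := hs t t.2 x
      rwa [Real.rpow_neg (wt_pos x).le, ← div_eq_mul_inv,
        le_div_iff₀ (Real.rpow_pos_of_pos (wt_pos x) _), mul_comm] at h1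
    · refine iSup_le fun x => iSup_le fun y => iSup_le fun hxy => ENNReal.ofReal_le_ofReal ?_
      have hpos : 0 < ‖x - y‖ ^ c.lam :=
        Real.rpow_pos_of_pos (norm_pos_iff.2 (sub_ne_zero.2 hxy.1)) _
      have hxw : ‖x - y‖ ≤ wt x / 2 := hxy.2.trans (by linarith [norm_le_wt x])
      have hw2 : wt2 x y ≤ 2 * wt x := by
        refine max_le (by linarith [wt_pos x]) ?_
        have := wt_le_add y x
        rw [norm_sub_rev] at this
        linarith [wt_pos x]
      have h3 : wt2 x y ^ (σ + c.lam) ≤ 2 ^ (σ + 1) * wt x ^ (σ + c.lam) := by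
        calc _ ≤ (2 * wt x) ^ (σ + c.lam) := Real.rpow_le_rpow
              ((wt_pos x).le.trans (le_max_left _ _)) hw2 (by linarith)
          _ = 2 ^ (σ + c.lam) * wt x ^ (σ + c.lam) := Real.mul_rpow (by norm_num) (wt_pos x).le
          _ ≤ _ := mul_le_mul_of_nonneg_right
              (Real.rpow_le_rpow_of_exponent_le (by norm_num) (by linarith))
              (Real.rpow_nonneg (wt_pos x).le _)
      have hwp : 0 < wt x ^ (σ + c.lam) := Real.rpow_pos_of_pos (wt_pos x) _
      have hmain : wt x ^ (σ + c.lam) * ‖v t x - v t y‖ ≤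
          4 * (1 + 2 ^ σ) * K * ‖x - y‖ ^ c.lam := by
        rcases le_or_gt ‖x - y‖ (wt x / 4) with hn | hf
        · have h1 := hH t t.2 x y hn
          rw [Real.rpow_neg (wt_pos x).le, ← div_eq_mul_inv, le_div_iff₀ hwp, mul_comm] at h1
          refine h1.trans (mul_le_mul_of_nonneg_right ?_ hpos.le)
          nlinarith [mul_nonneg h2σ.le hK]
        · have hy : wt x / 2 ≤ wt y := by linarith [wt_le_add x y]
          have h4 : wt y ^ (-σ) ≤ 2 ^ σ * wt x ^ (-σ) := by
            calc wt y ^ (-σ) ≤ (wt x / 2) ^ (-σ) :=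
                  Real.rpow_le_rpow_of_nonpos (by linarith [wt_pos x]) hy (by linarith)
              _ = _ := by
                  rw [Real.div_rpow (wt_pos x).le (by norm_num), Real.rpow_neg (by norm_num : (0:ℝ) ≤ 2)]
                  field_simp
          have h1 : ‖v t x - v t y‖ ≤ K * (1 + 2 ^ σ) * wt x ^ (-σ) := by
            refine (norm_sub_le _ _).trans ((add_le_add (hs t t.2 x) (hs t t.2 y)).trans ?_)
            nlinarith [mul_le_mul_of_nonneg_left h4 hK]
          have h5 : wt x ^ (σ + c.lam) * wt x ^ (-σ) = wt x ^ c.lam := by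
            rw [← Real.rpow_add (wt_pos x)]; congr 1; ring
          calc _ ≤ wt x ^ (σ + c.lam) * (K * (1 + 2 ^ σ) * wt x ^ (-σ)) := by gcongr
            _ = K * (1 + 2 ^ σ) * wt x ^ c.lam := by rw [← h5]; ring
            _ ≤ K * (1 + 2 ^ σ) * (4 * ‖x - y‖ ^ c.lam) := by gcongr; exact hfar x y hf
            _ = _ := by ring
      rw [div_le_iff₀ hpos]
      calc _ ≤ 2 ^ (σ + 1) * wt x ^ (σ + c.lam) * ‖v t x - v t y‖ := by gcongr
        _ = 2 ^ (σ + 1) * (wt x ^ (σ + c.lam) * ‖v t x - v t y‖) := by ring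
        _ ≤ 2 ^ (σ + 1) * (4 * (1 + 2 ^ σ) * K * ‖x - y‖ ^ c.lam) := by gcongr
        _ = _ := by ring
  · have hpos : 0 < |(t : ℝ) - t'| ^ (c.lam / 2) :=
      Real.rpow_pos_of_pos (abs_pos.2 (sub_ne_zero.2 hne)) _
    have h1 := ht t t.2 t' t'.2 x
    rw [Real.rpow_neg (wt_pos x).le, ← div_eq_mul_inv,
      le_div_iff₀ (Real.rpow_pos_of_pos (wt_pos x) _), mul_comm] at h1
    rwa [div_le_iff₀ hpos]

theorem tDeriv_zero (T : ℝ) (u : ℝ → Spc n → ℝ) : tDeriv T 0 u = u := by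
  funext t x
  simp [tDeriv]

theorem TD.tDeriv {T : ℝ} {s j : ℕ} {u : ℝ → Spc n → ℝ} (hT : 0 < T)
    (hu : ∀ x : Spc n, ContDiffOn ℝ s (fun t => u t x) (Set.Icc 0 T)) (hj : j < s) :
    TD T (tDeriv T j u) (tDeriv T (j + 1) u) := by
  intro x t ht
  have h := (hu x).differentiableOn_iteratedDerivWithin (m := j) (by exact_mod_cast hj)
    (uniqueDiffOn_Icc hT) t ht
  have h2 := h.hasDerivWithinAt
  rw [← iteratedDerivWithin_succ] at h2
  exact h2

theorem TD.tDeriv_succ_eq {T : ℝ} {j : ℕ} {u v : ℝ → Spc n → ℝ} (hT : 0 < T)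
    (h : TD T (NSdeRham.tDeriv T j u) v) : ∀ t ∈ Set.Icc 0 T,
    NSdeRham.tDeriv T (j + 1) u t = v t := by
  intro t ht
  funext x
  change iteratedDerivWithin (j + 1) (fun τ => u τ x) _ t = _
  rw [iteratedDerivWithin_succ]
  exact (h x t ht).derivWithin (uniqueDiffOn_Icc hT t ht)

theorem contDiff_exponent (s j k : ℕ) :
    (2 * ((s : WithTop ℕ∞) - (j : WithTop ℕ∞)) + (k : WithTop ℕ∞)) = ((2 * (s - j) + k : ℕ)) := by
  push_cast; rfl

/-- Members of the anisotropic Hölder space lie in the parabolic class. -/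
theorem AnisoReg.pr (s m : ℕ) {σ : ℝ} (hσ : 0 ≤ σ) : ∃ C : ℝ, 0 ≤ C ∧
    ∀ (c : Cfg) (K : ℝ) (u : ℝ → Spc n → ℝ), c.β = 0 → 0 ≤ K → AnisoReg c.T m s u →
      eAnisoKS c.T m s c.lam σ u ≤ ENNReal.ofReal K → Pr c s m σ (C * K) u := by
  refine ⟨2 ^ (σ + (2 * s + m : ℕ) + 1), by positivity, fun c K u hβ hK hreg hu => ?_⟩
  have key : ∀ j M, M + 2 * j ≤ 2 * s + m → j ≤ s →
      BasF c (σ + M) (2 ^ (σ + (2 * s + m : ℕ) + 1) * K) (mixDeriv c.T M j u) := by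
    intro j M hM hj
    have hM' : (M : ℝ) ≤ (2 * s + m : ℕ) := by exact_mod_cast (by omega : M ≤ 2 * s + m)
    obtain ⟨b, M', hb, hM1, rfl⟩ : ∃ b M', b ≤ m ∧ M' + 2 * j ≤ 2 * s ∧ b + M' = M :=
      ⟨min M m, M - min M m, by omega, by omega, by omega⟩
    have h1 : eAniso0 c.T c.lam (σ + (b + M' : ℕ)) (mixDeriv c.T (b + M') j u) ≤
        ENNReal.ofReal K := by
      refine le_trans ?_ hu
      rw [eAnisoKS]
      refine le_trans ?_ (Finset.single_le_sum (f := fun b : ℕ => _) (fun _ _ => zero_le)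
        (Finset.mem_range.2 (by omega : b < m + 1)))
      refine le_trans ?_ (Finset.single_le_sum (f := fun m : ℕ => _) (fun _ _ => zero_le)
        (Finset.mem_range.2 (by omega : M' < 2 * s + 1)))
      refine le_trans ?_ (Finset.single_le_sum (f := fun m : ℕ => _) (fun _ _ => zero_le)
        (Finset.mem_range.2 (by omega : j < s + 1)))
      rw [if_pos hM1, Nat.cast_add, ← add_assoc]
    have hc : ContinuousOn (fun p : ℝ × Spc n => mixDeriv c.T (b + M') j u p.1 p.2)
        (Set.Icc 0 c.T ×ˢ Set.univ) := by
      have h2 := hreg.2.2 j (b + M') hj hM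
      rw [continuousOn_iff_continuous_domRestrict]
      exact h2.comp (f := fun p : ↑(Set.Icc 0 c.T ×ˢ (Set.univ : Set (Spc n))) =>
        ((⟨p.1.1, p.2.1⟩ : Set.Icc 0 c.T), p.1.2)) (by fun_prop)
    refine ⟨hc, (eAniso0_imp hβ (by positivity) hK hc h1).2.imp (fun h t ht x => (h t ht x).trans ?_)
      fun h hh => (h hh).imp (fun h t ht x y hxy => (h t ht x y hxy).trans ?_)
        fun h t ht t' ht' x => (h t ht t' ht' x).trans ?_⟩
    all_goals
      have h0 : ∀ p : ℝ, 0 ≤ wt x ^ p := fun p => Real.rpow_nonneg (wt_pos x).le p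
      gcongr
      · exact h0 _
      · norm_num
  have main : ∀ r ≤ s, Pr c r m σ (2 ^ (σ + (2 * s + m : ℕ) + 1) * K) (tDeriv c.T (s - r) u) := by
    intro r
    have hcl : ∀ r ≤ s, Cl c (2 * r + m) σ (2 ^ (σ + (2 * s + m : ℕ) + 1) * K)
        (tDeriv c.T (s - r) u) := fun r hr => by
      refine Cl.of_basF (fun t ht => ?_) fun M hM => key (s - r) M (by omega) (by omega)
      have := hreg.2.1 (s - r) (by omega) t ht
      rw [contDiff_exponent, show s - (s - r) = r by omega] at this
      exact this
    induction r with
    | zero => intro _; simpa [Pr] using hcl 0 (by omega)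
    | succ r ih =>
      intro hr
      refine ⟨hcl _ hr, _, ?_, ih (by omega)⟩
      have := TD.tDeriv c.hT hreg.1 (by omega : s - (r + 1) < s)
      rwa [show s - (r + 1) + 1 = s - r by omega] at this
  simpa [tDeriv_zero] using main s le_rfl

/-- The parabolic class embeds into the anisotropic Hölder space. -/
theorem Pr.aniso (s m : ℕ) {σ : ℝ} (hσ : 0 ≤ σ) : ∃ C : ℝ, 0 ≤ C ∧
    ∀ (c : Cfg) (K : ℝ) (u : ℝ → Spc n → ℝ), c.β = 0 → c.h → Pr c s m σ K u →
      AnisoReg c.T m s u ∧ eAnisoKS c.T m s c.lam σ u ≤ ENNReal.ofReal (C * K) := by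
  set S : ℝ := σ + (2 * s + m : ℕ)
  set D : ℝ := (11 + 2 ^ (S + 1) * 4 * (1 + 2 ^ S)) * (n + 1) ^ (2 * s + m)
  have hD : 0 ≤ D := by positivity
  refine ⟨((m + 1 : ℕ) * ((2 * s + 1 : ℕ) * ((s + 1 : ℕ) * D))), by positivity,
    fun c K u hβ hh h => ?_⟩
  have hK : 0 ≤ K := h.nonneg
  have hT := c.hT
  have hpr : ∀ j ≤ s, Pr c (s - j) m σ K (tDeriv c.T j u) := by
    intro j
    induction j with
    | zero => intro _; simpa [tDeriv_zero] using h
    | succ j ih =>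
      intro hj
      have h1 := ih (by omega)
      rw [show s - j = (s - (j + 1)) + 1 by omega] at h1
      obtain ⟨-, v', hv, hp⟩ := h1
      exact hp.congr (hv.tDeriv_succ_eq hT)
  have htd : ∀ j < s, TD c.T (tDeriv c.T j u) (tDeriv c.T (j + 1) u) := by
    intro j hj
    have h1 := hpr j hj.le
    rw [show s - j = (s - (j + 1)) + 1 by omega] at h1
    obtain ⟨-, v', hv, hp⟩ := h1
    intro x t ht
    rw [hv.tDeriv_succ_eq hT t ht]
    exact hv x t ht
  have hbas : ∀ j M, j ≤ s → M + 2 * j ≤ 2 * s + m →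
      BasF c (σ + M) (n ^ M * K) (mixDeriv c.T M j u) := fun j M hj hM =>
    (hpr j hj).cl.basF (by omega)
  refine ⟨⟨fun x => ?_, fun j hj t ht => ?_, fun j M hj hM => ?_⟩, ?_⟩
  · refine contDiffOn_of_continuousOn_differentiableOn_deriv (fun j hj => ?_) fun j hj => ?_
    · have h1 : JC c.T (tDeriv c.T j u) := (hpr j (by exact_mod_cast hj)).cl.bas.1
      exact h1.comp (f := fun t => (t, x)) (by fun_prop) fun t ht => ⟨ht, Set.mem_univ _⟩
    · exact fun t ht => (htd j (by exact_mod_cast hj) x t ht).differentiableWithinAt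
  · rw [contDiff_exponent]
    exact (hpr j hj).cl.contDiff ht
  · exact (hbas j M hj hM).1.comp_continuous
      (f := fun p : Set.Icc (0 : ℝ) c.T × Spc n => ((p.1 : ℝ), p.2)) (by fun_prop)
      fun p => ⟨p.1.2, Set.mem_univ _⟩
  · rw [eAnisoKS, ENNReal.ofReal_mul (by positivity)]
    have hterm : ∀ b ∈ Finset.range (m + 1), ∀ M ∈ Finset.range (2 * s + 1),
        ∀ j ∈ Finset.range (s + 1), (if M + 2 * j ≤ 2 * s then
          eAniso0 c.T c.lam (σ + b + M) (mixDeriv c.T (b + M) j u) else 0) ≤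
          ENNReal.ofReal (D * K) := by
      intro b hb M hM j hj
      simp only [Finset.mem_range] at hb hM hj
      split_ifs with hcond
      · have h1 := hbas j (b + M) (by omega) (by omega)
        have h2 := eAniso0_le hβ hh (by positivity) (by positivity) h1
        rw [show σ + b + M = σ + (b + M : ℕ) by push_cast; ring]
        refine h2.trans (ENNReal.ofReal_le_ofReal ?_)
        have hM' : ((b + M : ℕ) : ℝ) ≤ (2 * s + m : ℕ) := by
          exact_mod_cast (by omega : b + M ≤ 2 * s + m)
        have h3 : (2 : ℝ) ^ (σ + (b + M : ℕ)) ≤ 2 ^ S :=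
          Real.rpow_le_rpow_of_exponent_le (by norm_num) (by simp only [S]; linarith)
        have h4 : (2 : ℝ) ^ (σ + (b + M : ℕ) + 1) ≤ 2 ^ (S + 1) :=
          Real.rpow_le_rpow_of_exponent_le (by norm_num) (by simp only [S]; linarith)
        have h5 : (n : ℝ) ^ (b + M) ≤ (n + 1) ^ (2 * s + m) :=
          (pow_le_pow_left₀ (by positivity) (by linarith) _).trans
            (pow_le_pow_right₀ (by linarith [(n.cast_nonneg : (0:ℝ) ≤ n)]) (by omega))
        rw [← mul_assoc]
        refine mul_le_mul_of_nonneg_right ?_ hK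
        simp only [D]
        gcongr
      · exact zero_le
    have hsum : ∀ {ι : Type} (S : Finset ι) (f : ι → ℝ≥0∞) (a : ℝ), 0 ≤ a →
        (∀ i ∈ S, f i ≤ ENNReal.ofReal a) → ∑ i ∈ S, f i ≤ ENNReal.ofReal (S.card * a) := by
      intro ι S f a ha hf
      refine (Finset.sum_le_sum hf).trans (le_of_eq ?_)
      rw [Finset.sum_const, nsmul_eq_mul, ENNReal.ofReal_mul (by positivity)]
      simp
    rw [← ENNReal.ofReal_mul (by positivity),
      show (((m + 1 : ℕ) : ℝ) * ((2 * s + 1 : ℕ) * ((s + 1 : ℕ) * D))) * K =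
        (Finset.range (m + 1)).card * ((Finset.range (2 * s + 1)).card *
          ((Finset.range (s + 1)).card * (D * K))) by simp; ring]
    exact hsum _ _ _ (by positivity) fun b hb => hsum _ _ _ (by positivity) fun M hM =>
      hsum _ _ _ (by positivity) fun j hj => hterm b hb M hM j hj

/-- Averages `∫ g(ζ) φ(x - √θ ζ) dζ`. -/
def heatA (g : Spc n → ℝ) (θ : ℝ) (φ : Spc n → ℝ) (x : Spc n) : ℝ :=
  ∫ ζ, g ζ * φ (x - Real.sqrt θ • ζ)

/-- Kernels which, together with their translation and dilation differences, decay of order `m`;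
`p` is the order of homogeneity of the dilations. -/
structure HKer (p : ℕ) (m C : ℝ) (g : Spc n → ℝ) : Prop where
  cont : Continuous g
  b0 : ∀ ζ, |g ζ| ≤ C * (1 + ‖ζ‖) ^ (-m)
  b1 : ∀ a ζ, ‖a‖ ≤ 1 → |g (ζ + a) - g ζ| ≤ C * ‖a‖ * (1 + ‖ζ‖) ^ (-m)
  b2 : ∀ r : ℝ, 1 / 2 ≤ r → r ≤ 1 → ∀ ζ, |r ^ (n + p) * g (r • ζ) - g ζ| ≤
    C * (1 - r) * (1 + ‖ζ‖) ^ (-m)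

theorem integrable_decay (n : ℕ) : Integrable (fun ζ : Spc n => (1 + ‖ζ‖) ^ (-((n : ℝ) + 1))) := by
  refine integrable_one_add_norm ?_
  simp

/-- Constant in the basic estimate for `heatA`. -/
def heatC (n : ℕ) (T γ : ℝ) : ℝ :=
  (1 + Real.sqrt T) ^ γ * ∫ ζ : Spc n, (1 + ‖ζ‖) ^ (-((n : ℝ) + 1))

theorem heatC_nonneg (n : ℕ) (T γ : ℝ) : 0 ≤ heatC n T γ := by
  unfold heatC
  have := Real.sqrt_nonneg T
  refine mul_nonneg (by positivity) (integral_nonneg fun ζ => by positivity)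

theorem heatA_integrand_le {κ φ : Spc n → ℝ} {γ T D F θ : ℝ} (hγ : 0 ≤ γ)
    (hκ : ∀ ζ, |κ ζ| ≤ D * (1 + ‖ζ‖) ^ (-(n + 1 + γ))) (hφ : ∀ y, |φ y| ≤ F * wt y ^ (-γ))
    (hD : 0 ≤ D) (hF : 0 ≤ F) (hθT : θ ≤ T) (x ζ : Spc n) :
    ‖κ ζ * φ (x - Real.sqrt θ • ζ)‖ ≤
      D * F * wt x ^ (-γ) * (1 + Real.sqrt T) ^ γ * (1 + ‖ζ‖) ^ (-((n : ℝ) + 1)) := by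
  have hs : Real.sqrt θ ≤ Real.sqrt T := Real.sqrt_le_sqrt hθT
  have hs0 := Real.sqrt_nonneg θ
  have hz := norm_nonneg ζ
  have h1 : wt (x - Real.sqrt θ • ζ) ^ (-γ) ≤
      ((1 + Real.sqrt T) * (1 + ‖ζ‖)) ^ γ * wt x ^ (-γ) := by
    have e : ‖x - (x - Real.sqrt θ • ζ)‖ ≤ Real.sqrt θ * ‖ζ‖ := by
      rw [sub_sub_cancel, norm_smul, Real.norm_of_nonneg hs0]
    refine (wt_rpow_le (-γ) _ _ e).trans ?_
    rw [abs_neg, abs_of_nonneg hγ]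
    have := wt_pos x
    gcongr
    nlinarith
  have h2 : (1 + ‖ζ‖) ^ (-(n + 1 + γ)) * (1 + ‖ζ‖) ^ γ = (1 + ‖ζ‖) ^ (-((n : ℝ) + 1)) := by
    rw [← Real.rpow_add (by positivity)]; congr 1; ring
  rw [Real.norm_eq_abs, abs_mul]
  have hp := wt_pos x
  calc |κ ζ| * |φ (x - Real.sqrt θ • ζ)|
      ≤ (D * (1 + ‖ζ‖) ^ (-(n + 1 + γ))) *
        (F * (((1 + Real.sqrt T) * (1 + ‖ζ‖)) ^ γ * wt x ^ (-γ))) := by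
        refine mul_le_mul (hκ ζ) ((hφ _).trans (mul_le_mul_of_nonneg_left h1 hF))
          (abs_nonneg _) (by positivity)
    _ = D * F * wt x ^ (-γ) * (1 + Real.sqrt T) ^ γ *
        ((1 + ‖ζ‖) ^ (-(n + 1 + γ)) * (1 + ‖ζ‖) ^ γ) := by
        rw [Real.mul_rpow (by positivity) (by positivity)]; ring
    _ = _ := by rw [h2]

theorem heatA_integrable {κ φ : Spc n → ℝ} {γ T D F θ : ℝ} (hγ : 0 ≤ γ) (hκc : Continuous κ)
    (hφc : Continuous φ)
    (hκ : ∀ ζ, |κ ζ| ≤ D * (1 + ‖ζ‖) ^ (-(n + 1 + γ))) (hφ : ∀ y, |φ y| ≤ F * wt y ^ (-γ))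
    (hD : 0 ≤ D) (hF : 0 ≤ F) (hθT : θ ≤ T) (x : Spc n) :
    Integrable fun ζ => κ ζ * φ (x - Real.sqrt θ • ζ) :=
  ((integrable_decay n).const_mul _).mono' (by fun_prop)
    (Eventually.of_forall fun ζ => heatA_integrand_le hγ hκ hφ hD hF hθT x ζ)

theorem heatA_le {κ φ : Spc n → ℝ} {γ T D F θ : ℝ} (hγ : 0 ≤ γ)
    (hκ : ∀ ζ, |κ ζ| ≤ D * (1 + ‖ζ‖) ^ (-(n + 1 + γ))) (hφ : ∀ y, |φ y| ≤ F * wt y ^ (-γ))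
    (hD : 0 ≤ D) (hF : 0 ≤ F) (hθT : θ ≤ T) (x : Spc n) :
    |heatA κ θ φ x| ≤ heatC n T γ * D * F * wt x ^ (-γ) := by
  have := norm_integral_le_of_norm_le ((integrable_decay n).const_mul _)
    (Eventually.of_forall fun ζ => heatA_integrand_le hγ hκ hφ hD hF hθT x ζ)
  rw [integral_const_mul] at this
  refine this.trans (le_of_eq ?_)
  unfold heatC; ring

theorem HKer.nonneg {p : ℕ} {m C : ℝ} {g : Spc n → ℝ} (h : HKer p m C g) : 0 ≤ C := by
  have := (abs_nonneg _).trans (h.b0 0)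
  simpa using this

theorem wt_rpow_near_neg {γ : ℝ} (hγ : 0 ≤ γ) (x y : Spc n) (h : ‖x - y‖ ≤ wt x / 4) :
    wt y ^ (-γ) ≤ 2 ^ γ * wt x ^ (-γ) := by
  simpa [abs_of_nonneg hγ] using wt_rpow_near (-γ) x y h

theorem heatA_holder {g φ : Spc n → ℝ} {p : ℕ} {γ T C F θ l : ℝ} (hγ : 0 ≤ γ)
    (hg : HKer p (n + 1 + γ) C g) (hφc : Continuous φ) (hφ : ∀ y, |φ y| ≤ F * wt y ^ (-γ))
    (hF : 0 ≤ F) (hθ : 0 < θ) (hθT : θ ≤ T) (hl0 : 0 < l) (hl1 : l ≤ 1) (x y : Spc n)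
    (hxy : ‖x - y‖ ≤ wt x / 4) :
    |heatA g θ φ x - heatA g θ φ y| ≤
      (1 + 2 ^ γ) * heatC n T γ * C * F * ‖x - y‖ ^ l * θ ^ (-(l / 2)) * wt x ^ (-γ) := by
  have hC := hg.nonneg
  have hc := heatC_nonneg n T γ
  have hs : 0 < Real.sqrt θ := Real.sqrt_pos.2 hθ
  have hx := wt_pos x
  have e0 : ‖x - y‖ ^ l * θ ^ (-(l / 2)) = (‖x - y‖ / Real.sqrt θ) ^ l := by
    rw [Real.div_rpow (norm_nonneg _) hs.le, Real.sqrt_eq_rpow, ← Real.rpow_mul hθ.le,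
      Real.rpow_neg hθ.le, show 1 / 2 * l = l / 2 by ring]
    rfl
  have e1 : (1 + 2 ^ γ) * heatC n T γ * C * F * ‖x - y‖ ^ l * θ ^ (-(l / 2)) * wt x ^ (-γ) =
    (1 + 2 ^ γ) * heatC n T γ * C * F * (‖x - y‖ / Real.sqrt θ) ^ l * wt x ^ (-γ) := by
    rw [← e0]; ring
  rw [e1]
  rcases le_or_gt (‖x - y‖ / Real.sqrt θ) 1 with h1 | h1
  · set a : Spc n := (Real.sqrt θ)⁻¹ • (y - x) with ha
    have hna : ‖a‖ = ‖x - y‖ / Real.sqrt θ := by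
      rw [ha, norm_smul, norm_inv, Real.norm_of_nonneg hs.le, norm_sub_rev]; ring
    have hA : heatA g θ φ y = ∫ ζ, g (ζ + a) * φ (x - Real.sqrt θ • ζ) := by
      unfold heatA
      rw [← integral_add_right_eq_self _ a]
      congr 1; ext ζ
      congr 2
      rw [smul_add, ha, smul_inv_smul₀ hs.ne']; abel
    have hb : ∀ ζ, |g ζ - g (ζ + a)| ≤ (C * ‖a‖) * (1 + ‖ζ‖) ^ (-(n + 1 + γ)) := fun ζ => by
      rw [abs_sub_comm]; exact hg.b1 a ζ (hna.trans_le h1)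
    have hi1 := heatA_integrable hγ hg.cont hφc hg.b0 hφ hC hF hθT x
    have hb2 : ∀ ζ, |g (ζ + a)| ≤ (C + C * ‖a‖) * (1 + ‖ζ‖) ^ (-(n + 1 + γ)) := fun ζ => by
      have := abs_sub_abs_le_abs_sub (g (ζ + a)) (g ζ)
      have h2 := hg.b1 a ζ (hna.trans_le h1)
      have h3 := hg.b0 ζ
      nlinarith
    have hi2 := heatA_integrable hγ (κ := fun ζ => g (ζ + a))
      (hg.cont.comp (continuous_id.add continuous_const)) hφc hb2 hφ
      (by positivity) hF hθT x
    have hE : heatA g θ φ x - heatA g θ φ y = heatA (fun ζ => g ζ - g (ζ + a)) θ φ x := by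
      rw [hA]; unfold heatA
      rw [← integral_sub hi1 hi2]
      congr 1; ext ζ; ring
    rw [hE]
    refine (heatA_le hγ hb hφ (by positivity) hF hθT x).trans ?_
    rw [hna]
    have h3 : ‖x - y‖ / Real.sqrt θ ≤ (‖x - y‖ / Real.sqrt θ) ^ l :=
      Real.self_le_rpow_of_le_one (by positivity) h1 hl1
    have h4 : 0 ≤ ‖x - y‖ / Real.sqrt θ := by positivity
    have h5 : (1:ℝ) ≤ 1 + 2 ^ γ := by
      have : (0:ℝ) ≤ 2 ^ γ := by positivity
      linarith
    calc heatC n T γ * (C * (‖x - y‖ / Real.sqrt θ)) * F * wt x ^ (-γ)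
        = 1 * (heatC n T γ * C * F) * (‖x - y‖ / Real.sqrt θ) * wt x ^ (-γ) := by ring
      _ ≤ (1 + 2 ^ γ) * (heatC n T γ * C * F) * (‖x - y‖ / Real.sqrt θ) ^ l * wt x ^ (-γ) := by
        gcongr
      _ = _ := by ring
  · have h2 : 1 ≤ (‖x - y‖ / Real.sqrt θ) ^ l := Real.one_le_rpow h1.le hl0.le
    have hx' := heatA_le hγ hg.b0 hφ hC hF hθT x
    have hy' := heatA_le hγ hg.b0 hφ hC hF hθT y
    have hw := wt_rpow_near_neg hγ x y hxy
    calc |heatA g θ φ x - heatA g θ φ y| ≤ |heatA g θ φ x| + |heatA g θ φ y| := abs_sub _ _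
      _ ≤ heatC n T γ * C * F * wt x ^ (-γ) + heatC n T γ * C * F * (2 ^ γ * wt x ^ (-γ)) := by
        refine add_le_add hx' (hy'.trans ?_)
        gcongr
      _ = (1 + 2 ^ γ) * heatC n T γ * C * F * 1 * wt x ^ (-γ) := by ring
      _ ≤ _ := by gcongr

theorem heatA_time {g φ : Spc n → ℝ} {p : ℕ} {γ T C F θ₁ θ₂ l : ℝ} (hγ : 0 ≤ γ)
    (hg : HKer p (n + 1 + γ) C g) (hφc : Continuous φ) (hφ : ∀ y, |φ y| ≤ F * wt y ^ (-γ))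
    (hF : 0 ≤ F) (hθ : 0 < θ₁) (h12 : θ₁ ≤ θ₂) (hθT : θ₂ ≤ T) (hl0 : 0 < l) (hl1 : l ≤ 1)
    (x : Spc n) :
    |θ₂ ^ (-(p : ℝ) / 2) * heatA g θ₂ φ x - θ₁ ^ (-(p : ℝ) / 2) * heatA g θ₁ φ x| ≤
      2 * heatC n T γ * C * F * (θ₂ - θ₁) ^ (l / 2) * θ₁ ^ (-(p : ℝ) / 2 + -(l / 2)) *
        wt x ^ (-γ) := by
  have hC := hg.nonneg
  have hc := heatC_nonneg n T γ
  have hθ2 : 0 < θ₂ := hθ.trans_le h12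
  have hs1 : 0 < Real.sqrt θ₁ := Real.sqrt_pos.2 hθ
  have hs2 : 0 < Real.sqrt θ₂ := Real.sqrt_pos.2 hθ2
  have hx := wt_pos x
  have e0 : (θ₂ - θ₁) ^ (l / 2) * θ₁ ^ (-(p : ℝ) / 2 + -(l / 2)) =
      θ₁ ^ (-(p : ℝ) / 2) * ((θ₂ - θ₁) / θ₁) ^ (l / 2) := by
    rw [Real.rpow_add hθ, Real.div_rpow (by linarith) hθ.le, Real.rpow_neg hθ.le (l / 2)]
    ring
  have e1 : 2 * heatC n T γ * C * F * (θ₂ - θ₁) ^ (l / 2) * θ₁ ^ (-(p : ℝ) / 2 + -(l / 2)) *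
      wt x ^ (-γ) = θ₁ ^ (-(p : ℝ) / 2) *
      (2 * heatC n T γ * C * F * ((θ₂ - θ₁) / θ₁) ^ (l / 2) * wt x ^ (-γ)) := by
    rw [mul_assoc (2 * heatC n T γ * C * F), e0]; ring
  rw [e1]
  set r : ℝ := Real.sqrt θ₁ / Real.sqrt θ₂ with hr
  have hr0 : 0 < r := div_pos hs1 hs2
  have hr1 : r ≤ 1 := by rw [hr, div_le_one hs2]; exact Real.sqrt_le_sqrt h12
  have hrsq : r ^ 2 = θ₁ / θ₂ := by
    rw [hr, div_pow, Real.sq_sqrt hθ.le, Real.sq_sqrt hθ2.le]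
  have e2 : θ₂ ^ (-(p : ℝ) / 2) = θ₁ ^ (-(p : ℝ) / 2) * r ^ p := by
    have a1 : ∀ a : ℝ, 0 < a → a ^ (-(p : ℝ) / 2) = (Real.sqrt a ^ p)⁻¹ := fun a ha => by
      rw [Real.sqrt_eq_rpow, ← Real.rpow_natCast, ← Real.rpow_mul ha.le, ← Real.rpow_neg ha.le]
      congr 1; ring
    rw [a1 _ hθ, a1 _ hθ2, hr, div_pow]
    field_simp
  have e3 : heatA g θ₂ φ x = r ^ n * ∫ ζ, g (r • ζ) * φ (x - Real.sqrt θ₁ • ζ) := by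
    unfold heatA
    have := Measure.integral_comp_smul (volume : Measure (Spc n))
      (fun ζ => g ζ * φ (x - Real.sqrt θ₂ • ζ)) r
    have h5 : ∀ ζ : Spc n, Real.sqrt θ₂ • r • ζ = Real.sqrt θ₁ • ζ := fun ζ => by
      rw [smul_smul]; congr 1; rw [hr]; field_simp
    simp only [h5, finrank_euclideanSpace, Fintype.card_fin, smul_eq_mul] at this
    rw [this, abs_of_nonneg (by positivity)]
    field_simp
  have hE : θ₂ ^ (-(p : ℝ) / 2) * heatA g θ₂ φ x - θ₁ ^ (-(p : ℝ) / 2) * heatA g θ₁ φ x =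
      θ₁ ^ (-(p : ℝ) / 2) * (r ^ p * heatA g θ₂ φ x - heatA g θ₁ φ x) := by
    rw [e2]; ring
  rw [hE, abs_mul, abs_of_nonneg (Real.rpow_nonneg hθ.le _)]
  refine mul_le_mul_of_nonneg_left ?_ (Real.rpow_nonneg hθ.le _)
  rcases le_or_gt (1 / 2) r with h1 | h1
  · have hi1 := heatA_integrable hγ hg.cont hφc hg.b0 hφ hC hF (h12.trans hθT) x
    have hb2 : ∀ ζ, |r ^ (n + p) * g (r • ζ)| ≤
        (C + C * (1 - r)) * (1 + ‖ζ‖) ^ (-(n + 1 + γ)) := fun ζ => by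
      have := abs_sub_abs_le_abs_sub (r ^ (n + p) * g (r • ζ)) (g ζ)
      have h2 := hg.b2 r h1 hr1 ζ
      have h3 := hg.b0 ζ
      nlinarith
    have hi2 := heatA_integrable hγ (κ := fun ζ => r ^ (n + p) * g (r • ζ))
      (continuous_const.mul (hg.cont.comp (continuous_const_smul r))) hφc hb2 hφ
      (by nlinarith) hF (h12.trans hθT) x
    have hE2 : r ^ p * heatA g θ₂ φ x - heatA g θ₁ φ x =
        heatA (fun ζ => r ^ (n + p) * g (r • ζ) - g ζ) θ₁ φ x := by
      rw [e3, ← mul_assoc, ← pow_add, ← integral_const_mul]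
      unfold heatA
      simp only [add_comm p n, ← mul_assoc]
      rw [← integral_sub hi2 hi1]
      congr 1; ext ζ; ring
    rw [hE2]
    refine (heatA_le hγ (hg.b2 r h1 hr1) hφ (mul_nonneg hC (by linarith)) hF
      (h12.trans hθT) x).trans ?_
    have h3 : 1 - r ≤ ((θ₂ - θ₁) / θ₁) ^ (l / 2) := by
      have a1 : 1 - r ≤ 1 - r ^ 2 := by nlinarith
      have a2 : 1 - r ^ 2 = (θ₂ - θ₁) / θ₂ := by rw [hrsq]; field_simp
      have a3 : (θ₂ - θ₁) / θ₂ ≤ ((θ₂ - θ₁) / θ₂) ^ (l / 2) :=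
        Real.self_le_rpow_of_le_one (div_nonneg (by linarith) hθ2.le)
          (by rw [div_le_one hθ2]; linarith) (by linarith)
      have a4 : ((θ₂ - θ₁) / θ₂) ^ (l / 2) ≤ ((θ₂ - θ₁) / θ₁) ^ (l / 2) := by
        refine Real.rpow_le_rpow (div_nonneg (by linarith) hθ2.le) ?_ (by linarith)
        exact div_le_div_of_nonneg_left (by linarith) hθ h12
      linarith
    have h4 : 0 ≤ 1 - r := by linarith
    calc heatC n T γ * (C * (1 - r)) * F * wt x ^ (-γ)
        = 1 * (heatC n T γ * C * F) * (1 - r) * wt x ^ (-γ) := by ring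
      _ ≤ 2 * (heatC n T γ * C * F) * ((θ₂ - θ₁) / θ₁) ^ (l / 2) * wt x ^ (-γ) := by
        gcongr; norm_num
      _ = _ := by ring
  · have h2 : 1 ≤ ((θ₂ - θ₁) / θ₁) ^ (l / 2) := by
      refine Real.one_le_rpow ?_ (by linarith)
      rw [le_div_iff₀ hθ]
      have : r ^ 2 ≤ 1 / 4 := by nlinarith
      rw [hrsq, div_le_iff₀ hθ2] at this
      linarith
    have hx1 := heatA_le hγ hg.b0 hφ hC hF (h12.trans hθT) x
    have hx2 := heatA_le hγ hg.b0 hφ hC hF hθT x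
    have hrp : r ^ p ≤ 1 := pow_le_one₀ hr0.le hr1
    calc |r ^ p * heatA g θ₂ φ x - heatA g θ₁ φ x|
        ≤ |r ^ p * heatA g θ₂ φ x| + |heatA g θ₁ φ x| := abs_sub _ _
      _ = r ^ p * |heatA g θ₂ φ x| + |heatA g θ₁ φ x| := by
        rw [abs_mul, abs_of_nonneg (by positivity : 0 ≤ r ^ p)]
      _ ≤ 1 * (heatC n T γ * C * F * wt x ^ (-γ)) + heatC n T γ * C * F * wt x ^ (-γ) := by
        gcongr
      _ = 2 * heatC n T γ * C * F * 1 * wt x ^ (-γ) := by ring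
      _ ≤ _ := by gcongr

theorem continuous_heatA {g : Spc n → ℝ} {p : ℕ} {γ C F : ℝ} {f : ℝ → Spc n → ℝ} (hγ : 0 ≤ γ)
    (hg : HKer p (n + 1 + γ) C g) (hf : Continuous (Function.uncurry f))
    (hb : ∀ τ y, |f τ y| ≤ F) :
    Continuous fun q : ℝ × ℝ × Spc n => heatA g q.1 (f q.2.1) q.2.2 := by
  unfold heatA
  have hF : 0 ≤ F := (abs_nonneg _).trans (hb 0 0)
  have hgi : Integrable g := by
    refine ((integrable_decay n).const_mul C).mono' hg.cont.aestronglyMeasurable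
      (Eventually.of_forall fun ζ => (hg.b0 ζ).trans ?_)
    refine mul_le_mul_of_nonneg_left (Real.rpow_le_rpow_of_exponent_le ?_ ?_) hg.nonneg
    · linarith [norm_nonneg ζ]
    · linarith
  have hg := hg.cont
  refine continuous_of_dominated (bound := fun ζ => F * |g ζ|) (fun q => ?_)
    (fun q => Eventually.of_forall fun ζ => ?_) (hgi.abs.const_mul F)
    (Eventually.of_forall fun ζ => ?_)
  · have : Continuous fun ζ => f q.2.1 (q.2.2 - Real.sqrt q.1 • ζ) :=
      hf.comp (by fun_prop : Continuous fun ζ => (q.2.1, q.2.2 - Real.sqrt q.1 • ζ))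
    exact (hg.mul this).aestronglyMeasurable
  · rw [norm_mul, mul_comm]
    exact mul_le_mul_of_nonneg_right (hb _ _) (abs_nonneg _)
  · have : Continuous fun q : ℝ × ℝ × Spc n => f q.2.1 (q.2.2 - Real.sqrt q.1 • ζ) :=
      hf.comp (by fun_prop :
        Continuous fun q : ℝ × ℝ × Spc n => (q.2.1, q.2.2 - Real.sqrt q.1 • ζ))
    exact continuous_const.mul this

theorem JC.of_holder {T l l' A B : ℝ} (hl : 0 < l) (hl' : 0 < l') {v : ℝ → Spc n → ℝ}
    (h1 : ∀ t ∈ Set.Icc 0 T, ∀ x y, ‖x - y‖ ≤ 1 / 4 → |v t x - v t y| ≤ A * ‖x - y‖ ^ l)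
    (h2 : ∀ t ∈ Set.Icc 0 T, ∀ t' ∈ Set.Icc 0 T, ∀ x, |v t x - v t' x| ≤ B * |t - t'| ^ l') :
    JC T v := by
  rintro ⟨t, x⟩ ⟨ht, -⟩
  simp only at ht
  have hc : Tendsto (fun q : ℝ × Spc n => A * ‖x - q.2‖ ^ l + B * |t - q.1| ^ l')
      (nhdsWithin (t, x) (Set.Icc 0 T ×ˢ Set.univ)) (nhds 0) := by
    have : Continuous fun q : ℝ × Spc n => A * ‖x - q.2‖ ^ l + B * |t - q.1| ^ l' := by
      refine (continuous_const.mul (Continuous.rpow_const (by fun_prop) fun _ => Or.inr hl.le)).add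
        (continuous_const.mul (Continuous.rpow_const (by fun_prop) fun _ => Or.inr hl'.le))
    have h := this.tendsto (t, x)
    simp only [sub_self, norm_zero, abs_zero, Real.zero_rpow hl.ne', Real.zero_rpow hl'.ne',
      mul_zero, add_zero] at h
    exact h.mono_left nhdsWithin_le_nhds
  refine tendsto_iff_dist_tendsto_zero.2 (squeeze_zero' (Eventually.of_forall fun _ => dist_nonneg)
    ?_ hc)
  have hn : ∀ᶠ q : ℝ × Spc n in nhdsWithin (t, x) (Set.Icc 0 T ×ˢ Set.univ), ‖x - q.2‖ ≤ 1 / 4 := by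
    have hcont : Continuous fun q : ℝ × Spc n => ‖x - q.2‖ := by fun_prop
    have := (hcont.tendsto (t, x)).eventually (gt_mem_nhds (by norm_num : ‖x - x‖ < 1 / 4))
    filter_upwards [nhdsWithin_le_nhds this] with q hq using le_of_lt hq
  filter_upwards [hn, self_mem_nhdsWithin] with q hq hq2
  have e1 := h1 q.1 hq2.1 x q.2 hq
  have e2 := h2 t ht q.1 hq2.1 x
  rw [dist_comm, Real.dist_eq]
  have := abs_sub_le (v t x) (v q.1 x) (v q.1 q.2)
  linarith

/-- Parabolic potentials. -/
def heatJ (p : ℕ) (g : Spc n → ℝ) (f : ℝ → Spc n → ℝ) (t : ℝ) (x : Spc n) : ℝ :=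
  ∫ τ in (0 : ℝ)..t, (t - τ) ^ (-(p : ℝ) / 2) * heatA g (t - τ) (f τ) x

theorem intervalIntegrable_sub_rpow {e : ℝ} (he : -1 < e) (t a b : ℝ) :
    IntervalIntegrable (fun τ => (t - τ) ^ e) volume a b := by
  have := (intervalIntegral.intervalIntegrable_rpow' he (a := t - a) (b := t - b)).comp_sub_left t
  simpa using this

theorem integral_sub_rpow {e : ℝ} (he : -1 < e) {a t : ℝ} :
    ∫ τ in a..t, (t - τ) ^ e = (t - a) ^ (e + 1) / (e + 1) := by
  rw [intervalIntegral.integral_comp_sub_left (fun s : ℝ => s ^ e), integral_rpow (Or.inl he),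
    sub_self, Real.zero_rpow (by linarith)]
  simp

theorem abs_integral_le_rpow {e M a t : ℝ} (he : -1 < e) (hat : a ≤ t) {F : ℝ → ℝ}
    (h : ∀ τ ∈ Set.Ioo a t, |F τ| ≤ M * (t - τ) ^ e) :
    |∫ τ in a..t, F τ| ≤ M * ((t - a) ^ (e + 1) / (e + 1)) := by
  rw [← integral_sub_rpow he, ← intervalIntegral.integral_const_mul]
  rw [← Real.norm_eq_abs]
  refine intervalIntegral.norm_integral_le_of_norm_le hat ?_
    ((intervalIntegrable_sub_rpow he t a t).const_mul M)
  have : ∀ᵐ τ : ℝ, τ ≠ t := by simp [ae_iff, measure_singleton]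
  filter_upwards [this] with τ hτ hτ2
  exact h τ ⟨hτ2.1, lt_of_le_of_ne hτ2.2 hτ⟩

theorem heatJ_intervalIntegrable {g : Spc n → ℝ} {p : ℕ} (hp : p ≤ 1) {γ C F : ℝ}
    {f : ℝ → Spc n → ℝ} (hγ : 0 ≤ γ)
    (hg : HKer p (n + 1 + γ) C g) (hf : Continuous (Function.uncurry f))
    (hb : ∀ τ y, |f τ y| ≤ F) (t a b : ℝ) (x : Spc n) :
    IntervalIntegrable (fun τ => (t - τ) ^ (-(p : ℝ) / 2) * heatA g (t - τ) (f τ) x)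
      volume a b := by
  have hp' : (p : ℝ) ≤ 1 := by exact_mod_cast hp
  refine (intervalIntegrable_sub_rpow (by linarith) t a b).mul_continuousOn ?_
  exact ((continuous_heatA hγ hg hf hb).comp
    (by fun_prop : Continuous fun τ : ℝ => (t - τ, τ, x))).continuousOn

theorem heatJ_sup {p : ℕ} (hp : p ≤ 1) {γ C T : ℝ} {g : Spc n → ℝ} (hγ : 0 ≤ γ)
    (hg : HKer p (n + 1 + γ) C g) : ∃ M : ℝ, 0 ≤ M ∧ ∀ (β K : ℝ) (f : ℝ → Spc n → ℝ), 0 < β →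
      0 ≤ K → (∀ τ ∈ Set.Icc 0 T, ∀ y, |f τ y| ≤ K * Real.exp (β * τ) * wt y ^ (-γ)) →
      ∀ t ∈ Set.Icc 0 T, ∀ x, |heatJ p g f t x| ≤
        M * β ^ (-(1 / 4) : ℝ) * K * Real.exp (β * t) * wt x ^ (-γ) := by
  have hp' : (p : ℝ) ≤ 1 := by exact_mod_cast hp
  have he : (-1 : ℝ) < -(p : ℝ) / 2 + -(1 / 4) := by linarith
  have hC := hg.nonneg
  have hc := heatC_nonneg n T γ
  rcases le_or_gt 0 T with hT | hT
  swap
  · exact ⟨0, le_rfl, fun β K f _ _ _ t ht => absurd (ht.1.trans ht.2) (not_le.2 hT)⟩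
  refine ⟨heatC n T γ * C * (T ^ (-(p : ℝ) / 2 + -(1 / 4) + 1) / (-(p : ℝ) / 2 + -(1 / 4) + 1)),
    mul_nonneg (mul_nonneg hc hC) (div_nonneg (by positivity) (by linarith)), ?_⟩
  intro β K f hβ hK hf t ht x
  have hx := wt_pos x
  have := abs_integral_le_rpow (M := heatC n T γ * C * (K * Real.exp (β * t) * β ^ (-(1 / 4) : ℝ)) *
    wt x ^ (-γ)) he ht.1
    (F := fun τ => (t - τ) ^ (-(p : ℝ) / 2) * heatA g (t - τ) (f τ) x) ?_
  · refine (show |heatJ p g f t x| ≤ _ from this).trans ?_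
    rw [sub_zero]
    have h1 : t ^ (-(p : ℝ) / 2 + -(1 / 4) + 1) ≤ T ^ (-(p : ℝ) / 2 + -(1 / 4) + 1) :=
      Real.rpow_le_rpow ht.1 ht.2 (by linarith)
    have h2 : (0:ℝ) < -(p : ℝ) / 2 + -(1 / 4) + 1 := by linarith
    calc _ ≤ heatC n T γ * C * (K * Real.exp (β * t) * β ^ (-(1 / 4) : ℝ)) * wt x ^ (-γ) *
          (T ^ (-(p : ℝ) / 2 + -(1 / 4) + 1) / (-(p : ℝ) / 2 + -(1 / 4) + 1)) := by gcongr
      _ = _ := by ring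
  · intro τ hτ
    have hs : 0 < t - τ := by linarith [hτ.2]
    have h1 := heatA_le hγ hg.b0 (hf τ ⟨hτ.1.le, hτ.2.le.trans ht.2⟩) hC (by positivity)
      (by linarith [hτ.1, ht.2] : t - τ ≤ T) x
    have h2 : Real.exp (β * τ) ≤ Real.exp (β * t) * (β ^ (-(1 / 4) : ℝ) * (t - τ) ^ (-(1 / 4) : ℝ)) := by
      have hy : 0 < β * (t - τ) := by positivity
      have e1 : Real.exp (β * τ) = Real.exp (β * t) * Real.exp (-(β * (t - τ))) := by
        rw [← Real.exp_add]; congr 1; ring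
      rw [e1, ← Real.mul_rpow hβ.le hs.le]
      refine mul_le_mul_of_nonneg_left ?_ (Real.exp_pos _).le
      rw [Real.exp_neg, Real.rpow_neg hy.le]
      refine inv_anti₀ (by positivity) ?_
      have h3 := Real.add_one_le_exp (β * (t - τ))
      rcases le_total 1 (β * (t - τ)) with h4 | h4
      · have := Real.rpow_le_self_of_one_le h4 (by norm_num : (1 / 4 : ℝ) ≤ 1)
        linarith
      · have := Real.rpow_le_one hy.le h4 (by norm_num : (0 : ℝ) ≤ 1 / 4)
        linarith
    rw [abs_mul, abs_of_nonneg (by positivity), Real.rpow_add hs]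
    calc (t - τ) ^ (-(p : ℝ) / 2) * |heatA g (t - τ) (f τ) x|
        ≤ (t - τ) ^ (-(p : ℝ) / 2) * (heatC n T γ * C * (K * (Real.exp (β * t) *
          (β ^ (-(1 / 4) : ℝ) * (t - τ) ^ (-(1 / 4) : ℝ)))) * wt x ^ (-γ)) := by
          refine mul_le_mul_of_nonneg_left (h1.trans ?_) (by positivity)
          gcongr
      _ = _ := by ring

theorem heatJ_bas {p : ℕ} (hp : p ≤ 1) {γ C : ℝ} {g : Spc n → ℝ} (c : Cfg) (hβ : c.β = 0)
    (hγ : 0 ≤ γ) (hg : HKer p (n + 1 + γ) C g) :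
    ∃ M : ℝ, 0 ≤ M ∧ ∀ (K : ℝ) (f : ℝ → Spc n → ℝ), Continuous (Function.uncurry f) → 0 ≤ K →
      (∀ τ y, |f τ y| ≤ K * wt y ^ (-γ)) → Bas c (γ - c.lam) (M * K) (heatJ p g f) := by
  have hp' : (p : ℝ) ≤ 1 := by exact_mod_cast hp
  have hl0 := c.hl0
  have hl1 := c.hl1
  have hT := c.hT
  have he : (-1 : ℝ) < -(p : ℝ) / 2 := by linarith
  have he2 : (-1 : ℝ) < -(p : ℝ) / 2 + -(c.lam / 2) := by linarith
  have hC := hg.nonneg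
  have hc := heatC_nonneg n c.T γ
  have hI : ∀ {e : ℝ}, -1 < e → ∀ t ∈ Set.Icc 0 c.T,
      (t - 0) ^ (e + 1) / (e + 1) ≤ c.T ^ (e + 1) / (e + 1) := fun {e} he t ht => by
    have : 0 < e + 1 := by linarith
    rw [sub_zero]
    exact div_le_div_of_nonneg_right (Real.rpow_le_rpow ht.1 ht.2 this.le) this.le
  set I₁ := c.T ^ (-(p : ℝ) / 2 + 1) / (-(p : ℝ) / 2 + 1) with hI₁
  set I₂ := c.T ^ (-(p : ℝ) / 2 + -(c.lam / 2) + 1) / (-(p : ℝ) / 2 + -(c.lam / 2) + 1) with hI₂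
  set I₃ := c.T ^ (-(p : ℝ) / 2 + -(c.lam / 2) + 1) / (-(p : ℝ) / 2 + 1) with hI₃
  have hI₁0 : 0 ≤ I₁ := div_nonneg (by positivity) (by linarith)
  have hI₂0 : 0 ≤ I₂ := div_nonneg (by positivity) (by linarith)
  have hI₃0 : 0 ≤ I₃ := div_nonneg (by positivity) (by linarith)
  set H := heatC n c.T γ * C with hH
  have hH0 : 0 ≤ H := mul_nonneg hc hC
  set M := H * I₁ + (1 + 2 ^ γ) * H * I₂ + 2 * H * I₂ + H * I₃ with hM
  have hg0 : (0:ℝ) ≤ 2 ^ γ := by positivity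
  have q1 := mul_nonneg hH0 hI₁0
  have q2 := mul_nonneg hH0 hI₂0
  have q3 := mul_nonneg hH0 hI₃0
  have q4 := mul_nonneg hg0 q2
  have m1 : H * I₁ ≤ M := by rw [hM]; nlinarith
  have m2 : (1 + 2 ^ γ) * H * I₂ ≤ M := by rw [hM]; nlinarith
  have m3 : 2 * H * I₂ + H * I₃ ≤ M := by rw [hM]; nlinarith
  have hM0 : 0 ≤ M := (mul_nonneg hH0 hI₁0).trans m1
  refine ⟨M, hM0, fun K f hf hK hfb => ?_⟩
  have hfb' : ∀ τ y, |f τ y| ≤ K := fun τ y => (hfb τ y).trans (by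
    have : wt y ^ (-γ) ≤ 1 := Real.rpow_le_one_of_one_le_of_nonpos (one_le_wt y) (by linarith)
    nlinarith)
  have hfc : ∀ τ, Continuous (f τ) := fun τ => hf.comp (by fun_prop : Continuous fun y => (τ, y))
  have hjint := fun t a b x => heatJ_intervalIntegrable hp hγ hg hf hfb' t a b x
  have hsup : ∀ t ∈ Set.Icc 0 c.T, ∀ x, |heatJ p g f t x| ≤ H * I₁ * K * wt x ^ (-γ) := by
    intro t ht x
    have hx := wt_pos x
    refine (abs_integral_le_rpow (M := H * K * wt x ^ (-γ)) he ht.1 ?_).trans ?_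
    · intro τ hτ
      have hs : 0 < t - τ := by linarith [hτ.2]
      rw [abs_mul, abs_of_nonneg (by positivity), mul_comm]
      exact mul_le_mul_of_nonneg_right (heatA_le hγ hg.b0 (hfb τ) hC hK
        (by linarith [hτ.1, ht.2]) x) (by positivity)
    · have := mul_le_mul_of_nonneg_left (hI he t ht)
        (by positivity : 0 ≤ H * K * wt x ^ (-γ))
      exact this.trans (le_of_eq (by rw [hI₁]; ring))
  have hsp : ∀ t ∈ Set.Icc 0 c.T, ∀ x y, ‖x - y‖ ≤ wt x / 4 →
      |heatJ p g f t x - heatJ p g f t y| ≤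
        (1 + 2 ^ γ) * H * I₂ * K * ‖x - y‖ ^ c.lam * wt x ^ (-γ) := by
    intro t ht x y hxy
    have hx := wt_pos x
    unfold heatJ
    rw [← intervalIntegral.integral_sub (hjint t 0 t x) (hjint t 0 t y)]
    refine (abs_integral_le_rpow (M := (1 + 2 ^ γ) * H * K * ‖x - y‖ ^ c.lam * wt x ^ (-γ)) he2
      ht.1 ?_).trans ?_
    · intro τ hτ
      have hs : 0 < t - τ := by linarith [hτ.2]
      rw [← mul_sub, abs_mul, abs_of_nonneg (by positivity), Real.rpow_add hs]
      refine (mul_le_mul_of_nonneg_left (heatA_holder hγ hg (hfc τ) (hfb τ) hK hs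
        (by linarith [hτ.1, ht.2] : t - τ ≤ c.T) hl0 hl1.le x y hxy) (by positivity)).trans
        (le_of_eq (by rw [hH]; ring))
    · have := mul_le_mul_of_nonneg_left (hI he2 t ht)
        (by positivity : 0 ≤ (1 + 2 ^ γ) * H * K * ‖x - y‖ ^ c.lam * wt x ^ (-γ))
      exact this.trans (le_of_eq (by rw [hI₂]; ring))
  have htm' : ∀ t ∈ Set.Icc 0 c.T, ∀ t' ∈ Set.Icc 0 c.T, t ≤ t' → ∀ x,
      |heatJ p g f t' x - heatJ p g f t x| ≤
        (2 * H * I₂ + H * I₃) * K * (t' - t) ^ (c.lam / 2) * wt x ^ (-γ) := by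
    intro t ht t' ht' htt x
    have hx := wt_pos x
    have hd : 0 ≤ t' - t := by linarith
    have hsplit : heatJ p g f t' x - heatJ p g f t x =
        (∫ τ in (0 : ℝ)..t, ((t' - τ) ^ (-(p : ℝ) / 2) * heatA g (t' - τ) (f τ) x -
          (t - τ) ^ (-(p : ℝ) / 2) * heatA g (t - τ) (f τ) x)) +
        ∫ τ in t..t', (t' - τ) ^ (-(p : ℝ) / 2) * heatA g (t' - τ) (f τ) x := by
      unfold heatJ
      rw [intervalIntegral.integral_sub (hjint t' 0 t x) (hjint t 0 t x),
        ← intervalIntegral.integral_add_adjacent_intervals (hjint t' 0 t x) (hjint t' t t' x)]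
      ring
    have b1 := abs_integral_le_rpow
      (M := 2 * H * K * (t' - t) ^ (c.lam / 2) * wt x ^ (-γ)) he2 ht.1
      (F := fun τ => (t' - τ) ^ (-(p : ℝ) / 2) * heatA g (t' - τ) (f τ) x -
          (t - τ) ^ (-(p : ℝ) / 2) * heatA g (t - τ) (f τ) x) (by
        intro τ hτ
        have hs : 0 < t - τ := by linarith [hτ.2]
        have := heatA_time hγ hg (hfc τ) (hfb τ) hK hs (by linarith : t - τ ≤ t' - τ)
          (by linarith [hτ.1, ht'.2] : t' - τ ≤ c.T) hl0 hl1.le x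
        rw [show t' - τ - (t - τ) = t' - t by ring] at this
        exact this.trans (le_of_eq (by rw [hH]; ring)))
    have b2 := abs_integral_le_rpow (M := H * K * wt x ^ (-γ)) he htt
      (F := fun τ => (t' - τ) ^ (-(p : ℝ) / 2) * heatA g (t' - τ) (f τ) x) (by
        intro τ hτ
        have hs : 0 < t' - τ := by linarith [hτ.2]
        rw [abs_mul, abs_of_nonneg (by positivity), mul_comm]
        exact mul_le_mul_of_nonneg_right (heatA_le hγ hg.b0 (hfb τ) hC hK
          (by linarith [hτ.1, ht'.2, ht.1]) x) (by positivity))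
    have b1' := b1.trans (mul_le_mul_of_nonneg_left (hI he2 t ht)
      (by positivity : 0 ≤ 2 * H * K * (t' - t) ^ (c.lam / 2) * wt x ^ (-γ)))
    have b3 : (t' - t) ^ (-(p : ℝ) / 2 + 1) / (-(p : ℝ) / 2 + 1) ≤
        (t' - t) ^ (c.lam / 2) * I₃ := by
      have h0 : (0:ℝ) < -(p : ℝ) / 2 + 1 := by linarith
      rw [hI₃, ← mul_div_assoc]
      refine div_le_div_of_nonneg_right ?_ h0.le
      have e1 : -(p : ℝ) / 2 + 1 = c.lam / 2 + (-(p : ℝ) / 2 + -(c.lam / 2) + 1) := by ring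
      rw [e1, Real.rpow_add_of_nonneg hd (by linarith) (by linarith)]
      refine mul_le_mul_of_nonneg_left ?_ (by positivity)
      refine Real.rpow_le_rpow hd (by linarith [ht.1, ht'.2]) (by linarith)
    have b2' := b2.trans (mul_le_mul_of_nonneg_left b3 (by positivity : 0 ≤ H * K * wt x ^ (-γ)))
    rw [hsplit]
    refine (abs_add_le _ _).trans ((add_le_add b1' b2').trans (le_of_eq ?_))
    rw [hI₂]; ring
  have htm : ∀ t ∈ Set.Icc 0 c.T, ∀ t' ∈ Set.Icc 0 c.T, ∀ x,
      |heatJ p g f t x - heatJ p g f t' x| ≤ M * K * |t - t'| ^ (c.lam / 2) * wt x ^ (-γ) := by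
    intro t ht t' ht' x
    have hx := wt_pos x
    rcases le_total t t' with h | h
    · rw [abs_sub_comm, abs_sub_comm t, abs_of_nonneg (by linarith : 0 ≤ t' - t)]
      refine (htm' t ht t' ht' h x).trans ?_
      gcongr
    · rw [abs_of_nonneg (by linarith : 0 ≤ t - t')]
      refine (htm' t' ht' t ht h x).trans ?_
      gcongr
  have hle : ∀ (x : Spc n) (a b : ℝ), a ≤ b → wt x ^ (-b) ≤ wt x ^ (-a) := fun x a b h =>
    Real.rpow_le_rpow_of_exponent_le (one_le_wt x) (by linarith)
  have h1le : ∀ x : Spc n, wt x ^ (-γ) ≤ 1 := fun x =>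
    Real.rpow_le_one_of_one_le_of_nonpos (one_le_wt x) (by linarith)
  have hMK : 0 ≤ M * K := mul_nonneg hM0 hK
  refine ⟨?_, ?_, fun _ => ⟨?_, ?_⟩⟩
  · refine JC.of_holder (l := c.lam) (l' := c.lam / 2) (A := M * K) (B := M * K) hl0 (by linarith)
      (fun t ht x y hxy => ?_) fun t ht t' ht' x => ?_
    · have hx := one_le_wt x
      refine (hsp t ht x y (by linarith)).trans ?_
      have a1 : (1 + 2 ^ γ) * H * I₂ * K ≤ M * K := mul_le_mul_of_nonneg_right m2 hK
      calc _ ≤ M * K * ‖x - y‖ ^ c.lam * 1 :=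
            mul_le_mul (mul_le_mul_of_nonneg_right a1 (by positivity)) (h1le x)
              (by have := wt_pos x; positivity) (by positivity)
        _ = _ := mul_one _
    · refine (htm t ht t' ht' x).trans ?_
      calc _ ≤ M * K * |t - t'| ^ (c.lam / 2) * 1 :=
            mul_le_mul_of_nonneg_left (h1le x) (by positivity)
        _ = _ := mul_one _
  · intro t ht x
    rw [hβ]
    simp only [zero_mul, Real.exp_zero, mul_one]
    refine (hsup t ht x).trans ?_
    exact mul_le_mul (mul_le_mul_of_nonneg_right m1 hK) (hle x _ _ (by linarith))
      (by have := wt_pos x; positivity) hMK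
  · intro t ht x y hxy
    rw [hβ]
    simp only [zero_mul, Real.exp_zero, mul_one]
    refine (hsp t ht x y hxy).trans ?_
    rw [show γ - c.lam + c.lam = γ by ring]
    have := wt_pos x
    gcongr
  · intro t ht t' ht' x
    rw [hβ]
    simp only [zero_mul, Real.exp_zero, mul_one]
    refine (htm t ht t' ht' x).trans ?_
    exact mul_le_mul_of_nonneg_left (hle x _ _ (by linarith)) (by positivity)

theorem rpow_mul_exp_le {b M s : ℝ} (hb : 0 < b) (hM : 0 ≤ M) (hs : 0 ≤ s) :
    (1 + s) ^ M * Real.exp (-b * s ^ 2) ≤ Real.exp (M ^ 2 / (4 * b)) := by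
  have h1 : (1 + s) ^ M ≤ Real.exp (s * M) := by
    rw [Real.exp_mul]
    exact Real.rpow_le_rpow (by linarith) (by linarith [Real.add_one_le_exp s]) hM
  calc (1 + s) ^ M * Real.exp (-b * s ^ 2) ≤ Real.exp (s * M) * Real.exp (-b * s ^ 2) := by gcongr
    _ = Real.exp (s * M + -b * s ^ 2) := (Real.exp_add _ _).symm
    _ ≤ _ := by
      refine Real.exp_le_exp.2 ?_
      rw [le_div_iff₀ (by positivity)]
      nlinarith [sq_nonneg (M - 2 * b * s)]

theorem HKer.of_decay {g : Spc n → ℝ} {m C : ℝ} (p : ℕ) (hm : 0 ≤ m) (hg : Differentiable ℝ g)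
    (h0 : ∀ ζ, |g ζ| ≤ C * (1 + ‖ζ‖) ^ (-m))
    (h1 : ∀ ζ, ‖fderiv ℝ g ζ‖ ≤ C * (1 + ‖ζ‖) ^ (-(m + 1))) :
    HKer p m ((n + p + 2) * 2 ^ (m + 1) * C) g := by
  have hC : 0 ≤ C := by
    have := (abs_nonneg _).trans (h0 0)
    simpa using this
  have hw : ∀ {u v : ℝ} (q : ℝ), 0 ≤ q → 0 ≤ u → 0 ≤ v → 1 + v ≤ 2 * (1 + u) →
      (1 + u) ^ (-q) ≤ 2 ^ q * (1 + v) ^ (-q) := fun {u v} q hq hu hv h => by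
    rw [Real.rpow_neg (by linarith), Real.rpow_neg (by linarith), ← div_eq_mul_inv,
      inv_le_comm₀ (by positivity) (by positivity), inv_div, div_le_iff₀ (by positivity),
      mul_comm, ← Real.mul_rpow (by norm_num) (by linarith)]
    exact Real.rpow_le_rpow (by linarith) h hq
  have h2m : (2 : ℝ) ^ m ≤ 2 ^ (m + 1) :=
    Real.rpow_le_rpow_of_exponent_le (by norm_num) (by linarith)
  have h1m : (1 : ℝ) ≤ 2 ^ (m + 1) := Real.one_le_rpow (by norm_num) (by linarith)
  have hnp : (0:ℝ) ≤ n + p := by positivity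
  refine ⟨hg.continuous, fun ζ => (h0 ζ).trans ?_, fun a ζ ha => ?_, fun r hr hr1 ζ => ?_⟩
  · refine mul_le_mul_of_nonneg_right ?_ (by positivity)
    nlinarith [mul_nonneg hnp (by linarith : (0:ℝ) ≤ 2 ^ (m + 1)),
      mul_nonneg hC (mul_nonneg hnp (by linarith : (0:ℝ) ≤ 2 ^ (m + 1))),
      mul_nonneg hC (sub_nonneg.2 h1m)]
  · have key := (convex_segment ζ (ζ + a)).norm_image_sub_le_of_norm_fderiv_le (𝕜 := ℝ) (f := g)
      (C := C * (2 ^ (m + 1) * (1 + ‖ζ‖) ^ (-(m + 1)))) (fun z _ => hg z) (fun z hz => ?_)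
      (left_mem_segment ℝ ζ (ζ + a)) (right_mem_segment ℝ ζ (ζ + a))
    · rw [add_sub_cancel_left, Real.norm_eq_abs] at key
      refine key.trans ?_
      have e : (1 + ‖ζ‖) ^ (-(m + 1)) ≤ (1 + ‖ζ‖) ^ (-m) :=
        Real.rpow_le_rpow_of_exponent_le (by linarith [norm_nonneg ζ]) (by linarith)
      calc _ ≤ C * (2 ^ (m + 1) * (1 + ‖ζ‖) ^ (-m)) * ‖a‖ := by gcongr
        _ = 1 * (2 ^ (m + 1) * C * ‖a‖ * (1 + ‖ζ‖) ^ (-m)) := by ring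
        _ ≤ (n + p + 2) * (2 ^ (m + 1) * C * ‖a‖ * (1 + ‖ζ‖) ^ (-m)) := by
          refine mul_le_mul_of_nonneg_right (by linarith) (by positivity)
        _ = _ := by ring
    · refine (h1 z).trans (mul_le_mul_of_nonneg_left (hw _ (by linarith) (norm_nonneg _)
        (norm_nonneg _) ?_) hC)
      have hd : dist z ζ ≤ 1 := by
        obtain ⟨s, ⟨hs0, hs1⟩, rfl⟩ := (mem_segment_iff_div.1 hz |> fun _ => hz) |>
          fun h => (segment_eq_image' ℝ ζ (ζ + a) ▸ h : z ∈ _)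
        simp only [add_sub_cancel_left, dist_eq_norm, norm_smul, Real.norm_of_nonneg hs0]
        nlinarith [norm_nonneg a]
      have := norm_sub_norm_le ζ z
      rw [dist_comm, dist_eq_norm] at hd
      linarith [norm_nonneg z]
  · have hB : ∀ s ∈ Set.Icc r 1, |g (s • ζ)| ≤ C * (2 ^ (m + 1) * (1 + ‖ζ‖) ^ (-m)) ∧
        ‖fderiv ℝ g (s • ζ)‖ * ‖ζ‖ ≤ C * (2 ^ (m + 1) * (1 + ‖ζ‖) ^ (-m)) := by
      intro s hs
      have hs0 : 0 ≤ s := by linarith [hs.1]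
      have hle : 1 + ‖ζ‖ ≤ 2 * (1 + ‖s • ζ‖) := by
        rw [norm_smul, Real.norm_of_nonneg hs0]
        nlinarith [norm_nonneg ζ, hs.1]
      have hp : 0 ≤ (1 + ‖ζ‖) ^ (-m) := by positivity
      constructor
      · refine (h0 _).trans (mul_le_mul_of_nonneg_left ((hw m hm (norm_nonneg _) (norm_nonneg _)
          hle).trans (mul_le_mul_of_nonneg_right h2m hp)) hC)
      · refine (mul_le_mul_of_nonneg_right ((h1 _).trans (mul_le_mul_of_nonneg_left
          (hw (m + 1) (by linarith) (norm_nonneg _) (norm_nonneg _) hle) hC))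
          (norm_nonneg ζ)).trans ?_
        have e : (1 + ‖ζ‖) ^ (-(m + 1)) * ‖ζ‖ ≤ (1 + ‖ζ‖) ^ (-m) := by
          have : (1 + ‖ζ‖) ^ (-m) = (1 + ‖ζ‖) ^ (-(m + 1)) * (1 + ‖ζ‖) := by
            rw [← Real.rpow_add_one (by positivity)]; congr 1; ring
          rw [this]
          refine mul_le_mul_of_nonneg_left (by linarith) (by positivity)
        calc _ = C * (2 ^ (m + 1) * ((1 + ‖ζ‖) ^ (-(m + 1)) * ‖ζ‖)) := by ring
          _ ≤ _ := by gcongr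
    have hd : ∀ s : ℝ, HasDerivAt (fun s : ℝ => s ^ (n + p) * g (s • ζ))
        (((n + p : ℕ) : ℝ) * s ^ (n + p - 1) * g (s • ζ) + s ^ (n + p) * fderiv ℝ g (s • ζ) ζ) s := by
      intro s
      have h2 : HasDerivAt (fun s : ℝ => s • ζ) ζ s := by
        simpa using (hasDerivAt_id s).smul_const ζ
      exact (hasDerivAt_pow (n + p) s).mul ((hg (s • ζ)).hasFDerivAt.comp_hasDerivAt s h2)
    have key := (convex_Icc r 1).norm_image_sub_le_of_norm_hasDerivWithin_le
      (f := fun s : ℝ => s ^ (n + p) * g (s • ζ))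
      (C := (n + p + 1) * (C * (2 ^ (m + 1) * (1 + ‖ζ‖) ^ (-m))))
      (fun s _ => (hd s).hasDerivWithinAt) (fun s hs => ?_)
      (Set.right_mem_Icc.2 hr1) (Set.left_mem_Icc.2 hr1)
    · simp only [one_pow, one_mul, one_smul] at key
      rw [Real.norm_eq_abs, Real.norm_eq_abs, abs_sub_comm r, abs_of_nonneg (by linarith : 0 ≤ 1 - r)]
        at key
      refine key.trans ?_
      have h1r : 0 ≤ 1 - r := by linarith
      calc _ = (n + p + 1) * (2 ^ (m + 1) * C * (1 - r) * (1 + ‖ζ‖) ^ (-m)) := by ring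
        _ ≤ (n + p + 2) * (2 ^ (m + 1) * C * (1 - r) * (1 + ‖ζ‖) ^ (-m)) := by
          refine mul_le_mul_of_nonneg_right (by linarith) (by positivity)
        _ = _ := by ring
    · obtain ⟨b1, b2⟩ := hB s hs
      have hs0 : 0 ≤ s := by linarith [hs.1]
      have hsp : ∀ j : ℕ, s ^ j ≤ 1 := fun j => pow_le_one₀ hs0 hs.2
      have b3 := ((fderiv ℝ g (s • ζ)).le_opNorm ζ).trans b2
      set R := C * (2 ^ (m + 1) * (1 + ‖ζ‖) ^ (-m)) with hR
      have hR0 : 0 ≤ R := (abs_nonneg _).trans b1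
      refine (norm_add_le _ _).trans ?_
      rw [norm_mul, norm_mul, norm_mul, Real.norm_natCast, Real.norm_of_nonneg (pow_nonneg hs0 _),
        Real.norm_of_nonneg (pow_nonneg hs0 _), Real.norm_eq_abs (g _)]
      calc _ ≤ ((n + p : ℕ) : ℝ) * 1 * R + 1 * R := by
            refine add_le_add (mul_le_mul (mul_le_mul_of_nonneg_left (hsp _) (by positivity)) b1
              (abs_nonneg _) (by positivity)) (mul_le_mul (hsp _) b3 (norm_nonneg _) zero_le_one)
        _ = _ := by push_cast; ring

/-- The Gaussian profile of the heat kernel. -/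
def gauss (n : ℕ) (μ : ℝ) (ζ : Spc n) : ℝ :=
  (4 * Real.pi * μ) ^ (-(n : ℝ) / 2) * Real.exp (-(1 / (4 * μ)) * ‖ζ‖ ^ 2)

/-- Partial derivatives of the Gaussian profile. -/
def gaussD (n : ℕ) (μ : ℝ) (i : Fin n) (ζ : Spc n) : ℝ :=
  -(1 / (2 * μ)) * (ζ i * gauss n μ ζ)

theorem hasFDerivAt_gauss (μ : ℝ) (ζ : Spc n) :
    HasFDerivAt (gauss n μ) ((-(1 / (2 * μ)) * gauss n μ ζ) • innerSL ℝ ζ) ζ := by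
  have h1 : HasFDerivAt (fun ζ : Spc n => -(1 / (4 * μ)) * ‖ζ‖ ^ 2)
      ((-(1 / (4 * μ))) • (2 • innerSL ℝ ζ)) ζ :=
    (hasStrictFDerivAt_norm_sq ζ).hasFDerivAt.const_mul _
  refine (h1.exp.const_mul _).congr_fderiv ?_
  ext v
  simp only [smul_apply, smul_eq_mul, gauss, nsmul_eq_mul, innerSL_apply_apply]
  push_cast
  by_cases h : μ = 0
  · simp [h]
  field_simp
  ring

theorem differentiable_gauss (μ : ℝ) : Differentiable ℝ (gauss n μ) :=
  fun ζ => (hasFDerivAt_gauss μ ζ).differentiableAt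

theorem pd_gauss (μ : ℝ) (i : Fin n) (ζ : Spc n) : pd i (gauss n μ) ζ = gaussD n μ i ζ := by
  unfold pd
  rw [(hasFDerivAt_gauss μ ζ).fderiv]
  simp [gaussD, EuclideanSpace.inner_single_right]
  ring

theorem gauss_nonneg {μ : ℝ} (hμ : 0 < μ) (ζ : Spc n) : 0 ≤ gauss n μ ζ := by
  unfold gauss; positivity

theorem gauss_decay {μ : ℝ} (hμ : 0 < μ) {m : ℝ} (hm : 0 ≤ m) :
    ∃ A : ℝ, 0 ≤ A ∧ ∀ ζ : Spc n, gauss n μ ζ * (1 + ‖ζ‖) ^ 2 ≤ A * (1 + ‖ζ‖) ^ (-m) := by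
  refine ⟨(4 * Real.pi * μ) ^ (-(n : ℝ) / 2) * Real.exp ((m + 2) ^ 2 / (4 * (1 / (4 * μ)))),
    by positivity, fun ζ => ?_⟩
  have h1 := rpow_mul_exp_le (b := 1 / (4 * μ)) (M := m + 2) (by positivity) (by linarith)
    (norm_nonneg ζ)
  have h2 : (1 + ‖ζ‖) ^ 2 = (1 + ‖ζ‖) ^ (m + 2) * (1 + ‖ζ‖) ^ (-m) := by
    rw [← Real.rpow_add (by positivity), ← Real.rpow_natCast]; congr 1; push_cast; ring
  unfold gauss
  rw [h2]
  calc _ = (4 * Real.pi * μ) ^ (-(n : ℝ) / 2) * ((1 + ‖ζ‖) ^ (m + 2) *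
        Real.exp (-(1 / (4 * μ)) * ‖ζ‖ ^ 2)) * (1 + ‖ζ‖) ^ (-m) := by ring
    _ ≤ _ := by gcongr

theorem norm_fderiv_gaussD_le {μ : ℝ} (hμ : 0 < μ) (i : Fin n) (ζ : Spc n) :
    ‖fderiv ℝ (gaussD n μ i) ζ‖ ≤
      (1 / (2 * μ)) * (‖ζ‖ * (1 / (2 * μ)) * ‖ζ‖ + 1) * gauss n μ ζ := by
  have hq : 0 < 1 / (2 * μ) := by positivity
  have hd : HasFDerivAt (gaussD n μ i) _ ζ :=
    (((EuclideanSpace.proj i : Spc n →L[ℝ] ℝ).hasFDerivAt (x := ζ)).mul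
      (hasFDerivAt_gauss μ ζ)).const_mul (-(1 / (2 * μ)))
  rw [hd.fderiv]
  have hpn : ‖(EuclideanSpace.proj i : Spc n →L[ℝ] ℝ)‖ ≤ 1 :=
    ContinuousLinearMap.opNorm_le_bound _ zero_le_one fun v => by
      simpa using abs_coord_le i v
  have hG := gauss_nonneg hμ ζ
  have e1 : ‖(EuclideanSpace.proj i : Spc n →L[ℝ] ℝ) ζ • (-(1 / (2 * μ)) * gauss n μ ζ) •
      innerSL ℝ ζ + gauss n μ ζ • (EuclideanSpace.proj i : Spc n →L[ℝ] ℝ)‖ ≤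
      ‖ζ‖ * (1 / (2 * μ) * gauss n μ ζ * ‖ζ‖) + gauss n μ ζ * 1 := by
    refine (norm_add_le _ _).trans (add_le_add ?_ ?_)
    · rw [norm_smul, norm_smul, innerSL_apply_norm, norm_mul, norm_neg, Real.norm_of_nonneg hq.le,
        Real.norm_of_nonneg hG]
      exact mul_le_mul_of_nonneg_right (by simpa using abs_coord_le i ζ) (by positivity)
    · rw [norm_smul, Real.norm_of_nonneg hG]
      exact mul_le_mul_of_nonneg_left hpn hG
  rw [norm_smul, norm_neg, Real.norm_of_nonneg hq.le]
  refine (mul_le_mul_of_nonneg_left e1 hq.le).trans (le_of_eq ?_)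
  ring

theorem hker_gauss {μ : ℝ} (hμ : 0 < μ) (p : ℕ) {m : ℝ} (hm : 0 ≤ m) :
    ∃ C : ℝ, HKer p m C (gauss n μ) ∧ ∀ i, HKer p m C (gaussD n μ i) := by
  obtain ⟨A, hA, h⟩ := gauss_decay (n := n) hμ (by linarith : 0 ≤ m + 1)
  set B := A * (1 + 1 / (2 * μ)) ^ 2 with hB
  have hq : 0 < 1 / (2 * μ) := by positivity
  have hAB : A ≤ B := by rw [hB]; nlinarith [mul_nonneg hA (by positivity : 0 ≤ (1 / (2 * μ)) ^ 2)]
  have hdec : ∀ ζ : Spc n, (1 + ‖ζ‖) ^ (-(m + 1)) ≤ (1 + ‖ζ‖) ^ (-m) := fun ζ =>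
    Real.rpow_le_rpow_of_exponent_le (by linarith [norm_nonneg ζ]) (by linarith)
  have key : ∀ (ζ : Spc n) (c : ℝ), c ≤ (1 + 1 / (2 * μ)) ^ 2 * (1 + ‖ζ‖) ^ 2 →
      c * gauss n μ ζ ≤ B * (1 + ‖ζ‖) ^ (-(m + 1)) := fun ζ c hc => by
    calc c * gauss n μ ζ ≤ (1 + 1 / (2 * μ)) ^ 2 * (1 + ‖ζ‖) ^ 2 * gauss n μ ζ :=
          mul_le_mul_of_nonneg_right hc (gauss_nonneg hμ ζ)
      _ = (1 + 1 / (2 * μ)) ^ 2 * (gauss n μ ζ * (1 + ‖ζ‖) ^ 2) := by ring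
      _ ≤ (1 + 1 / (2 * μ)) ^ 2 * (A * (1 + ‖ζ‖) ^ (-(m + 1))) :=
          mul_le_mul_of_nonneg_left (h ζ) (by positivity)
      _ = _ := by rw [hB]; ring
  have hBn : 0 ≤ B := hA.trans hAB
  set q := 1 / (2 * μ) with hqd
  have poly : ∀ z : ℝ, 0 ≤ z → 1 ≤ (1 + q) ^ 2 * (1 + z) ^ 2 ∧ q * z ≤ (1 + q) ^ 2 * (1 + z) ^ 2 ∧
      q * (z * q * z + 1) ≤ (1 + q) ^ 2 * (1 + z) ^ 2 := fun z hz => by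
    have e1 : 1 ≤ (1 + q) * (1 + z) := by nlinarith [mul_nonneg hq.le hz]
    have e2 : q * z ≤ (1 + q) * (1 + z) := by nlinarith [mul_nonneg hq.le hz]
    have e3 : (1 + q) ^ 2 * (1 + z) ^ 2 = ((1 + q) * (1 + z)) * ((1 + q) * (1 + z)) := by ring
    have e4 : (1 + q) * (1 + z) ≤ ((1 + q) * (1 + z)) * ((1 + q) * (1 + z)) :=
      le_mul_of_one_le_right (by linarith) e1
    refine ⟨by rw [e3]; linarith, by rw [e3]; linarith, ?_⟩
    have e5 : (1 + q) ^ 2 * (1 + z) ^ 2 = q * (z * q * z + 1) + (1 + q + q ^ 2 + 2 * z +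
      4 * q * z + 2 * q ^ 2 * z + z ^ 2 + 2 * q * z ^ 2) := by ring
    have : 0 ≤ 1 + q + q ^ 2 + 2 * z + 4 * q * z + 2 * q ^ 2 * z + z ^ 2 + 2 * q * z ^ 2 := by
      positivity
    linarith
  refine ⟨_, HKer.of_decay (C := B) p hm (differentiable_gauss μ) (fun ζ => ?_) (fun ζ => ?_),
    fun i => HKer.of_decay (C := B) p hm (fun ζ => ?_) (fun ζ => ?_) (fun ζ => ?_)⟩
  · rw [abs_of_nonneg (gauss_nonneg hμ ζ)]
    have := key ζ 1 (poly _ (norm_nonneg ζ)).1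
    rw [one_mul] at this
    exact this.trans (mul_le_mul_of_nonneg_left (hdec ζ) hBn)
  · rw [(hasFDerivAt_gauss μ ζ).fderiv, norm_smul, innerSL_apply_norm, norm_mul, norm_neg,
      Real.norm_of_nonneg hq.le, Real.norm_of_nonneg (gauss_nonneg hμ ζ)]
    exact (le_of_eq (by ring)).trans (key ζ (q * ‖ζ‖) (poly _ (norm_nonneg ζ)).2.1)
  · exact (((differentiable_coord i) ζ).mul (differentiable_gauss μ ζ)).const_mul _
  · unfold gaussD
    rw [abs_mul, abs_neg, abs_of_nonneg hq.le, abs_mul, abs_of_nonneg (gauss_nonneg hμ ζ)]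
    have := key ζ (q * |ζ i|) ((mul_le_mul_of_nonneg_left (abs_coord_le i ζ) hq.le).trans
      (poly _ (norm_nonneg ζ)).2.1)
    rw [← mul_assoc]
    exact this.trans (mul_le_mul_of_nonneg_left (hdec ζ) hBn)
  · exact (norm_fderiv_gaussD_le hμ i ζ).trans (key ζ _ (poly _ (norm_nonneg ζ)).2.2)

theorem proj_apply' (i : Fin n) (v : Spc n) : (EuclideanSpace.proj i : Spc n →L[ℝ] ℝ) v = v i := rfl

theorem hasFDerivAt_gauss_sum (μ : ℝ) (ζ : Spc n) :
    HasFDerivAt (gauss n μ) (∑ i, gaussD n μ i ζ • (EuclideanSpace.proj i : Spc n →L[ℝ] ℝ)) ζ := by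
  refine (hasFDerivAt_gauss μ ζ).congr_fderiv ?_
  ext v
  simp only [smul_apply, sum_apply, innerSL_apply_apply, gaussD,
    proj_apply', smul_eq_mul, PiLp.inner_apply, Finset.mul_sum]
  refine Finset.sum_congr rfl fun i _ => ?_
  simp
  ring

theorem norm_sum_smul_proj_le (a : Fin n → ℝ) :
    ‖∑ i, a i • (EuclideanSpace.proj i : Spc n →L[ℝ] ℝ)‖ ≤ ∑ i, |a i| := by
  refine (norm_sum_le _ _).trans (Finset.sum_le_sum fun i _ => ?_)
  rw [norm_smul, Real.norm_eq_abs]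
  exact mul_le_of_le_one_right (abs_nonneg _) (norm_proj_le i)

theorem hasFDerivAt_heatA {μ θ F : ℝ} (hμ : 0 < μ) (hθ : 0 < θ) {φ : Spc n → ℝ} (hφ : Continuous φ)
    (hb : ∀ y, |φ y| ≤ F) (x : Spc n) :
    HasFDerivAt (heatA (gauss n μ) θ φ)
      (∑ i, (θ ^ (-((1 : ℕ) : ℝ) / 2) * heatA (gaussD n μ i) θ φ x) •
        (EuclideanSpace.proj i : Spc n →L[ℝ] ℝ)) x := by
  have hF : 0 ≤ F := (abs_nonneg _).trans (hb 0)
  obtain ⟨C, hG, hGD⟩ := hker_gauss (n := n) hμ 0 (m := n + 1) (by positivity)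
  have hC := hG.nonneg
  set c := (Real.sqrt θ)⁻¹ with hc
  have hs : 0 < Real.sqrt θ := Real.sqrt_pos.2 hθ
  have hc0 : 0 < c := inv_pos.2 hs
  have hcθ : θ ^ (-((1 : ℕ) : ℝ) / 2) = c := by
    rw [hc, Real.sqrt_eq_rpow, ← Real.rpow_neg hθ.le]; norm_num
  have hshift : heatA (gauss n μ) θ φ = fun x' => ∫ ζ, gauss n μ (ζ + c • (x' - x)) *
      φ (x - Real.sqrt θ • ζ) := by
    funext x'
    unfold heatA
    rw [← integral_add_right_eq_self _ (c • (x' - x))]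
    refine integral_congr_ae (Eventually.of_forall fun ζ => ?_)
    simp only
    congr 2
    rw [smul_add, smul_smul, hc, mul_inv_cancel₀ hs.ne', one_smul]
    abel
  have hcont : ∀ x', Continuous fun ζ => gauss n μ (ζ + c • (x' - x)) * φ (x - Real.sqrt θ • ζ) :=
    fun x' => (hG.cont.comp (by fun_prop)).mul (hφ.comp (by fun_prop))
  have hI : ∀ {κ : Spc n → ℝ}, HKer 0 (n + 1) C κ →
      Integrable fun ζ => κ ζ * φ (x - Real.sqrt θ • ζ) := fun {κ} h =>
    heatA_integrable (γ := 0) (T := θ) le_rfl h.cont hφ (by simpa using h.b0)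
      (by simpa using hb) hC hF le_rfl x
  rw [hshift]
  refine (hasFDerivAt_integral_of_dominated_of_fderiv_le (Metric.ball_mem_nhds x hs)
    (F' := fun x' ζ => ∑ i, (c * gaussD n μ i (ζ + c • (x' - x)) * φ (x - Real.sqrt θ • ζ)) •
      (EuclideanSpace.proj i : Spc n →L[ℝ] ℝ))
    (bound := fun ζ => n * (c * (2 * C) * F) * (1 + ‖ζ‖) ^ (-((n : ℝ) + 1)))
    (Eventually.of_forall fun x' => (hcont x').aestronglyMeasurable) ?_ ?_
    (Eventually.of_forall fun ζ x' hx' => ?_) ((integrable_decay n).const_mul _)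
    (Eventually.of_forall fun ζ x' _ => ?_)).congr_fderiv ?_
  · simpa using hI hG
  · refine (continuous_finsetSum _ fun i _ => ?_).aestronglyMeasurable
    have := (hGD i).cont
    fun_prop
  · have ha : ‖c • (x' - x)‖ ≤ 1 := by
      rw [norm_smul, Real.norm_of_nonneg hc0.le, hc, inv_mul_le_iff₀ hs]
      rw [Metric.mem_ball, dist_eq_norm] at hx'
      linarith
    refine (norm_sum_smul_proj_le _).trans ?_
    calc _ ≤ ∑ _i : Fin n, c * (2 * C) * F * (1 + ‖ζ‖) ^ (-((n : ℝ) + 1)) := by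
          refine Finset.sum_le_sum fun i _ => ?_
          have e : |gaussD n μ i (ζ + c • (x' - x))| ≤ 2 * C * (1 + ‖ζ‖) ^ (-((n : ℝ) + 1)) := by
            have h1 := (hGD i).b1 _ ζ ha
            have h2 := (hGD i).b0 ζ
            have h3 := abs_sub_abs_le_abs_sub (gaussD n μ i (ζ + c • (x' - x))) (gaussD n μ i ζ)
            have h4 : C * ‖c • (x' - x)‖ * (1 + ‖ζ‖) ^ (-((n : ℝ) + 1)) ≤
                C * 1 * (1 + ‖ζ‖) ^ (-((n : ℝ) + 1)) := by gcongr
            linarith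
          rw [abs_mul, abs_mul, abs_of_pos hc0]
          calc _ ≤ c * (2 * C * (1 + ‖ζ‖) ^ (-((n : ℝ) + 1))) * F := by
                gcongr
                exact hb _
            _ = _ := by ring
      _ = _ := by simp; ring
  · have h1 : HasFDerivAt (fun x' : Spc n => ζ + c • (x' - x)) (c • ContinuousLinearMap.id ℝ (Spc n)) x' :=
      (((hasFDerivAt_id x').sub_const x).const_smul c).const_add ζ
    refine (((hasFDerivAt_gauss_sum μ _).comp x' h1).mul_const _).congr_fderiv ?_
    ext v
    simp only [smul_apply, sum_apply, ContinuousLinearMap.comp_apply,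
      proj_apply', smul_eq_mul, Finset.mul_sum, ContinuousLinearMap.id_apply,
      PiLp.smul_apply]
    refine Finset.sum_congr rfl fun i _ => ?_
    ring
  · rw [integral_finsetSum]
    · refine Finset.sum_congr rfl fun i _ => ?_
      rw [integral_smul_const, hcθ, heatA, ← integral_const_mul]
      simp only [sub_self, smul_zero, add_zero, mul_assoc]
    · intro i _
      simpa [mul_assoc] using ((hI (hGD i)).const_mul c).smul_const (EuclideanSpace.proj i : Spc n →L[ℝ] ℝ)

theorem hasFDerivAt_heatJ {μ F : ℝ} (hμ : 0 < μ) {f : ℝ → Spc n → ℝ}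
    (hf : Continuous (Function.uncurry f)) (hb : ∀ τ y, |f τ y| ≤ F) {t : ℝ} (ht : 0 ≤ t) (x : Spc n) :
    HasFDerivAt (heatJ 0 (gauss n μ) f t)
      (∑ i, heatJ 1 (gaussD n μ i) f t x • (EuclideanSpace.proj i : Spc n →L[ℝ] ℝ)) x := by
  have hF : 0 ≤ F := (abs_nonneg _).trans (hb 0 0)
  obtain ⟨C, hG, hGD⟩ := hker_gauss (n := n) hμ 0 (m := n + 1 + 0) (by positivity)
  obtain ⟨C', hG', hGD'⟩ := hker_gauss (n := n) hμ 1 (m := n + 1 + 0) (by positivity)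
  have hC' := hG'.nonneg
  have hI0 := fun x => heatJ_intervalIntegrable (Nat.zero_le 1) le_rfl hG hf hb t 0 t x
  have hI1 := fun i => heatJ_intervalIntegrable le_rfl le_rfl (hGD' i) hf hb t 0 t
  have he : (-1 : ℝ) < -((1 : ℕ) : ℝ) / 2 := by norm_num
  have hfc : ∀ τ, Continuous (f τ) := fun τ => hf.comp (by fun_prop : Continuous fun y => (τ, y))
  have hne : ∀ᵐ τ : ℝ, τ ≠ t := by simp [ae_iff, measure_singleton]
  refine (intervalIntegral.hasFDerivAt_integral_of_dominated_of_fderiv_le (Filter.univ_mem)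
    (F' := fun x τ => ∑ i, ((t - τ) ^ (-((1 : ℕ) : ℝ) / 2) * heatA (gaussD n μ i) (t - τ) (f τ) x) •
        (EuclideanSpace.proj i : Spc n →L[ℝ] ℝ))
    (bound := fun τ => n * (heatC n t 0 * C' * F) * (t - τ) ^ (-((1 : ℕ) : ℝ) / 2))
    (Eventually.of_forall fun x => ?_) (hI0 x) ?_ ?_
    ((intervalIntegrable_sub_rpow he t 0 t).const_mul _) ?_).congr_fderiv ?_
  · exact ((intervalIntegrable_iff.1 (hI0 x)).aestronglyMeasurable)
  · refine Finset.aestronglyMeasurable_fun_sum _ fun i _ => ?_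
    exact ((intervalIntegrable_iff.1 (hI1 i x)).aestronglyMeasurable).smul_const _
  · filter_upwards [hne] with τ hτ hτt x _
    rw [Set.uIoc_of_le ht] at hτt
    refine (norm_sum_smul_proj_le _).trans ?_
    calc _ ≤ ∑ _i : Fin n, (heatC n t 0 * C' * F) * (t - τ) ^ (-((1 : ℕ) : ℝ) / 2) := by
          refine Finset.sum_le_sum fun i _ => ?_
          have := heatA_le (γ := 0) (T := t) (θ := t - τ) le_rfl (hGD' i).b0 (φ := f τ)
            (by simpa using hb τ) hC' hF (by linarith [hτt.1]) x
          rw [neg_zero, Real.rpow_zero, mul_one] at this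
          have h0 : 0 ≤ (t - τ) ^ (-((1 : ℕ) : ℝ) / 2) := Real.rpow_nonneg (by linarith [hτt.2]) _
          rw [abs_mul, abs_of_nonneg h0, mul_comm]
          exact mul_le_mul_of_nonneg_right this h0
      _ = _ := by simp; ring
  · filter_upwards [hne] with τ hτ hτt x _
    rw [Set.uIoc_of_le ht] at hτt
    have hpos : 0 < t - τ := sub_pos.2 (lt_of_le_of_ne hτt.2 hτ)
    simpa using hasFDerivAt_heatA hμ hpos (hfc τ) (hb τ) x
  · rw [intervalIntegral.integral_finsetSum]
    · refine Finset.sum_congr rfl fun i _ => ?_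
      rw [intervalIntegral.integral_smul_const, heatJ]
    · intro i _
      have := (hI1 i x)
      rw [intervalIntegrable_iff] at this ⊢
      exact this.smul_const _

theorem pd_of_hasFDerivAt_sum {f : Spc n → ℝ} {a : Fin n → ℝ} {x : Spc n}
    (h : HasFDerivAt f (∑ i, a i • (EuclideanSpace.proj i : Spc n →L[ℝ] ℝ)) x) (j : Fin n) :
    pd j f x = a j := by
  unfold pd
  rw [h.fderiv]
  simp [sum_apply]

/-- Integration by parts against the Gaussian. -/
theorem heatA_gaussD {μ θ F : ℝ} (hμ : 0 < μ) {φ : Spc n → ℝ}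
    (hφ : Differentiable ℝ φ) (i : Fin n) (hc : Continuous (pd i φ)) (hb : ∀ y, |φ y| ≤ F)
    (hb' : ∀ y, |pd i φ y| ≤ F) (x : Spc n) :
    heatA (gaussD n μ i) θ φ x = Real.sqrt θ * heatA (gauss n μ) θ (pd i φ) x := by
  have hF : 0 ≤ F := (abs_nonneg _).trans (hb 0)
  obtain ⟨C, hG, hGD⟩ := hker_gauss (n := n) hμ 0 (m := n + 1) (by positivity)
  have hI : ∀ {κ : Spc n → ℝ} {φ : Spc n → ℝ}, Continuous φ → (∀ y, |φ y| ≤ F) → HKer 0 (n + 1) C κ →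
      Integrable fun ζ => κ ζ * φ (x - Real.sqrt θ • ζ) := fun {κ φ} hφ hb h =>
    heatA_integrable (γ := 0) (T := θ) le_rfl h.cont hφ (by simpa using h.b0)
      (by simpa using hb) hG.nonneg hF le_rfl x
  have hd : ∀ ζ, HasFDerivAt (fun ζ => φ (x - Real.sqrt θ • ζ))
      ((fderiv ℝ φ (x - Real.sqrt θ • ζ)).comp (-(Real.sqrt θ • ContinuousLinearMap.id ℝ (Spc n)))) ζ :=
    fun ζ => by
      have h1 : HasFDerivAt (fun ζ : Spc n => x - Real.sqrt θ • ζ)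
          (-(Real.sqrt θ • ContinuousLinearMap.id ℝ (Spc n))) ζ :=
        ((hasFDerivAt_id (𝕜 := ℝ) ζ).const_smul (Real.sqrt θ)).const_sub x
      exact (hφ _).hasFDerivAt.comp ζ h1
  have hv : ∀ ζ, fderiv ℝ (fun ζ => φ (x - Real.sqrt θ • ζ)) ζ (EuclideanSpace.single i 1) =
      -Real.sqrt θ * pd i φ (x - Real.sqrt θ • ζ) := fun ζ => by
    rw [(hd ζ).fderiv]
    simp [pd]
  have key := integral_mul_fderiv_eq_neg_fderiv_mul_of_integrable (μ := volume)
    (f := fun ζ => φ (x - Real.sqrt θ • ζ)) (g := gauss n μ) (v := EuclideanSpace.single i 1)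
    ?_ ?_ ?_ (fun ζ _ => (hd ζ).differentiableAt) (fun ζ _ => differentiable_gauss μ ζ)
  · simp only [hv] at key
    have h2 : ∀ ζ : Spc n, fderiv ℝ (gauss n μ) ζ (EuclideanSpace.single i 1) = gaussD n μ i ζ :=
      pd_gauss μ i
    simp only [h2] at key
    unfold heatA
    rw [← integral_const_mul]
    rw [← integral_neg] at key
    refine ((integral_congr_ae (Eventually.of_forall fun ζ => ?_)).trans key).trans
      (integral_congr_ae (Eventually.of_forall fun ζ => ?_))
    · exact mul_comm _ _
    · simp only; ring
  · simp only [hv]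
    refine ((hI hc hb' hG).const_mul (-Real.sqrt θ)).congr (Eventually.of_forall fun ζ => ?_)
    simp only; ring
  · have h2 : ∀ ζ : Spc n, fderiv ℝ (gauss n μ) ζ (EuclideanSpace.single i 1) = gaussD n μ i ζ :=
      pd_gauss μ i
    simp only [h2]
    exact (hI hφ.continuous hb (hGD i)).congr (Eventually.of_forall fun ζ => mul_comm _ _)
  · exact (hI hφ.continuous hb hG).congr (Eventually.of_forall fun ζ => mul_comm _ _)

/-- Extension of a time-dependent function beyond `[0,T]` by its end values. -/
def clampT (T : ℝ) (f : ℝ → Spc n → ℝ) (τ : ℝ) : Spc n → ℝ := f (max 0 (min τ T))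

theorem clamp_mem {T : ℝ} (hT : 0 ≤ T) (τ : ℝ) : max 0 (min τ T) ∈ Set.Icc 0 T :=
  ⟨le_max_left _ _, max_le hT (min_le_right _ _)⟩

theorem clamp_eq {T τ : ℝ} (h : τ ∈ Set.Icc 0 T) : max 0 (min τ T) = τ := by
  rw [min_eq_left h.2, max_eq_right h.1]

theorem clampT_eq {T τ : ℝ} (h : τ ∈ Set.Icc 0 T) (f : ℝ → Spc n → ℝ) : clampT T f τ = f τ := by
  rw [clampT, clamp_eq h]

theorem JC.clampT {T : ℝ} (hT : 0 ≤ T) {f : ℝ → Spc n → ℝ} (h : JC T f) :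
    Continuous (Function.uncurry (clampT T f)) := by
  have : Continuous fun p : ℝ × Spc n => (max 0 (min p.1 T), p.2) := by fun_prop
  exact ContinuousOn.comp_continuous h this fun p => ⟨clamp_mem hT _, Set.mem_univ _⟩

theorem heatKer_smul {μ θ : ℝ} (hμ : 0 < μ) (hθ : 0 < θ) (ζ : Spc n) :
    Real.sqrt θ ^ n * heatKer μ (Real.sqrt θ • ζ) θ = gauss n μ ζ := by
  have hs : 0 < Real.sqrt θ := Real.sqrt_pos.2 hθ
  have h1 : Real.sqrt θ ^ n = θ ^ ((n : ℝ) / 2) := by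
    rw [Real.sqrt_eq_rpow, ← Real.rpow_natCast, ← Real.rpow_mul hθ.le]; congr 1; ring
  have h2 : θ ^ ((n : ℝ) / 2) * θ ^ (-(n : ℝ) / 2) = 1 := by
    rw [← Real.rpow_add hθ, neg_div, add_neg_cancel, Real.rpow_zero]
  rw [heatKer, if_pos hθ, gauss, h1, Real.mul_rpow (by positivity) hθ.le, norm_smul,
    Real.norm_of_nonneg hs.le, mul_pow, Real.sq_sqrt hθ.le]
  have e : -(θ * ‖ζ‖ ^ 2) / (4 * μ * θ) = -(1 / (4 * μ)) * ‖ζ‖ ^ 2 := by field_simp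
  rw [e]
  calc _ = (θ ^ ((n : ℝ) / 2) * θ ^ (-(n : ℝ) / 2)) * ((4 * Real.pi * μ) ^ (-(n : ℝ) / 2) *
        Real.exp (-(1 / (4 * μ)) * ‖ζ‖ ^ 2)) := by ring
    _ = _ := by rw [h2, one_mul]

theorem integral_heatKer {μ θ : ℝ} (hμ : 0 < μ) (hθ : 0 < θ) (φ : Spc n → ℝ) (x : Spc n) :
    ∫ y, heatKer μ (x - y) θ * φ y = heatA (gauss n μ) θ φ x := by
  have hs : 0 < Real.sqrt θ := Real.sqrt_pos.2 hθ
  have h1 : ∫ y, heatKer μ (x - y) θ * φ y = ∫ z, heatKer μ z θ * φ (x - z) := by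
    rw [← integral_sub_left_eq_self _ volume x]
    simp only [sub_sub_cancel]
  have h2 := Measure.integral_comp_smul volume (fun z : Spc n => heatKer μ z θ * φ (x - z))
    (Real.sqrt θ)
  rw [finrank_euclideanSpace_fin, abs_of_pos (by positivity), smul_eq_mul,
    eq_inv_mul_iff_mul_eq₀ (by positivity), ← integral_const_mul] at h2
  rw [h1, ← h2, heatA]
  refine integral_congr_ae (Eventually.of_forall fun ζ => ?_)
  simp only
  rw [← mul_assoc, heatKer_smul hμ hθ]

theorem volPot_eq_heatJ {μ T t : ℝ} (hμ : 0 < μ) (f : ℝ → Spc n → ℝ) (ht : t ∈ Set.Icc 0 T)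
    (x : Spc n) : volPot μ f t x = heatJ 0 (gauss n μ) (clampT T f) t x := by
  rw [volPot, heatJ, intervalIntegral.integral_of_le ht.1]
  have hne : ∀ᵐ τ : ℝ, τ ≠ t := by simp [ae_iff, measure_singleton]
  refine setIntegral_congr_ae measurableSet_Ioc ?_
  filter_upwards [hne] with τ hτ hτt
  have hpos : 0 < t - τ := sub_pos.2 (lt_of_le_of_ne hτt.2 hτ)
  rw [integral_heatKer hμ hpos, clampT_eq ⟨hτt.1.le, hτt.2.trans ht.2⟩]
  simp

theorem volPot_congr {μ T t : ℝ} {f g : ℝ → Spc n → ℝ}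
    (h : ∀ t ∈ Set.Icc 0 T, f t = g t) (ht : t ∈ Set.Icc 0 T) : volPot μ f t = volPot μ g t := by
  funext x
  refine setIntegral_congr_fun measurableSet_Ioc fun τ hτ => ?_
  simp only [h τ ⟨hτ.1.le, hτ.2.trans ht.2⟩]

theorem hasFDerivAt_volPot {μ T t F : ℝ} (hμ : 0 < μ) {f : ℝ → Spc n → ℝ} (hf : JC T f)
    (hb : ∀ τ ∈ Set.Icc 0 T, ∀ y, |f τ y| ≤ F) (ht : t ∈ Set.Icc 0 T) (x : Spc n) :
    HasFDerivAt (volPot μ f t) (∑ i, heatJ 1 (gaussD n μ i) (clampT T f) t x •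
      (EuclideanSpace.proj i : Spc n →L[ℝ] ℝ)) x := by
  have hT := ht.1.trans ht.2
  rw [show volPot μ f t = heatJ 0 (gauss n μ) (clampT T f) t from
    funext fun x => volPot_eq_heatJ hμ f ht x]
  exact hasFDerivAt_heatJ hμ (hf.clampT hT) (fun τ => hb _ (clamp_mem hT τ)) ht.1 x

theorem pd_volPot {μ T t F : ℝ} (hμ : 0 < μ) {f : ℝ → Spc n → ℝ} (hf : JC T f)
    (hb : ∀ τ ∈ Set.Icc 0 T, ∀ y, |f τ y| ≤ F) (ht : t ∈ Set.Icc 0 T) (i : Fin n) (x : Spc n) :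
    pd i (volPot μ f t) x = heatJ 1 (gaussD n μ i) (clampT T f) t x :=
  pd_of_hasFDerivAt_sum (hasFDerivAt_volPot hμ hf hb ht x) i

theorem pd_volPot_eq {μ T t F : ℝ} (hμ : 0 < μ) {f : ℝ → Spc n → ℝ} (hf : JC T f)
    (hb : ∀ τ ∈ Set.Icc 0 T, ∀ y, |f τ y| ≤ F) (hd : ∀ τ ∈ Set.Icc 0 T, Differentiable ℝ (f τ))
    (i : Fin n) (hf' : JC T fun τ => pd i (f τ)) (hb' : ∀ τ ∈ Set.Icc 0 T, ∀ y, |pd i (f τ) y| ≤ F)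
    (ht : t ∈ Set.Icc 0 T) :
    pd i (volPot μ f t) = volPot μ (fun τ => pd i (f τ)) t := by
  have hT := ht.1.trans ht.2
  funext x
  rw [pd_volPot hμ hf hb ht, volPot_eq_heatJ hμ _ ht, heatJ, heatJ,
    intervalIntegral.integral_of_le ht.1, intervalIntegral.integral_of_le ht.1]
  have hne : ∀ᵐ τ : ℝ, τ ≠ t := by simp [ae_iff, measure_singleton]
  refine setIntegral_congr_ae measurableSet_Ioc ?_
  filter_upwards [hne] with τ hτ hτt
  have hpos : 0 < t - τ := sub_pos.2 (lt_of_le_of_ne hτt.2 hτ)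
  have hm : τ ∈ Set.Icc 0 T := ⟨hτt.1.le, hτt.2.trans ht.2⟩
  have hc : Continuous (pd i (f τ)) :=
    ContinuousOn.comp_continuous hf' (by fun_prop : Continuous fun y : Spc n => (τ, y))
      fun y => ⟨hm, Set.mem_univ _⟩
  rw [clampT_eq hm, clampT_eq hm, heatA_gaussD hμ (hd τ hm) i hc (hb τ hm) (hb' τ hm),
    ← mul_assoc, Real.sqrt_eq_rpow, ← Real.rpow_add hpos]
  norm_num

/-- Uniform bounds of a function of class `Cl`. -/
theorem Bas.abs_le_clamp {c : Cfg} {σ K : ℝ} {v : ℝ → Spc n → ℝ} (hh : c.β = 0)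
    (h : Bas c σ K v) : ∀ τ y, |clampT c.T v τ y| ≤ K * wt y ^ (-σ) := fun τ y => by
  simpa [hh, clampT] using h.2.1 _ (clamp_mem c.hT.le τ) y

theorem Bas.abs_le {c : Cfg} {σ K : ℝ} {v : ℝ → Spc n → ℝ} (hσ : 0 ≤ σ) (h : Bas c σ K v) :
    ∀ τ ∈ Set.Icc 0 c.T, ∀ y, |v τ y| ≤ K * Real.exp (c.β * c.T) := fun τ hτ y => by
  have hK := h.nonneg
  have hβ := c.hβ
  have hy := wt_pos y
  have h1 : wt y ^ (-σ) ≤ 1 :=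
    Real.rpow_le_one_of_one_le_of_nonpos (one_le_wt y) (by linarith)
  have h2 : Real.exp (c.β * τ) ≤ Real.exp (c.β * c.T) :=
    Real.exp_le_exp.2 (mul_le_mul_of_nonneg_left hτ.2 hβ)
  calc _ ≤ K * Real.exp (c.β * τ) * wt y ^ (-σ) := h.2.1 τ hτ y
    _ ≤ K * Real.exp (c.β * c.T) * 1 := by gcongr
    _ = _ := mul_one _

theorem Cl.volPot_step {μ : ℝ} (hμ : 0 < μ) {c c' : Cfg} (hT : c'.T = c.T) {N : ℕ} {γ K : ℝ}
    {f : ℝ → Spc n → ℝ} (hγ : 0 ≤ γ) (h : Cl c (N + 1) γ K f) {N' : ℕ} {σ K' : ℝ}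
    (hb : Bas c' σ K' (volPot μ f))
    (hd : ∀ i, Cl c' N' (σ + 1) K' (volPot μ fun τ => pd i (f τ))) :
    Cl c' (N' + 1) σ K' (volPot μ f) := by
  refine ⟨hb, fun t ht x => ?_, fun i => (hd i).congr fun t ht => ?_⟩
  · exact (hasFDerivAt_volPot hμ h.bas.1 (h.bas.abs_le hγ) (hT ▸ ht) x).differentiableAt
  · exact pd_volPot_eq hμ h.bas.1 (h.bas.abs_le hγ) h.2.1 i (h.2.2 i).bas.1
      ((h.2.2 i).bas.abs_le (by linarith)) (hT ▸ ht)

theorem Cl.volPot {μ : ℝ} (hμ : 0 < μ) (c : Cfg) (hβ : c.β = 0) (N : ℕ) {γ σ : ℝ} (hγ : 0 ≤ γ)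
    (hσ : σ + 1 + c.lam ≤ γ) :
    ∃ M : ℝ, 0 ≤ M ∧ ∀ (K : ℝ) (f : ℝ → Spc n → ℝ), Cl c.sup N γ K f →
      Cl c (N + 1) σ (M * K) (volPot μ f) := by
  have base : ∀ {γ σ : ℝ}, 0 ≤ γ → σ + 1 + c.lam ≤ γ → ∃ M : ℝ, 0 ≤ M ∧ ∀ (K : ℝ)
      (f : ℝ → Spc n → ℝ), Bas c.sup γ K f → Bas c σ (M * K) (NSdeRham.volPot μ f) ∧
        ∀ i, Bas c (σ + 1) (M * K) (heatJ 1 (gaussD n μ i) (clampT c.T f)) := by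
    intro γ σ hγ hσ
    obtain ⟨C, hG, hGD⟩ := hker_gauss (n := n) hμ 0 (m := n + 1 + γ) (by positivity)
    obtain ⟨C', hG', hGD'⟩ := hker_gauss (n := n) hμ 1 (m := n + 1 + γ) (by positivity)
    obtain ⟨M₀, hM₀, h₀⟩ := heatJ_bas (Nat.zero_le 1) c hβ hγ hG
    choose M hM h₁ using fun i => heatJ_bas le_rfl c hβ hγ (hGD' i)
    have hMs : 0 ≤ ∑ i, M i := Finset.sum_nonneg fun i _ => hM i
    refine ⟨M₀ + ∑ i, M i, by positivity, fun K f hf => ?_⟩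
    have hK := hf.nonneg
    have hc : Continuous (Function.uncurry (clampT c.T f)) := JC.clampT c.hT.le hf.1
    have hb := Bas.abs_le_clamp (c := c.sup) hβ hf
    have hl0 := c.hl0
    refine ⟨Bas.congr ((h₀ K _ hc hK hb).mono (by linarith) ?_) fun t ht => ?_, fun i =>
      (h₁ i K _ hc hK hb).mono (by linarith) ?_⟩
    · gcongr; linarith
    · exact funext fun x => volPot_eq_heatJ hμ f ht x
    · have := Finset.single_le_sum (f := M) (fun i _ => hM i) (Finset.mem_univ i)
      gcongr; linarith
  induction N generalizing γ σ with
  | zero =>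
    obtain ⟨M, hM, h⟩ := base hγ hσ
    refine ⟨M, hM, fun K f hf => ⟨(h K f hf).1, fun t ht x => ?_, fun i =>
      Bas.congr ((h K f hf).2 i) fun t ht => ?_⟩⟩
    · exact (hasFDerivAt_volPot hμ hf.1 (hf.bas.abs_le hγ) ht x).differentiableAt
    · exact funext fun x => pd_volPot hμ hf.1 (hf.bas.abs_le hγ) ht i x
  | succ N ih =>
    obtain ⟨M, hM, h⟩ := base hγ hσ
    obtain ⟨M', hM', h'⟩ := ih (γ := γ + 1) (σ := σ + 1) (by linarith) (by linarith)
    refine ⟨M + M', by positivity, fun K f hf => Cl.volPot_step hμ (c := c.sup) (c' := c) rfl hγ hf ?_ fun i => ?_⟩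
    · have hK := hf.nonneg
      exact (h K f hf.bas).1.mono le_rfl (by gcongr; linarith)
    · have hK := hf.nonneg
      exact (h' K _ (hf.2.2 i)).mono le_rfl (by gcongr; linarith)

theorem Cl.volPot_exp {μ : ℝ} (hμ : 0 < μ) {T : ℝ} (hT : 0 < T) (N : ℕ) {γ σ : ℝ} (hγ : 0 ≤ γ)
    (hσ : σ + 1 ≤ γ) :
    ∃ M : ℝ, 0 ≤ M ∧ ∀ (c : Cfg), c.T = T → ¬ c.h → 0 < c.β → ∀ (K : ℝ) (f : ℝ → Spc n → ℝ),
      Cl c N γ K f → Cl c (N + 1) σ (M * c.β ^ (-(1 / 4) : ℝ) * K) (NSdeRham.volPot μ f) := by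
  have base : ∀ {γ σ : ℝ}, 0 ≤ γ → σ + 1 ≤ γ → ∃ M : ℝ, 0 ≤ M ∧ ∀ (c : Cfg), c.T = T → ¬ c.h →
      0 < c.β → ∀ (K : ℝ)
      (f : ℝ → Spc n → ℝ), Bas c γ K f →
        Bas c σ (M * c.β ^ (-(1 / 4) : ℝ) * K) (NSdeRham.volPot μ f) ∧
        ∀ i, Bas c (σ + 1) (M * c.β ^ (-(1 / 4) : ℝ) * K)
          (heatJ 1 (gaussD n μ i) (clampT T f)) := by
    intro γ σ hγ hσ
    obtain ⟨C, hG, hGD⟩ := hker_gauss (n := n) hμ 0 (m := n + 1 + γ) (by positivity)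
    obtain ⟨C', hG', hGD'⟩ := hker_gauss (n := n) hμ 1 (m := n + 1 + γ) (by positivity)
    obtain ⟨M₀, hM₀, h₀⟩ := heatJ_sup (T := T) (Nat.zero_le 1) hγ hG
    choose M hM h₁ using fun i => heatJ_sup (T := T) le_rfl hγ (hGD' i)
    have hMs : 0 ≤ ∑ i, M i := Finset.sum_nonneg fun i _ => hM i
    refine ⟨M₀ + ∑ i, M i, by positivity, fun c hcT hh hβ K f hf => ?_⟩
    subst hcT
    have hK := hf.nonneg
    have hc : Continuous (Function.uncurry (clampT c.T f)) := JC.clampT c.hT.le hf.1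
    let c₀ : Cfg := ⟨c.T, 1 / 2, 0, True, c.hT, by norm_num, by norm_num, le_rfl⟩
    have hJ : ∀ {p : ℕ} {g : Spc n → ℝ} {C : ℝ}, p ≤ 1 → HKer p (n + 1 + γ) C g →
        JC c.T (heatJ p g (clampT c.T f)) := fun {p g C} hp hg => by
      obtain ⟨M, -, h⟩ := heatJ_bas hp c₀ rfl hγ hg
      refine (h (K * Real.exp (c.β * c.T)) _ hc (by positivity) fun τ y => ?_).1
      have hy := wt_pos y
      have h2 : Real.exp (c.β * (max 0 (min τ c.T))) ≤ Real.exp (c.β * c.T) :=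
        Real.exp_le_exp.2 (mul_le_mul_of_nonneg_left (clamp_mem c.hT.le τ).2 c.hβ)
      refine (hf.2.1 _ (clamp_mem c.hT.le τ) y).trans ?_
      gcongr
    have hb : ∀ τ ∈ Set.Icc 0 c.T, ∀ y, |clampT c.T f τ y| ≤ K * Real.exp (c.β * τ) * wt y ^ (-γ) :=
      fun τ hτ y => by rw [clampT_eq hτ]; exact hf.2.1 τ hτ y
    have hB : ∀ {p : ℕ} {g : Spc n → ℝ} {C M s : ℝ}, p ≤ 1 → HKer p (n + 1 + γ) C g → 0 ≤ M → s ≤ γ →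
        (∀ t ∈ Set.Icc 0 c.T, ∀ x, |heatJ p g (clampT c.T f) t x| ≤
          M * c.β ^ (-(1 / 4) : ℝ) * K * Real.exp (c.β * t) * wt x ^ (-γ)) →
        Bas c s (M * c.β ^ (-(1 / 4) : ℝ) * K) (heatJ p g (clampT c.T f)) :=
      fun {p g C M s} hp hg hM hs h =>
        Bas.mono (σ := γ) ⟨hJ hp hg, h, fun h => (hh h).elim⟩ hs le_rfl
    refine ⟨Bas.congr ((hB (Nat.zero_le 1) hG hM₀ (by linarith)
      (h₀ c.β K _ hβ hK hb)).mono le_rfl ?_) fun t ht => ?_, fun i =>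
      (hB le_rfl (hGD' i) (hM i) hσ (h₁ i c.β K _ hβ hK hb)).mono le_rfl ?_⟩
    · gcongr; linarith
    · exact funext fun x => volPot_eq_heatJ hμ f ht x
    · have := Finset.single_le_sum (f := M) (fun i _ => hM i) (Finset.mem_univ i)
      gcongr; linarith
  induction N generalizing γ σ with
  | zero =>
    obtain ⟨M, hM, h⟩ := base hγ hσ
    refine ⟨M, hM, fun c hcT hh hβ K f hf => ⟨(h c hcT hh hβ K f hf).1, fun t ht x => ?_, fun i =>
      Bas.congr ((h c hcT hh hβ K f hf).2 i) fun t ht => ?_⟩⟩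
    · exact (hasFDerivAt_volPot hμ hf.1 (hf.bas.abs_le hγ) ht x).differentiableAt
    · subst hcT
      exact funext fun x => pd_volPot hμ hf.1 (hf.bas.abs_le hγ) ht i x
  | succ N ih =>
    obtain ⟨M, hM, h⟩ := base hγ hσ
    obtain ⟨M', hM', h'⟩ := ih (γ := γ + 1) (σ := σ + 1) (by linarith) (by linarith)
    refine ⟨M + M', by positivity, fun c hcT hh hβ K f hf =>
      Cl.volPot_step hμ (c := c) rfl hγ hf ?_ fun i => ?_⟩
    · have hK := hf.nonneg
      exact (h c hcT hh hβ K f hf.bas).1.mono le_rfl (by gcongr; linarith)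
    · have hK := hf.nonneg
      exact (h' c hcT hh hβ K _ (hf.2.2 i)).mono le_rfl (by gcongr; linarith)

theorem integral_gauss {μ : ℝ} (hμ : 0 < μ) : ∫ ζ : Spc n, gauss n μ ζ = 1 := by
  have h := GaussianFourier.integral_rexp_neg_mul_sq_norm (V := Spc n) (b := 1 / (4 * μ)) (by positivity)
  unfold gauss
  rw [integral_const_mul, h, finrank_euclideanSpace_fin, neg_div, Real.rpow_neg (by positivity)]
  rw [show Real.pi / (1 / (4 * μ)) = 4 * Real.pi * μ by field_simp]
  exact inv_mul_cancel₀ (by positivity)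

theorem heatA_zero {μ : ℝ} (hμ : 0 < μ) (φ : Spc n → ℝ) (x : Spc n) :
    heatA (gauss n μ) 0 φ x = φ x := by
  simp [heatA, integral_mul_const, integral_gauss hμ]

/-- The heat equation for Gaussian averages, in terms of the standard deviation. -/
theorem hasDerivAt_gauss_dilate {μ F : ℝ} (hμ : 0 < μ) {φ : Spc n → ℝ} (hφ : Differentiable ℝ φ)
    (hc : ∀ i, Continuous (pd i φ)) (hb : ∀ y, |φ y| ≤ F) (hb' : ∀ i y, |pd i φ y| ≤ F)
    (x : Spc n) (r : ℝ) :
    HasDerivAt (fun r : ℝ => ∫ ζ, gauss n μ ζ * φ (x - r • ζ))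
      (∑ i, 2 * μ * ∫ ζ, gaussD n μ i ζ * pd i φ (x - r • ζ)) r := by
  have hF : 0 ≤ F := (abs_nonneg _).trans (hb 0)
  obtain ⟨C, hG, hGD⟩ := hker_gauss (n := n) hμ 0 (m := n + 1) (by positivity)
  have hC := hG.nonneg
  have hI : ∀ {κ ψ : Spc n → ℝ} (r : ℝ), HKer 0 (n + 1) C κ → Continuous ψ → (∀ y, |ψ y| ≤ F) →
      Integrable fun ζ => κ ζ * ψ (x - r • ζ) := fun {κ ψ} r h hψ hb => by
    refine ((integrable_decay n).const_mul (C * F)).mono'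
      (h.cont.mul (hψ.comp (by fun_prop))).aestronglyMeasurable (Eventually.of_forall fun ζ => ?_)
    rw [norm_mul, Real.norm_eq_abs, Real.norm_eq_abs]
    calc _ ≤ (C * (1 + ‖ζ‖) ^ (-((n : ℝ) + 1))) * F :=
          mul_le_mul (h.b0 ζ) (hb _) (abs_nonneg _) (by positivity)
      _ = _ := by ring
  have key := hasDerivAt_integral_of_dominated_loc_of_deriv_le (μ := volume) (𝕜 := ℝ)
    (F := fun r ζ => gauss n μ ζ * φ (x - r • ζ))
    (F' := fun r ζ => ∑ i, 2 * μ * (gaussD n μ i ζ * pd i φ (x - r • ζ)))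
    (bound := fun ζ => (n * (2 * μ) * (C * F)) * (1 + ‖ζ‖) ^ (-((n : ℝ) + 1)))
    (s := Set.univ) (x₀ := r) Filter.univ_mem
    (Eventually.of_forall fun r => (hI r hG hφ.continuous hb).aestronglyMeasurable)
    (hI r hG hφ.continuous hb)
    (integrable_finsetSum _ fun i _ => (hI r (hGD i) (hc i) (hb' i)).const_mul _).aestronglyMeasurable
    (Eventually.of_forall fun ζ r _ => ?_) ((integrable_decay n).const_mul _)
    (Eventually.of_forall fun ζ r _ => ?_)
  · refine key.2.congr_deriv ?_
    rw [integral_finsetSum _ fun i _ => (hI r (hGD i) (hc i) (hb' i)).const_mul _]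
    simp only [integral_const_mul]
  · rw [Real.norm_eq_abs]
    refine (Finset.abs_sum_le_sum_abs _ _).trans ?_
    calc _ ≤ ∑ _i : Fin n, 2 * μ * ((C * (1 + ‖ζ‖) ^ (-((n : ℝ) + 1))) * F) := by
          refine Finset.sum_le_sum fun i _ => ?_
          rw [abs_mul, abs_of_pos (by positivity : 0 < 2 * μ), abs_mul]
          gcongr
          · exact (hGD i).b0 ζ
          · exact hb' i _
      _ = _ := by simp; ring
  · have h1 : HasDerivAt (fun r : ℝ => x - r • ζ) (-ζ) r := by
      simpa using ((hasDerivAt_id r).smul_const ζ).const_sub x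
    have h2 := ((hφ (x - r • ζ)).hasFDerivAt.comp_hasDerivAt r h1).const_mul (gauss n μ ζ)
    refine h2.congr_deriv ?_
    rw [map_neg, fderiv_eq_sum]
    simp only [sum_apply, mul_neg, Finset.mul_sum, ← Finset.sum_neg_distrib]
    refine Finset.sum_congr rfl fun i _ => ?_
    simp only [gaussD, Function.comp_apply, ContinuousLinearMap.smulRight_apply,
      ContinuousLinearMap.id_apply, smul_apply, proj_apply', smul_eq_mul]
    field_simp

theorem heatA_eq_add_integral {μ F θ : ℝ} (hμ : 0 < μ) {φ : Spc n → ℝ} (hφ : Differentiable ℝ φ)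
    (hφ' : ∀ i, Differentiable ℝ (pd i φ)) (hb : ∀ y, |φ y| ≤ F) (hb' : ∀ i y, |pd i φ y| ≤ F)
    (hc : ∀ i, Continuous (pd i (pd i φ))) (hb'' : ∀ i y, |pd i (pd i φ) y| ≤ F)
    (hθ : 0 ≤ θ) (x : Spc n) :
    heatA (gauss n μ) θ φ x = φ x + μ * ∫ s in (0 : ℝ)..θ, heatA (gauss n μ) s (lap φ) x := by
  have hF : 0 ≤ F := (abs_nonneg _).trans (hb 0)
  obtain ⟨C, hG, hGD⟩ := hker_gauss (n := n) hμ 0 (m := n + 1 + 0) (by positivity)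
  have hlb : ∀ y, |lap φ y| ≤ n * F := fun y => by
    unfold lap
    refine (Finset.abs_sum_le_sum_abs _ _).trans ?_
    refine (Finset.sum_le_sum fun i _ => hb'' i y).trans_eq ?_
    simp
  have hlc : Continuous (lap φ) := by
    unfold lap; exact continuous_finsetSum _ fun i _ => hc i
  have hcont : ∀ {ψ : Spc n → ℝ} {F : ℝ}, Continuous ψ → (∀ y, |ψ y| ≤ F) →
      Continuous fun s => heatA (gauss n μ) s ψ x := fun {ψ F} hψ hb =>
    (continuous_heatA (f := fun _ => ψ) le_rfl hG (by fun_prop) fun _ => hb).comp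
      (by fun_prop : Continuous fun s : ℝ => ((s, (0 : ℝ), x) : ℝ × ℝ × Spc n))
  have hder : ∀ s ∈ Set.Ioo 0 θ, HasDerivAt (fun s => heatA (gauss n μ) s φ x)
      (μ * heatA (gauss n μ) s (lap φ) x) s := fun s hs => by
    have h1 := (hasDerivAt_gauss_dilate hμ hφ (fun i => (hφ' i).continuous) hb hb' x
      (Real.sqrt s)).comp s (Real.hasDerivAt_sqrt hs.1.ne')
    refine h1.congr_deriv ?_
    have e : ∀ i, ∫ ζ, gaussD n μ i ζ * pd i φ (x - Real.sqrt s • ζ) =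
        Real.sqrt s * heatA (gauss n μ) s (pd i (pd i φ)) x := fun i =>
      heatA_gaussD hμ (hφ' i) i (hc i) (hb' i) (hb'' i) x
    have h2 : heatA (gauss n μ) s (lap φ) x = ∑ i, heatA (gauss n μ) s (pd i (pd i φ)) x := by
      unfold heatA lap
      simp only [Finset.mul_sum]
      rw [integral_finsetSum]
      intro i _
      exact heatA_integrable (γ := 0) (T := s) le_rfl hG.cont (hc i) (by simpa using hG.b0)
        (by simpa using hb'' i) hG.nonneg hF le_rfl x
    have hs' := Real.sqrt_pos.2 hs.1
    simp only [e, h2, Finset.sum_mul, Finset.mul_sum]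
    refine Finset.sum_congr rfl fun i _ => ?_
    field_simp
  have := intervalIntegral.integral_eq_sub_of_hasDerivAt_of_le hθ
    (hcont hφ.continuous hb).continuousOn hder
    ((hcont hlc hlb).const_mul μ |>.intervalIntegrable _ _)
  rw [intervalIntegral.integral_const_mul, heatA_zero hμ] at this
  linarith

theorem integral_triangle_swap {H : ℝ → ℝ → ℝ} (hH : Continuous (Function.uncurry H)) {t : ℝ}
    (ht : 0 ≤ t) : ∫ τ in (0 : ℝ)..t, ∫ s in τ..t, H τ s = ∫ s in (0 : ℝ)..t, ∫ τ in (0 : ℝ)..s, H τ s := by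
  set S : Set (ℝ × ℝ) := {p | p.1 < p.2} with hS
  have hSm : MeasurableSet S := measurableSet_lt measurable_fst measurable_snd
  have hjint : Integrable (Function.uncurry fun τ s => S.indicator (Function.uncurry H) (τ, s))
      ((volume.restrict (Set.Ioc 0 t)).prod (volume.restrict (Set.Ioc 0 t))) := by
    rw [Measure.prod_restrict]
    have h1 : IntegrableOn (Function.uncurry H) (Set.Icc 0 t ×ˢ Set.Icc 0 t) (volume.prod volume) :=
      (hH.continuousOn).integrableOn_compact (isCompact_Icc.prod isCompact_Icc)
    have h2 := h1.mono_set (Set.prod_mono (Set.Ioc_subset_Icc_self (a := (0 : ℝ)) (b := t))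
      (Set.Ioc_subset_Icc_self (a := (0 : ℝ)) (b := t)))
    exact (Integrable.indicator h2 hSm)
  have hsw := integral_integral_swap hjint
  rw [intervalIntegral.integral_of_le ht, intervalIntegral.integral_of_le ht]
  refine Eq.trans (setIntegral_congr_fun measurableSet_Ioc fun τ hτ => ?_) (hsw.trans
    (setIntegral_congr_fun measurableSet_Ioc fun s hs => ?_))
  · rw [intervalIntegral.integral_of_le hτ.2]
    have e : (fun s => S.indicator (Function.uncurry H) (τ, s)) = (Set.Ioi τ).indicator (H τ) := by
      funext s; simp [Set.indicator, hS]
    rw [e, setIntegral_indicator measurableSet_Ioi]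
    congr 2
    ext s; simp only [Set.mem_inter_iff, Set.mem_Ioc, Set.mem_Ioi]
    exact ⟨fun h => ⟨⟨hτ.1.trans h.1, h.2⟩, h.1⟩, fun h => ⟨h.2, h.1.2⟩⟩
  · rw [intervalIntegral.integral_of_le hs.1.le]
    have e : (fun τ => S.indicator (Function.uncurry H) (τ, s)) =
        (Set.Iio s).indicator (fun τ => H τ s) := by
      funext τ; simp [Set.indicator, hS]
    rw [e, setIntegral_indicator measurableSet_Iio, integral_Ioc_eq_integral_Ioo]
    congr 2
    ext τ; simp only [Set.mem_inter_iff, Set.mem_Ioc, Set.mem_Ioo, Set.mem_Iio]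
    exact ⟨fun h => ⟨h.1.1, h.2⟩, fun h => ⟨⟨h.1, h.2.le.trans hs.2⟩, h.2⟩⟩

theorem volPot_td {μ : ℝ} (hμ : 0 < μ) {c : Cfg} (hβ : c.β = 0) {γ K : ℝ} (hγ : 0 ≤ γ)
    {f : ℝ → Spc n → ℝ} (hf : Cl c 2 γ K f) :
    TD c.T (volPot μ f) fun t x => f t x + μ * NSdeRham.volPot μ (fun τ => lap (f τ)) t x := by
  have hT := c.hT.le
  have hl : Cl c 0 (γ + 2) (n * K) fun t => lap (f t) := Cl.lap (N := 0) hf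
  obtain ⟨C, hG, hGD⟩ := hker_gauss (n := n) hμ 0 (m := n + 1 + 0) (by positivity)
  set fc := clampT c.T f with hfc
  set lc := clampT c.T (fun τ => lap (f τ)) with hlc
  have hfcc : Continuous (Function.uncurry fc) := hf.bas.1.clampT hT
  have hlcc : Continuous (Function.uncurry lc) := JC.clampT hT hl.bas.1
  have hbd : ∀ {g : ℝ → Spc n → ℝ} {σ K : ℝ}, 0 ≤ σ → Bas c σ K g → ∀ τ ∈ Set.Icc 0 c.T, ∀ y, |g τ y| ≤ K :=
    fun {g σ K} hσ h τ hτ y => by simpa [hβ] using h.abs_le hσ τ hτ y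
  have hK := hf.nonneg
  have hlb : ∀ τ y, |lc τ y| ≤ n * K := fun τ y => hbd (by linarith) hl.bas _ (clamp_mem hT τ) y
  have hcA := continuous_heatA (f := lc) le_rfl hG hlcc hlb
  have hfd : ∀ τ, Differentiable ℝ (fc τ) := fun τ => hf.2.1 _ (clamp_mem hT τ)
  have hfd1 : ∀ τ i, Differentiable ℝ (pd i (fc τ)) := fun τ i => (hf.2.2 i).2.1 _ (clamp_mem hT τ)
  have hstep : ∀ τ θ x, 0 ≤ θ → heatA (gauss n μ) θ (fc τ) x =
      fc τ x + μ * ∫ s in (0 : ℝ)..θ, heatA (gauss n μ) s (lc τ) x := fun τ θ x hθ => by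
    have hm := clamp_mem hT τ
    refine heatA_eq_add_integral (F := K) hμ (hfd τ) (hfd1 τ) ?_ ?_ ?_ ?_ hθ x
    · exact hbd hγ hf.bas _ hm
    · exact fun i => hbd (by linarith) (hf.2.2 i).bas _ hm
    · exact fun i => ContinuousOn.comp_continuous ((hf.2.2 i).2.2 i).bas.1
        (by fun_prop : Continuous fun y : Spc n => (max 0 (min τ c.T), y)) fun y => ⟨hm, Set.mem_univ _⟩
    · exact fun i => hbd (by linarith) ((hf.2.2 i).2.2 i).bas _ hm
  have hrep : ∀ x, ∀ t ∈ Set.Icc 0 c.T, NSdeRham.volPot μ f t x = ∫ s in (0 : ℝ)..t,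
      (fc s x + μ * ∫ τ in (0 : ℝ)..s, heatA (gauss n μ) (s - τ) (lc τ) x) := fun x t ht => by
    have hHc : Continuous (Function.uncurry fun τ s => heatA (gauss n μ) (s - τ) (lc τ) x) :=
      hcA.comp (by fun_prop : Continuous fun p : ℝ × ℝ => (p.2 - p.1, p.1, x))
    have hin : Continuous fun s => ∫ τ in (0 : ℝ)..s, heatA (gauss n μ) (s - τ) (lc τ) x :=
      intervalIntegral.continuous_parametric_intervalIntegral_of_continuous
        (f := fun s τ => heatA (gauss n μ) (s - τ) (lc τ) x)
        (hcA.comp (by fun_prop : Continuous fun p : ℝ × ℝ => (p.1 - p.2, p.2, x))) continuous_id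
    have hin' : Continuous fun τ => ∫ s in τ..t, heatA (gauss n μ) (s - τ) (lc τ) x := by
      have := intervalIntegral.continuous_parametric_intervalIntegral_of_continuous (μ := volume) (a₀ := t) hHc
        (continuous_id (X := ℝ))
      simp only [id] at this
      refine this.neg.congr fun τ => ?_
      rw [intervalIntegral.integral_symm]; rfl
    have hfx : Continuous fun τ => fc τ x := hfcc.comp (by fun_prop : Continuous fun τ : ℝ => (τ, x))
    rw [volPot_eq_heatJ hμ f ht, heatJ, intervalIntegral.integral_add
      (hfx.intervalIntegrable _ _) ((hin.const_mul μ).intervalIntegrable _ _),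
      intervalIntegral.integral_const_mul, ← integral_triangle_swap hHc ht.1,
      ← intervalIntegral.integral_const_mul, ← intervalIntegral.integral_add
      (hfx.intervalIntegrable _ _) ((hin'.const_mul μ).intervalIntegrable _ _)]
    refine intervalIntegral.integral_congr fun τ hτ => ?_
    rw [Set.uIcc_of_le ht.1] at hτ
    simp only [CharP.cast_eq_zero, neg_zero, zero_div, Real.rpow_zero, one_mul]
    rw [← hfc, hstep τ (t - τ) x (by linarith [hτ.2])]
    congr 2
    have := intervalIntegral.integral_comp_sub_right (a := τ) (b := t)
      (fun s => heatA (gauss n μ) s (lc τ) x) τ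
    rw [this, sub_self]
  intro x t ht
  have hin : Continuous fun s => fc s x + μ * ∫ τ in (0 : ℝ)..s, heatA (gauss n μ) (s - τ) (lc τ) x :=
    (hfcc.comp (by fun_prop : Continuous fun τ : ℝ => (τ, x))).add
    ((intervalIntegral.continuous_parametric_intervalIntegral_of_continuous
        (f := fun s τ => heatA (gauss n μ) (s - τ) (lc τ) x)
        (hcA.comp (by fun_prop : Continuous fun p : ℝ × ℝ => (p.1 - p.2, p.2, x))) continuous_id).const_mul μ)
  have hd := (hin.integral_hasStrictDerivAt 0 t).hasDerivAt.hasDerivWithinAt (s := Set.Icc 0 c.T)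
  refine (hd.congr (fun s hs => hrep x s hs) (hrep x t ht)).congr_deriv ?_
  beta_reduce
  rw [volPot_eq_heatJ hμ _ ht, heatJ, ← hlc, hfc, clampT_eq ht]
  simp

theorem Pr.volPot {μ : ℝ} (hμ : 0 < μ) (c : Cfg) (hβ : c.β = 0) (r m : ℕ) {γ σ : ℝ} (hγ : 0 ≤ γ)
    (hσ : σ + 1 + c.lam ≤ γ) :
    ∃ M : ℝ, 0 ≤ M ∧ ∀ (K : ℝ) (g : ℝ → Spc n → ℝ), Cl c.sup (2 * r + m) γ K g →
      (∀ r', r = r' + 1 → Pr c r' (m + 1) γ K g) → Pr c r (m + 1) σ (M * K) (volPot μ g) := by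
  induction r with
  | zero =>
    obtain ⟨M, hM, h⟩ := Cl.volPot (n := n) hμ c hβ m hγ hσ
    exact ⟨M, hM, fun K g hg _ => h K g (Cl.le hg (by omega))⟩
  | succ r ih =>
    obtain ⟨M₁, hM₁, h₁⟩ := ih
    obtain ⟨M, hM, h⟩ := Cl.volPot (n := n) hμ c hβ (2 * (r + 1) + m) hγ hσ
    have hl0 := c.hl0
    refine ⟨M + 1 + μ * (M₁ * n), by positivity, fun K g hg hg' => ⟨?_, _,
      volPot_td hμ (c := c.sup) hβ hγ (Cl.le hg (by omega)), ?_⟩⟩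
    · have hK := hg.nonneg
      refine (Cl.le (h K g hg) (by omega)).mono le_rfl ?_
      gcongr
      nlinarith [mul_nonneg hμ.le (mul_nonneg hM₁ (Nat.cast_nonneg n))]
    · have hK := hg.nonneg
      have h2 : Cl c.sup (2 * r + m) γ (n * K) fun t => NSdeRham.lap (g t) :=
        Cl.mono (Cl.lap (N := 2 * r + m) (Cl.le hg (by omega))) (by linarith) le_rfl
      have h3 := h₁ (n * K) _ h2 fun r' hr' => by
        subst hr'
        exact ((hg' _ rfl).shift).lap
      have h4 := ((hg' r rfl).mono le_rfl (by linarith : σ ≤ γ) le_rfl).add (h3.smul μ)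
      refine h4.mono le_rfl le_rfl ?_
      rw [abs_of_pos hμ]
      nlinarith [mul_nonneg hM hK]

theorem nontrivial_spc (hn : 0 < n) : Nontrivial (Spc n) := by
  refine ⟨⟨EuclideanSpace.single ⟨0, hn⟩ 1, 0, fun h => ?_⟩⟩
  have := norm_single_one (n := n) ⟨0, hn⟩
  rw [h, norm_zero] at this
  exact zero_ne_one this

theorem integrable_norm_wt (hn : 0 < n) {a e : ℝ} (ha : a < n) (hae : n < a + e) :
    Integrable fun z : Spc n => ‖z‖ ^ (-a) * wt z ^ (-e) := by
  have := nontrivial_spc hn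
  unfold wt
  rw [integrable_fun_norm_addHaar volume (f := fun r : ℝ => r ^ (-a) * Real.sqrt (1 + r ^ 2) ^ (-e)),
    finrank_euclideanSpace_fin]
  have hm : Measurable fun r : ℝ => r ^ (n - 1) • (r ^ (-a) * Real.sqrt (1 + r ^ 2) ^ (-e)) := by
    simp only [smul_eq_mul]; fun_prop
  have hr : ∀ r : ℝ, 0 < r → r ^ (n - 1) * r ^ (-a) = r ^ ((n : ℝ) - 1 - a) := fun r hr => by
    rw [← Real.rpow_natCast, ← Real.rpow_add hr, Nat.cast_sub (by omega)]
    push_cast; congr 1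
  rw [← Set.Ioc_union_Ioi_eq_Ioi zero_le_one, integrableOn_union]
  constructor
  · have h1 : IntegrableOn (fun r : ℝ => r ^ ((n : ℝ) - 1 - a)) (Set.Ioc 0 1) :=
      (intervalIntegrable_iff_integrableOn_Ioc_of_le zero_le_one).1
        (intervalIntegral.intervalIntegrable_rpow' (by linarith))
    refine Integrable.mono' h1 hm.aestronglyMeasurable ?_
    filter_upwards [ae_restrict_mem measurableSet_Ioc] with r hr'
    have h0 := hr'.1
    have hs : Real.sqrt (1 + r ^ 2) ^ (-e) ≤ 1 :=
      Real.rpow_le_one_of_one_le_of_nonpos (Real.one_le_sqrt.2 (by nlinarith)) (by linarith)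
    rw [smul_eq_mul, ← mul_assoc, hr r hr'.1, Real.norm_of_nonneg (by positivity)]
    exact mul_le_of_le_one_right (by positivity) hs
  · have h1 : IntegrableOn (fun r : ℝ => r ^ ((n : ℝ) - 1 - a - e)) (Set.Ioi 1) :=
      integrableOn_Ioi_rpow_of_lt (by linarith) one_pos
    refine Integrable.mono' h1 hm.aestronglyMeasurable ?_
    filter_upwards [ae_restrict_mem measurableSet_Ioi] with r hr'
    have h0 : 0 < r := one_pos.trans hr'
    have hs : Real.sqrt (1 + r ^ 2) ^ (-e) ≤ r ^ (-e) :=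
      Real.rpow_le_rpow_of_nonpos h0 (Real.le_sqrt_of_sq_le (by linarith)) (by linarith)
    rw [smul_eq_mul, ← mul_assoc, hr r h0, Real.norm_of_nonneg (by positivity), sub_eq_add_neg _ e,
      Real.rpow_add h0]
    gcongr

theorem integrable_wt {e : ℝ} (hn : 0 < n) (he : (n : ℝ) < e) :
    Integrable fun z : Spc n => wt z ^ (-e) := by
  have hn' : (0 : ℝ) < n := by exact_mod_cast hn
  simpa using integrable_norm_wt hn (a := 0) (e := e) hn' (by linarith)

/-- Pointwise splitting of a singular weighted kernel. -/
theorem weight_split {a b σ : ℝ} (hb : 0 ≤ b) (hba : b ≤ a) (hbσ : b ≤ σ) (x z : Spc n) :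
    wt x ^ b * ‖x - z‖ ^ (-a) * wt z ^ (-σ) ≤
      (2 ^ (σ + σ) + 4 ^ b * 5 ^ (a - b)) * (‖x - z‖ ^ (-a) * wt (x - z) ^ (-(σ - b)) +
        wt z ^ (-(a + σ - b))) := by
  have hx := wt_pos x
  have hz := wt_pos z
  have hxz := wt_pos (x - z)
  have hx1 := one_le_wt x
  have p1 : 0 ≤ ‖x - z‖ ^ (-a) * wt (x - z) ^ (-(σ - b)) := by positivity
  have p2 : 0 ≤ wt z ^ (-(a + σ - b)) := by positivity
  have q1 : (0 : ℝ) ≤ 2 ^ (σ + σ) := by positivity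
  have q2 : (0 : ℝ) ≤ 4 ^ b * 5 ^ (a - b) := by positivity
  rcases le_or_gt ‖x - z‖ (wt x / 4) with h | h
  · have h1 : wt z ^ (-σ) ≤ 2 ^ σ * wt x ^ (-σ) := by
      have := wt_rpow_near (-σ) x z h
      rwa [abs_neg, abs_of_nonneg (hb.trans hbσ)] at this
    have h2 : wt x ^ (-(σ - b)) ≤ 2 ^ σ * wt (x - z) ^ (-(σ - b)) := by
      have e : wt (x - z) ≤ 2 * wt x := by
        have := wt_le_one_add (x - z)
        linarith
      have := Real.rpow_le_rpow_of_nonpos hxz e (by linarith : -(σ - b) ≤ 0)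
      rw [Real.mul_rpow (by norm_num) hx.le, Real.rpow_neg (by norm_num),
        inv_mul_le_iff₀ (by positivity)] at this
      refine this.trans ?_
      gcongr
      · norm_num
      · linarith
    calc _ ≤ wt x ^ b * ‖x - z‖ ^ (-a) * (2 ^ σ * wt x ^ (-σ)) := by gcongr
      _ = 2 ^ σ * ‖x - z‖ ^ (-a) * wt x ^ (-(σ - b)) := by
        rw [show -(σ - b) = b + -σ by ring, Real.rpow_add hx]; ring
      _ ≤ 2 ^ σ * ‖x - z‖ ^ (-a) * (2 ^ σ * wt (x - z) ^ (-(σ - b))) := by gcongr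
      _ = 2 ^ (σ + σ) * (‖x - z‖ ^ (-a) * wt (x - z) ^ (-(σ - b))) := by
        rw [Real.rpow_add (by norm_num)]; ring
      _ ≤ _ := by nlinarith
  · have h0 : 0 < ‖x - z‖ := by linarith
    have h1 : wt x ^ b ≤ 4 ^ b * ‖x - z‖ ^ b := by
      rw [← Real.mul_rpow (by norm_num) h0.le]
      exact Real.rpow_le_rpow hx.le (by linarith) hb
    have h2 : ‖x - z‖ ^ (-(a - b)) ≤ 5 ^ (a - b) * wt z ^ (-(a - b)) := by
      have e : wt z ≤ 5 * ‖x - z‖ := by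
        have := wt_le_add z x
        rw [norm_sub_rev] at this
        linarith
      have := Real.rpow_le_rpow_of_nonpos hz e (by linarith : -(a - b) ≤ 0)
      rwa [Real.mul_rpow (by norm_num) h0.le, Real.rpow_neg (by norm_num : (0:ℝ) ≤ 5),
        inv_mul_le_iff₀ (by positivity)] at this
    calc _ ≤ 4 ^ b * ‖x - z‖ ^ b * ‖x - z‖ ^ (-a) * wt z ^ (-σ) := by gcongr
      _ = 4 ^ b * ‖x - z‖ ^ (-(a - b)) * wt z ^ (-σ) := by
        rw [show -(a - b) = b + -a by ring, Real.rpow_add h0]; ring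
      _ ≤ 4 ^ b * (5 ^ (a - b) * wt z ^ (-(a - b))) * wt z ^ (-σ) := by gcongr
      _ = (4 ^ b * 5 ^ (a - b)) * wt z ^ (-(a + σ - b)) := by
        rw [show -(a + σ - b) = -(a - b) + -σ by ring, Real.rpow_add hz]; ring
      _ ≤ _ := by nlinarith

/-- Mapping property of weakly singular convolutions between weights. -/
theorem weight_conv (hn : 0 < n) {a b σ : ℝ} (hb : 0 ≤ b) (hba : b ≤ a) (hbσ : b ≤ σ) (ha : a < n)
    (hab : n < a + σ - b) :
    ∃ M : ℝ, 0 ≤ M ∧ ∀ x : Spc n, Integrable (fun z => ‖x - z‖ ^ (-a) * wt z ^ (-σ)) ∧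
      ∫ z, ‖x - z‖ ^ (-a) * wt z ^ (-σ) ≤ M * wt x ^ (-b) := by
  have i1 := integrable_norm_wt hn (a := a) (e := σ - b) ha (by linarith)
  have i2 := integrable_wt hn (e := a + σ - b) hab
  set D : ℝ := 2 ^ (σ + σ) + 4 ^ b * 5 ^ (a - b) with hD
  have hD0 : 0 ≤ D := by positivity
  refine ⟨D * ((∫ z : Spc n, ‖z‖ ^ (-a) * wt z ^ (-(σ - b))) + ∫ z : Spc n, wt z ^ (-(a + σ - b))),
    mul_nonneg hD0 (add_nonneg (integral_nonneg fun z => ?_) (integral_nonneg fun z => ?_)),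
    fun x => ?_⟩
  · have := wt_pos z; positivity
  · have := wt_pos z; positivity
  · have hx := wt_pos x
    have i3 : Integrable fun z => D * (‖x - z‖ ^ (-a) * wt (x - z) ^ (-(σ - b)) + wt z ^ (-(a + σ - b))) :=
      ((i1.comp_sub_left x).add i2).const_mul D
    have hle : ∀ z, ‖x - z‖ ^ (-a) * wt z ^ (-σ) ≤ wt x ^ (-b) *
        (D * (‖x - z‖ ^ (-a) * wt (x - z) ^ (-(σ - b)) + wt z ^ (-(a + σ - b)))) := fun z => by
      rw [Real.rpow_neg hx.le, le_inv_mul_iff₀ (by positivity), ← mul_assoc]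
      exact weight_split hb hba hbσ x z
    have hnn : ∀ z, 0 ≤ ‖x - z‖ ^ (-a) * wt z ^ (-σ) := fun z => by
      have := wt_pos z; positivity
    have hm : Measurable fun z => ‖x - z‖ ^ (-a) * wt z ^ (-σ) := by
      have := (continuous_wt (n := n)).measurable
      fun_prop
    have hi : Integrable fun z => ‖x - z‖ ^ (-a) * wt z ^ (-σ) :=
      (i3.const_mul (wt x ^ (-b))).mono' hm.aestronglyMeasurable
        (Eventually.of_forall fun z => by rw [Real.norm_of_nonneg (hnn z)]; exact hle z)
    refine ⟨hi, (integral_mono hi (i3.const_mul (wt x ^ (-b))) hle).trans_eq ?_⟩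
    rw [integral_const_mul, integral_const_mul, integral_add (i1.comp_sub_left x) i2,
      integral_sub_left_eq_self (fun z => ‖z‖ ^ (-a) * wt z ^ (-(σ - b))) volume x]
    ring

/-- Kernels smooth away from the origin and homogeneous of degree `1 - n`. -/
structure HomKer (k : Spc n → ℝ) : Prop where
  zero : k 0 = 0
  smooth : ContDiffOn ℝ (⊤ : ℕ∞) k {0}ᶜ
  hom : ∀ (r : ℝ) (z : Spc n), 0 < r → z ≠ 0 → k (r • z) = r ^ (1 - (n : ℝ)) * k z

/-- Functions smooth away from the origin and homogeneous of degree `d` are bounded by `‖z‖ ^ d`. -/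
theorem exists_hom_bound {g : Spc n → ℝ} {d : ℝ} (hg : ContinuousOn g {0}ᶜ)
    (hom : ∀ (r : ℝ) (z : Spc n), 0 < r → z ≠ 0 → g (r • z) = r ^ d * g z) :
    ∃ C : ℝ, 0 ≤ C ∧ ∀ z ≠ 0, |g z| ≤ C * ‖z‖ ^ d := by
  have hs : Metric.sphere (0 : Spc n) 1 ⊆ {0}ᶜ := fun z hz => by
    rw [Set.mem_compl_iff, Set.mem_singleton_iff]
    rintro rfl
    simp at hz
  obtain ⟨C, hC⟩ := (isCompact_sphere (0 : Spc n) 1).exists_bound_of_continuousOn (hg.mono hs)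
  refine ⟨|C|, abs_nonneg _, fun z hz => ?_⟩
  have hz0 : 0 < ‖z‖ := norm_pos_iff.2 hz
  have hu : ‖z‖⁻¹ • z ∈ Metric.sphere (0 : Spc n) 1 := by
    rw [mem_sphere_zero_iff_norm, norm_smul, norm_inv, norm_norm, inv_mul_cancel₀ hz0.ne']
  have h1 := hom ‖z‖ (‖z‖⁻¹ • z) hz0 (hs hu)
  rw [smul_smul, mul_inv_cancel₀ hz0.ne', one_smul] at h1
  rw [h1, abs_mul, abs_of_nonneg (by positivity), mul_comm]
  exact mul_le_mul_of_nonneg_right ((hC _ hu).trans (le_abs_self C)) (by positivity)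

theorem isOpen_ne_zero : IsOpen ({0}ᶜ : Set (Spc n)) := isOpen_compl_singleton

theorem ContDiffOn.pd_compl {g : Spc n → ℝ} (hg : ContDiffOn ℝ (⊤ : ℕ∞) g {0}ᶜ) (i : Fin n) :
    ContDiffOn ℝ (⊤ : ℕ∞) (pd i g) {0}ᶜ :=
  (hg.fderiv_of_isOpen isOpen_ne_zero (by simp)).clm_apply contDiffOn_const

theorem hom_pd {g : Spc n → ℝ} {d : ℝ} (hg : DifferentiableOn ℝ g {0}ᶜ)
    (hom : ∀ (r : ℝ) (z : Spc n), 0 < r → z ≠ 0 → g (r • z) = r ^ d * g z) (i : Fin n)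
    (r : ℝ) (z : Spc n) (hr : 0 < r) (hz : z ≠ 0) : pd i g (r • z) = r ^ (d - 1) * pd i g z := by
  have hd : ∀ z ≠ 0, DifferentiableAt ℝ g z := fun z hz =>
    (hg z hz).differentiableAt (isOpen_ne_zero.mem_nhds hz)
  have h1 : HasFDerivAt (fun z => g (r • z))
      ((fderiv ℝ g (r • z)).comp (r • ContinuousLinearMap.id ℝ (Spc n))) z :=
    (hd _ (smul_ne_zero hr.ne' hz)).hasFDerivAt.comp z ((hasFDerivAt_id z).const_smul r)
  have h2 : HasFDerivAt (fun z => r ^ d * g z) (r ^ d • fderiv ℝ g z) z :=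
    (hd z hz).hasFDerivAt.const_mul _
  have h3 := h1.unique (h2.congr_of_eventuallyEq (by
    filter_upwards [isOpen_ne_zero.mem_nhds hz] with y hy using hom r y hr hy))
  have h4 := DFunLike.congr_fun h3 (EuclideanSpace.single i 1)
  simp only [ContinuousLinearMap.comp_apply, smul_apply, ContinuousLinearMap.id_apply, map_smul,
    smul_eq_mul] at h4
  unfold pd
  rw [Real.rpow_sub_one hr.ne']
  field_simp
  linarith

theorem HomKer.differentiableAt {k : Spc n → ℝ} (h : HomKer k) {z : Spc n} (hz : z ≠ 0) :
    DifferentiableAt ℝ k z :=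
  ((h.smooth.differentiableOn (by simp)) z hz).differentiableAt (isOpen_ne_zero.mem_nhds hz)

theorem HomKer.measurable {k : Spc n → ℝ} (h : HomKer k) : Measurable k :=
  measurable_of_continuousOn_compl_singleton 0 h.smooth.continuousOn

theorem HomKer.bound {k : Spc n → ℝ} (h : HomKer k) :
    ∃ C : ℝ, 0 ≤ C ∧ ∀ z, |k z| ≤ C * ‖z‖ ^ (-((n : ℝ) - 1)) := by
  obtain ⟨C, hC, hb⟩ := exists_hom_bound h.smooth.continuousOn h.hom
  refine ⟨C, hC, fun z => ?_⟩
  rcases eq_or_ne z 0 with rfl | hz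
  · rw [h.zero, abs_zero]; positivity
  · rw [neg_sub]; exact hb z hz

/-- The kernel `∂_b (z_a k)`. -/
def kerD (b a : Fin n) (k : Spc n → ℝ) (z : Spc n) : ℝ :=
  if z = 0 then 0 else pd b (fun z => z a * k z) z

theorem HomKer.mul_coord_smooth {k : Spc n → ℝ} (h : HomKer k) (a : Fin n) :
    ContDiffOn ℝ (⊤ : ℕ∞) (fun z => z a * k z) {0}ᶜ :=
  ContDiffOn.mul (EuclideanSpace.proj a : Spc n →L[ℝ] ℝ).contDiff.contDiffOn h.smooth

theorem HomKer.mul_coord_hom {k : Spc n → ℝ} (h : HomKer k) (a : Fin n) (r : ℝ) (z : Spc n)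
    (hr : 0 < r) (hz : z ≠ 0) :
    (r • z) a * k (r • z) = r ^ (2 - (n : ℝ)) * (z a * k z) := by
  rw [h.hom r z hr hz, show 2 - (n : ℝ) = 1 - n + 1 by ring, Real.rpow_add_one hr.ne']
  simp only [PiLp.smul_apply, smul_eq_mul]
  ring

theorem HomKer.kerD {k : Spc n → ℝ} (h : HomKer k) (b a : Fin n) : HomKer (kerD b a k) where
  zero := if_pos rfl
  smooth := (ContDiffOn.pd_compl (h.mul_coord_smooth a) b).congr fun z hz => if_neg hz
  hom r z hr hz := by
    unfold NSdeRham.kerD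
    rw [if_neg hz, if_neg (smul_ne_zero hr.ne' hz), hom_pd ((h.mul_coord_smooth a).differentiableOn
      (by simp)) (h.mul_coord_hom a) b r z hr hz]
    congr 2
    ring

theorem HomKer.holder (hn : 2 ≤ n) {k : Spc n → ℝ} (h : HomKer k) {l : ℝ} (hl0 : 0 < l)
    (hl1 : l < 1) : ∃ C : ℝ, 0 ≤ C ∧ ∀ a b, |k a - k b| ≤
      C * ‖a - b‖ ^ l * (‖a‖ ^ (-((n : ℝ) - 1 + l)) + ‖b‖ ^ (-((n : ℝ) - 1 + l))) := by
  obtain ⟨C, hC, hb⟩ := h.bound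
  choose D hD hDb using fun i => exists_hom_bound (ContDiffOn.pd_compl h.smooth i).continuousOn
    (hom_pd (h.smooth.differentiableOn (by simp)) h.hom i)
  have hn' : (2 : ℝ) ≤ n := by exact_mod_cast hn
  set E := ∑ i, D i with hE
  have hE0 : 0 ≤ E := Finset.sum_nonneg fun i _ => hD i
  have hfd : ∀ z ≠ 0, ‖fderiv ℝ k z‖ ≤ E * ‖z‖ ^ (-(n : ℝ)) := fun z hz => by
    have e : fderiv ℝ k z = ∑ i, pd i k z • (EuclideanSpace.proj i : Spc n →L[ℝ] ℝ) := by
      rw [fderiv_eq_sum]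
      refine Finset.sum_congr rfl fun i _ => ?_
      ext v; simp
    rw [e]
    refine (norm_sum_smul_proj_le _).trans ?_
    rw [hE, Finset.sum_mul]
    refine Finset.sum_le_sum fun i _ => ?_
    have := hDb i z hz
    rwa [show 1 - (n : ℝ) - 1 = -n by ring] at this
  have key : ∀ a b, ‖b‖ ≤ ‖a‖ → |k a - k b| ≤ (4 * C + 2 ^ (n : ℝ) * E) * ‖a - b‖ ^ l *
      (‖a‖ ^ (-((n : ℝ) - 1 + l)) + ‖b‖ ^ (-((n : ℝ) - 1 + l))) := by
    intro a b hab
    rcases eq_or_ne a 0 with rfl | ha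
    · have : b = 0 := by simpa using hab
      subst this
      rw [sub_self, abs_zero]; positivity
    have ha0 : 0 < ‖a‖ := norm_pos_iff.2 ha
    rcases le_or_gt (‖a‖ / 2) ‖a - b‖ with hc | hc
    · have h1 : ∀ z : Spc n, ‖z‖ ≤ ‖a‖ → |k z| ≤ 2 * C * ‖a - b‖ ^ l * ‖z‖ ^ (-((n : ℝ) - 1 + l)) := by
        intro z hza
        rcases eq_or_ne z 0 with rfl | hz
        · rw [h.zero, abs_zero]; positivity
        have hz0 : 0 < ‖z‖ := norm_pos_iff.2 hz
        have h2 : ‖z‖ ^ l ≤ 2 * ‖a - b‖ ^ l := by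
          calc ‖z‖ ^ l ≤ (2 * ‖a - b‖) ^ l := by gcongr; linarith
            _ = 2 ^ l * ‖a - b‖ ^ l := Real.mul_rpow (by norm_num) (norm_nonneg _)
            _ ≤ 2 ^ (1 : ℝ) * ‖a - b‖ ^ l := by gcongr; norm_num
            _ = _ := by norm_num
        calc |k z| ≤ C * ‖z‖ ^ (-((n : ℝ) - 1)) := hb z
          _ = C * (‖z‖ ^ l * ‖z‖ ^ (-((n : ℝ) - 1 + l))) := by
            rw [← Real.rpow_add hz0]; congr 2; ring
          _ ≤ C * (2 * ‖a - b‖ ^ l * ‖z‖ ^ (-((n : ℝ) - 1 + l))) := by gcongr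
          _ = _ := by ring
      have h2 : 0 ≤ ‖a - b‖ ^ l * (‖a‖ ^ (-((n : ℝ) - 1 + l)) + ‖b‖ ^ (-((n : ℝ) - 1 + l))) := by
        positivity
      have h3 : 0 ≤ (2 * C + 2 ^ (n : ℝ) * E) := by positivity
      calc |k a - k b| ≤ |k a| + |k b| := abs_sub _ _
        _ ≤ _ := add_le_add (h1 a le_rfl) (h1 b hab)
        _ ≤ _ := by nlinarith [mul_nonneg h3 h2]
    · have hseg : ∀ z ∈ segment ℝ a b, ‖a‖ / 2 ≤ ‖z‖ := fun z hz => by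
        have h1 : ‖a - z‖ ≤ ‖a - b‖ := by
          have := segment_subset_closedBall_left a b hz
          rw [mem_closedBall_iff_norm, norm_sub_rev] at this
          rwa [dist_eq_norm] at this
        have h2 := norm_sub_norm_le a z
        linarith
      have hz0 : ∀ z ∈ segment ℝ a b, z ≠ 0 := fun z hz h0 => by
        have := hseg z hz; rw [h0, norm_zero] at this; linarith
      have h1 := (convex_segment a b).norm_image_sub_le_of_norm_hasFDerivWithin_le (𝕜 := ℝ) (f := k)
        (C := E * (‖a‖ / 2) ^ (-(n : ℝ)))
        (fun z hz => (h.differentiableAt (hz0 z hz)).hasFDerivAt.hasFDerivWithinAt)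
        (fun z hz => (hfd z (hz0 z hz)).trans (mul_le_mul_of_nonneg_left
          (Real.rpow_le_rpow_of_nonpos (by positivity) (hseg z hz) (by linarith)) hE0))
        (right_mem_segment ℝ a b) (left_mem_segment ℝ a b)
      rw [Real.norm_eq_abs] at h1
      have h2 : ‖a - b‖ ≤ ‖a - b‖ ^ l * ‖a‖ ^ (1 - l) := by
        rcases eq_or_ne (a - b) 0 with h0 | h0
        · rw [h0, norm_zero]; positivity
        have h0' : 0 < ‖a - b‖ := norm_pos_iff.2 h0
        calc ‖a - b‖ = ‖a - b‖ ^ l * ‖a - b‖ ^ (1 - l) := by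
              rw [← Real.rpow_add h0']; norm_num
          _ ≤ _ := by
            gcongr
            · linarith
      have h3 : (‖a‖ / 2) ^ (-(n : ℝ)) = 2 ^ (n : ℝ) * ‖a‖ ^ (-(n : ℝ)) := by
        rw [Real.div_rpow ha0.le (by norm_num), Real.rpow_neg (by norm_num : (0 : ℝ) ≤ 2), div_inv_eq_mul,
          mul_comm]
      have h4 : 0 ≤ ‖a - b‖ ^ l * ‖a‖ ^ (-((n : ℝ) - 1 + l)) := by positivity
      have h5 : 0 ≤ ‖a - b‖ ^ l * ‖b‖ ^ (-((n : ℝ) - 1 + l)) := by positivity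
      have q : (0 : ℝ) ≤ 2 ^ (n : ℝ) * E := by positivity
      calc |k a - k b| ≤ E * (‖a‖ / 2) ^ (-(n : ℝ)) * ‖a - b‖ := h1
        _ ≤ E * (2 ^ (n : ℝ) * ‖a‖ ^ (-(n : ℝ))) * (‖a - b‖ ^ l * ‖a‖ ^ (1 - l)) := by
          rw [h3]; gcongr
        _ = 2 ^ (n : ℝ) * E * (‖a - b‖ ^ l * ‖a‖ ^ (-((n : ℝ) - 1 + l))) := by
          rw [show -((n : ℝ) - 1 + l) = -n + (1 - l) by ring, Real.rpow_add ha0]; ring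
        _ ≤ _ := by nlinarith [mul_nonneg q h5, mul_nonneg hC h4, mul_nonneg hC h5]
  refine ⟨4 * C + 2 ^ (n : ℝ) * E, by positivity, fun a b => ?_⟩
  rcases le_total ‖b‖ ‖a‖ with hab | hab
  · exact key a b hab
  · rw [abs_sub_comm, norm_sub_rev, add_comm (‖a‖ ^ _)]
    exact key b a hab

/-- Convolution with the kernel `k`. -/
def cv (k φ : Spc n → ℝ) (x : Spc n) : ℝ := ∫ z, k z * φ (x - z)

/-- Continuous functions of weighted sup norm at most `A`. -/
def Dec (σ A : ℝ) (φ : Spc n → ℝ) : Prop := Continuous φ ∧ ∀ y, |φ y| ≤ A * wt y ^ (-σ)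

/-- Kernels which are integrable against the weight `wt ^ (-σ)`. -/
def IK (σ : ℝ) (k : Spc n → ℝ) : Prop := Measurable k ∧ Integrable fun z => k z * wt z ^ (-σ)

theorem wt_neg (x : Spc n) : wt (-x) = wt x := by rw [wt, norm_neg, wt]

theorem Dec.nonneg {σ A : ℝ} {φ : Spc n → ℝ} (h : Dec σ A φ) : 0 ≤ A := by
  have h1 := (abs_nonneg _).trans (h.2 0)
  have := Real.rpow_pos_of_pos (wt_pos (0 : Spc n)) (-σ)
  exact nonneg_of_mul_nonneg_left h1 this

theorem cv_eq (k φ : Spc n → ℝ) (x : Spc n) : cv k φ x = ∫ z, k (x - z) * φ z := by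
  rw [cv, ← integral_sub_left_eq_self _ volume x]
  simp

theorem IK.of_bound (hn : 0 < n) {a e C : ℝ} {k : Spc n → ℝ} (hk : Measurable k) (ha : a < n)
    (hae : n < a + e) (hb : ∀ z, |k z| ≤ C * ‖z‖ ^ (-a)) : IK e k := by
  refine ⟨hk, ((integrable_norm_wt hn ha hae).const_mul C).mono' ?_
    (Eventually.of_forall fun z => ?_)⟩
  · have := (continuous_wt (n := n)).measurable
    fun_prop
  · rw [Real.norm_eq_abs, abs_mul, abs_of_nonneg (Real.rpow_nonneg (wt_pos z).le _), ← mul_assoc]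
    exact mul_le_mul_of_nonneg_right (hb z) (Real.rpow_nonneg (wt_pos z).le _)

theorem wt_sub_le (σ : ℝ) (x z : Spc n) :
    wt (x - z) ^ (-σ) ≤ (1 + ‖x‖) ^ |(-σ)| * wt z ^ (-σ) := by
  have := wt_rpow_le (-σ) (-z) (x - z) (r := ‖x‖) (by rw [← norm_neg]; simp)
  rwa [wt_neg] at this

theorem IK.dom {σ : ℝ} {k : Spc n → ℝ} (h : IK σ k) (x : Spc n) :
    Integrable fun z => |k z| * wt (x - z) ^ (-σ) := by
  refine (h.2.abs.const_mul ((1 + ‖x‖) ^ |(-σ)|)).mono' ?_ (Eventually.of_forall fun z => ?_)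
  · have := h.1
    have := (continuous_wt (n := n)).measurable
    fun_prop
  · have hz := Real.rpow_nonneg (wt_pos z).le (-σ)
    have hz' := Real.rpow_nonneg (wt_pos (x - z)).le (-σ)
    rw [Real.norm_eq_abs, abs_mul, abs_abs, abs_of_nonneg hz', abs_mul, abs_of_nonneg hz]
    calc |k z| * wt (x - z) ^ (-σ) ≤ |k z| * ((1 + ‖x‖) ^ |(-σ)| * wt z ^ (-σ)) := by
          gcongr; exact wt_sub_le σ x z
      _ = _ := by ring

theorem IK.integrable {σ A : ℝ} {k φ : Spc n → ℝ} (h : IK σ k) (hφ : Dec σ A φ) (x : Spc n) :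
    Integrable fun z => k z * φ (x - z) := by
  refine ((h.dom x).const_mul A).mono' ?_ (Eventually.of_forall fun z => ?_)
  · have := h.1
    have := hφ.1.measurable
    fun_prop
  · rw [Real.norm_eq_abs, abs_mul]
    calc |k z| * |φ (x - z)| ≤ |k z| * (A * wt (x - z) ^ (-σ)) := by gcongr; exact hφ.2 _
      _ = _ := by ring

theorem hasFDerivAt_cv {σ A : ℝ} {k φ : Spc n → ℝ} (h : IK σ k) (hφ : Dec σ A φ)
    (hd : Differentiable ℝ φ) (hφ' : ∀ i, Dec σ A (pd i φ)) (x : Spc n) :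
    HasFDerivAt (cv k φ) (∑ i, cv k (pd i φ) x • (EuclideanSpace.proj i : Spc n →L[ℝ] ℝ)) x := by
  have hA := hφ.nonneg
  have hm : ∀ {ψ : Spc n → ℝ}, Dec σ A ψ → ∀ x, AEStronglyMeasurable (fun z => k z * ψ (x - z)) :=
    fun hψ x => (h.integrable hψ x).aestronglyMeasurable
  refine (hasFDerivAt_integral_of_dominated_of_fderiv_le (Metric.ball_mem_nhds x one_pos)
    (F := fun x z => k z * φ (x - z))
    (F' := fun x z => ∑ i, (k z * pd i φ (x - z)) • (EuclideanSpace.proj i : Spc n →L[ℝ] ℝ))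
    (bound := fun z => n * (A * 2 ^ |(-σ)|) * (|k z| * wt (x - z) ^ (-σ)))
    (Eventually.of_forall fun x' => hm hφ x') (h.integrable hφ x) ?_
    (Eventually.of_forall fun z x' hx' => ?_) ((h.dom x).const_mul _)
    (Eventually.of_forall fun z x' _ => ?_)).congr_fderiv ?_
  · exact Finset.aestronglyMeasurable_fun_sum _ fun i _ => (hm (hφ' i) x).smul_const _
  · refine (norm_sum_smul_proj_le _).trans ?_
    rw [Metric.mem_ball, dist_eq_norm] at hx'
    have h1 := wt_rpow_le (-σ) (x - z) (x' - z) (r := 1) (by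
      rw [sub_sub_sub_cancel_right, norm_sub_rev]; exact hx'.le)
    norm_num at h1
    calc ∑ i, |k z * pd i φ (x' - z)| ≤ ∑ _i : Fin n, |k z| * (A * (2 ^ |σ| * wt (x - z) ^ (-σ))) := by
          refine Finset.sum_le_sum fun i _ => ?_
          rw [abs_mul]
          gcongr
          exact ((hφ' i).2 _).trans (by gcongr)
      _ = _ := by simp; ring
  · have h1 : HasFDerivAt (fun x => φ (x - z)) (fderiv ℝ φ (x' - z)) x' :=
      ((hd _).hasFDerivAt).comp x' ((hasFDerivAt_id x').sub_const z)
    refine (h1.const_mul (k z)).congr_fderiv ?_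
    rw [fderiv_eq_sum]
    ext v
    simp [Finset.mul_sum, mul_assoc]
  · rw [integral_finsetSum]
    · refine Finset.sum_congr rfl fun i _ => ?_
      rw [integral_smul_const, cv]
    · exact fun i _ => (h.integrable (hφ' i) x).smul_const _

theorem pd_cv {σ A : ℝ} {k φ : Spc n → ℝ} (h : IK σ k) (hφ : Dec σ A φ)
    (hd : Differentiable ℝ φ) (hφ' : ∀ i, Dec σ A (pd i φ)) (i : Fin n) :
    pd i (cv k φ) = cv k (pd i φ) :=
  funext fun x => pd_of_hasFDerivAt_sum (hasFDerivAt_cv h hφ hd hφ' x) i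

/-- A smooth bump function at the origin, equal to one on the unit ball and supported in the ball
of radius two. -/
def bmp (z : Spc n) : ℝ := (⟨1, 2, one_pos, one_lt_two⟩ : ContDiffBump (0 : Spc n)) z

theorem contDiff_bmp : ContDiff ℝ (⊤ : ℕ∞) (bmp (n := n)) := ContDiffBump.contDiff _

theorem bmp_one {z : Spc n} (h : ‖z‖ ≤ 1) : bmp z = 1 :=
  ContDiffBump.one_of_mem_closedBall _ (by simpa using h)

theorem bmp_zero {z : Spc n} (h : 2 ≤ ‖z‖) : bmp z = 0 :=
  ContDiffBump.zero_of_le_dist _ (by simpa using h)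

theorem bmp_mem (z : Spc n) : 0 ≤ bmp z ∧ bmp z ≤ 1 := ⟨ContDiffBump.nonneg _, ContDiffBump.le_one _⟩

theorem hasCompactSupport_bmp : HasCompactSupport (bmp (n := n)) := ContDiffBump.hasCompactSupport _

theorem continuous_pd_bmp (i : Fin n) : Continuous (pd i (bmp (n := n))) :=
  (contDiff_bmp.continuous_fderiv (by simp)).clm_apply continuous_const

theorem hasCompactSupport_pd_bmp (i : Fin n) : HasCompactSupport (pd i (bmp (n := n))) :=
  hasCompactSupport_bmp.fderiv_apply (𝕜 := ℝ) _

theorem pd_bmp_zero {z : Spc n} (h : 2 < ‖z‖) (i : Fin n) : pd i bmp z = 0 := by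
  have : bmp =ᶠ[nhds z] fun _ : Spc n => (0 : ℝ) := by
    filter_upwards [(isOpen_lt continuous_const continuous_norm).mem_nhds h] with y hy
    exact bmp_zero (le_of_lt hy)
  rw [pd, this.fderiv_eq]; simp

theorem pd_bmp_zero' {z : Spc n} (h : ‖z‖ < 1) (i : Fin n) : pd i bmp z = 0 := by
  have : bmp =ᶠ[nhds z] fun _ : Spc n => (1 : ℝ) := by
    filter_upwards [(isOpen_lt continuous_norm continuous_const).mem_nhds h] with y hy
    exact bmp_one (le_of_lt hy)
  rw [pd, this.fderiv_eq]; simp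

theorem exists_pd_bmp_bound : ∃ C : ℝ, 0 ≤ C ∧ ∀ (i : Fin n) (z : Spc n),
    |pd i bmp z| ≤ C ∧ ‖z‖ * |pd i bmp z| ≤ C := by
  choose D hD using fun i : Fin n =>
    (hasCompactSupport_pd_bmp i).exists_bound_of_continuous (continuous_pd_bmp i)
  have hD0 : ∀ i, 0 ≤ D i := fun i => (norm_nonneg _).trans (hD i 0)
  have hS : ∀ i, D i ≤ ∑ i, D i := fun i => Finset.single_le_sum (fun i _ => hD0 i) (Finset.mem_univ i)
  have hS0 : 0 ≤ ∑ i, D i := Finset.sum_nonneg fun i _ => hD0 i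
  refine ⟨2 * ∑ i, D i, by positivity, fun i z => ?_⟩
  have h1 : |pd i bmp z| ≤ ∑ i, D i := (hD i z).trans (hS i)
  refine ⟨by linarith, ?_⟩
  rcases le_or_gt ‖z‖ 2 with h | h
  · gcongr
  · rw [pd_bmp_zero h, abs_zero, mul_zero]; positivity

theorem pd_comp_smul {f : Spc n → ℝ} (hf : Differentiable ℝ f) (r : ℝ) (i : Fin n) (z : Spc n) :
    pd i (fun z => f (r • z)) z = r * pd i f (r • z) := by
  have h1 : HasFDerivAt (fun z => f (r • z))
      ((fderiv ℝ f (r • z)).comp (r • ContinuousLinearMap.id ℝ (Spc n))) z :=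
    (hf _).hasFDerivAt.comp z ((hasFDerivAt_id z).const_smul r)
  rw [pd, h1.fderiv, pd]
  simp

/-- The annular cutoff, equal to one for `2 / m ≤ ‖z‖ ≤ m`. -/
def cut (m : ℕ) (z : Spc n) : ℝ := bmp ((m : ℝ)⁻¹ • z) - bmp ((m : ℝ) • z)

theorem contDiff_cut (m : ℕ) : ContDiff ℝ (⊤ : ℕ∞) (cut (n := n) m) :=
  (contDiff_bmp.comp (contDiff_const_smul _)).sub (contDiff_bmp.comp (contDiff_const_smul _))

theorem abs_cut_le (m : ℕ) (z : Spc n) : |cut m z| ≤ 1 := by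
  have h1 := bmp_mem ((m : ℝ)⁻¹ • z)
  have h2 := bmp_mem ((m : ℝ) • z)
  rw [cut, abs_le]
  constructor <;> linarith [h1.1, h1.2, h2.1, h2.2]

theorem pd_cut (m : ℕ) (i : Fin n) (z : Spc n) : pd i (cut m) z =
    (m : ℝ)⁻¹ * pd i bmp ((m : ℝ)⁻¹ • z) - m * pd i bmp ((m : ℝ) • z) := by
  have hb : Differentiable ℝ (bmp (n := n)) := contDiff_bmp.differentiable (by simp)
  have hs : ∀ r : ℝ, Differentiable ℝ fun z : Spc n => bmp (r • z) := fun r =>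
    hb.comp (differentiable_id.const_smul r)
  rw [← pd_comp_smul hb, ← pd_comp_smul hb]
  unfold pd cut
  rw [fderiv_fun_sub (hs _ z) (hs _ z)]
  rfl

theorem cut_near {m : ℕ} (hm : 1 ≤ m) {z : Spc n} (hz : ‖z‖ < (m : ℝ)⁻¹) : cut m z = 0 := by
  have hm' : (1 : ℝ) ≤ m := by exact_mod_cast hm
  have hm0 : (0 : ℝ) < m := by linarith
  have h1 : (m : ℝ) * ‖z‖ ≤ 1 := by
    calc (m : ℝ) * ‖z‖ ≤ m * (m : ℝ)⁻¹ := by gcongr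
      _ = 1 := mul_inv_cancel₀ hm0.ne'
  have h2 : (m : ℝ)⁻¹ * ‖z‖ ≤ 1 := by
    have : (m : ℝ)⁻¹ ≤ 1 := inv_le_one_of_one_le₀ hm'
    nlinarith [norm_nonneg z]
  rw [cut, bmp_one, bmp_one, sub_self] <;>
  · rw [norm_smul, Real.norm_of_nonneg (by positivity)]; assumption

theorem tendsto_natCast_smul_norm {z : Spc n} (hz : z ≠ 0) :
    Tendsto (fun m : ℕ => ‖(m : ℝ) • z‖) atTop atTop := by
  simp_rw [norm_smul, RCLike.norm_natCast]
  exact tendsto_natCast_atTop_atTop.atTop_mul_const (norm_pos_iff.2 hz)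

theorem tendsto_inv_natCast_smul_norm (z : Spc n) :
    Tendsto (fun m : ℕ => ‖(m : ℝ)⁻¹ • z‖) atTop (nhds 0) := by
  have : Tendsto (fun m : ℕ => (m : ℝ)⁻¹ • z) atTop (nhds ((0 : ℝ) • z)) :=
    tendsto_inv_atTop_nhds_zero_nat.smul_const z
  simpa using this.norm

theorem cut_eventually {z : Spc n} (hz : z ≠ 0) : ∀ᶠ m : ℕ in atTop, cut m z = 1 := by
  filter_upwards [(tendsto_natCast_smul_norm hz).eventually_ge_atTop 2,
    (tendsto_inv_natCast_smul_norm z).eventually_le_const one_pos] with m h1 h2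
  rw [cut, bmp_one h2, bmp_zero h1, sub_zero]

theorem pd_cut_eventually {z : Spc n} (hz : z ≠ 0) (i : Fin n) :
    ∀ᶠ m : ℕ in atTop, pd i (cut m) z = 0 := by
  filter_upwards [(tendsto_natCast_smul_norm hz).eventually_gt_atTop 2,
    (tendsto_inv_natCast_smul_norm z).eventually_lt_const one_pos] with m h1 h2
  rw [pd_cut, pd_bmp_zero' h2, pd_bmp_zero h1]; simp

theorem exists_pd_cut_bound : ∃ C : ℝ, 0 ≤ C ∧ ∀ (m : ℕ) (i : Fin n) (z : Spc n),
    |pd i (cut m) z| * ‖z‖ ≤ C := by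
  obtain ⟨C, hC, h⟩ := exists_pd_bmp_bound (n := n)
  have h1 : ∀ (r : ℝ), 0 ≤ r → ∀ (i : Fin n) (z : Spc n), |r * pd i bmp (r • z)| * ‖z‖ ≤ C := by
    intro r hr i z
    have := (h i (r • z)).2
    rw [norm_smul, Real.norm_of_nonneg hr] at this
    rw [abs_mul, abs_of_nonneg hr]
    linarith
  refine ⟨2 * C, by positivity, fun m i z => ?_⟩
  rw [pd_cut]
  have a := h1 (m : ℝ)⁻¹ (by positivity) i z
  have b := h1 m (by positivity) i z
  have c := mul_le_mul_of_nonneg_right (abs_sub ((m : ℝ)⁻¹ * pd i bmp ((m : ℝ)⁻¹ • z))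
    (m * pd i bmp ((m : ℝ) • z))) (norm_nonneg z)
  linarith

/-- Integration by parts against a kernel cut off near the origin and at infinity. -/
theorem integral_cut_mul {g φ : Spc n → ℝ} (hg : DifferentiableOn ℝ g {0}ᶜ)
    (hφ : Differentiable ℝ φ) (i : Fin n) (x : Spc n)
    (h1 : Integrable fun z => g z * pd i φ (x - z))
    {m : ℕ} (hm : 1 ≤ m)
    (h0 : Integrable fun z => cut m z * g z * φ (x - z))
    (h2 : Integrable fun z => pd i (fun z => cut m z * g z) z * φ (x - z)) :
    ∫ z, cut m z * (g z * pd i φ (x - z)) =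
      ∫ z, pd i (fun z => cut m z * g z) z * φ (x - z) := by
  have hcd : Differentiable ℝ (cut (n := n) m) := (contDiff_cut m).differentiable (by simp)
  have hD : Differentiable ℝ fun z => cut m z * g z := by
    intro z
    rcases eq_or_ne z 0 with rfl | hz
    · have : (fun z : Spc n => cut m z * g z) =ᶠ[nhds 0] fun _ => 0 := by
        filter_upwards [Metric.ball_mem_nhds (0 : Spc n) (ε := (m : ℝ)⁻¹) (by positivity)] with y hy
        rw [cut_near hm (by simpa using hy), zero_mul]
      exact this.differentiableAt_iff.2 (differentiableAt_const _)
    · exact (hcd z).mul ((hg z hz).differentiableAt (isOpen_ne_zero.mem_nhds hz))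
  have hψ : ∀ z, HasFDerivAt (fun z => φ (x - z)) (-fderiv ℝ φ (x - z)) z := fun z =>
    ((hφ _).hasFDerivAt.comp z ((hasFDerivAt_id z).const_sub x)).congr_fderiv (by ext v; simp)
  have e : ∀ z, fderiv ℝ (fun z => φ (x - z)) z (EuclideanSpace.single i 1) = -pd i φ (x - z) :=
    fun z => by rw [(hψ z).fderiv]; rfl
  have h1' : Integrable fun z => cut m z * (g z * pd i φ (x - z)) :=
    h1.bdd_mul (c := 1) (contDiff_cut m).continuous.aestronglyMeasurable
      (Eventually.of_forall fun z => abs_cut_le m z)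
  have key := integral_mul_fderiv_eq_neg_fderiv_mul_of_integrable (μ := volume)
    (f := fun z => cut m z * g z) (g := fun z => φ (x - z)) (v := EuclideanSpace.single i 1) h2
    (by simp_rw [e]; exact h1'.neg.congr (Eventually.of_forall fun z => by simp; ring)) h0
    (fun z _ => hD z) (fun z _ => (hψ z).differentiableAt)
  simp_rw [e] at key
  rw [← neg_inj, ← integral_neg]
  refine Eq.trans (integral_congr_ae (Eventually.of_forall fun z => ?_)) key
  simp only; ring

theorem ae_ne_zero (hn : 0 < n) : ∀ᵐ z : Spc n, z ≠ 0 := by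
  have := nontrivial_spc hn
  simp [ae_iff, measure_singleton]

theorem pd_cut_mul {g : Spc n → ℝ} (hg : DifferentiableOn ℝ g {0}ᶜ) (m : ℕ) (i : Fin n) {z : Spc n}
    (hz : z ≠ 0) :
    pd i (fun z => cut m z * g z) z = cut m z * pd i g z + pd i (cut m) z * g z := by
  have hc : DifferentiableAt ℝ (cut m) z := (contDiff_cut m).differentiable (by simp) z
  have hd := (hg z hz).differentiableAt (isOpen_ne_zero.mem_nhds hz)
  unfold pd
  rw [fderiv_fun_mul hc hd]
  simp only [add_apply, smul_apply, smul_eq_mul]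
  ring

theorem continuous_pd_cut (m : ℕ) (i : Fin n) : Continuous (pd i (cut (n := n) m)) :=
  ((contDiff_cut m).continuous_fderiv (by simp)).clm_apply continuous_const

theorem abs_cut_le_norm {m : ℕ} (hm : 1 ≤ m) (z : Spc n) : |cut m z| ≤ m * ‖z‖ := by
  have hm0 : (0 : ℝ) < m := by exact_mod_cast hm
  rcases lt_or_ge ‖z‖ (m : ℝ)⁻¹ with h | h
  · rw [cut_near hm h, abs_zero]; positivity
  · refine (abs_cut_le m z).trans ?_
    rwa [inv_le_iff_one_le_mul₀' hm0] at h

theorem abs_cut_mul_norm_le {m : ℕ} (hm : 1 ≤ m) (z : Spc n) : |cut m z| * ‖z‖ ≤ 2 * m := by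
  have hm1 : (1 : ℝ) ≤ m := by exact_mod_cast hm
  rcases le_or_gt ‖z‖ (2 * m) with h | h
  · calc |cut m z| * ‖z‖ ≤ 1 * (2 * m) := by gcongr; exact abs_cut_le m z
      _ = _ := one_mul _
  · have h1 : 2 ≤ (m : ℝ)⁻¹ * ‖z‖ := by
      rw [le_inv_mul_iff₀ (by linarith)]; linarith
    have h2 : 2 ≤ m * ‖z‖ := by nlinarith
    rw [cut, bmp_zero, bmp_zero, sub_zero, abs_zero, zero_mul]
    · positivity
    · rwa [norm_smul, RCLike.norm_natCast]
    · rwa [norm_smul, norm_inv, RCLike.norm_natCast]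

theorem exists_abs_pd_cut_le (m : ℕ) : ∃ C : ℝ, ∀ (i : Fin n) (z : Spc n), |pd i (cut m) z| ≤ C := by
  obtain ⟨C, hC, h⟩ := exists_pd_bmp_bound (n := n)
  refine ⟨(m : ℝ)⁻¹ * C + m * C, fun i z => ?_⟩
  rw [pd_cut]
  refine (abs_sub _ _).trans ?_
  rw [abs_mul, abs_mul, abs_of_nonneg (by positivity : (0 : ℝ) ≤ (m : ℝ)⁻¹), Nat.abs_cast]
  gcongr
  · exact (h i _).1
  · exact (h i _).1

theorem integrable_mul_of_weight (hn : 0 < n) {c w F : Spc n → ℝ} {C : ℝ} (hc : Continuous c)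
    (hw : Measurable w) (hw0 : ∀ z ≠ 0, w z ≠ 0) (hb : ∀ z ≠ 0, |c z| ≤ C * |w z|)
    (h : Integrable fun z => w z * F z) : Integrable fun z => c z * F z := by
  have hne := ae_ne_zero hn
  have hm : AEStronglyMeasurable F := by
    refine (hw.inv.aestronglyMeasurable.mul h.aestronglyMeasurable).congr ?_
    filter_upwards [hne] with z hz
    simp only [Pi.mul_apply, Pi.inv_apply]
    rw [inv_mul_cancel_left₀ (hw0 z hz)]
  refine (h.norm.const_mul C).mono' (hc.aestronglyMeasurable.mul hm) ?_
  filter_upwards [hne] with z hz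
  rw [norm_mul, norm_mul, Real.norm_eq_abs, Real.norm_eq_abs, ← mul_assoc]
  exact mul_le_mul_of_nonneg_right (hb z hz) (abs_nonneg _)

theorem integral_cut_mul_eq (hn : 0 < n) {g φ : Spc n → ℝ} (hg : DifferentiableOn ℝ g {0}ᶜ)
    (hφ : Differentiable ℝ φ) (i : Fin n) (x : Spc n)
    (h1 : Integrable fun z => g z * pd i φ (x - z)) {m : ℕ} (hm : 1 ≤ m)
    (h0 : Integrable fun z => cut m z * (g z * φ (x - z)))
    (h2 : Integrable fun z => cut m z * (pd i g z * φ (x - z)))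
    (h3 : Integrable fun z => pd i (cut m) z * (g z * φ (x - z))) :
    ∫ z, cut m z * (g z * pd i φ (x - z)) =
      (∫ z, cut m z * (pd i g z * φ (x - z))) + ∫ z, pd i (cut m) z * (g z * φ (x - z)) := by
  have e0 : (fun z => pd i (fun z => cut m z * g z) z * φ (x - z)) =ᵐ[volume] fun z =>
      cut m z * (pd i g z * φ (x - z)) + pd i (cut m) z * (g z * φ (x - z)) := by
    filter_upwards [ae_ne_zero hn] with z hz
    rw [pd_cut_mul hg m i hz]; ring
  rw [integral_cut_mul hg hφ i x h1 hm (h0.congr (Eventually.of_forall fun z => (mul_assoc _ _ _).symm))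
    ((h2.add h3).congr e0.symm), integral_congr_ae e0, integral_add h2 h3]

theorem tendsto_integral_cut (hn : 0 < n) {F : Spc n → ℝ} (h : Integrable F) :
    Tendsto (fun m : ℕ => ∫ z, cut m z * F z) atTop (nhds (∫ z, F z)) := by
  refine tendsto_integral_of_dominated_convergence (fun z => |F z|)
    (fun m => (contDiff_cut m).continuous.aestronglyMeasurable.mul h.aestronglyMeasurable) h.abs
    (fun m => Eventually.of_forall fun z => ?_) ?_
  · rw [norm_mul, Real.norm_eq_abs, Real.norm_eq_abs]
    exact mul_le_of_le_one_left (abs_nonneg _) (abs_cut_le m z)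
  · filter_upwards [ae_ne_zero hn] with z hz
    refine tendsto_const_nhds.congr' ?_
    filter_upwards [cut_eventually hz] with m hm
    rw [hm, one_mul]

theorem integrable_pd_cut (hn : 0 < n) {F : Spc n → ℝ} (m : ℕ) (i : Fin n)
    (h : Integrable fun z => ‖z‖⁻¹ * F z) : Integrable fun z => pd i (cut m) z * F z := by
  obtain ⟨C, hC, hb⟩ := exists_pd_cut_bound (n := n)
  refine integrable_mul_of_weight hn (C := C) (continuous_pd_cut m i) (w := fun z => ‖z‖⁻¹)
    (by fun_prop) (fun z hz => inv_ne_zero (norm_ne_zero_iff.2 hz)) (fun z hz => ?_) h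
  rw [abs_inv, abs_norm, ← div_eq_mul_inv, le_div_iff₀ (norm_pos_iff.2 hz)]
  exact hb m i z

theorem tendsto_integral_pd_cut (hn : 0 < n) {F : Spc n → ℝ} (i : Fin n)
    (h : Integrable fun z => ‖z‖⁻¹ * F z) :
    Tendsto (fun m : ℕ => ∫ z, pd i (cut m) z * F z) atTop (nhds 0) := by
  obtain ⟨C, hC, hb⟩ := exists_pd_cut_bound (n := n)
  have hne := ae_ne_zero hn
  have := tendsto_integral_of_dominated_convergence (F := fun (m : ℕ) z => pd i (cut m) z * F z)
    (f := fun _ => 0) (μ := volume) (fun z => C * |‖z‖⁻¹ * F z|)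
    (fun m => (integrable_pd_cut hn m i h).aestronglyMeasurable) (h.abs.const_mul C)
    (fun m => ?_) ?_
  · simpa using this
  · filter_upwards [hne] with z hz
    have hz0 := norm_pos_iff.2 hz
    rw [norm_mul, Real.norm_eq_abs, Real.norm_eq_abs, abs_mul, abs_inv, abs_norm]
    calc |pd i (cut m) z| * |F z| = |pd i (cut m) z| * ‖z‖ * (‖z‖⁻¹ * |F z|) := by field_simp
      _ ≤ _ := by gcongr; exact hb m i z
  · filter_upwards [hne] with z hz
    refine tendsto_const_nhds.congr' ?_
    filter_upwards [pd_cut_eventually hz i] with m hm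
    rw [hm, zero_mul]

theorem integral_by_parts (hn : 0 < n) {g φ : Spc n → ℝ} (hg : DifferentiableOn ℝ g {0}ᶜ)
    (hφ : Differentiable ℝ φ) (i : Fin n) (x : Spc n)
    (h1 : Integrable fun z => g z * pd i φ (x - z))
    (h2 : Integrable fun z => pd i g z * φ (x - z))
    (h3 : Integrable fun z => ‖z‖⁻¹ * (g z * φ (x - z))) :
    ∫ z, g z * pd i φ (x - z) = ∫ z, pd i g z * φ (x - z) := by
  have a2 := (tendsto_integral_cut hn h2).add (tendsto_integral_pd_cut hn i h3)
  rw [add_zero] at a2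
  refine tendsto_nhds_unique ((tendsto_integral_cut hn h1).congr' ?_) a2
  filter_upwards [eventually_ge_atTop 1] with m hm
  refine integral_cut_mul_eq hn hg hφ i x h1 hm ?_ ?_ (integrable_pd_cut hn m i h3)
  · refine integrable_mul_of_weight hn (C := 2 * m) (contDiff_cut m).continuous (w := fun z => ‖z‖⁻¹)
      (by fun_prop) (fun z hz => inv_ne_zero (norm_ne_zero_iff.2 hz)) (fun z hz => ?_) h3
    rw [abs_inv, abs_norm, ← div_eq_mul_inv, le_div_iff₀ (norm_pos_iff.2 hz)]
    exact abs_cut_mul_norm_le hm z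
  · exact h2.bdd_mul (c := 1) (contDiff_cut m).continuous.aestronglyMeasurable
      (Eventually.of_forall fun z => abs_cut_le m z)

theorem Bas.dec {c : Cfg} {σ K : ℝ} {F : ℝ → Spc n → ℝ} (h : Bas c σ K F) {t : ℝ}
    (ht : t ∈ Set.Icc 0 c.T) : Dec σ (K * Real.exp (c.β * t)) (F t) :=
  ⟨ContinuousOn.comp_continuous (f := fun x : Spc n => (t, x)) (g := fun p : ℝ × Spc n => F p.1 p.2)
    h.1 (by fun_prop) fun x => ⟨ht, Set.mem_univ _⟩, h.2.1 t ht⟩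

theorem HomKer.ik (hn : 2 ≤ n) {k : Spc n → ℝ} (hk : HomKer k) {σ : ℝ} (hσ : 1 < σ) : IK σ k := by
  obtain ⟨C, -, hb⟩ := hk.bound
  exact IK.of_bound (by omega) hk.measurable (by linarith) (by linarith) hb

theorem HomKer.cv_sup (hn : 2 ≤ n) {k : Spc n → ℝ} (hk : HomKer k) {δ σ : ℝ} (hδ : 1 ≤ δ)
    (hδn : δ < n) (hσ : δ < σ) : ∃ C : ℝ, 0 ≤ C ∧ ∀ (A : ℝ) (φ : Spc n → ℝ), Dec σ A φ →
      ∀ x, |cv k φ x| ≤ C * A * wt x ^ (-(δ - 1)) := by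
  obtain ⟨C, hC, hb⟩ := hk.bound
  obtain ⟨M, hM, hw⟩ := weight_conv (n := n) (by omega) (a := n - 1) (b := δ - 1) (σ := σ)
    (by linarith) (by linarith) (by linarith) (by linarith) (by linarith)
  refine ⟨C * M, by positivity, fun A φ hφ x => ?_⟩
  have hA := hφ.nonneg
  rw [cv_eq]
  rw [← Real.norm_eq_abs]
  refine (norm_integral_le_of_norm_le ((hw x).1.const_mul (C * A)) (Eventually.of_forall fun z => ?_)).trans ?_
  · rw [norm_mul, Real.norm_eq_abs, Real.norm_eq_abs]
    calc |k (x - z)| * |φ z| ≤ (C * ‖x - z‖ ^ (-((n : ℝ) - 1))) * (A * wt z ^ (-σ)) := by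
          gcongr
          · exact hb _
          · exact hφ.2 z
      _ = _ := by ring
  · rw [integral_const_mul]
    calc C * A * ∫ z, ‖x - z‖ ^ (-((n : ℝ) - 1)) * wt z ^ (-σ) ≤ C * A * (M * wt x ^ (-(δ - 1))) := by
          gcongr; exact (hw x).2
      _ = _ := by ring

theorem IK.integrable' {σ A : ℝ} {k φ : Spc n → ℝ} (h : IK σ k) (hφ : Dec σ A φ) (x : Spc n) :
    Integrable fun z => k (x - z) * φ z := by
  have := (h.integrable hφ x).comp_sub_left x
  simpa using this

theorem cv_sub {σ A B : ℝ} {k φ ψ : Spc n → ℝ} (h : IK σ k) (hφ : Dec σ A φ) (hψ : Dec σ B ψ)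
    (x : Spc n) : cv k (fun y => φ y - ψ y) x = cv k φ x - cv k ψ x := by
  unfold cv
  rw [← integral_sub (h.integrable hφ x) (h.integrable hψ x)]
  simp only [mul_sub]

theorem HomKer.cv_holder (hn : 2 ≤ n) {k : Spc n → ℝ} (hk : HomKer k) {δ σ l : ℝ} (hδ : 1 ≤ δ)
    (hδn : δ < n) (hσ : δ < σ) (hl0 : 0 < l) (hl1 : l < 1) : ∃ C : ℝ, 0 ≤ C ∧
      ∀ (A : ℝ) (φ : Spc n → ℝ), Dec σ A φ → ∀ x y, ‖x - y‖ ≤ wt x / 4 →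
        |cv k φ x - cv k φ y| ≤ C * A * ‖x - y‖ ^ l * wt x ^ (-(δ - 1 + l)) := by
  obtain ⟨C, hC, hb⟩ := hk.holder hn hl0 hl1
  obtain ⟨M, hM, hw⟩ := weight_conv (n := n) (by omega) (a := n - 1 + l) (b := δ - 1 + l) (σ := σ)
    (by linarith) (by linarith) (by linarith) (by linarith) (by linarith)
  refine ⟨C * M * (1 + 2 ^ |-(δ - 1 + l)|), by positivity, fun A φ hφ x y hxy => ?_⟩
  have hA := hφ.nonneg
  have hik := hk.ik hn (lt_of_le_of_lt hδ hσ)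
  have hwy := wt_rpow_near (-(δ - 1 + l)) x y hxy
  rw [cv_eq, cv_eq, ← integral_sub (hik.integrable' hφ x) (hik.integrable' hφ y)]
  rw [← Real.norm_eq_abs]
  refine (norm_integral_le_of_norm_le (((hw x).1.add (hw y).1).const_mul (C * A * ‖x - y‖ ^ l))
    (Eventually.of_forall fun z => ?_)).trans ?_
  · rw [← sub_mul, norm_mul, Real.norm_eq_abs, Real.norm_eq_abs]
    have h1 := hb (x - z) (y - z)
    rw [sub_sub_sub_cancel_right] at h1
    calc |k (x - z) - k (y - z)| * |φ z| ≤ (C * ‖x - y‖ ^ l * (‖x - z‖ ^ (-((n : ℝ) - 1 + l)) +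
          ‖y - z‖ ^ (-((n : ℝ) - 1 + l)))) * (A * wt z ^ (-σ)) := by
          gcongr
          exact hφ.2 z
      _ = _ := by simp only [Pi.add_apply]; ring
  · rw [integral_const_mul]
    simp only [Pi.add_apply]
    rw [integral_add (hw x).1 (hw y).1]
    calc _ ≤ C * A * ‖x - y‖ ^ l * (M * wt x ^ (-(δ - 1 + l)) + M * (2 ^ |-(δ - 1 + l)| *
          wt x ^ (-(δ - 1 + l)))) := by
          gcongr
          · exact (hw x).2
          · exact (hw y).2.trans (by gcongr)
      _ = _ := by ring

theorem JC.cv {c : Cfg} {σ K : ℝ} {k : Spc n → ℝ} (hk : IK σ k) {F : ℝ → Spc n → ℝ}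
    (h : Bas c σ K F) : JC c.T fun t => cv k (F t) := by
  have hc := JC.clampT c.hT.le h.1
  have hK := h.nonneg
  set A := K * Real.exp (c.β * c.T) with hA
  have hA0 : 0 ≤ A := by positivity
  have hb : ∀ t y, |NSdeRham.clampT c.T F t y| ≤ A * wt y ^ (-σ) := fun t y => by
    refine (h.2.1 _ (clamp_mem c.hT.le t) y).trans ?_
    have := c.hβ
    have := (clamp_mem c.hT.le t).2
    have := Real.rpow_nonneg (wt_pos y).le (-σ)
    rw [hA]
    gcongr
  have key : Continuous fun p : ℝ × Spc n => NSdeRham.cv k (NSdeRham.clampT c.T F p.1) p.2 := by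
    refine continuous_iff_continuousAt.2 fun p => ?_
    refine continuousAt_of_dominated (bound := fun z => A * 2 ^ |(-σ)| * (|k z| * wt (p.2 - z) ^ (-σ)))
      (Eventually.of_forall fun q => ?_) ?_ ((hk.dom p.2).const_mul _) (Eventually.of_forall fun z => ?_)
    · have hm : Measurable fun z => NSdeRham.clampT c.T F q.1 (q.2 - z) :=
        (hc.comp (by fun_prop : Continuous fun z : Spc n => (q.1, q.2 - z))).measurable
      exact (hk.1.mul hm).aestronglyMeasurable
    · filter_upwards [Metric.ball_mem_nhds p one_pos] with q hq
      have hq' : ‖p.2 - q.2‖ ≤ 1 := by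
        rw [← dist_eq_norm, dist_comm]
        exact (le_max_right _ _).trans (le_of_lt (Metric.mem_ball.1 hq))
      refine Eventually.of_forall fun z => ?_
      have h1 := wt_rpow_le (-σ) (p.2 - z) (q.2 - z) (r := 1) (by rwa [sub_sub_sub_cancel_right])
      rw [one_add_one_eq_two] at h1
      rw [norm_mul, Real.norm_eq_abs, Real.norm_eq_abs]
      calc |k z| * |NSdeRham.clampT c.T F q.1 (q.2 - z)|
          ≤ |k z| * (A * (2 ^ |(-σ)| * wt (p.2 - z) ^ (-σ))) := by
            gcongr
            exact (hb _ _).trans (by gcongr)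
        _ = _ := by ring
    · have : Continuous fun q : ℝ × Spc n => k z * NSdeRham.clampT c.T F q.1 (q.2 - z) :=
        continuous_const.mul (hc.comp (by fun_prop : Continuous fun q : ℝ × Spc n => (q.1, q.2 - z)))
      exact this.continuousAt
  refine key.continuousOn.congr fun p hp => ?_
  simp only [clampT_eq hp.1]

theorem Bas.cv (hn : 2 ≤ n) {k : Spc n → ℝ} (hk : HomKer k) {δ σ l : ℝ} (hδ : 1 ≤ δ)
    (hδn : δ < n) (hσ : δ < σ) (hl0 : 0 < l) (hl1 : l < 1) : ∃ C : ℝ, 0 ≤ C ∧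
      ∀ (c : Cfg) (K : ℝ) (F : ℝ → Spc n → ℝ), c.lam = l → Bas c σ K F →
        Bas c (δ - 1) (C * K) (fun t => cv k (F t)) := by
  obtain ⟨C, hC, h1⟩ := hk.cv_sup hn hδ hδn hσ
  obtain ⟨D, hD, h2⟩ := hk.cv_holder hn hδ hδn hσ hl0 hl1
  refine ⟨C + D, by positivity, fun c K F hcl h => ⟨JC.cv (hk.ik hn (lt_of_le_of_lt hδ hσ)) h, fun t ht x => ?_, fun hh => ⟨fun t ht x y hxy => ?_, fun t ht t' ht' x => ?_⟩⟩⟩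
  · have hK := h.nonneg
    have := Real.rpow_nonneg (wt_pos x).le (-(δ - 1))
    refine (h1 _ _ (h.dec ht) x).trans ?_
    calc C * (K * Real.exp (c.β * t)) * wt x ^ (-(δ - 1))
        ≤ (C + D) * (K * Real.exp (c.β * t)) * wt x ^ (-(δ - 1)) := by gcongr; linarith
      _ = _ := by ring
  · have hK := h.nonneg
    have := c.hβ
    have := ht.2
    have := Real.rpow_nonneg (wt_pos x).le (-(δ - 1 + l))
    rw [hcl]
    refine (h2 _ _ (h.dec ht) x y hxy).trans ?_
    calc D * (K * Real.exp (c.β * t)) * ‖x - y‖ ^ l * wt x ^ (-(δ - 1 + l))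
        ≤ (C + D) * (K * Real.exp (c.β * c.T)) * ‖x - y‖ ^ l * wt x ^ (-(δ - 1 + l)) := by
          gcongr; linarith
      _ = _ := by ring
  · have hK := h.nonneg
    have := Real.rpow_nonneg (wt_pos x).le (-(δ - 1))
    rw [← cv_sub (hk.ik hn (lt_of_le_of_lt hδ hσ)) (h.dec ht) (h.dec ht') x]
    refine (h1 (K * Real.exp (c.β * c.T) * |t - t'| ^ (c.lam / 2)) _
      ⟨(h.dec ht).1.sub (h.dec ht').1, (h.2.2 hh).2 t ht t' ht'⟩ x).trans ?_
    calc C * (K * Real.exp (c.β * c.T) * |t - t'| ^ (c.lam / 2)) * wt x ^ (-(δ - 1))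
        ≤ (C + D) * (K * Real.exp (c.β * c.T) * |t - t'| ^ (c.lam / 2)) * wt x ^ (-(δ - 1)) := by
          gcongr; linarith
      _ = _ := by ring

theorem HomKer.mul_coord_cv (hn : 2 ≤ n) {k φ : Spc n → ℝ} (hk : HomKer k) {σ A B : ℝ} (hσ : 1 < σ)
    (hφ : Dec σ A φ) (hd : Differentiable ℝ φ) (i a : Fin n) (hφ' : Dec (σ + 1) B (pd i φ))
    (hφa : Dec σ B fun y => y a * pd i φ y) (x : Spc n) :
    x a * cv k (pd i φ) x = cv (NSdeRham.kerD i a k) φ x + cv k (fun y => y a * pd i φ y) x := by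
  have hn0 : 0 < n := by omega
  obtain ⟨C, hC, hb⟩ := hk.bound
  have hkm := hk.measurable
  have hg : DifferentiableOn ℝ (fun z : Spc n => z a * k z) {0}ᶜ :=
    (hk.mul_coord_smooth a).differentiableOn (by simp)
  have ha : Measurable fun z : Spc n => z a := (differentiable_coord a).continuous.measurable
  have i1 : IK (σ + 1) fun z : Spc n => z a * k z := by
    refine IK.of_bound hn0 (a := n - 2) (C := C) (ha.mul hkm) (by linarith)
      (by linarith) fun z => ?_
    rcases eq_or_ne z 0 with rfl | hz
    · simp only [hk.zero, mul_zero, abs_zero]; positivity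
    · rw [abs_mul]
      calc |z a| * |k z| ≤ ‖z‖ * (C * ‖z‖ ^ (-((n : ℝ) - 1))) := by
            gcongr
            · exact abs_coord_le a z
            · exact hb z
        _ = C * ‖z‖ ^ (-((n : ℝ) - 1) + 1) := by
            rw [Real.rpow_add_one (norm_ne_zero_iff.2 hz)]; ring
        _ = _ := by congr 2; ring
  have i3 : IK σ fun z : Spc n => ‖z‖⁻¹ * (z a * k z) := by
    refine IK.of_bound hn0 (a := n - 1) (C := C) (by fun_prop) (by linarith)
      (by linarith) fun z => ?_
    rw [abs_mul, abs_mul, abs_inv, abs_norm, ← mul_assoc]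
    refine (mul_le_of_le_one_left (abs_nonneg _) ?_).trans (hb z)
    rcases eq_or_ne z 0 with rfl | hz
    · simp
    · rw [inv_mul_le_iff₀ (norm_pos_iff.2 hz), mul_one]; exact abs_coord_le a z
  have e2 : (fun z => NSdeRham.kerD i a k z * φ (x - z)) =ᵐ[volume]
      fun z => pd i (fun z => z a * k z) z * φ (x - z) := by
    filter_upwards [ae_ne_zero hn0] with z hz
    rw [NSdeRham.kerD, if_neg hz]
  have i2 := ((hk.kerD i a).ik hn hσ).integrable hφ x
  have ibp := integral_by_parts hn0 hg hd i x (i1.integrable hφ' x) (i2.congr e2)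
    ((i3.integrable hφ x).congr (Eventually.of_forall fun z => by simp only; ring))
  unfold cv
  rw [integral_congr_ae e2, ← ibp, ← integral_add (i1.integrable hφ' x)
    ((hk.ik hn hσ).integrable hφa x), ← integral_const_mul]
  refine integral_congr_ae (Eventually.of_forall fun z => ?_)
  simp only [PiLp.sub_apply]
  ring

theorem Cl.dec {c : Cfg} {N : ℕ} {σ K : ℝ} {F : ℝ → Spc n → ℝ} (h : Cl c N σ K F) {t : ℝ}
    (ht : t ∈ Set.Icc 0 c.T) : Dec σ (K * Real.exp (c.β * t)) (F t) := h.bas.dec ht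

theorem Dec.mono {σ σ' A : ℝ} {φ : Spc n → ℝ} (h : Dec σ A φ) (hσ : σ' ≤ σ) : Dec σ' A φ := by
  have hA := h.nonneg
  refine ⟨h.1, fun y => (h.2 y).trans ?_⟩
  have := one_le_wt y
  gcongr

theorem Cl.pd_cv (hn : 2 ≤ n) {c : Cfg} {N : ℕ} {σ K : ℝ} {k : Spc n → ℝ} (hk : HomKer k)
    (hσ : 1 < σ) {F : ℝ → Spc n → ℝ} (h : Cl c (N + 1) σ K F) {t : ℝ} (ht : t ∈ Set.Icc 0 c.T) :
    Differentiable ℝ (cv k (F t)) ∧ ∀ i, NSdeRham.pd i (cv k (F t)) = cv k (NSdeRham.pd i (F t)) := by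
  have h' : ∀ i, Dec σ _ (NSdeRham.pd i (F t)) := fun i => ((h.2.2 i).dec ht).mono (by linarith)
  exact ⟨fun x => (hasFDerivAt_cv (hk.ik hn hσ) (h.dec ht) (h.2.1 t ht) h' x).differentiableAt,
    fun i => NSdeRham.pd_cv (hk.ik hn hσ) (h.dec ht) (h.2.1 t ht) h' i⟩

theorem Cl.cv (hn : 2 ≤ n) {δ l : ℝ} (hδ : 1 ≤ δ) (hδn : δ < n) (hl0 : 0 < l) (hl1 : l < 1) (N : ℕ)
    {σ : ℝ} (hσ : δ < σ) {k : Spc n → ℝ} (hk : HomKer k) : ∃ C : ℝ, 0 ≤ C ∧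
      ∀ (c : Cfg) (K : ℝ) (F : ℝ → Spc n → ℝ), c.lam = l → Cl c N σ K F →
        Cl c N (δ - 1) (C * K) (fun t => cv k (F t)) := by
  induction N generalizing σ k with
  | zero => exact Bas.cv hn hk hδ hδn hσ hl0 hl1
  | succ N ih =>
    obtain ⟨C₀, hC₀, h₀⟩ := Bas.cv hn hk hδ hδn hσ hl0 hl1
    obtain ⟨C₁, hC₁, h₁⟩ := ih hσ hk
    choose D hD h₂ using fun i a => ih hσ (hk.kerD i a)
    obtain ⟨C₂, hC₂, h₃⟩ := Cl.coord_mul (n := n) N (σ + 1)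
    obtain ⟨C₃, hC₃, h₄⟩ := Cl.of_coord (n := n) N (δ - 1)
    set S := ∑ i, ∑ a, D i a with hS
    have hSD : ∀ i a, D i a ≤ S := fun i a =>
      (Finset.single_le_sum (f := D i) (fun a _ => hD i a) (Finset.mem_univ a)).trans
        (Finset.single_le_sum (f := fun i => ∑ a, D i a)
          (fun i _ => Finset.sum_nonneg fun a _ => hD i a) (Finset.mem_univ i))
    have hS0 : 0 ≤ S := Finset.sum_nonneg fun i _ => Finset.sum_nonneg fun a _ => hD i a
    set E := C₁ + S + C₁ * C₂ with hE
    have hE0 : 0 ≤ E := by positivity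
    refine ⟨C₀ + C₃ * E, by positivity, fun c K F hc h => ⟨?_, fun t ht => (h.pd_cv hn hk
      (lt_of_le_of_lt hδ hσ) ht).1, fun i => ?_⟩⟩
    · have hK := h.nonneg
      refine (h₀ c K F hc h.bas).mono le_rfl ?_
      gcongr
      linarith [mul_nonneg hC₃ hE0]
    · have hK := h.nonneg
      have hσ1 := lt_of_le_of_lt hδ hσ
      have hpd := h.2.2 i
      have key : Cl c N (δ - 1 + 1) (C₃ * (E * K)) fun t => NSdeRham.cv k (NSdeRham.pd i (F t)) := by
        refine h₄ c (E * K) _ ((h₁ c K _ hc (hpd.mono (by linarith) le_rfl)).mono le_rfl ?_) fun a => ?_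
        · rw [hE]; gcongr; linarith [mul_nonneg hC₁ hC₂]
        · have hx := h₃ c K a _ hpd
          rw [add_sub_cancel_right] at hx
          refine (((h₂ i a c K F hc h.drop).add (h₁ c (C₂ * K) _ hc hx)).mono le_rfl ?_).congr
            fun t ht => funext fun x => ?_
          · have := hSD i a
            calc D i a * K + C₁ * (C₂ * K) = (D i a + C₁ * C₂) * K := by ring
              _ ≤ E * K := by rw [hE]; gcongr; linarith
          · exact hk.mul_coord_cv hn hσ1 (h.dec ht) (h.2.1 t ht) i a
              (B := max (K * Real.exp (c.β * t)) (C₂ * K * Real.exp (c.β * t)))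
              ⟨(hpd.dec ht).1, fun y => ((hpd.dec ht).2 y).trans (by
                have := Real.rpow_nonneg (wt_pos y).le (-(σ + 1))
                gcongr; exact le_max_left _ _)⟩
              ⟨(hx.dec ht).1, fun y => ((hx.dec ht).2 y).trans (by
                have := Real.rpow_nonneg (wt_pos y).le (-σ)
                gcongr; exact le_max_right _ _)⟩ x
      refine (key.mono le_rfl ?_).congr fun t ht => (h.pd_cv hn hk hσ1 ht).2 i
      calc C₃ * (E * K) = C₃ * E * K := by ring
        _ ≤ _ := by gcongr; linarith

theorem TD.abs_sub_le {T : ℝ} {v v' : ℝ → Spc n → ℝ} (h : TD T v v') {x : Spc n} {A : ℝ}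
    (hA : ∀ t ∈ Set.Icc 0 T, |v' t x| ≤ A) {t t' : ℝ} (ht : t ∈ Set.Icc 0 T)
    (ht' : t' ∈ Set.Icc 0 T) : |v t' x - v t x| ≤ A * |t' - t| := by
  have := (convex_Icc 0 T).norm_image_sub_le_of_norm_hasDerivWithin_le (𝕜 := ℝ)
    (f := fun τ => v τ x) (f' := fun τ => v' τ x) (fun τ hτ => h x τ hτ) hA ht ht'
  simpa using this

theorem TD.cv {c : Cfg} {σ K K' : ℝ} {k : Spc n → ℝ} (hk : IK σ k) {F F' : ℝ → Spc n → ℝ}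
    (hF : Bas c σ K F) (hF' : Bas c σ K' F') (h : TD c.T F F') :
    TD c.T (fun t => cv k (F t)) fun t => cv k (F' t) := by
  intro x t ht
  have hK := hF'.nonneg
  set A := K' * Real.exp (c.β * c.T) with hA
  have hb : ∀ t ∈ Set.Icc 0 c.T, ∀ y, |F' t y| ≤ A * wt y ^ (-σ) := fun t ht y => by
    refine (hF'.2.1 t ht y).trans ?_
    have := c.hβ
    have := ht.2
    have := Real.rpow_nonneg (wt_pos y).le (-σ)
    rw [hA]
    gcongr
  have hA0 : 0 ≤ A := by positivity
  rw [hasDerivWithinAt_iff_tendsto_slope]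
  have e : ∀ᶠ t' in nhdsWithin t (Set.Icc 0 c.T \ {t}),
      ∫ z, k z * ((t' - t)⁻¹ * (F t' (x - z) - F t (x - z))) =
        slope (fun τ => NSdeRham.cv k (F τ) x) t t' := by
    filter_upwards [self_mem_nhdsWithin] with t' ht'
    rw [slope_def_field, div_eq_inv_mul, ← cv_sub hk (hF.dec ht'.1) (hF.dec ht), NSdeRham.cv,
      ← integral_const_mul]
    refine integral_congr_ae (Eventually.of_forall fun z => ?_)
    simp only; ring
  refine Tendsto.congr' e (tendsto_integral_filter_of_dominated_convergence
    (fun z => A * (|k z| * wt (x - z) ^ (-σ))) ?_ ?_ ((hk.dom x).const_mul A) ?_)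
  · filter_upwards [self_mem_nhdsWithin] with t' ht'
    have h1 := (hF.dec ht'.1).1.measurable
    have h2 := (hF.dec ht).1.measurable
    have h3 := hk.1
    exact Measurable.aestronglyMeasurable (by fun_prop)
  · filter_upwards [self_mem_nhdsWithin] with t' ht'
    refine Eventually.of_forall fun z => ?_
    have hne : 0 < |t' - t| := abs_pos.2 (sub_ne_zero.2 ht'.2)
    have h1 := h.abs_sub_le (x := x - z) (fun τ hτ => hb τ hτ (x - z)) ht ht'.1
    rw [norm_mul, norm_mul, Real.norm_eq_abs, Real.norm_eq_abs, Real.norm_eq_abs, abs_inv]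
    have h2 : |t' - t|⁻¹ * |F t' (x - z) - F t (x - z)| ≤ A * wt (x - z) ^ (-σ) := by
      rw [inv_mul_le_iff₀ hne]; linarith
    calc |k z| * (|t' - t|⁻¹ * |F t' (x - z) - F t (x - z)|) ≤ |k z| * (A * wt (x - z) ^ (-σ)) := by
          gcongr
      _ = _ := by ring
  · refine Eventually.of_forall fun z => ?_
    have h1 := h (x - z) t ht
    rw [hasDerivWithinAt_iff_tendsto_slope] at h1
    refine (h1.congr fun t' => ?_).const_mul (k z)
    rw [slope_def_field, div_eq_inv_mul]

theorem Pr.cv (hn : 2 ≤ n) {δ l : ℝ} (hδ : 1 ≤ δ) (hδn : δ < n) (hl0 : 0 < l) (hl1 : l < 1)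
    (r m : ℕ) {σ : ℝ} (hσ : δ < σ) {k : Spc n → ℝ} (hk : HomKer k) : ∃ C : ℝ, 0 ≤ C ∧
      ∀ (c : Cfg) (K : ℝ) (F : ℝ → Spc n → ℝ), c.lam = l → Pr c r m σ K F →
        Pr c r m (δ - 1) (C * K) (fun t => cv k (F t)) := by
  induction r with
  | zero => exact Cl.cv hn hδ hδn hl0 hl1 m hσ hk
  | succ r ih =>
    obtain ⟨C, hC, h₀⟩ := Cl.cv hn hδ hδn hl0 hl1 (2 * (r + 1) + m) hσ hk
    obtain ⟨D, hD, h₁⟩ := ih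
    refine ⟨C + D, by positivity, fun c K F hc h => ?_⟩
    have hK := h.nonneg
    obtain ⟨hF, F', hFF', hF'⟩ := h
    refine ⟨(h₀ c K F hc hF).mono le_rfl ?_, _, TD.cv (hk.ik hn (lt_of_le_of_lt hδ hσ)) hF.bas
      hF'.cl.bas hFF', (h₁ c K F' hc hF').mono le_rfl le_rfl ?_⟩
    · gcongr; linarith
    · gcongr; linarith

/-- The kernel `x_i / ‖x‖ ^ n`, proportional to the gradient of the Newtonian kernel. -/
def gradKer (i : Fin n) (z : Spc n) : ℝ := z i * ‖z‖ ^ (-(n : ℝ))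

theorem hasFDerivAt_comp_norm_sq {g : ℝ → ℝ} {g' : ℝ} {z : Spc n} (h : HasDerivAt g g' (‖z‖ ^ 2)) :
    HasFDerivAt (fun z => g (‖z‖ ^ 2)) (g' • (2 • (innerSL ℝ z))) z :=
  h.comp_hasFDerivAt z (hasStrictFDerivAt_norm_sq z).hasFDerivAt

theorem pd_comp_norm_sq {g : ℝ → ℝ} {g' : ℝ} {z : Spc n} (h : HasDerivAt g g' (‖z‖ ^ 2)) (i : Fin n) :
    pd i (fun z => g (‖z‖ ^ 2)) z = 2 * z i * g' := by
  rw [pd, (hasFDerivAt_comp_norm_sq h).fderiv]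
  simp [EuclideanSpace.inner_single_right]
  ring

theorem sq_rpow_half {r : ℝ} (hr : 0 ≤ r) (p : ℝ) : (r ^ 2) ^ (p / 2) = r ^ p := by
  rw [← Real.rpow_natCast, ← Real.rpow_mul hr]
  congr 1
  push_cast
  ring

theorem norm_rpow_eq (p : ℝ) : (fun z : Spc n => ‖z‖ ^ p) = fun z => (‖z‖ ^ 2) ^ (p / 2) :=
  funext fun z => (sq_rpow_half (norm_nonneg z) p).symm

theorem hasDerivAt_rpow_half (p : ℝ) {z : Spc n} (hz : z ≠ 0) :
    HasDerivAt (fun u : ℝ => u ^ (p / 2)) (p / 2 * ‖z‖ ^ (p - 2)) (‖z‖ ^ 2) := by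
  have h0 : 0 < ‖z‖ ^ 2 := by have := norm_pos_iff.2 hz; positivity
  have := Real.hasDerivAt_rpow_const (x := ‖z‖ ^ 2) (p := p / 2) (Or.inl h0.ne')
  rwa [show p / 2 - 1 = (p - 2) / 2 by ring, sq_rpow_half (norm_nonneg z)] at this

theorem pd_norm_rpow (p : ℝ) {z : Spc n} (hz : z ≠ 0) (i : Fin n) :
    pd i (fun z : Spc n => ‖z‖ ^ p) z = p * (z i * ‖z‖ ^ (p - 2)) := by
  rw [norm_rpow_eq, pd_comp_norm_sq (hasDerivAt_rpow_half p hz)]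
  ring

theorem differentiableAt_norm_rpow (p : ℝ) {z : Spc n} (hz : z ≠ 0) :
    DifferentiableAt ℝ (fun z : Spc n => ‖z‖ ^ p) z := by
  rw [norm_rpow_eq]
  exact (hasFDerivAt_comp_norm_sq (hasDerivAt_rpow_half p hz)).differentiableAt

theorem exists_lapKer_grad (hn : 2 ≤ n) : ∃ c : ℝ, ∀ z ≠ 0, DifferentiableAt ℝ (lapKer n) z ∧
    ∀ i, pd i (lapKer n) z = c * gradKer i z := by
  rcases eq_or_ne n 2 with rfl | h2
  · refine ⟨1 / Real.pi, fun z hz => ?_⟩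
    have h0 : 0 < ‖z‖ ^ 2 := by have := norm_pos_iff.2 hz; positivity
    have e : lapKer 2 = fun z => (fun u : ℝ => 1 / Real.pi * (1 / 2 * Real.log u)) (‖z‖ ^ 2) := by
      funext z
      simp only [lapKer, if_pos, Real.log_pow]
      push_cast; ring
    have hd : HasDerivAt (fun u : ℝ => 1 / Real.pi * (1 / 2 * Real.log u))
        (1 / Real.pi * (1 / 2 * (‖z‖ ^ 2)⁻¹)) (‖z‖ ^ 2) :=
      ((Real.hasDerivAt_log h0.ne').const_mul _).const_mul _
    rw [e]
    refine ⟨(hasFDerivAt_comp_norm_sq hd).differentiableAt, fun i => ?_⟩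
    rw [pd_comp_norm_sq hd, gradKer, Real.rpow_neg (norm_nonneg z)]
    norm_num
    ring
  · have h2' : (2 : ℝ) - n ≠ 0 := by
      have : (n : ℝ) ≠ 2 := by exact_mod_cast h2
      intro h; apply this; linarith
    refine ⟨1 / sphArea n, fun z hz => ?_⟩
    have e : lapKer n = fun z => (fun u : ℝ => u ^ ((2 - (n : ℝ)) / 2) / (sphArea n * (2 - (n : ℝ))))
        (‖z‖ ^ 2) := by
      funext z
      simp only [lapKer, if_neg h2, sq_rpow_half (norm_nonneg z)]
    have hd := (hasDerivAt_rpow_half (2 - (n : ℝ)) hz).div_const (sphArea n * (2 - (n : ℝ)))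
    rw [e]
    refine ⟨(hasFDerivAt_comp_norm_sq hd).differentiableAt, fun i => ?_⟩
    rw [pd_comp_norm_sq hd, gradKer, show 2 - (n : ℝ) - 2 = -n by ring]
    rcases eq_or_ne (sphArea n) 0 with hs | hs
    · simp [hs]
    · field_simp

theorem contDiffAt_norm_rpow (p : ℝ) {z : Spc n} (hz : z ≠ 0) :
    ContDiffAt ℝ (⊤ : ℕ∞) (fun z : Spc n => ‖z‖ ^ p) z :=
  (contDiffAt_norm ℝ hz).rpow_const_of_ne (norm_ne_zero_iff.2 hz)

theorem gradKer_hom (i : Fin n) : HomKer (gradKer i) where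
  zero := by simp [gradKer]
  smooth := fun z hz => ((EuclideanSpace.proj i : Spc n →L[ℝ] ℝ).contDiff.contDiffAt.mul
    (contDiffAt_norm_rpow _ hz)).contDiffWithinAt
  hom r z hr hz := by
    rw [gradKer, gradKer, norm_smul, Real.norm_of_nonneg hr.le, Real.mul_rpow hr.le (norm_nonneg z),
      show 1 - (n : ℝ) = -n + 1 by ring, Real.rpow_add_one hr.ne', PiLp.smul_apply, smul_eq_mul]
    ring

theorem pd_coord' (i : Fin n) (z : Spc n) : pd i (fun z : Spc n => z i) z = 1 := by
  have : HasFDerivAt (fun z : Spc n => z i) (EuclideanSpace.proj i : Spc n →L[ℝ] ℝ) z :=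
    (EuclideanSpace.proj i : Spc n →L[ℝ] ℝ).hasFDerivAt
  rw [pd, this.fderiv]
  simp

theorem sum_pd_gradKer {z : Spc n} (hz : z ≠ 0) : ∑ i, pd i (gradKer i) z = 0 := by
  have h0 := norm_pos_iff.2 hz
  have e : ∀ i, pd i (gradKer i) z = ‖z‖ ^ (-(n : ℝ)) - n * (z i ^ 2 * ‖z‖ ^ (-(n : ℝ) - 2)) := by
    intro i
    have h1 := pd_norm_rpow (-(n : ℝ)) hz i
    have h2 := pd_coord' i z
    unfold pd at h1 h2 ⊢
    unfold gradKer
    rw [fderiv_fun_mul (differentiable_coord i z) (differentiableAt_norm_rpow _ hz)]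
    simp only [add_apply, smul_apply, smul_eq_mul]
    rw [h1, h2]; ring
  simp only [e]
  rw [Finset.sum_sub_distrib, Finset.sum_const, ← Finset.mul_sum, ← Finset.sum_mul, Finset.card_univ,
    Fintype.card_fin, nsmul_eq_mul, ← EuclideanSpace.real_norm_sq_eq, ← Real.rpow_natCast,
    ← Real.rpow_add h0]
  norm_num

theorem IK.of_bound_add (hn : 0 < n) {a b e C : ℝ} {k : Spc n → ℝ} (hk : Measurable k) (ha : a < n)
    (hb : b < n) (hae : n < a + e) (hbe : n < b + e)
    (h : ∀ z, |k z| ≤ C * (‖z‖ ^ (-a) + ‖z‖ ^ (-b))) : IK e k := by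
  refine ⟨hk, (((integrable_norm_wt hn ha hae).add (integrable_norm_wt hn hb hbe)).const_mul
    C).mono' ?_ (Eventually.of_forall fun z => ?_)⟩
  · have := (continuous_wt (n := n)).measurable
    fun_prop
  · have hw := Real.rpow_nonneg (wt_pos z).le (-e)
    rw [Real.norm_eq_abs, abs_mul, abs_of_nonneg hw]
    refine (mul_le_mul_of_nonneg_right (h z) hw).trans_eq ?_
    simp only [Pi.add_apply]
    ring

theorem measurable_lapKer : Measurable (lapKer n) := by
  unfold lapKer
  split_ifs
  · exact (Real.measurable_log.comp measurable_norm).const_mul _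
  · fun_prop

theorem exists_lapKer_bound (hn : 2 ≤ n) {η : ℝ} (hη : 0 < η) (hη1 : η < 1) : ∃ C : ℝ, ∀ z : Spc n,
    |lapKer n z| ≤ C * (‖z‖ ^ (-(n - 2 + η)) + ‖z‖ ^ (-(n - 2 - η))) := by
  rcases eq_or_ne n 2 with rfl | h2
  · refine ⟨|1 / Real.pi| * η⁻¹, fun z => ?_⟩
    simp only [lapKer, if_pos, abs_mul]
    rw [mul_assoc]
    gcongr
    have h0 := norm_nonneg z
    have h1 := Real.log_le_rpow_div h0 hη
    have h2 := Real.log_le_rpow_div (inv_nonneg.2 h0) hη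
    have p1 := Real.rpow_nonneg h0 η
    have p2 := Real.rpow_nonneg h0 (-η)
    rw [Real.log_inv, Real.inv_rpow h0, ← Real.rpow_neg h0] at h2
    have e1 : -(((2 : ℕ) : ℝ) - 2 + η) = -η := by norm_num
    have e2 : -(((2 : ℕ) : ℝ) - 2 - η) = η := by norm_num
    rw [e1, e2, inv_mul_eq_div, add_div, abs_le]
    have := div_nonneg p1 hη.le
    have := div_nonneg p2 hη.le
    constructor <;> linarith
  · refine ⟨|(sphArea n * (2 - (n : ℝ)))⁻¹|, fun z => ?_⟩
    have hn3 : (3 : ℝ) ≤ n := by exact_mod_cast (by omega : 3 ≤ n)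
    have h0 := norm_nonneg z
    simp only [lapKer, if_neg h2, div_eq_inv_mul, abs_mul]
    rw [abs_of_nonneg (Real.rpow_nonneg h0 _)]
    gcongr
    rcases h0.eq_or_lt' with hz | hz
    · rw [hz, Real.zero_rpow (by linarith)]
      positivity
    · have p1 := Real.rpow_nonneg h0 (-(n - 2 + η))
      have p2 := Real.rpow_nonneg h0 (-(n - 2 - η))
      rcases le_total ‖z‖ 1 with h | h
      · have := Real.rpow_le_rpow_of_exponent_ge hz h (show -(n - 2 + η) ≤ 2 - n by linarith)
        linarith
      · have := Real.rpow_le_rpow_of_exponent_le h (show 2 - n ≤ -(n - 2 - η) by linarith)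
        linarith

theorem lapKer_ik (hn : 2 ≤ n) {e : ℝ} (he : 2 < e) : IK e (lapKer n) := by
  obtain ⟨C, hC⟩ := exists_lapKer_bound hn (η := min ((e - 2) / 2) (1 / 2))
    (lt_min (by linarith) (by norm_num)) (min_lt_of_right_lt (by norm_num))
  have h1 := min_le_left ((e - 2) / 2) (1 / 2)
  have h2 := min_le_right ((e - 2) / 2) (1 / 2)
  have h3 : 0 < min ((e - 2) / 2) (1 / 2) := lt_min (by linarith) (by norm_num)
  exact IK.of_bound_add (by omega) measurable_lapKer (by linarith) (by linarith)
    (by linarith) (by linarith) hC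

theorem norm_inv_mul_lapKer_ik (hn : 2 ≤ n) {e : ℝ} (he : 2 < e) :
    IK e (fun z : Spc n => ‖z‖⁻¹ * lapKer n z) := by
  obtain ⟨C, hC⟩ := exists_lapKer_bound hn (η := min ((e - 2) / 2) (1 / 2))
    (lt_min (by linarith) (by norm_num)) (min_lt_of_right_lt (by norm_num))
  set η := min ((e - 2) / 2) (1 / 2) with hη
  have h1 := min_le_left ((e - 2) / 2) (1 / 2)
  have h2 := min_le_right ((e - 2) / 2) (1 / 2)
  have h3 : 0 < η := lt_min (by linarith) (by norm_num)
  have hm := measurable_lapKer (n := n)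
  have hn' : (2 : ℝ) ≤ n := by exact_mod_cast hn
  refine IK.of_bound_add (a := n - 1 + η) (b := n - 1 - η) (C := C) (by omega) (by fun_prop)
    (by linarith) (by linarith) (by linarith) (by linarith) fun z => ?_
  rcases eq_or_ne z 0 with rfl | hz
  · simp only [norm_zero, inv_zero, zero_mul, abs_zero]
    rw [Real.zero_rpow (by linarith), Real.zero_rpow (by linarith)]
    simp
  · have hz0 := norm_pos_iff.2 hz
    rw [abs_mul, abs_inv, abs_norm, inv_mul_le_iff₀ hz0]
    refine (hC z).trans_eq ?_
    rw [show -((n : ℝ) - 2 + η) = -(n - 1 + η) + 1 by ring, Real.rpow_add_one hz0.ne',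
      show -((n : ℝ) - 2 - η) = -(n - 1 - η) + 1 by ring, Real.rpow_add_one hz0.ne']
    ring

theorem exists_pd_newtPot (hn : 2 ≤ n) : ∃ c : ℝ, ∀ (e A : ℝ) (φ : Spc n → ℝ), 2 < e → Dec e A φ →
    Differentiable ℝ φ → (∀ i, Dec e A (pd i φ)) → Differentiable ℝ (newtPot φ) ∧
    ∀ i, pd i (newtPot φ) = fun x => c * cv (gradKer i) φ x := by
  obtain ⟨c, hc⟩ := exists_lapKer_grad hn
  refine ⟨c, fun e A φ he hφ hd hφ' => ?_⟩
  have hk := lapKer_ik hn he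
  have e1 : newtPot φ = cv (lapKer n) φ := funext fun x => (cv_eq _ _ x).symm
  rw [e1]
  refine ⟨fun x => (hasFDerivAt_cv hk hφ hd hφ' x).differentiableAt, fun i => ?_⟩
  rw [pd_cv hk hφ hd hφ']
  funext x
  have hae : ∀ᵐ z : Spc n, pd i (lapKer n) z * φ (x - z) = c * (gradKer i z * φ (x - z)) := by
    filter_upwards [ae_ne_zero (n := n) (by omega)] with z hz
    rw [(hc z hz).2, mul_assoc]
  have hi := (((gradKer_hom i).ik hn (by linarith : 1 < e)).integrable hφ x).const_mul c
  have h3 : Integrable fun z => ‖z‖⁻¹ * (lapKer n z * φ (x - z)) := by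
    have := (norm_inv_mul_lapKer_ik hn he).integrable hφ x
    simpa only [mul_assoc] using this
  rw [cv, integral_by_parts (by omega) (fun z hz => (hc z hz).1.differentiableWithinAt) hd i x
    (hk.integrable (hφ' i) x) (hi.congr (hae.mono fun z hz => hz.symm)) h3, integral_congr_ae hae,
    integral_const_mul, cv]

theorem integrable_pd_bmp_mul (hn : 2 ≤ n) {k : Spc n → ℝ} (hk : HomKer k) (i : Fin n) :
    Integrable fun z => pd i bmp z * k z := by
  have hc : Continuous fun z : Spc n => wt z ^ (2 : ℝ) * pd i bmp z :=
    (continuous_wt.rpow_const fun x => Or.inl (wt_pos x).ne').mul (continuous_pd_bmp i)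
  obtain ⟨C, hC⟩ := ((hasCompactSupport_pd_bmp i).mul_left (f := fun z : Spc n => wt z ^ (2 : ℝ))
    ).exists_bound_of_continuous hc
  refine (((hk.ik hn (by norm_num : (1 : ℝ) < 2)).2).bdd_mul (c := C) hc.aestronglyMeasurable
    (Eventually.of_forall hC)).congr (Eventually.of_forall fun z => ?_)
  have := wt_pos z
  simp only
  rw [Real.rpow_neg this.le]
  field_simp

theorem tendsto_integral_near (hn : 2 ≤ n) {k φ : Spc n → ℝ} (hk : HomKer k) {σ A : ℝ} (hσ : 0 ≤ σ)
    (hφ : Dec σ A φ) (i : Fin n) (x : Spc n) :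
    Tendsto (fun m : ℕ => ∫ z, m * pd i bmp ((m : ℝ) • z) * (k z * φ (x - z))) atTop
      (nhds ((∫ z, pd i bmp z * k z) * φ x)) := by
  have hi := integrable_pd_bmp_mul hn hk i
  have hA := hφ.nonneg
  have hb : ∀ y, |φ y| ≤ A := fun y => (hφ.2 y).trans (mul_le_of_le_one_right hA
    (Real.rpow_le_one_of_one_le_of_nonpos (one_le_wt y) (by linarith)))
  have h1 : Tendsto (fun m : ℕ => ∫ z, pd i bmp z * k z * φ (x - (m : ℝ)⁻¹ • z)) atTop
      (nhds (∫ z, pd i bmp z * k z * φ x)) := by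
    refine tendsto_integral_of_dominated_convergence (fun z => |pd i bmp z * k z| * A) (fun m => ?_)
      (hi.abs.mul_const A) (fun m => Eventually.of_forall fun z => ?_)
      (Eventually.of_forall fun z => ?_)
    · exact hi.aestronglyMeasurable.mul (hφ.1.comp (by fun_prop)).aestronglyMeasurable
    · rw [Real.norm_eq_abs, abs_mul]
      gcongr
      exact hb _
    · refine tendsto_const_nhds.mul ((hφ.1.tendsto x).comp ?_)
      have : Tendsto (fun m : ℕ => x - (m : ℝ)⁻¹ • z) atTop (nhds (x - (0 : ℝ) • z)) :=
        tendsto_const_nhds.sub (tendsto_inv_atTop_nhds_zero_nat.smul_const z)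
      simpa using this
  rw [integral_mul_const] at h1
  refine h1.congr' ?_
  filter_upwards [eventually_ge_atTop 1] with m hm
  have hm0 : (0 : ℝ) < m := by exact_mod_cast hm
  have h2 := Measure.integral_comp_smul (volume : Measure (Spc n))
    (fun w => pd i bmp w * k w * φ (x - (m : ℝ)⁻¹ • w)) (m : ℝ)
  rw [finrank_euclideanSpace_fin, smul_eq_mul, abs_of_nonneg (by positivity)] at h2
  have h3 : ∫ w, pd i bmp w * k w * φ (x - (m : ℝ)⁻¹ • w) = (m : ℝ) ^ n *
      ∫ z, pd i bmp ((m : ℝ) • z) * k ((m : ℝ) • z) * φ (x - (m : ℝ)⁻¹ • (m : ℝ) • z) := by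
    rw [h2]; field_simp
  rw [h3, ← integral_const_mul]
  refine integral_congr_ae ?_
  filter_upwards [ae_ne_zero (n := n) (by omega)] with z hz
  rw [hk.hom m z hm0 hz, smul_smul, inv_mul_cancel₀ hm0.ne', one_smul, sub_eq_add_neg 1,
    Real.rpow_add hm0, Real.rpow_one, Real.rpow_neg hm0.le, Real.rpow_natCast]
  field_simp

theorem tendsto_integral_far {F : Spc n → ℝ} (hF : Integrable F) (i : Fin n) :
    Tendsto (fun m : ℕ => ∫ z, (m : ℝ)⁻¹ * pd i bmp ((m : ℝ)⁻¹ • z) * F z) atTop (nhds 0) := by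
  obtain ⟨C, hC, hb⟩ := exists_pd_bmp_bound (n := n)
  have := tendsto_integral_of_dominated_convergence (μ := volume) (f := fun _ : Spc n => (0 : ℝ))
    (F := fun (m : ℕ) z => (m : ℝ)⁻¹ * pd i bmp ((m : ℝ)⁻¹ • z) * F z) (fun z => C * |F z|)
    (fun m => ?_) (hF.abs.const_mul C) (fun m => Eventually.of_forall fun z => ?_)
    (Eventually.of_forall fun z => ?_)
  · simpa using this
  · exact (((continuous_pd_bmp i).comp (continuous_const_smul _)).const_mul _
      ).aestronglyMeasurable.mul hF.aestronglyMeasurable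
  · rw [Real.norm_eq_abs, abs_mul, abs_mul, abs_of_nonneg (by positivity)]
    gcongr
    calc (m : ℝ)⁻¹ * |pd i bmp ((m : ℝ)⁻¹ • z)| ≤ 1 * C := by
          gcongr
          · exact Nat.cast_inv_le_one m
          · exact (hb i _).1
      _ = C := one_mul C
  · have h0 : Tendsto (fun m : ℕ => (m : ℝ)⁻¹ * (C * |F z|)) atTop (nhds 0) := by
      simpa using tendsto_inv_atTop_nhds_zero_nat.mul_const (C * |F z|)
    refine squeeze_zero_norm (fun m => ?_) h0
    rw [Real.norm_eq_abs, abs_mul, abs_mul, abs_of_nonneg (by positivity), mul_assoc]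
    gcongr
    exact (hb i _).1

theorem exists_sum_cv_gradKer (hn : 2 ≤ n) : ∃ c : ℝ, ∀ (σ A : ℝ) (φ : Spc n → ℝ), 1 < σ →
    Dec σ A φ → Differentiable ℝ φ → (∀ i, Dec σ A (pd i φ)) →
    ∀ x, ∑ i, cv (gradKer i) (pd i φ) x = c * φ x := by
  refine ⟨-∑ i : Fin n, ∫ z, pd i bmp z * gradKer i z, fun σ A φ hσ hφ hd hφ' x => ?_⟩
  have hn0 : 0 < n := by omega
  have hik : ∀ i : Fin n, IK σ (gradKer i) := fun i => (gradKer_hom i).ik hn hσ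
  have hin := fun i => (hik i).integrable hφ x
  have h1 := fun i => (hik i).integrable (hφ' i) x
  have hsm : ∀ i : Fin n, DifferentiableOn ℝ (gradKer (n := n) i) {0}ᶜ := fun i =>
    (gradKer_hom i).smooth.differentiableOn (by simp)
  have h0 : ∀ i m, Integrable fun z => cut m z * (gradKer i z * φ (x - z)) := fun i m =>
    (hin i).bdd_mul (c := 1) (contDiff_cut m).continuous.aestronglyMeasurable
      (Eventually.of_forall fun z => abs_cut_le m z)
  have h3 : ∀ i m, Integrable fun z => pd i (cut m) z * (gradKer i z * φ (x - z)) := fun i m => by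
    obtain ⟨C, hC⟩ := exists_abs_pd_cut_le (n := n) m
    exact (hin i).bdd_mul (c := C) (continuous_pd_cut m i).aestronglyMeasurable
      (Eventually.of_forall fun z => hC i z)
  have h2 : ∀ i m, 1 ≤ m → Integrable fun z => cut m z * (pd i (gradKer i) z * φ (x - z)) := by
    intro i m hm
    obtain ⟨C, hC, hb⟩ := exists_hom_bound (ContDiffOn.pd_compl (gradKer_hom i).smooth i).continuousOn
      (hom_pd (hsm i) (gradKer_hom i).hom i)
    have hmeas : Measurable fun z => cut m z * pd i (gradKer (n := n) i) z :=
      (contDiff_cut m).continuous.measurable.mul (measurable_fderiv_apply_const ℝ _ _)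
    have : IK σ fun z => cut m z * pd i (gradKer (n := n) i) z := by
      refine IK.of_bound (C := m * C) hn0 hmeas (a := n - 1) (by linarith) (by linarith)
        fun z => ?_
      rcases eq_or_ne z 0 with rfl | hz
      · have := abs_cut_le_norm hm (0 : Spc n)
        rw [norm_zero, mul_zero] at this
        rw [abs_mul, le_antisymm this (abs_nonneg _), zero_mul]
        positivity
      · have hz0 := norm_pos_iff.2 hz
        rw [abs_mul]
        calc _ ≤ (m * ‖z‖) * (C * ‖z‖ ^ (1 - (n : ℝ) - 1)) :=
              mul_le_mul (abs_cut_le_norm hm z) (hb z hz) (abs_nonneg _) (by positivity)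
          _ = _ := by rw [Real.rpow_sub_one hz0.ne', neg_sub]; field_simp
    simpa only [mul_assoc] using this.integrable hφ x
  have hL : Tendsto (fun m : ℕ => ∑ i, ∫ z, cut m z * (gradKer i z * pd i φ (x - z))) atTop
      (nhds (∑ i, cv (gradKer i) (pd i φ) x)) :=
    tendsto_finsetSum _ fun i _ => tendsto_integral_cut hn0 (h1 i)
  have hR : Tendsto (fun m : ℕ => ∑ i, ((∫ z, (m : ℝ)⁻¹ * pd i bmp ((m : ℝ)⁻¹ • z) *
      (gradKer i z * φ (x - z))) - ∫ z, m * pd i bmp ((m : ℝ) • z) * (gradKer i z * φ (x - z))))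
      atTop (nhds (∑ i : Fin n, (0 - (∫ z, pd i bmp z * gradKer i z) * φ x))) :=
    tendsto_finsetSum _ fun i _ => (tendsto_integral_far (hin i) i).sub
      (tendsto_integral_near hn (gradKer_hom i) (by linarith) hφ i x)
  have hE : ∀ᶠ m : ℕ in atTop, ∑ i, ((∫ z, (m : ℝ)⁻¹ * pd i bmp ((m : ℝ)⁻¹ • z) *
      (gradKer i z * φ (x - z))) - ∫ z, m * pd i bmp ((m : ℝ) • z) * (gradKer i z * φ (x - z))) =
      ∑ i, ∫ z, cut m z * (gradKer i z * pd i φ (x - z)) := by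
    filter_upwards [eventually_ge_atTop 1] with m hm
    have e1 : ∀ i, ∫ z, cut m z * (gradKer i z * pd i φ (x - z)) =
        (∫ z, cut m z * (pd i (gradKer i) z * φ (x - z))) +
          ∫ z, pd i (cut m) z * (gradKer i z * φ (x - z)) := fun i =>
      integral_cut_mul_eq hn0 (hsm i) hd i x (h1 i) hm (h0 i m) (h2 i m hm) (h3 i m)
    have e2 : ∑ i, ∫ z, cut m z * (pd i (gradKer i) z * φ (x - z)) = 0 := by
      rw [← integral_finsetSum _ fun i _ => h2 i m hm]
      refine integral_eq_zero_of_ae ?_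
      filter_upwards [ae_ne_zero (n := n) hn0] with z hz
      rw [← Finset.mul_sum, ← Finset.sum_mul, sum_pd_gradKer hz]
      simp
    rw [Finset.sum_congr rfl fun i _ => e1 i, Finset.sum_add_distrib, e2, zero_add]
    obtain ⟨C, hC, hb⟩ := exists_pd_bmp_bound (n := n)
    have hbd : ∀ (i : Fin n) (a r : ℝ), Integrable fun z =>
        a * pd i bmp (r • z) * (gradKer i z * φ (x - z)) := fun i a r =>
      (hin i).bdd_mul (c := |a| * C) (((continuous_pd_bmp i).comp (continuous_const_smul r)
        ).const_mul a).aestronglyMeasurable (Eventually.of_forall fun z => by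
          rw [Real.norm_eq_abs, abs_mul]; gcongr; exact (hb i _).1)
    refine Finset.sum_congr rfl fun i _ => ?_
    rw [← integral_sub (hbd i _ _) (hbd i _ _)]
    refine integral_congr_ae (Eventually.of_forall fun z => ?_)
    simp only [pd_cut]
    ring
  rw [tendsto_nhds_unique hL (hR.congr' hE), neg_mul, Finset.sum_mul, ← Finset.sum_neg_distrib]
  simp

theorem pd_comm {f : Spc n → ℝ} (hf : Differentiable ℝ f) (hf' : ∀ i, Differentiable ℝ (pd i f))
    (i j : Fin n) (x : Spc n) : pd i (pd j f) x = pd j (pd i f) x := by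
  have h1 : fderiv ℝ f = fun y => ∑ i, pd i f y • (EuclideanSpace.proj i : Spc n →L[ℝ] ℝ) :=
    (fderiv_eq_sum f).trans rfl
  have h2 : HasFDerivAt (fderiv ℝ f) (fderiv ℝ (fderiv ℝ f) x) x := by
    refine DifferentiableAt.hasFDerivAt ?_
    rw [h1]
    exact DifferentiableAt.fun_sum fun i _ => (hf' i x).smul_const _
  have h3 := second_derivative_symmetric (fun y => (hf y).hasFDerivAt) h2
    (EuclideanSpace.single i 1) (EuclideanSpace.single j 1)
  have h4 : ∀ a b : Fin n, pd a (pd b f) x =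
      fderiv ℝ (fderiv ℝ f) x (EuclideanSpace.single a 1) (EuclideanSpace.single b 1) := by
    intro a b
    have : HasFDerivAt (pd b f) ((fderiv ℝ (fderiv ℝ f) x).flip (EuclideanSpace.single b 1)) x := by
      have := h2.clm_apply (hasFDerivAt_const (EuclideanSpace.single b (1 : ℝ)) x)
      refine this.congr_fderiv ?_
      ext y; simp
    rw [pd, this.fderiv]
    simp
  rw [h4, h4, h3]

/-- The sign attached to the position of `i` relative to `S`. -/
def sg (S : Finset (Fin n)) (i : Fin n) : ℝ := (-1) ^ (S.filter fun j => j < i).card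

/-- The sign of the pair `(j, i)`. -/
def eps (j i : Fin n) : ℝ := if j < i then -1 else 1

theorem sg_mul_self (S : Finset (Fin n)) (i : Fin n) : sg S i * sg S i = 1 := by
  rw [sg, ← pow_add, Even.neg_one_pow ⟨_, rfl⟩]

theorem abs_sg (S : Finset (Fin n)) (i : Fin n) : |sg S i| = 1 := by
  rw [sg, abs_pow]; simp

theorem sg_insert {S : Finset (Fin n)} {i : Fin n} (hi : i ∉ S) (j : Fin n) :
    sg (insert i S) j = sg S j * eps i j := by
  unfold sg eps
  rw [Finset.filter_insert]
  split_ifs with h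
  · rw [Finset.card_insert_of_notMem (by simp [hi]), pow_succ]
  · rw [mul_one]

theorem eps_mul_self (i j : Fin n) : eps i j * eps i j = 1 := by
  unfold eps; split_ifs <;> simp

theorem sg_erase {S : Finset (Fin n)} {j : Fin n} (hj : j ∈ S) (i : Fin n) :
    sg (S.erase j) i = sg S i * eps j i := by
  have := sg_insert (S := S.erase j) (by simp) i (i := j)
  rw [Finset.insert_erase hj] at this
  rw [this, mul_assoc, eps_mul_self, mul_one]

theorem eps_swap {i j : Fin n} (h : i ≠ j) : eps i j = -eps j i := by
  unfold eps
  rcases lt_or_gt_of_ne h with h | h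
  · simp [h, h.not_gt]
  · simp [h, h.not_gt]

theorem eps_self (i : Fin n) : eps i i = 1 := by simp [eps]

/-- The exterior derivative on families indexed by all finite sets. -/
def dE (ω : Finset (Fin n) → Spc n → ℝ) (S : Finset (Fin n)) (x : Spc n) : ℝ :=
  ∑ i, if i ∈ S then sg S i * pd i (ω (S.erase i)) x else 0

/-- The codifferential on families indexed by all finite sets. -/
def coE (ω : Finset (Fin n) → Spc n → ℝ) (S : Finset (Fin n)) (x : Spc n) : ℝ :=
  -∑ i, if i ∉ S then sg S i * pd i (ω (insert i S)) x else 0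

/-- Extension of a form by zero to all finite sets. -/
def extF {q : ℕ} (v : FormS n q) (S : Finset (Fin n)) (x : Spc n) : ℝ :=
  if h : S.card = q then v ⟨S, h⟩ x else 0

theorem extF_coe {q : ℕ} (v : FormS n q) (I : Idx n q) : extF v I.1 = v I := by
  funext x; simp [extF, I.2]

theorem extF_mk {q : ℕ} (v : FormS n q) {S : Finset (Fin n)} (h : S.card = q) :
    extF v S = v ⟨S, h⟩ := by
  funext x; simp [extF, h]

theorem extF_zero {q : ℕ} (v : FormS n q) {S : Finset (Fin n)} (h : S.card ≠ q) :
    extF v S = fun _ => 0 := by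
  funext x; simp [extF, h]

theorem dS_eq {q : ℕ} (v : FormS n q) (J : Idx n (q + 1)) : dS v J = dE (extF v) J.1 := by
  funext x
  unfold dS dE
  refine Finset.sum_congr rfl fun i _ => ?_
  by_cases h : i ∈ J.1
  · rw [dif_pos h, if_pos h, extF_mk]; rfl
  · rw [dif_neg h, if_neg h]

theorem pd_zero (i : Fin n) (x : Spc n) : pd i (fun _ : Spc n => (0 : ℝ)) x = 0 := by
  simp [pd]

theorem coDS_eq {q : ℕ} (v : FormS n q) (K : Idx n (q - 1)) : coDS v K = coE (extF v) K.1 := by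
  funext x
  unfold coDS coE
  congr 1
  refine Finset.sum_congr rfl fun i _ => ?_
  by_cases h : i ∈ K.1
  · rw [dif_neg (by simp [h]), if_neg (not_not.2 h)]
  · rw [if_pos h]
    by_cases h' : (insert i K.1).card = q
    · rw [dif_pos ⟨h, h'⟩, extF_mk v h']; rfl
    · rw [dif_neg (by simp [h']), extF_zero v h', pd_zero, mul_zero]

theorem extF_dS {q : ℕ} (v : FormS n q) : extF (dS v) = dE (extF v) := by
  funext S x
  by_cases h : S.card = q + 1
  · rw [extF_mk _ h, dS_eq]
  · rw [extF_zero _ h, dE]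
    symm
    refine Finset.sum_eq_zero fun i _ => ?_
    split_ifs with hi
    · have := Finset.card_erase_add_one hi
      rw [extF_zero v (by omega), pd_zero, mul_zero]
    · rfl

theorem extF_coDS {q : ℕ} (hq : 1 ≤ q) (v : FormS n q) : extF (coDS v) = coE (extF v) := by
  funext S x
  by_cases h : S.card = q - 1
  · rw [extF_mk _ h, coDS_eq]
  · rw [extF_zero _ h, coE]
    symm
    rw [neg_eq_zero]
    refine Finset.sum_eq_zero fun i _ => ?_
    by_cases hi : i ∈ S
    · rw [if_neg (not_not.2 hi)]
    · have := Finset.card_insert_of_notMem hi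
      rw [extF_zero v (by omega), pd_zero, mul_zero, ite_self]

theorem sum_antisymm {g : Fin n → Fin n → ℝ} (h : ∀ i j, g i j = -g j i) : ∑ i, ∑ j, g i j = 0 := by
  have h1 : ∑ i, ∑ j, g i j = -∑ i, ∑ j, g i j := by
    conv_lhs => rw [Finset.sum_comm]
    rw [← Finset.sum_neg_distrib]
    refine Finset.sum_congr rfl fun i _ => ?_
    rw [← Finset.sum_neg_distrib]
    exact Finset.sum_congr rfl fun j _ => h j i
  linarith

theorem pd_sum_ite {ι : Type*} (s : Finset ι) (p : ι → Prop) [DecidablePred p] (a : ι → ℝ) (f : ι → Spc n → ℝ) (i : Fin n)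
    (x : Spc n) (hf : ∀ j ∈ s, p j → DifferentiableAt ℝ (f j) x) :
    pd i (fun x => ∑ j ∈ s, if p j then a j * f j x else 0) x =
      ∑ j ∈ s, if p j then a j * pd i (f j) x else 0 := by
  have h : ∀ j ∈ s, HasFDerivAt (fun x => if p j then a j * f j x else 0)
      (if p j then a j • fderiv ℝ (f j) x else 0) x := by
    intro j hj
    split_ifs with h
    · exact (hf j hj h).hasFDerivAt.const_mul _
    · exact hasFDerivAt_const _ _
  rw [pd, (HasFDerivAt.fun_sum h).fderiv, sum_apply]
  refine Finset.sum_congr rfl fun j _ => ?_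
  split_ifs <;> simp [pd]

/-- Functions which are differentiable together with their first partial derivatives. -/
def D2 (f : Spc n → ℝ) : Prop := Differentiable ℝ f ∧ ∀ i, Differentiable ℝ (pd i f)

theorem pd_dE {ω : Finset (Fin n) → Spc n → ℝ} (hω : ∀ S, D2 (ω S)) (j : Fin n)
    (S : Finset (Fin n)) (x : Spc n) :
    pd j (dE ω S) x = ∑ i, if i ∈ S then sg S i * pd j (pd i (ω (S.erase i))) x else 0 :=
  pd_sum_ite Finset.univ (fun i => i ∈ S) (fun i => sg S i) (fun i => pd i (ω (S.erase i))) j x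
    fun i _ _ => (hω _).2 i x

theorem pd_coE {ω : Finset (Fin n) → Spc n → ℝ} (hω : ∀ S, D2 (ω S)) (j : Fin n)
    (S : Finset (Fin n)) (x : Spc n) :
    pd j (coE ω S) x = -∑ i, if i ∉ S then sg S i * pd j (pd i (ω (insert i S))) x else 0 := by
  rw [← pd_sum_ite Finset.univ (fun i => i ∉ S) (fun i => sg S i) (fun i => pd i (ω (insert i S))) j x
    fun i _ _ => (hω _).2 i x]
  have : coE ω S = -fun x => ∑ i, if i ∉ S then sg S i * pd i (ω (insert i S)) x else 0 := rfl
  rw [pd, this, fderiv_neg]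
  rfl

theorem dE_dE {ω : Finset (Fin n) → Spc n → ℝ} (hω : ∀ S, D2 (ω S)) (S : Finset (Fin n)) (x : Spc n) :
    dE (dE ω) S x = 0 := by
  refine Eq.trans ?_ (sum_antisymm (g := fun j i : Fin n => if j ∈ S ∧ i ∈ S ∧ i ≠ j then
    sg S j * sg S i * eps j i * pd j (pd i (ω ((S.erase j).erase i))) x else 0) fun i j => ?_)
  · refine Finset.sum_congr rfl fun j _ => ?_
    by_cases hj : j ∈ S
    · rw [if_pos hj, pd_dE hω, Finset.mul_sum]
      refine Finset.sum_congr rfl fun i _ => ?_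
      by_cases hi : i ∈ S ∧ i ≠ j
      · rw [if_pos (Finset.mem_erase.2 ⟨hi.2, hi.1⟩), if_pos ⟨hj, hi⟩, sg_erase hj]
        ring
      · rw [if_neg (by rw [Finset.mem_erase]; tauto), if_neg (by tauto), mul_zero]
    · rw [if_neg hj]
      exact (Finset.sum_eq_zero fun i _ => if_neg (by tauto)).symm
  · by_cases h : i ∈ S ∧ j ∈ S ∧ j ≠ i
    · rw [if_pos h, if_pos ⟨h.2.1, h.1, h.2.2.symm⟩, eps_swap h.2.2, Finset.erase_right_comm,
        pd_comm (hω _).1 (hω _).2]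
      ring
    · rw [if_neg h, if_neg (by tauto), neg_zero]

theorem coE_coE {ω : Finset (Fin n) → Spc n → ℝ} (hω : ∀ S, D2 (ω S)) (S : Finset (Fin n)) (x : Spc n) :
    coE (coE ω) S x = 0 := by
  rw [coE, neg_eq_zero]
  refine Eq.trans ?_ (sum_antisymm (g := fun j i : Fin n => if j ∉ S ∧ i ∉ S ∧ i ≠ j then
    -(sg S j * sg S i * eps j i * pd j (pd i (ω (insert i (insert j S)))) x) else 0) fun i j => ?_)
  · refine Finset.sum_congr rfl fun j _ => ?_
    by_cases hj : j ∉ S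
    · rw [if_pos hj, pd_coE hω, mul_neg, Finset.mul_sum, ← Finset.sum_neg_distrib]
      refine Finset.sum_congr rfl fun i _ => ?_
      by_cases hi : i ∉ S ∧ i ≠ j
      · rw [if_pos (by rw [Finset.mem_insert]; tauto), if_pos ⟨hj, hi⟩, sg_insert hj]
        ring
      · rw [if_neg (by rw [Finset.mem_insert]; tauto), if_neg (by tauto), mul_zero, neg_zero]
    · rw [if_neg hj]
      exact (Finset.sum_eq_zero fun i _ => if_neg (by tauto)).symm
  · by_cases h : i ∉ S ∧ j ∉ S ∧ j ≠ i
    · rw [if_pos h, if_pos ⟨h.2.1, h.1, h.2.2.symm⟩, eps_swap h.2.2, Finset.insert_comm,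
        pd_comm (hω _).1 (hω _).2]
      ring
    · rw [if_neg h, if_neg (by tauto), neg_zero]

theorem dE_coE_add {ω : Finset (Fin n) → Spc n → ℝ} (hω : ∀ S, D2 (ω S)) (S : Finset (Fin n))
    (x : Spc n) : dE (coE ω) S x + coE (dE ω) S x = -∑ i, pd i (pd i (ω S)) x := by
  have h1 : dE (coE ω) S x = -∑ j, ∑ i, if j ∈ S ∧ i ∉ S.erase j then
      sg S j * sg S i * eps j i * pd j (pd i (ω (insert i (S.erase j)))) x else 0 := by
    rw [dE, ← Finset.sum_neg_distrib]
    refine Finset.sum_congr rfl fun j _ => ?_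
    by_cases hj : j ∈ S
    · rw [if_pos hj, pd_coE hω, mul_neg, Finset.mul_sum]
      congr 1
      refine Finset.sum_congr rfl fun i _ => ?_
      by_cases hi : i ∉ S.erase j
      · rw [if_pos hi, if_pos ⟨hj, hi⟩, sg_erase hj]; ring
      · rw [if_neg hi, if_neg (by tauto), mul_zero]
    · rw [if_neg hj]
      simp [hj]
  have h2 : coE (dE ω) S x = -∑ j, ∑ i, if i ∉ S ∧ j ∈ insert i S then
      sg S j * sg S i * eps i j * pd i (pd j (ω ((insert i S).erase j))) x else 0 := by
    rw [coE, Finset.sum_comm]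
    congr 1
    refine Finset.sum_congr rfl fun i _ => ?_
    by_cases hi : i ∉ S
    · rw [if_pos hi, pd_dE hω, Finset.mul_sum]
      refine Finset.sum_congr rfl fun j _ => ?_
      by_cases hj : j ∈ insert i S
      · rw [if_pos hj, if_pos ⟨hi, hj⟩, sg_insert hi]; ring
      · rw [if_neg hj, if_neg (by tauto), mul_zero]
    · rw [if_neg hi]
      exact (Finset.sum_eq_zero fun j _ => if_neg (by tauto)).symm
  rw [h1, h2, ← neg_add, ← Finset.sum_add_distrib]
  congr 1
  refine Finset.sum_congr rfl fun j _ => ?_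
  rw [← Finset.sum_add_distrib, Finset.sum_eq_single j]
  · by_cases hj : j ∈ S
    · rw [if_pos ⟨hj, Finset.notMem_erase j S⟩, if_neg (by tauto), eps_self, Finset.insert_erase hj,
        sg_mul_self]
      ring
    · rw [if_neg (by tauto), if_pos ⟨hj, Finset.mem_insert_self j S⟩, eps_self,
        Finset.erase_insert hj, sg_mul_self]
      ring
  · intro i _ hij
    by_cases h : j ∈ S ∧ i ∉ S
    · rw [if_pos ⟨h.1, fun h' => h.2 (Finset.mem_of_mem_erase h')⟩,
        if_pos ⟨h.2, Finset.mem_insert_of_mem h.1⟩, eps_swap hij, pd_comm (hω _).1 (hω _).2,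
        Finset.erase_insert_of_ne hij]
      ring
    · rw [if_neg, if_neg, add_zero]
      · rw [Finset.mem_insert]; tauto
      · rw [Finset.mem_erase]; tauto
  · simp

/-- Differentiable functions decaying, with their first partial derivatives, like `wt ^ (-e)`. -/
def D1 (e A : ℝ) (f : Spc n → ℝ) : Prop := Dec e A f ∧ Differentiable ℝ f ∧ ∀ i, Dec e A (pd i f)

theorem D1.zero (e : ℝ) {A : ℝ} (hA : 0 ≤ A) : D1 (n := n) e A (fun _ => 0) := by
  have h : Dec (n := n) e A fun _ => 0 := ⟨continuous_const, fun y => by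
    have := Real.rpow_nonneg (wt_pos y).le (-e)
    rw [abs_zero]; positivity⟩
  refine ⟨h, differentiable_const _, fun i => ?_⟩
  rwa [show pd i (fun _ : Spc n => (0 : ℝ)) = fun _ => 0 from funext (pd_zero i)]

theorem newtPot_eq_cv (φ : Spc n → ℝ) : newtPot φ = cv (lapKer n) φ :=
  funext fun x => (cv_eq _ _ x).symm

theorem exists_newtPot (hn : 2 ≤ n) : ∃ c c' : ℝ, ∀ (e A : ℝ) (f : Spc n → ℝ), 2 < e → D1 e A f →
    D2 (newtPot f) ∧ (∀ i, pd i (newtPot f) = fun x => c * cv (gradKer i) f x) ∧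
    (∀ i, pd i (newtPot f) = newtPot (pd i f)) ∧
    ∀ x, ∑ i, pd i (pd i (newtPot f)) x = c' * f x := by
  obtain ⟨c, hc⟩ := exists_pd_newtPot hn
  obtain ⟨c', hc'⟩ := exists_sum_cv_gradKer hn
  refine ⟨c, c * c', fun e A f he hf => ?_⟩
  obtain ⟨h1, h2⟩ := hc e A f he hf.1 hf.2.1 hf.2.2
  have he1 : 1 < e := by linarith
  have hd := fun i => hasFDerivAt_cv ((gradKer_hom i).ik hn he1) hf.1 hf.2.1 hf.2.2
  refine ⟨⟨h1, fun i => ?_⟩, h2, fun i => ?_, fun x => ?_⟩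
  · rw [h2]
    exact fun x => (hd i x).differentiableAt.const_mul c
  · rw [newtPot_eq_cv, newtPot_eq_cv]
    exact pd_cv (lapKer_ik hn he) hf.1 hf.2.1 hf.2.2 i
  · rw [mul_assoc, ← hc' e A f he1 hf.1 hf.2.1 hf.2.2, Finset.mul_sum]
    refine Finset.sum_congr rfl fun i _ => ?_
    rw [h2]
    exact (congrFun (pd_const_mul i c fun x => (hd i x).differentiableAt) x).trans
      (by rw [pd_cv ((gradKer_hom i).ik hn he1) hf.1 hf.2.1 hf.2.2])

theorem sum_cv {σ A : ℝ} {k : Spc n → ℝ} (h : IK σ k) {ι : Type*} (s : Finset ι) (p : ι → Prop)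
    [DecidablePred p] (a : ι → ℝ) {φ : ι → Spc n → ℝ} (hφ : ∀ i, Dec σ A (φ i)) (x : Spc n) :
    (∑ i ∈ s, if p i then a i * cv k (φ i) x else 0) =
      cv k (fun y => ∑ i ∈ s, if p i then a i * φ i y else 0) x := by
  have : ∀ i ∈ s, Integrable fun z => if p i then a i * (k z * φ i (x - z)) else 0 := by
    intro i _
    split_ifs
    · exact (h.integrable (hφ i) x).const_mul _
    · exact integrable_zero _ _ _
  unfold cv
  rw [← (integral_congr_ae (Eventually.of_forall fun z => ?_) :
    ∫ z, ∑ i ∈ s, (if p i then a i * (k z * φ i (x - z)) else 0) = _), integral_finsetSum _ this]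
  · refine Finset.sum_congr rfl fun i _ => ?_
    split_ifs
    · rw [integral_const_mul]
    · rw [integral_zero]
  · simp only
    rw [Finset.mul_sum]
    refine Finset.sum_congr rfl fun i _ => ?_
    split_ifs
    · ring
    · rw [mul_zero]

theorem dE_neg (η : Finset (Fin n) → Spc n → ℝ) (S : Finset (Fin n)) (x : Spc n) :
    dE (fun S x => -η S x) S x = -dE η S x := by
  unfold dE
  rw [← Finset.sum_neg_distrib]
  refine Finset.sum_congr rfl fun i _ => ?_
  rw [pd, fderiv_fun_neg]
  split_ifs
  · rw [neg_apply, mul_neg, ← pd]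
  · rw [neg_zero]

theorem coE_neg (η : Finset (Fin n) → Spc n → ℝ) (S : Finset (Fin n)) (x : Spc n) :
    coE (fun S x => -η S x) S x = -coE η S x := by
  unfold coE
  congr 1
  rw [← Finset.sum_neg_distrib]
  refine Finset.sum_congr rfl fun i _ => ?_
  rw [pd, fderiv_fun_neg]
  split_ifs
  · rw [neg_zero]
  · rw [neg_apply, mul_neg, ← pd]

/-- The operator `Φ_q` on static forms. -/
def phiS {q : ℕ} (f : FormS n (q + 1)) : FormS n q := fun K x =>
  -coDS (n := n) (q := q + 1) (fun J y => newtPot (f J) y) K x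

theorem newtPot_zero : newtPot (fun _ : Spc n => (0 : ℝ)) = fun _ => 0 := by
  funext x; simp [newtPot]

theorem extF_newtPot {q : ℕ} (f : FormS n q) :
    extF (fun J y => newtPot (f J) y) = fun S => newtPot (extF f S) := by
  funext S
  by_cases h : S.card = q
  · rw [extF_mk _ h, extF_mk _ h]
  · rw [extF_zero _ h, extF_zero _ h, newtPot_zero]

theorem extF_phiS {q : ℕ} (f : FormS n (q + 1)) :
    extF (phiS f) = fun S x => -coE (fun S => newtPot (extF f S)) S x := by
  funext S x
  rw [← extF_newtPot, ← extF_coDS (by omega)]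
  by_cases h : S.card = q
  · rw [extF_mk _ h, extF_mk _ (q := q + 1 - 1) h]; rfl
  · rw [extF_zero _ h, extF_zero _ (q := q + 1 - 1) h, neg_zero]

theorem extF_D1 {q : ℕ} {f : FormS n q} {e A : ℝ} (hA : 0 ≤ A) (hf : ∀ J, D1 e A (f J))
    (S : Finset (Fin n)) : D1 e A (extF f S) := by
  by_cases h : S.card = q
  · rw [extF_mk _ h]; exact hf _
  · rw [extF_zero _ h]; exact D1.zero e hA

theorem D2.zero : D2 (n := n) fun _ => 0 := by
  refine ⟨differentiable_const _, fun i => ?_⟩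
  rw [show pd i (fun _ : Spc n => (0 : ℝ)) = fun _ => 0 from funext (pd_zero i)]
  exact differentiable_const _

theorem extF_D2 {q : ℕ} {f : FormS n q} (hf : ∀ J, D2 (f J)) (S : Finset (Fin n)) :
    D2 (extF f S) := by
  by_cases h : S.card = q
  · rw [extF_mk _ h]; exact hf _
  · rw [extF_zero _ h]; exact D2.zero

theorem coDS_phiS (hn : 2 ≤ n) {q : ℕ} {f : FormS n (q + 1)} {e A : ℝ} (hA : 0 ≤ A)
    (he : 2 < e) (hf : ∀ J, D1 e A (f J)) (K : Idx n (q - 1)) (x : Spc n) : coDS (phiS f) K x = 0 := by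
  obtain ⟨c, c', hc⟩ := exists_newtPot hn
  rw [coDS_eq, extF_phiS, coE_neg, coE_coE fun S => (hc e A _ he (extF_D1 hA hf S)).1, neg_zero]

theorem exists_dS_phiS (hn : 2 ≤ n) : ∃ c : ℝ, ∀ (q : ℕ) (v : FormS n q) (e A : ℝ), 0 ≤ A → 2 < e →
    (∀ I, D2 (v I)) → (∀ J, D1 e A (dS v J)) → ∀ J x, dS (phiS (dS v)) J x = c * dS v J x := by
  obtain ⟨c, c', hc⟩ := exists_newtPot hn
  refine ⟨c', fun q v e A hA he hv hf J x => ?_⟩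
  have h := fun S => hc e A _ he (extF_D1 hA hf S)
  have h0 : dE (fun S => newtPot (extF (dS v) S)) = fun _ _ => 0 := by
    funext S x
    have h1 := sum_cv (lapKer_ik hn he) Finset.univ (fun i => i ∈ S) (fun i => sg S i)
      (fun i => (extF_D1 hA hf (S.erase i)).2.2 i) x
    have h2 : (fun y => ∑ i, if i ∈ S then sg S i * pd i (extF (dS v) (S.erase i)) y else 0) =
        fun _ => 0 := by
      funext y
      have := dE_dE (fun S => extF_D2 hv S) S y
      rwa [← extF_dS] at this
    rw [h2, ← newtPot_eq_cv, newtPot_zero] at h1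
    refine Eq.trans ?_ h1
    rw [dE]
    refine Finset.sum_congr rfl fun i _ => ?_
    rw [(h (S.erase i)).2.2.1, newtPot_eq_cv]
  have h3 := dE_coE_add (fun S => (h S).1) J.1 x
  rw [h0] at h3
  have h4 : coE (fun (_ : Finset (Fin n)) (_ : Spc n) => (0 : ℝ)) J.1 x = 0 := by
    simp [coE, pd_zero]
  rw [h4, add_zero, (h J.1).2.2.2, extF_coe] at h3
  rw [dS_eq, extF_phiS, dE_neg, h3, neg_neg]

theorem exists_phiS_eq (hn : 2 ≤ n) : ∃ c : ℝ, ∀ (q : ℕ) (v : FormS n q) (σ e A : ℝ), 0 ≤ A → 2 < e →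
    1 < σ → (∀ I, D1 σ A (v I)) → (∀ J, D1 e A (dS v J)) → ∀ K x, phiS (dS v) K x =
    c * ∑ i, if i ∉ K.1 then sg K.1 i * ∑ j, (if j ∈ insert i K.1 then sg (insert i K.1) j *
      pd j (cv (gradKer i) (extF v ((insert i K.1).erase j))) x else 0) else 0 := by
  obtain ⟨c, c', hc⟩ := exists_newtPot hn
  refine ⟨c, fun q v σ e A hA he hσ hv hf K x => ?_⟩
  have h := fun S => hc e A _ he (extF_D1 hA hf S)
  rw [← extF_coe (phiS (dS v)), extF_phiS]
  show -coE _ _ _ = _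
  rw [coE, neg_neg, Finset.mul_sum]
  refine Finset.sum_congr rfl fun i _ => ?_
  by_cases hi : i ∉ K.1
  · rw [if_pos hi, if_pos hi, (h _).2.1]
    have hk := (gradKer_hom i).ik hn hσ
    have h1 := sum_cv hk Finset.univ (fun j => j ∈ insert i K.1) (fun j => sg (insert i K.1) j)
      (fun j => (extF_D1 hA hv ((insert i K.1).erase j)).2.2 j) x
    rw [extF_dS]
    rw [mul_left_comm]
    congr 2
    refine h1.symm.trans (Finset.sum_congr rfl fun j _ => ?_)
    have h2 := extF_D1 hA hv ((insert i K.1).erase j)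
    rw [pd_cv hk h2.1 h2.2.1 h2.2.2]
  · rw [if_neg hi, if_neg hi, mul_zero]

theorem Pr.sum_sg {c : Cfg} {r m : ℕ} {σ K : ℝ} (hK : 0 ≤ K) (p : Fin n → Prop) [DecidablePred p]
    (S : Finset (Fin n)) {v : Fin n → ℝ → Spc n → ℝ} (h : ∀ i, p i → Pr c r m σ K (v i)) :
    Pr c r m σ (n * K) fun t x => ∑ i, if p i then sg S i * v i t x else 0 := by
  have := Pr.sum (c := c) (r := r) (m := m) (σ := σ) Finset.univ (K := fun _ : Fin n => K)
    (v := fun i t x => if p i then sg S i * v i t x else 0) fun i _ => by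
    by_cases hi : p i
    · simp only [if_pos hi]
      have := (h i hi).smul (sg S i)
      rwa [abs_sg, one_mul] at this
    · simp only [if_neg hi]
      exact Pr.zero c r m σ hK
  simpa only [Finset.sum_const, Finset.card_univ, Fintype.card_fin, nsmul_eq_mul] using this

theorem Pr.extF {q : ℕ} {c : Cfg} {r m : ℕ} {σ K : ℝ} (hK : 0 ≤ K) {v : FormT n q}
    (h : ∀ I, Pr c r m σ K (v I)) (S : Finset (Fin n)) :
    Pr c r m σ K fun t => NSdeRham.extF (fun I => v I t) S := by
  by_cases hS : S.card = q
  · simp only [extF_mk _ hS]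
    exact h _
  · simp only [extF_zero _ hS]
    exact Pr.zero c r m σ hK

theorem Pr.dT {q : ℕ} {c : Cfg} {r m : ℕ} {σ K : ℝ} (hK : 0 ≤ K) {v : FormT n q}
    (h : ∀ I, Pr c r (m + 1) σ K (v I)) (J : Idx n (q + 1)) :
    Pr c r m (σ + 1) (n * K) (NSdeRham.dT v J) := by
  refine (Pr.sum_sg hK (fun i => i ∈ J.1) J.1
    fun i _ => (Pr.extF hK h (J.1.erase i)).pd i).congr fun t _ => ?_
  funext x
  exact congrFun (dS_eq (fun I => v I t) J) x

theorem Cl.d1 {c : Cfg} {N : ℕ} {σ K : ℝ} {v : ℝ → Spc n → ℝ} (h : Cl c (N + 1) σ K v) {t : ℝ}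
    (ht : t ∈ Set.Icc 0 c.T) : D1 σ (K * Real.exp (c.β * t)) (v t) :=
  ⟨h.dec ht, h.2.1 t ht, fun i => ((h.2.2 i).dec ht).mono (by linarith)⟩

theorem Cl.d2 {c : Cfg} {N : ℕ} {σ K : ℝ} {v : ℝ → Spc n → ℝ} (h : Cl c (N + 2) σ K v) {t : ℝ}
    (ht : t ∈ Set.Icc 0 c.T) : D2 (v t) :=
  ⟨h.2.1 t ht, fun i => (h.2.2 i).2.1 t ht⟩

theorem D1.mono {e A A' : ℝ} {f : Spc n → ℝ} (h : D1 e A f) (hA : A ≤ A') : D1 e A' f := by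
  have key : ∀ g : Spc n → ℝ, Dec e A g → Dec e A' g := fun g hg => ⟨hg.1, fun y =>
    (hg.2 y).trans (by have := Real.rpow_nonneg (wt_pos y).le (-e); gcongr)⟩
  exact ⟨key _ h.1, h.2.1, fun i => key _ (h.2.2 i)⟩

theorem Pr.phi (hn : 2 ≤ n) {δ l σ : ℝ} (hδ : 1 ≤ δ) (hδn : δ < n) (hl0 : 0 < l) (hl1 : l < 1)
    (hσ : δ < σ) (q r m : ℕ) (hm : 1 ≤ 2 * r + m) : ∃ C : ℝ, 0 ≤ C ∧
      ∀ (c : Cfg) (K : ℝ) (v : FormT n q), c.lam = l → 0 ≤ K →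
        (∀ I, Pr c r (m + 1) σ K (v I)) →
        (∀ I, Pr c r m δ (C * K) (PhiOp (NSdeRham.dT v) I)) ∧
        (∀ J, Pr c r m (δ + 1) (C * K) (NSdeRham.dT (PhiOp (NSdeRham.dT v)) J)) ∧
        ∀ L, ∀ t ∈ Set.Icc 0 c.T, ∀ x, coDT (PhiOp (NSdeRham.dT v)) L t x = 0 := by
  obtain ⟨a, ha⟩ := exists_dS_phiS (n := n) hn
  obtain ⟨b, hb⟩ := exists_phiS_eq (n := n) hn
  choose C hC hcv using fun i : Fin n =>
    Pr.cv hn hδ hδn hl0 hl1 r (m + 1) hσ (gradKer_hom (n := n) i)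
  set C₁ := ∑ i, C i with hC₁
  have hC0 : 0 ≤ C₁ := Finset.sum_nonneg fun i _ => hC i
  have hCi : ∀ i, C i ≤ C₁ := fun i =>
    Finset.single_le_sum (fun i _ => hC i) (Finset.mem_univ i)
  refine ⟨|b| * (n * (n * C₁)) + |a| * n, by positivity, fun c K v hl hK hv => ?_⟩
  have hcl : ∀ I, Cl c (2 * r + m - 1 + 2) σ K (v I) := fun I => by
    have := (hv I).cl
    rwa [show 2 * r + (m + 1) = 2 * r + m - 1 + 2 by omega] at this
  have hdv := fun J => Pr.dT hK hv J
  have hdcl : ∀ J, Cl c (2 * r + m - 1 + 1) (σ + 1) (n * K) (NSdeRham.dT v J) := fun J => by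
    have := (hdv J).cl
    rwa [show 2 * r + m = 2 * r + m - 1 + 1 by omega] at this
  have hd1 : ∀ t ∈ Set.Icc 0 c.T, ∀ J : Idx n (q + 1),
      D1 (σ + 1) ((n + 1) * K * Real.exp (c.β * t)) (dS (fun I => v I t) J) := fun t ht J =>
    ((hdcl J).d1 ht).mono (by gcongr; linarith)
  have hv1 : ∀ t ∈ Set.Icc 0 c.T, ∀ I, D1 σ ((n + 1) * K * Real.exp (c.β * t)) (v I t) :=
    fun t ht I => ((hcl I).d1 ht).mono (by gcongr; nlinarith [(Nat.cast_nonneg n : (0 : ℝ) ≤ n)])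
  have hA : ∀ t : ℝ, 0 ≤ (n + 1) * K * Real.exp (c.β * t) := fun t => by positivity
  refine ⟨fun I => ?_, fun J => ?_, fun L t ht x => ?_⟩
  · have h1 : ∀ i S, Pr c r (m + 1) (δ - 1) (C₁ * K)
        fun t => NSdeRham.cv (gradKer i) (NSdeRham.extF (fun I => v I t) S) := fun i S =>
      (hcv i c K _ hl (Pr.extF hK hv S)).mono le_rfl le_rfl (by gcongr; exact hCi i)
    have h2 := Pr.sum_sg (c := c) (r := r) (m := m) (σ := δ - 1 + 1) (K := n * (C₁ * K))
      (by positivity) (fun i => i ∉ I.1) I.1 fun i _ => Pr.sum_sg (by positivity)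
        (fun j => j ∈ insert i I.1) (insert i I.1) fun j _ => (h1 i ((insert i I.1).erase j)).pd j
    refine ((h2.smul b).congr fun t ht => ?_).mono le_rfl (by linarith) ?_
    · funext x
      exact hb q (fun I => v I t) σ (σ + 1) _ (hA t) (by linarith) (by linarith) (hv1 t ht)
        (hd1 t ht) I x
    · nlinarith [mul_nonneg (mul_nonneg (abs_nonneg a) (Nat.cast_nonneg n : (0 : ℝ) ≤ n)) hK]
  · refine (((hdv J).smul a).congr fun t ht => ?_).mono le_rfl (by linarith) ?_
    · funext x
      exact ha q (fun I => v I t) (σ + 1) _ (hA t) (by linarith) (fun I => (hcl I).d2 ht)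
        (hd1 t ht) J x
    · have : 0 ≤ |b| * (n * (n * C₁)) * K := by positivity
      nlinarith
  · exact coDS_phiS hn (hA t) (by linarith : (2 : ℝ) < σ + 1) (hd1 t ht) L x

theorem volPot_sub {μ T t F G : ℝ} (hμ : 0 < μ) {f g : ℝ → Spc n → ℝ} (hf : JC T f) (hg : JC T g)
    (hfb : ∀ τ ∈ Set.Icc 0 T, ∀ y, |f τ y| ≤ F) (hgb : ∀ τ ∈ Set.Icc 0 T, ∀ y, |g τ y| ≤ G)
    (ht : t ∈ Set.Icc 0 T) (x : Spc n) :
    volPot μ (fun τ y => f τ y - g τ y) t x = volPot μ f t x - volPot μ g t x := by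
  have hT := ht.1.trans ht.2
  obtain ⟨C, hG, -⟩ := hker_gauss (n := n) hμ 0 (m := n + 1 + 0) (by positivity)
  have hjint := fun {h : ℝ → Spc n → ℝ} {H : ℝ} (hh : JC T h)
      (hb : ∀ τ ∈ Set.Icc 0 T, ∀ y, |h τ y| ≤ H) =>
    heatJ_intervalIntegrable (Nat.zero_le 1) le_rfl hG (hh.clampT hT)
      (fun τ => hb _ (clamp_mem hT τ)) t 0 t x
  rw [volPot_eq_heatJ hμ _ ht, volPot_eq_heatJ hμ _ ht, volPot_eq_heatJ hμ _ ht, heatJ, heatJ, heatJ,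
    ← intervalIntegral.integral_sub (hjint hf hfb) (hjint hg hgb)]
  refine intervalIntegral.integral_congr fun τ _ => ?_
  simp only [← mul_sub]
  congr 1
  have hi := fun {h : ℝ → Spc n → ℝ} {H : ℝ} (hh : JC T h)
      (hb : ∀ τ ∈ Set.Icc 0 T, ∀ y, |h τ y| ≤ H) =>
    heatA_integrable (γ := 0) (φ := clampT T h τ) le_rfl hG.cont
      ((hh.clampT hT).comp (by fun_prop : Continuous fun y : Spc n => (τ, y))) hG.b0
      (fun y => by simpa [clampT] using hb _ (clamp_mem hT τ) y) hG.nonneg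
      ((abs_nonneg _).trans (hb _ (clamp_mem hT τ) 0)) (le_refl (t - τ)) x
  rw [heatA, heatA, heatA, ← integral_sub (hi hf hfb) (hi hg hgb)]
  refine integral_congr_ae (Eventually.of_forall fun ζ => ?_)
  simp only [clampT]
  ring

theorem extF_sub {q : ℕ} (v v' : FormS n q) (S : Finset (Fin n)) :
    extF (fun I x => v I x - v' I x) S = fun x => extF v S x - extF v' S x := by
  by_cases h : S.card = q
  · rw [extF_mk _ h, extF_mk _ h, extF_mk _ h]
  · rw [extF_zero _ h, extF_zero _ h, extF_zero _ h]; simp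

theorem pd_sub {f g : Spc n → ℝ} {x : Spc n} (i : Fin n) (hf : DifferentiableAt ℝ f x)
    (hg : DifferentiableAt ℝ g x) : pd i (fun y => f y - g y) x = pd i f x - pd i g x := by
  rw [pd, fderiv_fun_sub hf hg]; rfl

theorem dE_sub {η η' : Finset (Fin n) → Spc n → ℝ} (h : ∀ S, Differentiable ℝ (η S))
    (h' : ∀ S, Differentiable ℝ (η' S)) (S : Finset (Fin n)) (x : Spc n) :
    dE (fun S x => η S x - η' S x) S x = dE η S x - dE η' S x := by
  unfold dE
  rw [← Finset.sum_sub_distrib]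
  refine Finset.sum_congr rfl fun i _ => ?_
  split_ifs
  · rw [pd_sub i (h _ x) (h' _ x), mul_sub]
  · rw [sub_zero]

theorem coE_sub {η η' : Finset (Fin n) → Spc n → ℝ} (h : ∀ S, Differentiable ℝ (η S))
    (h' : ∀ S, Differentiable ℝ (η' S)) (S : Finset (Fin n)) (x : Spc n) :
    coE (fun S x => η S x - η' S x) S x = coE η S x - coE η' S x := by
  unfold coE
  rw [neg_sub_neg, ← Finset.sum_sub_distrib, ← Finset.sum_neg_distrib]
  refine Finset.sum_congr rfl fun i _ => ?_
  split_ifs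
  · simp
  · rw [pd_sub i (h _ x) (h' _ x)]; ring

theorem extF_differentiable {q : ℕ} {v : FormS n q} (h : ∀ I, Differentiable ℝ (v I))
    (S : Finset (Fin n)) : Differentiable ℝ (extF v S) := by
  by_cases hS : S.card = q
  · rw [extF_mk _ hS]; exact h _
  · rw [extF_zero _ hS]; exact differentiable_const _

theorem dS_sub {q : ℕ} {v v' : FormS n q} (h : ∀ I, Differentiable ℝ (v I))
    (h' : ∀ I, Differentiable ℝ (v' I)) (J : Idx n (q + 1)) (x : Spc n) :
    dS (fun I x => v I x - v' I x) J x = dS v J x - dS v' J x := by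
  rw [dS_eq, dS_eq, dS_eq, ← dE_sub (extF_differentiable h) (extF_differentiable h')]
  congr 1
  exact funext (extF_sub v v')

theorem coDS_sub {q : ℕ} {v v' : FormS n q} (h : ∀ I, Differentiable ℝ (v I))
    (h' : ∀ I, Differentiable ℝ (v' I)) (L : Idx n (q - 1)) (x : Spc n) :
    coDS (fun I x => v I x - v' I x) L x = coDS v L x - coDS v' L x := by
  rw [coDS_eq, coDS_eq, coDS_eq, ← coE_sub (extF_differentiable h) (extF_differentiable h')]
  congr 1
  exact funext (extF_sub v v')

theorem D1.sub {e A B : ℝ} {f g : Spc n → ℝ} (hf : D1 e A f) (hg : D1 e B g) :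
    D1 e (A + B) fun x => f x - g x := by
  have key : ∀ {f g : Spc n → ℝ}, Dec e A f → Dec e B g → Dec e (A + B) fun x => f x - g x :=
    fun hf hg => ⟨hf.1.sub hg.1, fun y => by
      rw [add_mul]; exact (abs_sub _ _).trans (add_le_add (hf.2 y) (hg.2 y))⟩
  refine ⟨key hf.1 hg.1, hf.2.1.sub hg.2.1, fun i => ?_⟩
  rw [show pd i (fun x => f x - g x) = fun x => pd i f x - pd i g x from
    funext fun x => pd_sub i (hf.2.1 x) (hg.2.1 x)]
  exact key (hf.2.2 i) (hg.2.2 i)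

theorem phiS_sub (hn : 2 ≤ n) {q : ℕ} {v v' : FormS n q} {σ e A : ℝ} (hA : 0 ≤ A) (he : 2 < e)
    (hσ : 1 < σ) (hv : ∀ I, D1 σ A (v I)) (hdv : ∀ J, D1 e A (dS v J)) (hv' : ∀ I, D1 σ A (v' I))
    (hdv' : ∀ J, D1 e A (dS v' J)) (K : Idx n q) (x : Spc n) :
    phiS (dS fun I x => v I x - v' I x) K x = phiS (dS v) K x - phiS (dS v') K x := by
  obtain ⟨c, hc⟩ := exists_phiS_eq (n := n) hn
  have hd : dS (fun I x => v I x - v' I x) = fun J x => dS v J x - dS v' J x :=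
    funext fun J => funext fun x => dS_sub (fun I => (hv I).2.1) (fun I => (hv' I).2.1) J x
  rw [hc q _ σ e (A + A) (by linarith) he hσ (fun I => (hv I).sub (hv' I))
      (fun J => by rw [hd]; exact (hdv J).sub (hdv' J)) K x,
    hc q v σ e A hA he hσ hv hdv K x, hc q v' σ e A hA he hσ hv' hdv' K x, ← mul_sub,
    ← Finset.sum_sub_distrib]
  congr 1
  refine Finset.sum_congr rfl fun i _ => ?_
  by_cases hi : i ∉ K.1
  · rw [if_pos hi, if_pos hi, if_pos hi, ← mul_sub, ← Finset.sum_sub_distrib]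
    congr 1
    refine Finset.sum_congr rfl fun j _ => ?_
    split_ifs
    · have hk := (gradKer_hom i).ik hn hσ
      have h1 := extF_D1 hA hv ((insert i K.1).erase j)
      have h2 := extF_D1 hA hv' ((insert i K.1).erase j)
      rw [extF_sub, ← mul_sub, ← pd_sub j (hasFDerivAt_cv hk h1.1 h1.2.1 h1.2.2 x).differentiableAt
        (hasFDerivAt_cv hk h2.1 h2.2.1 h2.2.2 x).differentiableAt]
      congr 2
      exact funext (cv_sub hk h1.1 h2.1)
    · rw [sub_zero]
  · rw [if_neg hi, if_neg hi, if_neg hi, sub_zero]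

theorem bilin_eq_sum {ι κ θ : Type*} [Fintype ι] [Fintype κ] [DecidableEq ι] [DecidableEq κ]
    (B : (ι → ℝ) →ₗ[ℝ] (κ → ℝ) →ₗ[ℝ] (θ → ℝ)) (a : ι → ℝ) (b : κ → ℝ) (e : θ) :
    B a b e = ∑ i, ∑ j, B (fun i' => if i = i' then 1 else 0) (fun j' => if j = j' then 1 else 0) e *
      (a i * b j) := by
  rw [LinearMap.pi_apply_eq_sum_univ B a, LinearMap.sum_apply, Finset.sum_apply]
  refine Finset.sum_congr rfl fun i _ => ?_
  rw [LinearMap.smul_apply, LinearMap.pi_apply_eq_sum_univ _ b, Pi.smul_apply, Finset.sum_apply,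
    smul_eq_mul, Finset.mul_sum]
  refine Finset.sum_congr rfl fun j _ => ?_
  rw [Pi.smul_apply, smul_eq_mul]
  ring

/-- A family of sets of functions, indexed by a bound, which behaves like the balls of a
seminorm. -/
structure Balls (P : ℝ → (ℝ → Spc n → ℝ) → Prop) : Prop where
  zero : ∀ K, 0 ≤ K → P K fun _ _ => 0
  add : ∀ K K' v v', P K v → P K' v' → P (K + K') fun t x => v t x + v' t x
  smul : ∀ K v (a : ℝ), P K v → P (|a| * K) fun t x => a * v t x

theorem Balls.sum {P : ℝ → (ℝ → Spc n → ℝ) → Prop} (hP : Balls P) {ι : Type*} (s : Finset ι)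
    {K : ι → ℝ} {v : ι → ℝ → Spc n → ℝ} (h : ∀ i ∈ s, P (K i) (v i)) :
    P (∑ i ∈ s, K i) (fun t x => ∑ i ∈ s, v i t x) := by
  induction s using Finset.induction_on with
  | empty => simpa using hP.zero 0 le_rfl
  | insert a s ha ih =>
    simp only [Finset.sum_insert ha]
    exact hP.add _ _ _ _ (h a (Finset.mem_insert_self a s))
      (ih fun i hi => h i (Finset.mem_insert_of_mem hi))

theorem bilin_mem {ι κ θ : Type*} [Fintype ι] [Fintype κ] [Fintype θ]
    (B : (ι → ℝ) →ₗ[ℝ] (κ → ℝ) →ₗ[ℝ] (θ → ℝ)) : ∃ C : ℝ, 0 ≤ C ∧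
      ∀ P : ℝ → (ℝ → Spc n → ℝ) → Prop, Balls P → ∀ (K : ℝ) (a : ι → ℝ → Spc n → ℝ)
        (b : κ → ℝ → Spc n → ℝ), 0 ≤ K → (∀ i j, P K fun t x => a i t x * b j t x) →
        ∀ e, ∃ K' ≤ C * K, P K' fun t x => B (fun i => a i t x) (fun j => b j t x) e := by
  have key : ∀ e, ∃ C : ℝ, 0 ≤ C ∧ ∀ P : ℝ → (ℝ → Spc n → ℝ) → Prop, Balls P →
      ∀ (K : ℝ) (a : ι → ℝ → Spc n → ℝ)
        (b : κ → ℝ → Spc n → ℝ), 0 ≤ K → (∀ i j, P K fun t x => a i t x * b j t x) →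
        P (C * K) fun t x => B (fun i => a i t x) (fun j => b j t x) e := fun e => by
    refine ⟨∑ i, ∑ j, |B (fun i' => if i = i' then 1 else 0) (fun j' => if j = j' then 1 else 0) e|,
      by positivity, fun P hP K a b hK h => ?_⟩
    rw [show (fun t x => B (fun i => a i t x) (fun j => b j t x) e) = _ from
      funext fun t => funext fun x => bilin_eq_sum B _ _ e]
    simp only [Finset.sum_mul]
    exact hP.sum _ fun i _ => hP.sum _ fun j _ => hP.smul _ _ _ (h i j)
  choose C hC h using key
  refine ⟨∑ e, C e, Finset.sum_nonneg fun e _ => hC e, fun P hP K a b hK hab e =>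
    ⟨_, ?_, h e P hP K a b hK hab⟩⟩
  have := Finset.single_le_sum (fun e _ => hC e) (Finset.mem_univ e)
  gcongr

theorem Wop_eq {q : ℕ} (M₁ : M1Type n q) (w u : FormT n q) (I : Idx n q) (t : ℝ) (x : Spc n) :
    Wop M₁ w u I t x =
      ((M₁.comp (LinearMap.inl ℝ _ _)) (fun J => dT u J t x) (fun I => w I t x) I +
        (M₁.comp (LinearMap.inr ℝ _ _)) (fun L => coDT u L t x) (fun I => w I t x) I) +
      ((M₁.comp (LinearMap.inl ℝ _ _)) (fun J => dT w J t x) (fun I => u I t x) I +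
        (M₁.comp (LinearMap.inr ℝ _ _)) (fun L => coDT w L t x) (fun I => u I t x) I) := by
  have key : ∀ a b c, M₁ (a, b) c I = M₁ (a, 0) c I + M₁ (0, b) c I := fun a b c => by
    rw [← Pi.add_apply, ← LinearMap.add_apply, ← map_add, Prod.mk_add_mk, add_zero, zero_add]
  exact congrArg₂ (· + ·) (key _ _ _) (key _ _ _)

theorem Wop_mem {q : ℕ} (M₁ : M1Type n q) : ∃ C : ℝ, 0 ≤ C ∧
    ∀ P : ℝ → (ℝ → Spc n → ℝ) → Prop, Balls P → ∀ (K : ℝ) (w u : FormT n q), 0 ≤ K →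
      (∀ J I, P K fun t x => dT u J t x * w I t x) →
      (∀ L I, P K fun t x => coDT u L t x * w I t x) →
      (∀ J I, P K fun t x => dT w J t x * u I t x) →
      (∀ L I, P K fun t x => coDT w L t x * u I t x) →
      ∀ I, ∃ K' ≤ C * K, P K' (Wop M₁ w u I) := by
  obtain ⟨C₁, hC₁, h₁⟩ := bilin_mem (n := n) (M₁.comp (LinearMap.inl ℝ _ _))
  obtain ⟨C₂, hC₂, h₂⟩ := bilin_mem (n := n) (M₁.comp (LinearMap.inr ℝ _ _))
  refine ⟨(C₁ + C₂) + (C₁ + C₂), by positivity, fun P hP K w u hK ha hb hc hd I => ?_⟩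
  obtain ⟨K₁, hK₁, ha⟩ := h₁ P hP K _ _ hK ha I
  obtain ⟨K₂, hK₂, hb⟩ := h₂ P hP K _ _ hK hb I
  obtain ⟨K₃, hK₃, hc⟩ := h₁ P hP K _ _ hK hc I
  obtain ⟨K₄, hK₄, hd⟩ := h₂ P hP K _ _ hK hd I
  refine ⟨(K₁ + K₂) + (K₃ + K₄), by linarith, ?_⟩
  rw [show Wop M₁ w u I = _ from funext fun t => funext fun x => Wop_eq M₁ w u I t x]
  exact hP.add _ _ _ _ (hP.add _ _ _ _ ha hb) (hP.add _ _ _ _ hc hd)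

theorem balls_pr (c : Cfg) (r m : ℕ) (σ : ℝ) : Balls (n := n) (Pr c r m σ) :=
  ⟨fun _ hK => Pr.zero c r m σ hK, fun _ _ _ _ h h' => h.add h', fun _ _ a h => h.smul a⟩

/-- Bounds for a form, its differential and its codifferential. -/
def XF {q : ℕ} (c : Cfg) (r m : ℕ) (δ K : ℝ) (u : FormT n q) : Prop :=
  (∀ I, Pr c r m δ K (u I)) ∧ (∀ J, Pr c r m (δ + 1) K (dT u J)) ∧
    ∀ L, Pr c r m (δ + 1) K (coDT u L)

theorem Wop_pr {q : ℕ} (M₁ : M1Type n q) (r m : ℕ) (δ : ℝ) : ∃ C : ℝ, 0 ≤ C ∧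
    ∀ (c : Cfg) (K₁ K₂ : ℝ) (w u : FormT n q), 0 ≤ K₁ → 0 ≤ K₂ → XF c.flat r m δ K₁ w →
      XF c.flat r m δ K₂ u → ∀ I, Pr c.flat r m (2 * δ + 1) (C * K₁ * K₂) (Wop M₁ w u I) := by
  obtain ⟨C₁, hC₁, h₁⟩ := Wop_mem M₁
  obtain ⟨C₂, hC₂, h₂⟩ := Pr.mul (n := n) r m (δ + 1) δ
  refine ⟨C₁ * C₂, by positivity, fun c K₁ K₂ w u hK₁ hK₂ hw hu I => ?_⟩
  have e : δ + 1 + δ = 2 * δ + 1 := by ring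
  obtain ⟨K', hK', h⟩ := h₁ _ (balls_pr c.flat r m (2 * δ + 1)) (C₂ * K₁ * K₂) w u (by positivity)
    (fun J I => by have := h₂ c _ _ _ _ (hu.2.1 J) (hw.1 I); rwa [e, mul_right_comm] at this)
    (fun J I => by have := h₂ c _ _ _ _ (hu.2.2 J) (hw.1 I); rwa [e, mul_right_comm] at this)
    (fun J I => e ▸ h₂ c _ _ _ _ (hw.2.1 J) (hu.1 I))
    (fun J I => e ▸ h₂ c _ _ _ _ (hw.2.2 J) (hu.1 I)) I
  exact h.mono le_rfl le_rfl (hK'.trans_eq (by ring))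

theorem Wop_cl {q : ℕ} (M₁ : M1Type n q) (m : ℕ) (δ : ℝ) : ∃ C : ℝ, 0 ≤ C ∧
    ∀ (c : Cfg) (K₁ K₂ : ℝ) (w u : FormT n q), 0 ≤ K₁ → 0 ≤ K₂ → XF c.flat 0 m δ K₁ w →
      XF c 0 m δ K₂ u → ∀ I, Cl c m (2 * δ + 1) (C * K₁ * K₂) (Wop M₁ w u I) := by
  obtain ⟨C₁, hC₁, h₁⟩ := Wop_mem M₁
  obtain ⟨C₂, hC₂, h₂⟩ := Cl.mul (n := n) m (δ + 1) δ
  obtain ⟨C₃, hC₃, h₃⟩ := Cl.mul (n := n) m δ (δ + 1)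
  refine ⟨C₁ * (C₂ + C₃), by positivity, fun c K₁ K₂ w u hK₁ hK₂ hw hu I => ?_⟩
  have e : δ + 1 + δ = 2 * δ + 1 := by ring
  have e' : δ + (δ + 1) = 2 * δ + 1 := by ring
  have h0 : 0 ≤ K₁ * K₂ := by positivity
  have k₂ : C₂ * K₁ * K₂ ≤ (C₂ + C₃) * K₁ * K₂ := by nlinarith
  have k₃ : C₃ * K₁ * K₂ ≤ (C₂ + C₃) * K₁ * K₂ := by nlinarith
  obtain ⟨K', hK', h⟩ := h₁ _ (balls_pr c 0 m (2 * δ + 1)) ((C₂ + C₃) * K₁ * K₂) w u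
    (by positivity)
    (fun J I => ((h₃ c _ _ _ _ (hw.1 I) (hu.2.1 J)).mono e'.ge k₃).congr
      fun t _ => funext fun x => mul_comm _ _)
    (fun J I => ((h₃ c _ _ _ _ (hw.1 I) (hu.2.2 J)).mono e'.ge k₃).congr
      fun t _ => funext fun x => mul_comm _ _)
    (fun J I => (h₂ c _ _ _ _ (hw.2.1 J) (hu.1 I)).mono e.ge k₂)
    (fun J I => (h₂ c _ _ _ _ (hw.2.2 J) (hu.1 I)).mono e.ge k₂) I
  exact Cl.mono h le_rfl (hK'.trans_eq (by ring))

theorem summable_geom (K : ℝ) : Summable fun j : ℕ => K / 2 ^ j := by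
  simpa [div_eq_mul_inv, inv_pow] using
    (summable_geometric_of_lt_one (by norm_num : (0 : ℝ) ≤ 2⁻¹) (by norm_num)).mul_left K

theorem tsum_geom (K : ℝ) : ∑' j : ℕ, K / 2 ^ j = 2 * K := by
  have := tsum_geometric_of_lt_one (by norm_num : (0 : ℝ) ≤ 2⁻¹) (by norm_num)
  simp only [div_eq_mul_inv, ← inv_pow]
  rw [tsum_mul_left, this]
  norm_num
  ring

theorem Bas.summable {c : Cfg} {σ K : ℝ} (hσ : 0 ≤ σ) {v : ℕ → ℝ → Spc n → ℝ}
    (h : ∀ j, Bas c σ (K / 2 ^ j) (v j)) {t : ℝ} (ht : t ∈ Set.Icc 0 c.T) (x : Spc n) :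
    Summable fun j => v j t x :=
  ((summable_geom K).mul_right (Real.exp (c.β * c.T))).of_norm_bounded
    fun j => (h j).abs_le hσ t ht x

theorem Bas.tsum {c : Cfg} (hh : ¬ c.h) {σ K : ℝ} (hσ : 0 ≤ σ) {v : ℕ → ℝ → Spc n → ℝ}
    (h : ∀ j, Bas c σ (K / 2 ^ j) (v j)) : Bas c σ (2 * K) fun t x => ∑' j, v j t x := by
  refine ⟨continuousOn_tsum (fun j => (h j).1)
    ((summable_geom K).mul_right (Real.exp (c.β * c.T)))
    fun j p hp => (h j).abs_le hσ p.1 hp.1 p.2, fun t ht x => ?_, fun h => (hh h).elim⟩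
  have h1 : Summable fun j : ℕ => K / 2 ^ j * Real.exp (c.β * t) * wt x ^ (-σ) :=
    ((summable_geom K).mul_right _).mul_right _
  rw [← Real.norm_eq_abs]
  refine (tsum_of_norm_bounded (f := fun j => v j t x) h1.hasSum
    fun j => (h j).2.1 t ht x).trans_eq ?_
  rw [tsum_mul_right, tsum_mul_right, tsum_geom]

theorem Cl.hasSum_pd {c : Cfg} {N : ℕ} {σ K : ℝ} (hσ : 0 ≤ σ) {v : ℕ → ℝ → Spc n → ℝ}
    (h : ∀ j, Cl c (N + 1) σ (K / 2 ^ j) (v j)) {t : ℝ} (ht : t ∈ Set.Icc 0 c.T) :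
    Differentiable ℝ (fun x => ∑' j, v j t x) ∧
      ∀ i x, HasSum (fun j => NSdeRham.pd i (v j t) x) (NSdeRham.pd i (fun x => ∑' j, v j t x) x) := by
  have hs : Summable fun j : ℕ => n * (K / 2 ^ j * Real.exp (c.β * c.T)) :=
    ((summable_geom K).mul_right _).mul_left _
  have hb : ∀ j x, ‖fderiv ℝ (v j t) x‖ ≤ n * (K / 2 ^ j * Real.exp (c.β * c.T)) := fun j x => by
    rw [fderiv_eq_sum]
    refine (norm_sum_smul_proj_le _).trans ?_
    refine (Finset.sum_le_sum fun i _ =>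
      ((h j).2.2 i).bas.abs_le (by linarith) t ht x).trans_eq ?_
    simp
  have key := fun x => hasFDerivAt_tsum hs (fun j x => ((h j).2.1 t ht x).hasFDerivAt) hb
    (Bas.summable hσ (fun j => (h j).bas) ht x) x
  refine ⟨fun x => (key x).differentiableAt, fun i x => ?_⟩
  rw [NSdeRham.pd, (key x).fderiv]
  have : Summable fun j => fderiv ℝ (v j t) x := hs.of_norm_bounded fun j => hb j x
  exact (ContinuousLinearMap.apply ℝ ℝ (EuclideanSpace.single i (1 : ℝ))).hasSum this.hasSum

theorem Cl.tsum {c : Cfg} (hh : ¬ c.h) {N : ℕ} {σ K : ℝ} (hσ : 0 ≤ σ) {v : ℕ → ℝ → Spc n → ℝ}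
    (h : ∀ j, Cl c N σ (K / 2 ^ j) (v j)) : Cl c N σ (2 * K) fun t x => ∑' j, v j t x := by
  induction N generalizing σ v with
  | zero => exact Bas.tsum hh hσ h
  | succ N ih =>
    refine ⟨Bas.tsum hh hσ fun j => (h j).bas, fun t ht => (Cl.hasSum_pd hσ h ht).1, fun i => ?_⟩
    refine (ih (by linarith) fun j => (h j).2.2 i).congr fun t ht => ?_
    exact funext fun x => ((Cl.hasSum_pd hσ h ht).2 i x).tsum_eq.symm

theorem extF_tsum {q : ℕ} (g : ℕ → FormS n q) (S : Finset (Fin n)) :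
    extF (fun I x => ∑' j, g j I x) S = fun x => ∑' j, extF (g j) S x := by
  by_cases h : S.card = q
  · simp only [extF_mk _ h]
  · simp only [extF_zero _ h, tsum_zero]

theorem XF.congr {q : ℕ} {c : Cfg} {r m : ℕ} {δ K : ℝ} {u u' : FormT n q} (h : XF c r m δ K u)
    (he : ∀ I, ∀ t ∈ Set.Icc 0 c.T, u' I t = u I t) : XF c r m δ K u' := by
  have h1 : ∀ t ∈ Set.Icc 0 c.T, (fun I => u' I t) = fun I => u I t := fun t ht =>
    funext fun I => he I t ht
  refine ⟨fun I => (h.1 I).congr (he I), fun J => (h.2.1 J).congr fun t ht => ?_,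
    fun L => (h.2.2 L).congr fun t ht => ?_⟩
  · rw [NSdeRham.dT, NSdeRham.dT, h1 t ht]
  · rw [coDT, coDT, h1 t ht]

theorem XF.mono {q : ℕ} {c : Cfg} {r m m' : ℕ} {δ K K' : ℝ} {u : FormT n q} (h : XF c r m δ K u)
    (hm : m' ≤ m) (hK : K ≤ K') : XF c r m' δ K' u :=
  ⟨fun I => (h.1 I).mono hm le_rfl hK, fun J => (h.2.1 J).mono hm le_rfl hK,
    fun L => (h.2.2 L).mono hm le_rfl hK⟩

theorem XF.tsum {q : ℕ} {c : Cfg} (hh : ¬ c.h) {N : ℕ} {δ K : ℝ} (hδ : 0 ≤ δ)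
    (hK : 0 ≤ K) {g : ℕ → FormT n q} (h : ∀ j, XF c 0 (N + 1) δ (K / 2 ^ j) (g j)) :
    XF c 0 (N + 1) δ (2 * K) fun I t x => ∑' j, g j I t x := by
  have hext : ∀ j S, Cl c (N + 1) δ (K / 2 ^ j) fun t => NSdeRham.extF (fun I => g j I t) S :=
    fun j S => Pr.extF (r := 0) (by positivity) (h j).1 S
  have hs := fun S t ht => (Cl.hasSum_pd hδ (fun j => hext j S) (t := t) ht).2
  refine ⟨fun I => Cl.tsum hh hδ fun j => (h j).1 I, fun J => ?_, fun L => ?_⟩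
  · refine Cl.congr (Cl.tsum hh (by linarith) fun j => (h j).2.1 J) fun t ht => funext fun x => ?_
    refine Eq.symm (HasSum.tsum_eq ?_)
    simp only [NSdeRham.dT, dS_eq]
    rw [show NSdeRham.extF (fun I x => ∑' j, g j I t x) = _ from funext fun S => extF_tsum _ S]
    refine hasSum_sum fun i _ => ?_
    split_ifs
    · exact (hs _ t ht i x).mul_left _
    · exact hasSum_zero
  · refine Cl.congr (Cl.tsum hh (by linarith) fun j => (h j).2.2 L) fun t ht => funext fun x => ?_
    refine Eq.symm (HasSum.tsum_eq ?_)
    simp only [coDT, coDS_eq]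
    rw [show NSdeRham.extF (fun I x => ∑' j, g j I t x) = _ from funext fun S => extF_tsum _ S]
    refine (hasSum_sum fun i _ => ?_).neg
    split_ifs
    · exact hasSum_zero
    · exact (hs _ t ht i x).mul_left _

theorem XF.phi (hn : 2 ≤ n) {δ l σ : ℝ} (hδ : 1 ≤ δ) (hδn : δ < n) (hl0 : 0 < l) (hl1 : l < 1)
    (hσ : δ < σ) (q r m : ℕ) (hm : 1 ≤ 2 * r + m) : ∃ C : ℝ, 0 ≤ C ∧
      ∀ (c : Cfg) (K : ℝ) (v : FormT n q), c.lam = l → 0 ≤ K →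
        (∀ I, Pr c r (m + 1) σ K (v I)) →
        XF c r m δ (C * K) (PhiOp (dT v)) ∧ CoClosed c.T (PhiOp (dT v)) := by
  obtain ⟨C, hC, h⟩ := Pr.phi hn hδ hδn hl0 hl1 hσ q r m hm
  refine ⟨C, hC, fun c K v hc hK hv => ?_⟩
  obtain ⟨h1, h2, h3⟩ := h c K v hc hK hv
  exact ⟨⟨h1, h2, fun L => (Pr.zero c r m (δ + 1) (by positivity)).congr
    fun t ht => funext fun x => h3 L t ht x⟩, h3⟩

/-- The operator `Φ_q d_q Ψ_{μ,q} W_q`. -/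
def opA {q : ℕ} (μ : ℝ) (M₁ : M1Type n q) (w u : FormT n q) : FormT n q :=
  PhiOp (dT (volPotF μ (Wop M₁ w u)))

theorem volPot_Wop_exp {q : ℕ} {μ T δ : ℝ} (hμ : 0 < μ) (hT : 0 < T) (hδ : 0 ≤ δ)
    (M₁ : M1Type n q) (N : ℕ) : ∃ M : ℝ, 0 ≤ M ∧ ∀ (c : Cfg), c.T = T → ¬ c.h → 0 < c.β →
      ∀ (K₁ K₂ : ℝ) (w u : FormT n q), 0 ≤ K₁ → 0 ≤ K₂ → XF c.flat 0 N δ K₁ w →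
        XF c 0 N δ K₂ u → ∀ I, Cl c (N + 1) (2 * δ) (M * c.β ^ (-(1 / 4) : ℝ) * (K₁ * K₂))
          (volPot μ (Wop M₁ w u I)) := by
  obtain ⟨C, hC, hW⟩ := Wop_cl M₁ N δ
  obtain ⟨M, hM, hV⟩ := Cl.volPot_exp (n := n) hμ hT N (γ := 2 * δ + 1) (σ := 2 * δ)
    (by linarith) le_rfl
  refine ⟨M * C, by positivity, fun c hc hh hβ K₁ K₂ w u h₁ h₂ hw hu I => ?_⟩
  convert hV c hc hh hβ _ _ (hW c K₁ K₂ w u h₁ h₂ hw hu I) using 1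
  ring

theorem opA_exp (hn : 2 ≤ n) {q : ℕ} {μ T δ l : ℝ} (hμ : 0 < μ) (hT : 0 < T) (hδ : 1 ≤ δ)
    (hδn : δ < n) (hl0 : 0 < l) (hl1 : l < 1) (M₁ : M1Type n q) (N : ℕ) (hN : 1 ≤ N) :
    ∃ M : ℝ, 0 ≤ M ∧ ∀ (c : Cfg), c.T = T → c.lam = l → ¬ c.h → 0 < c.β →
      ∀ (K₁ K₂ : ℝ) (w u : FormT n q), 0 ≤ K₁ → 0 ≤ K₂ → XF c.flat 0 N δ K₁ w →
        XF c 0 N δ K₂ u → XF c 0 N δ (M * c.β ^ (-(1 / 4) : ℝ) * K₁ * K₂) (opA μ M₁ w u) ∧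
          CoClosed c.T (opA μ M₁ w u) := by
  obtain ⟨M, hM, hV⟩ := volPot_Wop_exp (n := n) hμ hT (zero_le_one.trans hδ) M₁ N
  obtain ⟨C, hC, hP⟩ := XF.phi hn hδ hδn hl0 hl1 (σ := 2 * δ) (by linarith) q 0 N (by omega)
  refine ⟨C * M, by positivity, fun c hc hcl hh hβ K₁ K₂ w u h₁ h₂ hw hu => ?_⟩
  have := hP c _ _ hcl (by positivity) (hV c hc hh hβ K₁ K₂ w u h₁ h₂ hw hu)
  exact ⟨this.1.mono le_rfl (by linarith), this.2⟩

theorem XF.diff {q : ℕ} {c : Cfg} {N : ℕ} {δ K : ℝ} {u : FormT n q} (h : XF c 0 (N + 1) δ K u)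
    {t : ℝ} (ht : t ∈ Set.Icc 0 c.T) (I : Idx n q) : Differentiable ℝ (u I t) :=
  (h.1 I).2.1 t ht

theorem dT_sub {q : ℕ} {T : ℝ} {u u' u'' : FormT n q}
    (h : ∀ t ∈ Set.Icc 0 T, ∀ I, Differentiable ℝ (u I t))
    (h' : ∀ t ∈ Set.Icc 0 T, ∀ I, Differentiable ℝ (u' I t))
    (he : ∀ I, ∀ t ∈ Set.Icc 0 T, u'' I t = fun x => u I t x - u' I t x)
    {t : ℝ} (ht : t ∈ Set.Icc 0 T) :
    (∀ J, dT u'' J t = fun x => dT u J t x - dT u' J t x) ∧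
      ∀ L, coDT u'' L t = fun x => coDT u L t x - coDT u' L t x := by
  have e : (fun I => u'' I t) = fun I x => u I t x - u' I t x := funext fun I => he I t ht
  exact ⟨fun J => by rw [dT, e]; exact funext fun x => dS_sub (h t ht) (h' t ht) J x,
    fun L => by rw [coDT, e]; exact funext fun x => coDS_sub (h t ht) (h' t ht) L x⟩

theorem XF.sub {q : ℕ} {c : Cfg} {r m : ℕ} {δ K K' : ℝ} {u u' u'' : FormT n q}
    (h : XF c r m δ K u) (h' : XF c r m δ K' u')
    (hd : ∀ t ∈ Set.Icc 0 c.T, ∀ I, Differentiable ℝ (u I t))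
    (hd' : ∀ t ∈ Set.Icc 0 c.T, ∀ I, Differentiable ℝ (u' I t))
    (he : ∀ I, ∀ t ∈ Set.Icc 0 c.T, u'' I t = fun x => u I t x - u' I t x) :
    XF c r m δ (K + K') u'' := by
  have key : ∀ {σ : ℝ} {a b d : ℝ → Spc n → ℝ}, Pr c r m σ K a → Pr c r m σ K' b →
      (∀ t ∈ Set.Icc 0 c.T, d t = fun x => a t x - b t x) → Pr c r m σ (K + K') d :=
    fun {σ a b d} ha hb hd => by
      have := (ha.add (hb.smul (-1))).congr (w := d) fun t ht => by
        rw [hd t ht]; exact funext fun x => by ring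
      simpa using this
  exact ⟨fun I => key (h.1 I) (h'.1 I) (he I),
    fun J => key (h.2.1 J) (h'.2.1 J) fun t ht => (dT_sub hd hd' he ht).1 J,
    fun L => key (h.2.2 L) (h'.2.2 L) fun t ht => (dT_sub hd hd' he ht).2 L⟩

theorem opA_sub (hn : 2 ≤ n) {q : ℕ} {μ δ : ℝ} (hμ : 0 < μ) (hδ : 1 ≤ δ) (M₁ : M1Type n q) {N : ℕ}
    {c : Cfg} (hh : ¬ c.h) (hβ : 0 < c.β) {K₁ K K' : ℝ} (hK₁ : 0 ≤ K₁) (hK : 0 ≤ K) (hK' : 0 ≤ K')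
    {w u u' u'' : FormT n q} (hw : XF c.flat 0 (N + 1) δ K₁ w) (hu : XF c 0 (N + 1) δ K u)
    (hu' : XF c 0 (N + 1) δ K' u')
    (he : ∀ I, ∀ t ∈ Set.Icc 0 c.T, u'' I t = fun x => u I t x - u' I t x) (I : Idx n q) {t : ℝ}
    (ht : t ∈ Set.Icc 0 c.T) :
    opA μ M₁ w u'' I t = fun x => opA μ M₁ w u I t x - opA μ M₁ w u' I t x := by
  obtain ⟨C, hC, hW⟩ := Wop_cl M₁ (N + 1) δ
  obtain ⟨M, hM, hV⟩ := volPot_Wop_exp (n := n) hμ c.hT (zero_le_one.trans hδ) M₁ (N + 1)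
  have eW : ∀ I, ∀ t ∈ Set.Icc 0 c.T,
      Wop M₁ w u'' I t = fun x => Wop M₁ w u I t x - Wop M₁ w u' I t x := by
    intro I t ht
    obtain ⟨e1, e2⟩ := dT_sub (fun t ht I => hu.diff ht I) (fun t ht I => hu'.diff ht I) he ht
    funext x
    have a1 : ddFib u'' t x = ddFib u t x - ddFib u' t x :=
      Prod.ext (funext fun J => congrFun (e1 J) x) (funext fun L => congrFun (e2 L) x)
    have a2 : fib u'' t x = fib u t x - fib u' t x := funext fun I => congrFun (he I t ht) x
    simp only [Wop, a1, a2, map_sub, LinearMap.sub_apply, Pi.sub_apply]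
    ring
  have h1 := hW c _ _ w u hK₁ hK hw hu
  have h2 := hW c _ _ w u' hK₁ hK' hw hu'
  have eV : ∀ I, volPot μ (Wop M₁ w u'' I) t =
      fun x => volPot μ (Wop M₁ w u I) t x - volPot μ (Wop M₁ w u' I) t x := fun I => by
    rw [volPot_congr (eW I) ht]
    exact funext fun x => volPot_sub hμ (h1 I).bas.1 (h2 I).bas.1
      ((h1 I).bas.abs_le (by linarith)) ((h2 I).bas.abs_le (by linarith)) ht x
  set B := M * c.β ^ (-(1 / 4) : ℝ) * (K₁ * (K + K')) with hB
  have hB0 : 0 ≤ B := by positivity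
  have v1 := hV c rfl hh hβ K₁ (K + K') w u hK₁ (by linarith) hw (hu.mono le_rfl (by linarith))
  have v2 := hV c rfl hh hβ K₁ (K + K') w u' hK₁ (by linarith) hw (hu'.mono le_rfl (by linarith))
  have hA : ∀ v : FormT n q, (∀ I, Cl c (N + 1 + 1) (2 * δ) B (v I)) →
      (∀ I, D1 (2 * δ) ((n + 1) * (B * Real.exp (c.β * t))) (v I t)) ∧
      ∀ J, D1 (2 * δ + 1) ((n + 1) * (B * Real.exp (c.β * t))) (dS (fun I => v I t) J) :=
    fun v hv => by
      have hE : 0 ≤ B * Real.exp (c.β * t) := by positivity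
      have hnE : 0 ≤ n * (B * Real.exp (c.β * t)) := by positivity
      refine ⟨fun I => (Cl.d1 (hv I) ht).mono (by linarith), fun J => ?_⟩
      exact (Cl.d1 (Pr.dT (r := 0) hB0 hv J) ht).mono (by rw [mul_assoc]; linarith)
  have a1 := hA _ v1
  have a2 := hA _ v2
  funext x
  change phiS (dS fun I => volPot μ (Wop M₁ w u'' I) t) I x = _
  rw [show (fun I => volPot μ (Wop M₁ w u'' I) t) = _ from funext eV]
  exact phiS_sub hn (by positivity) (by linarith : 2 < 2 * δ + 1) (by linarith) a1.1 a1.2 a2.1 a2.2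
    I x

theorem eq_zero_of_geom {a Q : ℝ} (h : ∀ m : ℕ, |a| ≤ Q / 2 ^ m) : a = 0 :=
  abs_nonpos_iff.1 (ge_of_tendsto' (summable_geom Q).tendsto_atTop_zero h)

theorem dS_neg {q : ℕ} (v : FormS n q) (J : Idx n (q + 1)) (x : Spc n) :
    dS (fun I x => -v I x) J x = -dS v J x := by
  rw [dS, dS, ← Finset.sum_neg_distrib]
  refine Finset.sum_congr rfl fun i _ => ?_
  split_ifs
  · simp only [pd, fderiv_fun_neg, neg_apply, mul_neg]
  · exact neg_zero.symm

theorem coDS_neg {q : ℕ} (v : FormS n q) (L : Idx n (q - 1)) (x : Spc n) :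
    coDS (fun I x => -v I x) L x = -coDS v L x := by
  rw [coDS, coDS]
  refine congrArg Neg.neg ?_
  rw [← Finset.sum_neg_distrib]
  refine Finset.sum_congr rfl fun i _ => ?_
  split_ifs
  · simp only [pd, fderiv_fun_neg, neg_apply, mul_neg]
  · exact neg_zero.symm

theorem XF.neg {q : ℕ} {c : Cfg} {r m : ℕ} {δ K : ℝ} {u u' : FormT n q} (h : XF c r m δ K u)
    (he : ∀ I, ∀ t ∈ Set.Icc 0 c.T, u' I t = fun x => -u I t x) : XF c r m δ K u' := by
  refine XF.congr (u := fun I t x => -u I t x) ?_ he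
  have key : ∀ {σ : ℝ} {a d : ℝ → Spc n → ℝ}, Pr c r m σ K a → (∀ t x, d t x = -a t x) →
      Pr c r m σ K d := fun {σ a d} ha hd => by
    simpa using (ha.smul (-1)).congr (w := d) fun t _ => funext fun x => by rw [hd]; ring
  exact ⟨fun I => key (h.1 I) fun _ _ => rfl,
    fun J => key (h.2.1 J) fun t x => dS_neg (fun I => u I t) J x,
    fun L => key (h.2.2 L) fun t x => coDS_neg (fun I => u I t) L x⟩

theorem exists_contraction (hn : 2 ≤ n) {q : ℕ} {μ T δ l : ℝ} (hμ : 0 < μ) (hT : 0 < T)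
    (hδ : 1 ≤ δ) (hδn : δ < n) (hl0 : 0 < l) (hl1 : l < 1) (M₁ : M1Type n q) (N : ℕ) {K₁ : ℝ}
    (hK₁ : 0 ≤ K₁) : ∃ c : Cfg, c.T = T ∧ c.lam = l ∧ ¬ c.h ∧ 0 < c.β ∧
      ∀ (w u : FormT n q) (K : ℝ), 0 ≤ K → XF c.flat 0 (N + 1) δ K₁ w → XF c 0 (N + 1) δ K u →
        XF c 0 (N + 1) δ (K / 2) (opA μ M₁ w u) ∧ CoClosed c.T (opA μ M₁ w u) := by
  obtain ⟨M, hM, h⟩ := opA_exp hn hμ hT hδ hδn hl0 hl1 M₁ (N + 1) (by omega)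
  have hlim : Tendsto (fun β : ℝ => M * β ^ (-(1 / 4) : ℝ) * K₁) atTop (nhds (M * 0 * K₁)) :=
    ((tendsto_rpow_neg_atTop (by norm_num)).const_mul M).mul_const K₁
  rw [mul_zero, zero_mul] at hlim
  obtain ⟨β, hβ, hβ0⟩ := ((hlim.eventually_le_const (by norm_num : (0 : ℝ) < 1 / 2)).and
    (eventually_gt_atTop 0)).exists
  refine ⟨⟨T, l, β, False, hT, hl0, hl1, hβ0.le⟩, rfl, rfl, id, hβ0, fun w u K hK hw hu => ?_⟩
  obtain ⟨h1, h2⟩ := h ⟨T, l, β, False, hT, hl0, hl1, hβ0.le⟩ rfl rfl id hβ0 K₁ K w u hK₁ hK hw hu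
  exact ⟨h1.mono le_rfl (by nlinarith), h2⟩

theorem XF.abs_le {q : ℕ} {c : Cfg} {N : ℕ} {δ K : ℝ} {u : FormT n q} (hδ : 0 ≤ δ)
    (h : XF c 0 N δ K u) (I : Idx n q) {t : ℝ} (ht : t ∈ Set.Icc 0 c.T) (x : Spc n) :
    |u I t x| ≤ K * Real.exp (c.β * c.T) :=
  (Cl.bas (h.1 I)).abs_le hδ t ht x

theorem neumann (hn : 2 ≤ n) {q : ℕ} {μ δ : ℝ} (hμ : 0 < μ) (hδ : 1 ≤ δ) (M₁ : M1Type n q)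
    {N : ℕ} {c : Cfg} (hh : ¬ c.h) (hβ : 0 < c.β) {K₁ : ℝ} (hK₁ : 0 ≤ K₁) {w : FormT n q}
    (hw : XF c.flat 0 (N + 1) δ K₁ w)
    (hA : ∀ (u : FormT n q) (K : ℝ), 0 ≤ K → XF c 0 (N + 1) δ K u →
        XF c 0 (N + 1) δ (K / 2) (opA μ M₁ w u) ∧ CoClosed c.T (opA μ M₁ w u))
    {F : ℝ} (hF : 0 ≤ F) {f : FormT n q} (hf : XF c 0 (N + 1) δ F f) (hfc : CoClosed c.T f) :
    ∃ u, XF c 0 (N + 1) δ (2 * F) u ∧ CoClosed c.T u ∧ EqOnT c.T (u + opA μ M₁ w u) f := by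
  have hδ0 : 0 ≤ δ := zero_le_one.trans hδ
  set g : ℕ → FormT n q := fun j => Nat.rec f (fun _ v I t x => -opA μ M₁ w v I t x) j with hg
  have hgs : ∀ j I t x, g (j + 1) I t x = -opA μ M₁ w (g j) I t x := fun _ _ _ _ => rfl
  have hgX : ∀ j, XF c 0 (N + 1) δ (F / 2 ^ j) (g j) := fun j => by
    induction j with
    | zero => rw [pow_zero, div_one]; exact hf
    | succ j ih =>
      rw [pow_succ, ← div_div]
      exact (hA _ _ (by positivity) ih).1.neg fun I t _ => funext fun x => hgs j I t x
  set U : ℕ → FormT n q := fun m I t x => ∑' j, g (j + m) I t x with hU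
  have hUX : ∀ m, XF c 0 (N + 1) δ (2 * (F / 2 ^ m)) (U m) := fun m =>
    XF.tsum hh hδ0 (by positivity) fun j => by
      rw [div_div, ← pow_add, add_comm m]; exact hgX (j + m)
  have hUs : ∀ m I, ∀ t ∈ Set.Icc 0 c.T, ∀ x, U m I t x = g m I t x + U (m + 1) I t x :=
    fun m I t ht x => by
      have hs : Summable fun j => g (j + m) I t x :=
        (summable_nat_add_iff (f := fun j => g j I t x) m).2
          (Bas.summable hδ0 (fun j => Cl.bas ((hgX j).1 I)) ht x)
      simp only [hU]
      rw [hs.tsum_eq_zero_add, zero_add]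
      simp only [add_right_comm _ 1 m, add_assoc]
  have hop : ∀ m I, ∀ t ∈ Set.Icc 0 c.T, ∀ x, opA μ M₁ w (g m) I t x =
      opA μ M₁ w (U m) I t x - opA μ M₁ w (U (m + 1)) I t x := fun m I t ht x =>
    congrFun (opA_sub hn hμ hδ M₁ hh hβ hK₁ (by positivity) (by positivity) hw (hUX m)
      (hUX (m + 1)) (fun I t ht => funext fun x => by rw [hUs m I t ht]; ring) I ht) x
  have hE : ∀ m I, ∀ t ∈ Set.Icc 0 c.T, ∀ x,
      opA μ M₁ w (U 0) I t x + U 1 I t x = opA μ M₁ w (U m) I t x + U (m + 1) I t x :=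
    fun m I t ht x => by
      induction m with
      | zero => rfl
      | succ m ih =>
        rw [ih]
        linarith [hUs (m + 1) I t ht x, hop m I t ht x, hgs m I t x]
  have hE0 : ∀ I, ∀ t ∈ Set.Icc 0 c.T, ∀ x, opA μ M₁ w (U 0) I t x + U 1 I t x = 0 :=
    fun I t ht x => by
      refine eq_zero_of_geom (Q := 3 * F * Real.exp (c.β * c.T)) fun m => ?_
      rw [hE m I t ht x]
      have h1 := (hA _ _ (by positivity) (hUX m)).1.abs_le hδ0 I ht x
      have h2 := (hUX (m + 1)).abs_le hδ0 I ht x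
      have hp : 0 ≤ F / 2 ^ m * Real.exp (c.β * c.T) := by positivity
      have e : F / 2 ^ (m + 1) = F / 2 ^ m / 2 := by rw [pow_succ, div_div]
      rw [e] at h2
      refine (abs_add_le _ _).trans ((add_le_add h1 h2).trans ?_)
      have e2 : 3 * F * Real.exp (c.β * c.T) / 2 ^ m = 3 * (F / 2 ^ m * Real.exp (c.β * c.T)) := by
        ring
      rw [e2]
      linarith
  have hfix : ∀ I, ∀ t ∈ Set.Icc 0 c.T, ∀ x, U 0 I t x = f I t x - opA μ M₁ w (U 0) I t x :=
    fun I t ht x => by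
      have h1 := hUs 0 I t ht x
      have h2 := hE0 I t ht x
      have h3 : g 0 I t x = f I t x := rfl
      rw [zero_add] at h1
      linarith
  have hX : XF c 0 (N + 1) δ (2 * F) (U 0) := by simpa using hUX 0
  obtain ⟨h1, h2⟩ := hA _ _ (by positivity) hX
  refine ⟨U 0, hX, fun L t ht x => ?_, fun I t ht x => ?_⟩
  · rw [(dT_sub (fun t ht I => hf.diff ht I) (fun t ht I => h1.diff ht I)
      (fun I t ht => funext (hfix I t ht)) ht).2 L]
    simp only [hfc L t ht x, h2 L t ht x, sub_zero]
  · change U 0 I t x + opA μ M₁ w (U 0) I t x = f I t x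
    linarith [hfix I t ht x]

theorem neumann_unique (hn : 2 ≤ n) {q : ℕ} {μ δ : ℝ} (hμ : 0 < μ) (hδ : 1 ≤ δ) (M₁ : M1Type n q)
    {N : ℕ} {c : Cfg} (hh : ¬ c.h) (hβ : 0 < c.β) {K₁ : ℝ} (hK₁ : 0 ≤ K₁) {w : FormT n q}
    (hw : XF c.flat 0 (N + 1) δ K₁ w)
    (hA : ∀ (u : FormT n q) (K : ℝ), 0 ≤ K → XF c 0 (N + 1) δ K u →
        XF c 0 (N + 1) δ (K / 2) (opA μ M₁ w u) ∧ CoClosed c.T (opA μ M₁ w u))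
    {K K' : ℝ} (hK : 0 ≤ K) (hK' : 0 ≤ K') {u u' : FormT n q} (hu : XF c 0 (N + 1) δ K u)
    (hu' : XF c 0 (N + 1) δ K' u')
    (he : EqOnT c.T (u + opA μ M₁ w u) (u' + opA μ M₁ w u')) : EqOnT c.T u u' := by
  have hδ0 : 0 ≤ δ := zero_le_one.trans hδ
  set d : FormT n q := fun I t x => u I t x - u' I t x with hd
  have hdX : ∀ m : ℕ, XF c 0 (N + 1) δ ((K + K') / 2 ^ m) d := fun m => by
    induction m with
    | zero =>
      simpa using hu.sub hu' (fun t ht I => hu.diff ht I)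
        (fun t ht I => hu'.diff ht I) fun _ _ _ => rfl
    | succ m ih =>
      rw [pow_succ, ← div_div]
      refine (hA _ _ (by positivity) ih).1.neg fun I t ht => funext fun x => ?_
      rw [opA_sub hn hμ hδ M₁ hh hβ hK₁ hK hK' hw hu hu' (fun _ _ _ => rfl) I ht]
      have : u I t x + opA μ M₁ w u I t x = u' I t x + opA μ M₁ w u' I t x := he I t ht x
      simp only [hd]
      linarith
  intro I t ht x
  refine sub_eq_zero.1 (eq_zero_of_geom (Q := (K + K') * Real.exp (c.β * c.T)) fun m => ?_)
  exact ((hdX m).abs_le hδ0 I ht x).trans_eq (by ring)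

theorem XF.map {q : ℕ} {c c' : Cfg} {A : ℝ} (hT : c'.T = c.T)
    (hB : ∀ (N : ℕ) (σ K : ℝ) (v : ℝ → Spc n → ℝ), Cl c N σ K v → Cl c' N σ (A * K) v) {r m : ℕ}
    {δ K : ℝ} {u : FormT n q} (h : XF c r m δ K u) : XF c' r m δ (A * K) u :=
  ⟨fun I => (h.1 I).map hT hB, fun J => (h.2.1 J).map hT hB, fun L => (h.2.2 L).map hT hB⟩

theorem XF.to_sup {q : ℕ} {c c' : Cfg} (hT : c'.T = c.T) (hβ : c.β = 0) (hh : ¬ c'.h) {r m : ℕ}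
    {δ K : ℝ} {u : FormT n q} (h : XF c r m δ K u) : XF c' r m δ K u := by
  rw [← one_mul K]
  refine h.map hT fun N σ K v hv => Cl.map hT (fun σ K v hv => ⟨?_, fun t ht x => ?_,
    fun h => (hh h).elim⟩) hv
  · rw [hT]; exact hv.1
  · have hK := hv.nonneg
    have hw := Real.rpow_nonneg (wt_pos x).le (-σ)
    rw [hT] at ht
    refine (hv.2.1 t ht x).trans ?_
    have h1 : Real.exp (c.β * t) ≤ Real.exp (c'.β * t) := by
      rw [hβ, zero_mul]
      exact Real.exp_le_exp.2 (mul_nonneg c'.hβ ht.1)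
    rw [one_mul]
    gcongr

theorem XF.cl {q : ℕ} {c : Cfg} {r m : ℕ} {δ K : ℝ} {u : FormT n q} (h : XF c r m δ K u) :
    XF c 0 (2 * r + m) δ K u :=
  ⟨fun I => (h.1 I).cl, fun J => (h.2.1 J).cl, fun L => (h.2.2 L).cl⟩

theorem Pr.shift_le {c : Cfg} {r j m : ℕ} {σ K : ℝ} {v : ℝ → Spc n → ℝ}
    (h : Pr c (r + j) m σ K v) : Pr c r (m + 2 * j) σ K v := by
  induction j generalizing m with
  | zero => exact h
  | succ j ih =>
    have := ih (Pr.shift h)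
    rwa [add_assoc, add_comm 2 (2 * j)] at this

theorem XF.shift_le {q : ℕ} {c : Cfg} {r r' m m' : ℕ} {δ K : ℝ} {u : FormT n q}
    (h : XF c r m δ K u) (hr : r' ≤ r) (hm : 2 * r' + m' ≤ 2 * r + m) : XF c r' m' δ K u := by
  obtain ⟨j, rfl⟩ := Nat.exists_eq_add_of_le hr
  have key : ∀ {σ : ℝ} {v : ℝ → Spc n → ℝ}, Pr c (r' + j) m σ K v → Pr c r' m' σ K v :=
    fun h => h.shift_le.mono (by omega) le_rfl le_rfl
  exact ⟨fun I => key (h.1 I), fun J => key (h.2.1 J), fun L => key (h.2.2 L)⟩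

theorem Cfg.flat_eq {c : Cfg} (h : c.β = 0) : c.flat = c := by
  cases c
  simp_all [Cfg.flat]

theorem opA_gain (hn : 2 ≤ n) {q : ℕ} {μ δ : ℝ} (hμ : 0 < μ) (hδ : 1 ≤ δ) (hδn : δ < n)
    (M₁ : M1Type n q) (c : Cfg) (hβ : c.β = 0) (r m : ℕ) (hm : 1 ≤ 2 * r + m) :
    ∃ C : ℝ, 0 ≤ C ∧ ∀ (K₁ K₂ : ℝ) (w u : FormT n q), 0 ≤ K₁ → 0 ≤ K₂ →
      XF c.sup 0 (2 * r + m) δ K₁ w → XF c.sup 0 (2 * r + m) δ K₂ u →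
      (∀ r', r = r' + 1 → XF c r' (m + 1) δ K₁ w ∧ XF c r' (m + 1) δ K₂ u) →
      XF c r m δ (C * K₁ * K₂) (opA μ M₁ w u) ∧ CoClosed c.T (opA μ M₁ w u) := by
  have hl := c.hl1
  obtain ⟨C₁, hC₁, h₁⟩ := Wop_cl M₁ (2 * r + m) δ
  obtain ⟨C₂, hC₂, h₂⟩ := Wop_pr M₁ (r - 1) (m + 1) δ
  obtain ⟨M, hM, hV⟩ := Pr.volPot (n := n) hμ c hβ r m (γ := 2 * δ + 1) (σ := 2 * δ - c.lam)
    (by linarith) (by linarith)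
  obtain ⟨C, hC, hP⟩ := XF.phi hn hδ hδn c.hl0 c.hl1 (σ := 2 * δ - c.lam) (by linarith) q r m hm
  refine ⟨C * (M * (C₁ + C₂)), by positivity, fun K₁ K₂ w u hK₁ hK₂ hw hu hr => ?_⟩
  have hK : 0 ≤ K₁ * K₂ := by positivity
  have hf : c.sup.flat = c.sup := Cfg.flat_eq hβ
  have := hP c (M * ((C₁ + C₂) * K₁ * K₂)) (volPotF μ (Wop M₁ w u)) rfl (by positivity) fun I => by
    refine hV _ _ ((h₁ c.sup K₁ K₂ w u hK₁ hK₂ (hf.symm ▸ hw) hu I).mono le_rfl (by nlinarith)) ?_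
    rintro r' rfl
    obtain ⟨hw', hu'⟩ := hr r' rfl
    have := h₂ c K₁ K₂ w u hK₁ hK₂ ((Cfg.flat_eq hβ).symm ▸ hw') ((Cfg.flat_eq hβ).symm ▸ hu') I
    rw [Cfg.flat_eq hβ] at this
    exact this.mono le_rfl le_rfl (by nlinarith)
  refine ⟨this.1.mono le_rfl (le_of_eq (by ring)), this.2⟩

theorem bootstrap (hn : 2 ≤ n) {q : ℕ} {μ δ : ℝ} (hμ : 0 < μ) (hδ : 1 ≤ δ) (hδn : δ < n)
    (M₁ : M1Type n q) (c : Cfg) (hβ : c.β = 0) (s k : ℕ) {K₁ : ℝ} (hK₁ : 0 ≤ K₁) {w : FormT n q}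
    (hw : XF c.sup 0 (2 * s + k + 1) δ K₁ w) (hw' : XF c s k δ K₁ w) (r : ℕ) (hr : r ≤ s) :
    ∃ C : ℝ, 0 ≤ C ∧ ∀ (K : ℝ) (u f : FormT n q), 0 ≤ K →
      XF c.sup 0 (2 * s + k + 1) δ K u → XF c s k δ K f →
      (∀ t ∈ Set.Icc 0 c.T, ∀ I, Differentiable ℝ (f I t)) →
      (∀ I, ∀ t ∈ Set.Icc 0 c.T, u I t = fun x => f I t x - opA μ M₁ w u I t x) →
      XF c r (2 * (s - r) + k + 1) δ (C * K) (opA μ M₁ w u) := by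
  induction r with
  | zero =>
    obtain ⟨C, hC, h⟩ := opA_gain hn hμ hδ hδn M₁ c hβ 0 (2 * s + k + 1) (by omega)
    refine ⟨C * K₁, by positivity, fun K u f hK hu _ _ _ => ?_⟩
    have e : 2 * 0 + (2 * s + k + 1) = 2 * s + k + 1 := by omega
    exact (h K₁ K w u hK₁ hK (e.symm ▸ hw) (e.symm ▸ hu) fun r' h => by omega).1
  | succ r ih =>
    obtain ⟨C', hC', ih⟩ := ih (by omega)
    obtain ⟨C, hC, h⟩ := opA_gain hn hμ hδ hδn M₁ c hβ (r + 1) (2 * (s - (r + 1)) + k + 1)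
      (by omega)
    refine ⟨C * K₁ * (1 + C'), by positivity, fun K u f hK hu hf hd he => ?_⟩
    have hA := ih K u f hK hu hf hd he
    have hdA : ∀ t ∈ Set.Icc 0 c.T, ∀ I, Differentiable ℝ (opA μ M₁ w u I t) :=
      fun t ht I => XF.diff (hA.shift_le (r' := 0) (m' := 0 + 1) (by omega) (by omega)) ht I
    have e : 2 * (r + 1) + (2 * (s - (r + 1)) + k + 1) = 2 * s + k + 1 := by omega
    have hsub := XF.sub (hf.shift_le (r' := r) (m' := 2 * (s - (r + 1)) + k + 1 + 1) (by omega)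
      (by omega)) (hA.mono (m' := 2 * (s - (r + 1)) + k + 1 + 1) (by omega) le_rfl) hd hdA he
    have h0 : 0 ≤ C' * K := by positivity
    rw [mul_assoc]
    refine (h K₁ ((1 + C') * K) w u hK₁ (by positivity) (e.symm ▸ hw)
      (e.symm ▸ hu.mono le_rfl (by linarith)) fun r' hr' => ?_).1
    obtain rfl : r = r' := by omega
    exact ⟨hw'.shift_le (by omega) (by omega), hsub.mono le_rfl (by linarith)⟩

theorem AnisoReg.mono {T : ℝ} {k k' s : ℕ} {u : ℝ → Spc n → ℝ} (h : AnisoReg T k s u)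
    (hk : k' ≤ k) : AnisoReg T k' s u :=
  ⟨h.1, fun j hj t ht => (h.2.1 j hj t ht).of_le (by gcongr),
    fun j m hj hm => h.2.2 j m hj (by omega)⟩

theorem FMemF.pr (s k : ℕ) {σ : ℝ} (hσ : 0 ≤ σ) : ∃ C : ℝ, 0 ≤ C ∧
    ∀ (c₁ c₂ : Cfg) (p : ℕ) (u : FormT n p) (K : ℝ), c₂.T = c₁.T → c₁.β = 0 → c₂.β = 0 → 0 ≤ K →
      FMemF c₁.T k s c₁.lam c₂.lam σ u → eFF c₁.T k s c₁.lam c₂.lam σ u ≤ ENNReal.ofReal K →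
      (∀ I, Pr c₁ s (k + 1) σ (C * K) (u I)) ∧ ∀ I, Pr c₂ s k σ (C * K) (u I) := by
  obtain ⟨C₁, hC₁, h₁⟩ := AnisoReg.pr (n := n) s (k + 1) hσ
  obtain ⟨C₂, hC₂, h₂⟩ := AnisoReg.pr (n := n) s k hσ
  refine ⟨C₁ + C₂, by positivity, fun c₁ c₂ p u K hT hβ₁ hβ₂ hK hu hn => ?_⟩
  have hI : ∀ I, eFn c₁.T k s c₁.lam c₂.lam σ (u I) ≤ ENNReal.ofReal K := fun I =>
    (Finset.single_le_sum (f := fun I => eFn c₁.T k s c₁.lam c₂.lam σ (u I))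
      (fun _ _ => zero_le) (Finset.mem_univ I)).trans hn
  exact ⟨fun I => (h₁ c₁ K (u I) hβ₁ hK (hu.1 I) (le_self_add.trans (hI I))).mono le_rfl le_rfl
      (by nlinarith),
    fun I => (h₂ c₂ K (u I) hβ₂ hK (hT ▸ (hu.1 I).mono (by omega))
      (hT ▸ le_add_self.trans (hI I))).mono le_rfl le_rfl (by nlinarith)⟩

theorem Pr.fmemF (s k : ℕ) {σ : ℝ} (hσ : 0 ≤ σ) (p : ℕ) : ∃ C : ℝ, 0 ≤ C ∧
    ∀ (c₁ c₂ : Cfg) (u : FormT n p) (K : ℝ), c₂.T = c₁.T → c₁.β = 0 → c₂.β = 0 → c₁.h → c₂.h →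
      0 ≤ K → (∀ I, Pr c₁ s (k + 1) σ K (u I)) → (∀ I, Pr c₂ s k σ K (u I)) →
      FMemF c₁.T k s c₁.lam c₂.lam σ u ∧
        eFF c₁.T k s c₁.lam c₂.lam σ u ≤ ENNReal.ofReal (C * K) := by
  obtain ⟨C₁, hC₁, h₁⟩ := Pr.aniso (n := n) s (k + 1) hσ
  obtain ⟨C₂, hC₂, h₂⟩ := Pr.aniso (n := n) s k hσ
  refine ⟨Fintype.card (Idx n p) * (C₁ + C₂), by positivity,
    fun c₁ c₂ u K hT hβ₁ hβ₂ hh₁ hh₂ hK hu₁ hu₂ => ?_⟩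
  have key : eFF c₁.T k s c₁.lam c₂.lam σ u ≤
      ENNReal.ofReal (Fintype.card (Idx n p) * (C₁ + C₂) * K) := by
    calc eFF c₁.T k s c₁.lam c₂.lam σ u
        ≤ ∑ _I : Idx n p, ENNReal.ofReal ((C₁ + C₂) * K) := Finset.sum_le_sum fun I _ => by
          rw [add_mul, ENNReal.ofReal_add (by positivity) (by positivity)]
          exact add_le_add (h₁ c₁ K _ hβ₁ hh₁ (hu₁ I)).2 (hT ▸ (h₂ c₂ K _ hβ₂ hh₂ (hu₂ I)).2)
      _ = _ := by
          rw [Finset.sum_const, nsmul_eq_mul, mul_assoc,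
            ENNReal.ofReal_mul (p := (Fintype.card (Idx n p) : ℝ)) (by positivity),
            ENNReal.ofReal_natCast, Finset.card_univ]
  exact ⟨⟨fun I => (h₁ c₁ K _ hβ₁ hh₁ (hu₁ I)).1, ne_top_of_le_ne_top ENNReal.ofReal_ne_top key⟩,
    key⟩

theorem FMemD.xf (s k : ℕ) {δ : ℝ} (hδ : 0 ≤ δ) : ∃ C : ℝ, 0 ≤ C ∧
    ∀ (c₁ c₂ : Cfg) (q : ℕ) (u : FormT n q), c₂.T = c₁.T → c₁.β = 0 → c₂.β = 0 →
      FMemD c₁.T k s c₁.lam c₂.lam δ u →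
      XF c₁ s (k + 1) δ (C * (eFD c₁.T k s c₁.lam c₂.lam δ u).toReal) u ∧
        XF c₂ s k δ (C * (eFD c₁.T k s c₁.lam c₂.lam δ u).toReal) u := by
  obtain ⟨C₁, hC₁, h₁⟩ := FMemF.pr (n := n) s k hδ
  obtain ⟨C₂, hC₂, h₂⟩ := FMemF.pr (n := n) s k (σ := δ + 1) (by linarith)
  refine ⟨C₁ + C₂, by positivity, fun c₁ c₂ q u hT hβ₁ hβ₂ hu => ?_⟩
  have hfin : eFD c₁.T k s c₁.lam c₂.lam δ u ≠ ⊤ :=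
    ENNReal.add_ne_top.2 ⟨ENNReal.add_ne_top.2 ⟨hu.1.2, hu.2.1.2⟩, hu.2.2.2⟩
  set K := (eFD c₁.T k s c₁.lam c₂.lam δ u).toReal with hKd
  have hK : 0 ≤ K := ENNReal.toReal_nonneg
  have e : eFD c₁.T k s c₁.lam c₂.lam δ u = ENNReal.ofReal K := (ENNReal.ofReal_toReal hfin).symm
  have a1 := h₁ c₁ c₂ q u K hT hβ₁ hβ₂ hK hu.1 (e ▸ le_self_add.trans le_self_add)
  have a2 := h₂ c₁ c₂ _ _ K hT hβ₁ hβ₂ hK hu.2.1 (e ▸ le_add_self.trans le_self_add)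
  have a3 := h₂ c₁ c₂ _ _ K hT hβ₁ hβ₂ hK hu.2.2 (e ▸ le_add_self)
  have k1 : C₁ * K ≤ (C₁ + C₂) * K := by nlinarith
  have k2 : C₂ * K ≤ (C₁ + C₂) * K := by nlinarith
  exact ⟨⟨fun I => (a1.1 I).mono le_rfl le_rfl k1, fun J => (a2.1 J).mono le_rfl le_rfl k2,
      fun L => (a3.1 L).mono le_rfl le_rfl k2⟩,
    ⟨fun I => (a1.2 I).mono le_rfl le_rfl k1, fun J => (a2.2 J).mono le_rfl le_rfl k2,
      fun L => (a3.2 L).mono le_rfl le_rfl k2⟩⟩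

theorem XF.fmemD (s k : ℕ) {δ : ℝ} (hδ : 0 ≤ δ) (q : ℕ) : ∃ C : ℝ, 0 ≤ C ∧
    ∀ (c₁ c₂ : Cfg) (u : FormT n q) (K : ℝ), c₂.T = c₁.T → c₁.β = 0 → c₂.β = 0 → c₁.h → c₂.h →
      0 ≤ K → XF c₁ s (k + 1) δ K u → XF c₂ s k δ K u →
      FMemD c₁.T k s c₁.lam c₂.lam δ u ∧
        eFD c₁.T k s c₁.lam c₂.lam δ u ≤ ENNReal.ofReal (C * K) := by
  obtain ⟨C₁, hC₁, h₁⟩ := Pr.fmemF (n := n) s k hδ q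
  obtain ⟨C₂, hC₂, h₂⟩ := Pr.fmemF (n := n) s k (σ := δ + 1) (by linarith) (q + 1)
  obtain ⟨C₃, hC₃, h₃⟩ := Pr.fmemF (n := n) s k (σ := δ + 1) (by linarith) (q - 1)
  refine ⟨C₁ + C₂ + C₃, by positivity, fun c₁ c₂ u K hT hβ₁ hβ₂ hh₁ hh₂ hK hu₁ hu₂ => ?_⟩
  have a1 := h₁ c₁ c₂ u K hT hβ₁ hβ₂ hh₁ hh₂ hK hu₁.1 hu₂.1
  have a2 := h₂ c₁ c₂ _ K hT hβ₁ hβ₂ hh₁ hh₂ hK hu₁.2.1 hu₂.2.1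
  have a3 := h₃ c₁ c₂ _ K hT hβ₁ hβ₂ hh₁ hh₂ hK hu₁.2.2 hu₂.2.2
  refine ⟨⟨a1.1, a2.1, a3.1⟩, ?_⟩
  rw [add_mul, add_mul, ENNReal.ofReal_add (by positivity) (by positivity),
    ENNReal.ofReal_add (by positivity) (by positivity)]
  exact add_le_add (add_le_add a1.2 a2.2) a3.2

/-- A form `a - b` belongs to the graph space when `a` does and `b` gains one derivative. -/
theorem XF.sub_fmemD (s k : ℕ) {δ : ℝ} (hδ : 0 ≤ δ) (q : ℕ) {c₁ c₂ : Cfg} (hT : c₂.T = c₁.T)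
    (hl : c₁.lam ≤ c₂.lam) (hβ₁ : c₁.β = 0) (hβ₂ : c₂.β = 0) (hh₁ : c₁.h) (hh₂ : c₂.h) :
    ∃ C : ℝ, 0 ≤ C ∧ ∀ (a b v : FormT n q) (K K' : ℝ), 0 ≤ K → 0 ≤ K' →
      XF c₁ s (k + 1) δ K a → XF c₂ s k δ K a → XF c₂ s (k + 1) δ K' b →
      (∀ I, ∀ t ∈ Set.Icc 0 c₁.T, v I t = fun x => a I t x - b I t x) →
      FMemD c₁.T k s c₁.lam c₂.lam δ v ∧
        eFD c₁.T k s c₁.lam c₂.lam δ v ≤ ENNReal.ofReal (C * (K + K')) := by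
  obtain ⟨C, hC, h⟩ := XF.fmemD (n := n) s k hδ q
  set A := 1 + c₂.T ^ ((c₂.lam - c₁.lam) / 2) with hA
  have hA1 : 1 ≤ A := by
    have := Real.rpow_nonneg c₂.hT.le ((c₂.lam - c₁.lam) / 2)
    linarith
  refine ⟨C * A, by positivity, fun a b v K K' hK hK' ha₁ ha₂ hb hv => ?_⟩
  have hb₁ : XF c₁ s (k + 1) δ (A * K') b := by
    refine hb.map hT.symm fun N σ K v hv => ?_
    convert Cl.lower (l := c₁.lam) c₁.hl0 hl c₁.hl1 hv using 1
    cases c₁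
    cases c₂
    simp_all
  have da : ∀ t ∈ Set.Icc 0 c₁.T, ∀ I, Differentiable ℝ (a I t) := fun t ht I =>
    XF.diff (ha₁.shift_le (r' := 0) (m' := 0 + 1) (by omega) (by omega)) ht I
  have db : ∀ t ∈ Set.Icc 0 c₁.T, ∀ I, Differentiable ℝ (b I t) := fun t ht I =>
    XF.diff (hb₁.shift_le (r' := 0) (m' := 0 + 1) (by omega) (by omega)) ht I
  have v₁ := (ha₁.sub hb₁ da db hv).mono le_rfl (K' := A * (K + K')) (by nlinarith)
  have v₂ := (ha₂.sub (hb.mono (Nat.le_succ k) le_rfl) (hT ▸ da) (hT ▸ db) (hT ▸ hv)).mono le_rfl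
    (K' := A * (K + K')) (by nlinarith)
  obtain ⟨m1, m2⟩ := h c₁ c₂ v _ hT hβ₁ hβ₂ hh₁ hh₂ (by positivity) v₁ v₂
  exact ⟨m1, m2.trans_eq (by rw [mul_assoc])⟩

/-- `I + Φ_q d_q Ψ_{μ,q} W_q` is continuously invertible on
`𝓕^{k,𝐬(s,λ,λ',δ)}_{T,Λ^q,𝒟_{d⊕d*}} ∩ 𝒮_{d^*}`. -/
theorem stmt13 (n q s k : ℕ) (hn : 2 ≤ n) (hq1 : 1 ≤ q) (hq2 : q ≤ n - 1)
    (hs : 1 ≤ s) (hk : 1 ≤ k) (lam lam' δ μ T : ℝ)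
    (h1 : 0 < lam) (h2 : lam < lam') (h3 : lam' < 1)
    (hδ1 : (n : ℝ) / 2 < δ) (hδ2 : δ < n) (hδ3 : δ ≠ (n : ℝ) - 1)
    (hμ : 0 < μ) (hT : 0 < T)
    (M₁ : M1Type n q) (w : FormT n q) (hw : FMemD T k s lam lam' δ w) :
    ∃ C : ℝ, 0 < C ∧
      (∀ u : FormT n q, FMemD T k s lam lam' δ u → CoClosed T u →
        (FMemD T k s lam lam' δ (u + PhiOp (dT (volPotF μ (Wop M₁ w u)))) ∧
          CoClosed T (u + PhiOp (dT (volPotF μ (Wop M₁ w u))))) ∧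
        eFD T k s lam lam' δ (u + PhiOp (dT (volPotF μ (Wop M₁ w u)))) ≤
          ENNReal.ofReal C * eFD T k s lam lam' δ u) ∧
      ∀ f : FormT n q, FMemD T k s lam lam' δ f → CoClosed T f →
        ∃ u : FormT n q, FMemD T k s lam lam' δ u ∧ CoClosed T u ∧
          EqOnT T (u + PhiOp (dT (volPotF μ (Wop M₁ w u)))) f ∧
          eFD T k s lam lam' δ u ≤ ENNReal.ofReal C * eFD T k s lam lam' δ f ∧
          ∀ u' : FormT n q, FMemD T k s lam lam' δ u' → CoClosed T u' →
            EqOnT T (u' + PhiOp (dT (volPotF μ (Wop M₁ w u')))) f → EqOnT T u' u := by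
  have hδ : 1 ≤ δ := by
    have : (2 : ℝ) ≤ n := by exact_mod_cast hn
    linarith
  have hδ0 : 0 ≤ δ := zero_le_one.trans hδ
  set c₁ : Cfg := ⟨T, lam, 0, True, hT, h1, h2.trans h3, le_rfl⟩ with hc₁
  set c₂ : Cfg := ⟨T, lam', 0, True, hT, h1.trans h2, h3, le_rfl⟩ with hc₂
  obtain ⟨Ca, hCa, ha⟩ := FMemD.xf (n := n) s k hδ0
  obtain ⟨Cb, hCb, hb⟩ := XF.sub_fmemD (n := n) s k hδ0 q (c₁ := c₁) (c₂ := c₂) rfl h2.le rfl rfl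
    trivial trivial
  have hxf := fun (v : FormT n q) => ha c₁ c₂ q v rfl rfl rfl
  obtain ⟨hw₁, hw₂⟩ := hxf w hw
  obtain ⟨W, hWe⟩ : ∃ W, W = Ca * (eFD T k s lam lam' δ w).toReal := ⟨_, rfl⟩
  rw [← hWe] at hw₁ hw₂
  have hW : 0 ≤ W := hWe ▸ mul_nonneg hCa ENNReal.toReal_nonneg
  have hsup : ∀ (v : FormT n q) (K : ℝ), XF c₁ s (k + 1) δ K v →
      ∀ c : Cfg, c.T = T → ¬ c.h → XF c 0 (2 * s + k + 1) δ K v :=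
    fun v K hv c hcT hch => hv.cl.to_sup hcT rfl hch
  have hwc := hsup w W hw₁ c₂.sup rfl id
  have hdiff : ∀ (v : FormT n q) (K : ℝ), XF c₁ s (k + 1) δ K v → ∀ t ∈ Set.Icc 0 T, ∀ I,
      Differentiable ℝ (v I t) := fun v K hv t ht I =>
    XF.diff (hv.shift_le (r' := 0) (m' := 0 + 1) (by omega) (by omega)) ht I
  obtain ⟨Cg, hCg, hg⟩ := opA_gain hn hμ hδ hδ2 M₁ c₂ rfl s (k + 1) (by omega)
  obtain ⟨c, hcT, hcl, hch, hcβ, hc⟩ := exists_contraction hn hμ hT hδ hδ2 (h1.trans h2) h3 M₁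
    (2 * s + k) hW
  have hwf : XF c.flat 0 (2 * s + k + 1) δ W w := hsup w W hw₁ c.flat hcT hch
  obtain ⟨Cs, hCs, hs'⟩ := bootstrap hn hμ hδ hδ2 M₁ c₂ rfl s k hW hwc hw₂ s le_rfl
  obtain ⟨E, hE⟩ : ∃ E, E = Real.exp (c.β * c.T) := ⟨_, rfl⟩
  have hE1 : 1 ≤ E := hE ▸ Real.one_le_exp (mul_nonneg c.hβ c.hT.le)
  obtain ⟨C, hC⟩ : ∃ C, C = Cb * (Ca + Cg * W * Ca) + Cb * (Ca + Cs * (E * (2 * Ca))) + 1 := ⟨_, rfl⟩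
  have hE0 := zero_le_one.trans hE1
  have hC0 : 0 < C := by rw [hC]; positivity
  have hle : ∀ (v f : FormT n q) (K : ℝ), FMemD T k s lam lam' δ f →
      eFD T k s lam lam' δ v ≤ ENNReal.ofReal K → K ≤ C * (eFD T k s lam lam' δ f).toReal →
      eFD T k s lam lam' δ v ≤ ENNReal.ofReal C * eFD T k s lam lam' δ f := fun v f K hf hv hK => by
    have hfin : eFD T k s lam lam' δ f ≠ ⊤ :=
      ENNReal.add_ne_top.2 ⟨ENNReal.add_ne_top.2 ⟨hf.1.2, hf.2.1.2⟩, hf.2.2.2⟩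
    refine (hv.trans (ENNReal.ofReal_le_ofReal hK)).trans_eq ?_
    rw [ENNReal.ofReal_mul hC0.le, ENNReal.ofReal_toReal hfin]
  refine ⟨C, hC0, fun u hu huc => ?_, fun f hf hfc => ?_⟩
  · obtain ⟨hu₁, hu₂⟩ := hxf u hu
    have hK0 : 0 ≤ (eFD T k s lam lam' δ u).toReal := ENNReal.toReal_nonneg
    have hle := fun v K => hle v u K hu
    generalize (eFD T k s lam lam' δ u).toReal = K at *
    have hCK : 0 ≤ Ca * K := mul_nonneg hCa hK0
    obtain ⟨hA, hAc⟩ := hg W (Ca * K) w u hW hCK hwc (hsup u _ hu₁ c₂.sup rfl id)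
      fun r' hr' => ⟨hw₂.shift_le (by omega) (by omega), hu₂.shift_le (by omega) (by omega)⟩
    change (FMemD T k s lam lam' δ (u + opA μ M₁ w u) ∧ CoClosed T (u + opA μ M₁ w u)) ∧
      eFD T k s lam lam' δ (u + opA μ M₁ w u) ≤ _
    generalize opA μ M₁ w u = A at hA hAc ⊢
    obtain ⟨v, hv⟩ : ∃ v, v = u + A := ⟨_, rfl⟩
    rw [← hv]
    have hN := hA.neg (u' := fun I t x => -A I t x) fun _ _ _ => rfl
    have he : ∀ I, ∀ t ∈ Set.Icc 0 T, v I t = fun x => u I t x - -A I t x := fun I t _ => by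
      rw [hv]; exact funext fun x => (sub_neg_eq_add _ _).symm
    have hK' : 0 ≤ Cg * W * (Ca * K) := by positivity
    obtain ⟨m1, m2⟩ := hb u (fun I t x => -A I t x) v (Ca * K) _ hCK hK' hu₁ hu₂ hN he
    refine ⟨⟨m1, fun L t ht x => ?_⟩, hle _ _ m2 ?_⟩
    · have hd : ∀ t ∈ Set.Icc 0 T, ∀ I, Differentiable ℝ fun x => -A I t x :=
        fun t ht I => XF.diff (hN.shift_le (r' := 0) (m' := 0 + 1) (by omega) (by omega)) ht I
      have h0 : coDT (fun I t x => -A I t x) L t x = -coDT A L t x := coDS_neg (fun I => A I t) L x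
      have h1 : coDT v L t x = _ := congrFun ((dT_sub (hdiff u _ hu₁) hd he ht).2 L) x
      rw [h1, h0, huc L t ht x, hAc L t ht x, neg_zero, sub_zero]
    · have : 0 ≤ (Cb * (Ca + Cs * (E * (2 * Ca))) + 1) * K := by positivity
      calc Cb * (Ca * K + Cg * W * (Ca * K)) = Cb * (Ca + Cg * W * Ca) * K := by ring
        _ ≤ C * K := by rw [hC]; linarith
  · obtain ⟨hf₁, hf₂⟩ := hxf f hf
    have hK0 : 0 ≤ (eFD T k s lam lam' δ f).toReal := ENNReal.toReal_nonneg
    have hle := fun v K => hle v f K hf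
    generalize (eFD T k s lam lam' δ f).toReal = K at *
    have hCK : 0 ≤ Ca * K := mul_nonneg hCa hK0
    obtain ⟨u, hu, huc, hue⟩ := neumann hn hμ hδ M₁ hch hcβ hW hwf (fun u K hK => hc w u K hK hwf)
      hCK (hsup f _ hf₁ c hcT hch) (hcT ▸ hfc)
    rw [hcT] at huc hue
    have hu' : XF c₂.sup 0 (2 * s + k + 1) δ (E * (2 * (Ca * K))) u := by
      rw [hE]
      exact (XF.map (c := c) (c' := c.flat) rfl (fun N σ K v hv => Cl.flat_of_sup hch hv) hu).to_sup
        hcT.symm rfl id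
    have he : ∀ I, ∀ t ∈ Set.Icc 0 T, u I t = fun x => f I t x - opA μ M₁ w u I t x :=
      fun I t ht => funext fun x => by
        have : u I t x + opA μ M₁ w u I t x = f I t x := hue I t ht x
        linarith
    have hEK : 2 * (Ca * K) ≤ E * (2 * (Ca * K)) := le_mul_of_one_le_left (by positivity) hE1
    have hA := hs' _ u f (by positivity) hu' (hf₂.mono le_rfl (by linarith)) (hdiff f _ hf₁) he
    rw [Nat.sub_self, mul_zero, zero_add] at hA
    obtain ⟨m1, m2⟩ := hb f _ u _ _ hCK (by positivity) hf₁ hf₂ hA he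
    refine ⟨u, m1, huc, hue, hle _ _ m2 ?_, fun u' hu' _ he' => ?_⟩
    · have : 0 ≤ (Cb * (Ca + Cg * W * Ca) + 1) * K := by positivity
      calc Cb * (Ca * K + Cs * (E * (2 * (Ca * K)))) = Cb * (Ca + Cs * (E * (2 * Ca))) * K := by
            ring
        _ ≤ C * K := by rw [hC]; linarith
    · have := neumann_unique hn hμ hδ M₁ hch hcβ hW hwf (fun u K hK => hc w u K hK hwf)
        (K := Ca * (eFD T k s lam lam' δ u').toReal) (mul_nonneg hCa ENNReal.toReal_nonneg)
        (mul_nonneg zero_le_two hCK)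
        (hsup u' _ (hxf u' hu').1 c hcT hch) hu
        (fun I t ht x => (he' I t (hcT ▸ ht) x).trans (hue I t (hcT ▸ ht) x).symm)
      exact hcT ▸ this

end NSdeRham

end
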